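/- Let d ≥ 5 be an integer and let R ⊂ (0,∞) be a lacunary set of admissible radii admitting an admissible good/bad prime dichotomy (G,B) with parameter s ∈ (0,1]. Then for every real p with d/(d−(1+s)) ≤ p ≤ 2 and (d−1)/(d−2) < p ≤ 2, there exists C such that ‖sup_{r∈R}|H_r f|‖_{ℓ^p(ℤ^d)} ≤ C‖f‖_{ℓ^p(ℤ^d)} for all finitely supported f : ℤ^d → ℂ. Moreover, if d = 4 and additionally 2 ∈ G, the same holds for the same range of p. -/

import Mathlib

open scoped ENNReal NNReal BigOperators
open MeasureTheory

noncomputable section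

/-- `e(t) = exp(2πit)`. -/
def eC (t : ℝ) : ℂ := Complex.exp (2 * Real.pi * Complex.I * t)

/-- `|x|²` for `x ∈ ℤ^d`. -/
def normSqZ {d : ℕ} (x : Fin d → ℤ) : ℤ := ∑ i, (x i) ^ 2

/-- The natural number `r²` of an admissible radius `r`. -/
def radSq (r : ℝ) : ℕ := ⌊r ^ 2⌋₊

/-- `r` is an admissible radius: `r > 0` and `r² ∈ ℕ`. -/
def IsAdmissible (r : ℝ) : Prop := 0 < r ∧ ∃ n : ℕ, r ^ 2 = (n : ℝ)

/-- A set of positive reals is lacunary. -/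
def Lacunary (R : Set ℝ) : Prop := ∃ c : ℝ, 1 < c ∧ ∀ r ∈ R, ∀ s ∈ R, r < s → c * r ≤ s

/-- `N_d(r)`: the number of lattice points on the sphere of radius `r` in `ℤ^d`. -/
def sphereCount (d : ℕ) (r : ℝ) : ℕ := Nat.card {x : Fin d → ℤ // normSqZ x = (radSq r : ℤ)}

/-- The discrete spherical average `A_r f`. -/
def sphAvg (d : ℕ) (r : ℝ) (f : (Fin d → ℤ) → ℂ) (x : Fin d → ℤ) : ℂ :=
  (sphereCount d r : ℂ)⁻¹ *
    ∑' y : Fin d → ℤ, if normSqZ y = (radSq r : ℤ) then f (x - y) else 0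

/-- The `ℓ^p(ℤ^d)` norm, valued in `ℝ≥0∞`. -/
def lpNorm (d : ℕ) (p : ℝ) (f : (Fin d → ℤ) → ℂ) : ℝ≥0∞ :=
  (∑' x : Fin d → ℤ, (‖f x‖₊ : ℝ≥0∞) ^ p) ^ (1 / p)

/-- `(G, B)` is an admissible good/bad prime dichotomy for the set of radii `R`,
with parameter `s`. -/
def GoodBadDichotomy (R : Set ℝ) (G B : Set ℕ) (s : ℝ) : Prop :=
  (∀ p : ℕ, p.Prime → p ∈ G ∪ B) ∧
  (∀ p ∈ G, Nat.Prime p) ∧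
  (∀ p ∈ B, Nat.Prime p) ∧
  (∀ p ∈ G, ∀ r ∈ R, IsUnit ((radSq r : ZMod p))) ∧
  (∀ ε : ℝ, 0 < ε → ∃ C : ℝ, 0 < C ∧ ∀ p ∈ G,
    (({z : ZMod p | ∃ r ∈ R, z = (radSq r : ZMod p)}.ncard : ℝ)) ≤ C * (p : ℝ) ^ ε) ∧
  Summable (fun q : B => (q : ℝ) ^ (-s))

/-- `∏_{i ≤ T} p_i`, the product of the first `⌊T⌋` primes. -/
def primorialUpTo (T : ℝ) : ℕ := ∏ i ∈ Finset.range ⌊T⌋₊, Nat.nth Nat.Prime i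

/-- `∏_{j₀ ≤ i ≤ T} p_i` where `p_i` is the `i`-th prime (`1`-indexed). -/
def prodPrimesFrom (j₀ : ℕ) (T : ℝ) : ℕ :=
  ∏ i ∈ Finset.Icc j₀ ⌊T⌋₊, Nat.nth Nat.Prime (i - 1)

/-- `n_j = 1 + ∏_{i ≤ 2^{j^η}} p_i`. -/
def nseq (η : ℝ) (j : ℕ) : ℕ := 1 + primorialUpTo ((2 : ℝ) ^ ((j : ℝ) ^ η))

/-- The normalized Kloosterman sum `K(q, N; n)`. -/
def kloosterman (d q : ℕ) (N : ℤ) (n : Fin d → ℤ) : ℂ :=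
  ((q : ℂ)⁻¹) ^ d *
    ∑ u : Fin q,
      if Nat.Coprime (u : ℕ) q then
        eC (-(((u : ℕ) : ℝ) * (N : ℝ)) / q) *
          ∑ b : Fin d → Fin q,
            eC ((((u : ℕ) : ℝ) * ∑ i, (((b i : ℕ) : ℝ)) ^ 2
                + ∑ i, ((b i : ℕ) : ℝ) * ((n i : ℝ))) / q)
      else 0

/-- The Ramanujan sum `c_q(N)`. -/
def ramanujanSum (q : ℕ) (N : ℤ) : ℂ :=
  ∑ u : Fin q, if Nat.Coprime (u : ℕ) q then eC ((((u : ℕ) : ℝ) * (N : ℝ)) / q) else 0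

/-- The measure `dσ_r = (2 r^{d-1})⁻¹ ℋ^{d-1} ⌞ {|x| = r}` on `ℝ^d`. -/
def sphMeasure (d : ℕ) (r : ℝ) : Measure (EuclideanSpace ℝ (Fin d)) :=
  (ENNReal.ofReal (2 * r ^ (d - 1)))⁻¹ •
    (μH[((d : ℝ) - 1)] : Measure (EuclideanSpace ℝ (Fin d))).restrict (Metric.sphere 0 r)

/-- The Fourier transform `𝓕dσ_r(ξ) = ∫ e(x·ξ) dσ_r(x)`. -/
def fourierSphMeasure (d : ℕ) (r : ℝ) (ξ : Fin d → ℝ) : ℂ :=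
  ∫ x : EuclideanSpace ℝ (Fin d), eC (∑ i, x i * ξ i) ∂(sphMeasure d r)

/-- `Ψ` is a smooth bump: supported in `[-1/4,1/4]^d` and `1` on `[-1/8,1/8]^d`. -/
def IsBump (d : ℕ) (Ψ : (Fin d → ℝ) → ℝ) : Prop :=
  ContDiff ℝ (⊤ : ℕ∞) Ψ ∧
  (∀ x, x ∉ Set.Icc (fun _ => -(1/4 : ℝ)) (fun _ => (1/4 : ℝ)) → Ψ x = 0) ∧
  (∀ x ∈ Set.Icc (fun _ => -(1/8 : ℝ)) (fun _ => (1/8 : ℝ)), Ψ x = 1)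

/-- `Ψ'` is a smooth cutoff with `1_{[-1/4,1/4]^d} ≤ Ψ' ≤ 1_{[-1/2,1/2]^d}`. -/
def IsCutoff (d : ℕ) (Ψ' : (Fin d → ℝ) → ℝ) : Prop :=
  ContDiff ℝ (⊤ : ℕ∞) Ψ' ∧
  (∀ x, Set.indicator (Set.Icc (fun _ => -(1/4 : ℝ)) (fun _ => (1/4 : ℝ)))
      (fun _ => (1 : ℝ)) x ≤ Ψ' x) ∧
  (∀ x, Ψ' x ≤ Set.indicator (Set.Icc (fun _ => -(1/2 : ℝ)) (fun _ => (1/2 : ℝ)))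
      (fun _ => (1 : ℝ)) x)

/-- The Fourier transform of `f : ℤ^d → ℂ`, `f̂(ξ) = ∑_n f(n) e(n·ξ)`. -/
def ftZ {d : ℕ} (f : (Fin d → ℤ) → ℂ) (ξ : Fin d → ℝ) : ℂ :=
  ∑' n : Fin d → ℤ, f n * eC (∑ i, (n i : ℝ) * ξ i)

/-- The Fourier multiplier operator on `ℤ^d` with 1-periodic multiplier `m`. -/
def mulOp (d : ℕ) (m : (Fin d → ℝ) → ℂ) (f : (Fin d → ℤ) → ℂ) (x : Fin d → ℤ) : ℂ :=
  ∫ ξ in Set.Icc (0 : Fin d → ℝ) 1, m ξ * ftZ f ξ * eC (-∑ i, (x i : ℝ) * ξ i)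

/-- The multiplier of `H^q_r`. -/
def mHqr (d q : ℕ) (r : ℝ) (Ψ : (Fin d → ℝ) → ℝ) (ξ : Fin d → ℝ) : ℂ :=
  ∑' n : Fin d → ℤ,
    kloosterman d q ((radSq r : ℤ)) n * ((Ψ (fun i => (q : ℝ) * ξ i - (n i : ℝ)) : ℝ) : ℂ) *
      fourierSphMeasure d r (fun i => ξ i - (n i : ℝ) / q)

/-- The multiplier of `U^{1,q}_r` for `q = q₁q₂`. -/
def mU1 (d q₁ q₂ : ℕ) (r : ℝ) (Ψ' : (Fin d → ℝ) → ℝ) (ξ : Fin d → ℝ) : ℂ :=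
  ∑' n : Fin d → ℤ,
    kloosterman d q₁ ((radSq r : ℤ)) n *
      ((Ψ' (fun i => ((q₁ * q₂ : ℕ) : ℝ) * ξ i - (n i : ℝ)) : ℝ) : ℂ)

/-- The `ℓ^p(ℤ^d) → ℓ^p(ℤ^d)` operator norm (as a supremum over finitely supported
functions in the unit ball). -/
def opNormLp (d : ℕ) (p : ℝ) (T : ((Fin d → ℤ) → ℂ) → ((Fin d → ℤ) → ℂ)) : ℝ≥0∞ :=
  ⨆ f : {f : (Fin d → ℤ) → ℂ // (Function.support f).Finite ∧ lpNorm d p f ≤ 1},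
    lpNorm d p (T f.1)

/-- `𝓕Ψ_q(ζ) = ∫_{ℝ^d} Ψ(qy) e(y·ζ) dy`. -/
def ftPsiQ (d q : ℕ) (Ψ : (Fin d → ℝ) → ℝ) (ζ : Fin d → ℝ) : ℂ :=
  ∫ y : Fin d → ℝ, ((Ψ (fun i => (q : ℝ) * y i) : ℝ) : ℂ) * eC (∑ i, y i * ζ i)

/-- The kernel `K^q_r(x) = c_q(r² - |x|²) · ((𝓕Ψ_q) * dσ_r)(x)`. -/
def kernelK (d q : ℕ) (r : ℝ) (Ψ : (Fin d → ℝ) → ℝ) (x : Fin d → ℤ) : ℂ :=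
  ramanujanSum q ((radSq r : ℤ) - normSqZ x) *
    ∫ y : EuclideanSpace ℝ (Fin d), ftPsiQ d q Ψ (fun i => ((x i : ℝ)) - y i) ∂(sphMeasure d r)

/-- Discrete convolution on `ℤ^d`. -/
def dconv {d : ℕ} (f g : (Fin d → ℤ) → ℂ) (x : Fin d → ℤ) : ℂ :=
  ∑' y : Fin d → ℤ, f y * g (x - y)

/-- `Ã_r f = f * σ_r` with `σ_r = r^{2-d} 1_{sphere}`. -/
def tildeAvg (d : ℕ) (r : ℝ) (f : (Fin d → ℤ) → ℂ) (x : Fin d → ℤ) : ℂ :=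
  (r : ℂ) ^ ((2 : ℤ) - (d : ℤ)) *
    ∑' y : Fin d → ℤ, if normSqZ y = (radSq r : ℤ) then f (x - y) else 0

/-- The error operator `E_r f = Ã_r f - ∑_{1 ≤ q ≤ r} C^q_r f`. -/
def errOp (d : ℕ) (r : ℝ) (Ψ : (Fin d → ℝ) → ℝ) (f : (Fin d → ℤ) → ℂ) (x : Fin d → ℤ) : ℂ :=
  tildeAvg d r f x - ∑ q ∈ Finset.Icc 1 ⌊r⌋₊, dconv f (kernelK d q r Ψ) x

/-- The Euclidean norm `|x|` of `x ∈ ℤ^d`. -/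
def euclNormZ {d : ℕ} (x : Fin d → ℤ) : ℝ := Real.sqrt (∑ i, ((x i : ℝ)) ^ 2)

/-- The polynomial `X^D · ∑_{k<m} (aX + b/X)^{p^k}`, where `D = p^(m-1)`. -/
def stepY {K : Type*} [Field K] (p m : ℕ) (a b : K) : Polynomial K :=
  ∑ k ∈ Finset.range m, (Polynomial.monomial (p ^ (m - 1) + p ^ k) (a ^ p ^ k)
    + Polynomial.monomial (p ^ (m - 1) - p ^ k) (b ^ p ^ k))

lemma stepY_natDegree {K : Type*} [Field K] {p m : ℕ} (hp : 1 < p) (hm : 0 < m) {a b : K}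
    (ha : a ≠ 0) : (stepY p m a b).natDegree = 2 * p ^ (m - 1) := by
  obtain ⟨m, rfl⟩ : ∃ n, m = n + 1 := ⟨m - 1, by omega⟩
  simp only [Nat.add_sub_cancel]
  apply Polynomial.natDegree_eq_of_le_of_coeff_ne_zero
  · unfold stepY
    apply Polynomial.natDegree_sum_le_of_forall_le
    intro k hk
    have hk' : k ≤ m := by simpa [Nat.lt_succ_iff] using hk
    have := Nat.pow_le_pow_right (by omega : 0 < p) hk'
    refine (Polynomial.natDegree_add_le _ _).trans (max_le ?_ ?_)
    · refine (Polynomial.natDegree_monomial_le _).trans ?_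
      simp only [Nat.add_sub_cancel]; omega
    · refine (Polynomial.natDegree_monomial_le _).trans ?_
      simp only [Nat.add_sub_cancel]; omega
  · unfold stepY
    rw [Polynomial.finsetSum_coeff, Finset.sum_eq_single m]
    · have : 0 < p ^ m := by positivity
      simp only [Nat.add_sub_cancel, Polynomial.coeff_add, Polynomial.coeff_monomial]
      rw [if_pos (by omega), if_neg (by omega), add_zero]
      exact pow_ne_zero _ ha
    · intro k hk hkm
      have hk' : k < m := by
        have := Finset.mem_range.1 hk
        omega
      have h1 := Nat.pow_lt_pow_right hp hk'
      simp only [Nat.add_sub_cancel, Polynomial.coeff_add, Polynomial.coeff_monomial]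
      rw [if_neg (by omega), if_neg (by omega), add_zero]
    · simp

lemma stepY_eval {K : Type*} [Field K] {p m : ℕ} (hp : p.Prime) [CharP K p] (hm : 0 < m) {a b x : K}
    (hx : x ≠ 0) : (stepY p m a b).eval x
      = x ^ p ^ (m - 1) * ∑ k ∈ Finset.range m, (a * x + b * x⁻¹) ^ p ^ k := by
  have := Fact.mk hp
  unfold stepY
  rw [Polynomial.eval_finsetSum, Finset.mul_sum]
  refine Finset.sum_congr rfl fun k hk => ?_
  have hk' : k ≤ m - 1 := by have := Finset.mem_range.1 hk; omega
  have h1 := Nat.pow_le_pow_right hp.pos hk'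
  rw [add_pow_char_pow, Polynomial.eval_add, Polynomial.eval_monomial, Polynomial.eval_monomial]
  obtain ⟨e, he⟩ := Nat.exists_eq_add_of_le h1
  have h2 : x ^ p ^ k * x⁻¹ ^ p ^ k = 1 := by rw [← mul_pow, mul_inv_cancel₀ hx, one_pow]
  rw [he, Nat.add_sub_cancel_left, mul_pow, mul_pow, pow_add, pow_add]
  linear_combination (-(b ^ p ^ k * x ^ e)) * h2

/-- Stepanov's bound for the number of points with prescribed trace of `ax + b/x`. -/
theorem stepanov_count {K : Type*} [Field K] [Fintype K] [DecidableEq K] {p m : ℕ} (hp : p.Prime)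
    (hp2 : 2 < p) [CharP K p] (hm : 0 < m) (hK : Fintype.card K = p ^ (2 * m)) {a b t : K}
    (ha : a ≠ 0) :
    (Finset.univ.filter fun x : K => x ≠ 0 ∧
      ∑ k ∈ Finset.range (2 * m), (a * x + b * x⁻¹) ^ p ^ k = t).card
      ≤ p ^ (2 * m - 1) + 5 * p ^ m := by
  classical
  have := Fact.mk hp
  set D := p ^ (m - 1) with hD
  set Q := p ^ m with hQ
  have hQD : Q = p * D := by
    rw [hQ, hD, ← pow_succ']; congr 1; omega
  have hDpos : 0 < D := by positivity
  set Y := stepY p m a b with hY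
  have hYdeg : Y.natDegree = 2 * D := stepY_natDegree hp.one_lt hm ha
  have hY0 : Y ≠ 0 := by
    intro h; rw [h] at hYdeg; simp at hYdeg; omega
  set N := D * Q + D + 4 + 2 * Q with hN
  let ι := Fin D × Fin p × Fin (D + 4)
  let P : ι → Polynomial K := fun i => Polynomial.X ^ (i.1.1 * Q + i.2.2.1 + (p - 1 - i.2.1.1) * D)
      * (Polynomial.C t * Polynomial.X ^ D - Y) ^ i.2.1.1
  let L : (ι → K) →ₗ[K] (Fin N → K) :=
    { toFun := fun h n => ∑ i, h i * (P i).coeff n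
      map_add' := by
        intro x y; ext n; simp [add_mul, Finset.sum_add_distrib]
      map_smul' := by
        intro c x; ext n; simp [Finset.mul_sum, mul_assoc] }
  have hker : LinearMap.ker L ≠ ⊥ := by
    apply LinearMap.ker_ne_bot_of_finrank_lt
    simp only [Module.finrank_fintype_fun_eq_card, Fintype.card_fin, Fintype.card_prod, ι]
    rw [hN, ← mul_assoc, mul_comm D p, ← hQD]
    nlinarith
  obtain ⟨h', hh', hne⟩ := Submodule.exists_mem_ne_zero_of_ne_bot hker
  have hPdeg : ∀ i, (P i).natDegree < N := by
    rintro ⟨⟨i, hi⟩, ⟨j, hj⟩, ⟨k, hk⟩⟩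
    have e1 : (Polynomial.C t * Polynomial.X ^ D - Y).natDegree ≤ 2 * D := by
      refine (Polynomial.natDegree_sub_le _ _).trans (max_le ?_ hYdeg.le)
      refine (Polynomial.natDegree_C_mul_X_pow_le _ _).trans (by omega)
    have e2 : ((Polynomial.C t * Polynomial.X ^ D - Y) ^ j).natDegree ≤ j * (2 * D) :=
      (Polynomial.natDegree_pow_le).trans (Nat.mul_le_mul_left _ e1)
    have e3 : (P ⟨⟨i, hi⟩, ⟨j, hj⟩, ⟨k, hk⟩⟩).natDegree ≤ (i * Q + k + (p - 1 - j) * D)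
        + j * (2 * D) := by
      refine (Polynomial.natDegree_mul_le).trans ?_
      simp only [Polynomial.natDegree_X_pow]
      omega
    refine lt_of_le_of_lt e3 ?_
    obtain ⟨e, he⟩ : ∃ e, p = e + 1 + j := ⟨p - 1 - j, by omega⟩
    have : p - 1 - j = e := by omega
    rw [this, hN]
    have : e * D + j * (2 * D) ≤ 2 * Q := by
      rw [hQD, he]; nlinarith
    have : i * Q ≤ D * Q := Nat.mul_le_mul_right _ hi.le
    omega
  have hLzero : ∑ i, Polynomial.C (h' i) * P i = 0 := by
    ext n
    rw [Polynomial.finsetSum_coeff]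
    simp only [Polynomial.coeff_C_mul, Polynomial.coeff_zero]
    by_cases hn : n < N
    · have := congrFun (LinearMap.mem_ker.1 hh') ⟨n, hn⟩
      simpa [L] using this
    · refine Finset.sum_eq_zero fun i _ => ?_
      rw [Polynomial.coeff_eq_zero_of_natDegree_lt (by have := hPdeg i; omega), mul_zero]
  have hroot : ∀ y : K, ∃ z : K, z ^ Q = y := by
    intro y
    have := (frobeniusEquiv K p)
    refine ⟨(iterateFrobeniusEquiv K p m).symm y, ?_⟩
    rw [hQ, ← iterateFrobeniusEquiv_def, RingEquiv.apply_symm_apply]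
  choose rt hrt using hroot
  let H : Polynomial K := ∑ i : ι, Polynomial.C (rt (h' i)) *
    (Polynomial.X ^ (i.1.1 + (p - 1 - i.2.1.1) * D + i.2.2.1 * Q) * Y ^ i.2.1.1)
  have hMdeg : ∀ i : ι, ((Polynomial.X ^ (i.1.1 + (p - 1 - i.2.1.1) * D + i.2.2.1 * Q)
      * Y ^ i.2.1.1 : Polynomial K)).natDegree = (p - 1) * D + (i.1.1 + i.2.1.1 * D + i.2.2.1 * Q) := by
    rintro ⟨⟨i, hi⟩, ⟨j, hj⟩, ⟨k, hk⟩⟩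
    rw [Polynomial.natDegree_mul (pow_ne_zero _ Polynomial.X_ne_zero) (pow_ne_zero _ hY0),
      Polynomial.natDegree_X_pow, Polynomial.natDegree_pow, hYdeg]
    obtain ⟨e, he⟩ : ∃ e, p = e + 1 + j := ⟨p - 1 - j, by omega⟩
    have h2 : p - 1 = e + j := by omega
    simp only [h2, Nat.add_sub_cancel]
    ring
  have hinj : Function.Injective fun i : ι => i.1.1 + i.2.1.1 * D + i.2.2.1 * Q := by
    rintro ⟨⟨i, hi⟩, ⟨j, hj⟩, ⟨k, hk⟩⟩ ⟨⟨i', hi'⟩, ⟨j', hj'⟩, ⟨k', hk'⟩⟩ heq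
    simp only at heq
    have e1 : i + D * (j + p * k) = i' + D * (j' + p * k') := by
      rw [hQD] at heq; linarith
    have e2 : i = i' := by
      have := congrArg (· % D) e1
      simpa [Nat.add_mul_mod_self_left, Nat.mod_eq_of_lt hi, Nat.mod_eq_of_lt hi'] using this
    subst e2
    have e3 : j + p * k = j' + p * k' := by
      exact Nat.eq_of_mul_eq_mul_left hDpos (by omega)
    have e4 : j = j' := by
      have := congrArg (· % p) e3
      simpa [Nat.add_mul_mod_self_left, Nat.mod_eq_of_lt hj, Nat.mod_eq_of_lt hj'] using this
    subst e4
    have e5 : k = k' := Nat.eq_of_mul_eq_mul_left hp.pos (by omega)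
    subst e5
    rfl
  have hrt0 : ∀ y, y ≠ 0 → rt y ≠ 0 := by
    intro y hy h0
    apply hy
    rw [← hrt y, h0, zero_pow (by positivity)]
  have hH0 : H ≠ 0 := by
    obtain ⟨i0, hi0⟩ : ∃ i, h' i ≠ 0 := by
      by_contra hcon
      push Not at hcon
      exact hne (funext hcon)
    let S : Finset ι := Finset.univ.filter fun i => h' i ≠ 0
    obtain ⟨im, him, hmax⟩ := S.exists_max_image (fun i : ι => i.1.1 + i.2.1.1 * D + i.2.2.1 * Q)
      ⟨i0, by simpa [S] using hi0⟩
    have him' : h' im ≠ 0 := by simpa [S] using him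
    intro hH
    have hc := congrArg (fun P : Polynomial K =>
      P.coeff ((p - 1) * D + (im.1.1 + im.2.1.1 * D + im.2.2.1 * Q))) hH
    simp only [H, Polynomial.finsetSum_coeff, Polynomial.coeff_C_mul, Polynomial.coeff_zero] at hc
    rw [Finset.sum_eq_single im] at hc
    · rw [← hMdeg im, Polynomial.coeff_natDegree] at hc
      rcases mul_eq_zero.1 hc with h1 | h1
      · exact hrt0 _ him' h1
      · rw [Polynomial.leadingCoeff_eq_zero] at h1
        exact (mul_ne_zero (pow_ne_zero _ Polynomial.X_ne_zero) (pow_ne_zero _ hY0)) h1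
    · intro i _ hi
      by_cases hz : h' i = 0
      · have : rt (h' i) = 0 := by
          have := hrt (h' i)
          rw [hz] at this ⊢
          exact pow_eq_zero_iff (by positivity) |>.1 this
        rw [this, zero_mul]
      · rw [Polynomial.coeff_eq_zero_of_natDegree_lt, mul_zero]
        rw [hMdeg]
        have h1 := hmax i (by simpa [S] using hz)
        have h2 : (fun i : ι => i.1.1 + i.2.1.1 * D + i.2.2.1 * Q) i
            ≠ (fun i : ι => i.1.1 + i.2.1.1 * D + i.2.2.1 * Q) im := fun h => hi (hinj h)
        simp only at h1 h2
        omega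
    · simp
  have hHdeg : H.natDegree ≤ (D + 5) * Q := by
    refine Polynomial.natDegree_sum_le_of_forall_le _ _ fun i _ => ?_
    refine (Polynomial.natDegree_C_mul_le _ _).trans ?_
    rw [hMdeg]
    obtain ⟨⟨i, hi⟩, ⟨j, hj⟩, ⟨k, hk⟩⟩ := i
    simp only
    have e1 : i + j * D + 1 ≤ Q := by
      rw [hQD]; nlinarith
    have e2 : (p - 1) * D ≤ Q := by rw [hQD]; exact Nat.mul_le_mul_right _ (by omega)
    have e3 : k * Q ≤ (D + 3) * Q := Nat.mul_le_mul_right _ (by omega)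
    nlinarith
  have hsub : (Finset.univ.filter fun x : K => x ≠ 0 ∧
      ∑ k ∈ Finset.range (2 * m), (a * x + b * x⁻¹) ^ p ^ k = t) ⊆ H.roots.toFinset := by
    intro x hx
    obtain ⟨hx0, hxt⟩ := (Finset.mem_filter.1 hx).2
    rw [Multiset.mem_toFinset, Polynomial.mem_roots hH0, Polynomial.IsRoot.def]
    set y := ∑ k ∈ Finset.range m, (a * x + b * x⁻¹) ^ p ^ k with hy
    have hYx : Y.eval x = x ^ D * y := stepY_eval hp hm hx0
    have hyQ : y ^ Q = t - y := by
      rw [← hxt, two_mul, Finset.sum_range_add, ← hy, add_sub_cancel_left, hQ, hy,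
        sum_pow_char_pow]
      refine Finset.sum_congr rfl fun k _ => ?_
      rw [← pow_mul, ← pow_add, add_comm m k]
    have hxq : x ^ (Q * Q) = x := by
      rw [hQ, ← pow_add, ← two_mul, ← hK, FiniteField.pow_card]
    have key : (H.eval x) ^ Q * x ^ ((p - 1) * D) = x ^ ((p - 1) * D * Q) *
        (∑ i, Polynomial.C (h' i) * P i).eval x := by
      simp only [H, Polynomial.eval_finsetSum]
      rw [hQ, sum_pow_char_pow, ← hQ, Finset.sum_mul, Finset.mul_sum]
      refine Finset.sum_congr rfl fun i _ => ?_
      obtain ⟨⟨i, hi⟩, ⟨j, hj⟩, ⟨k, hk⟩⟩ := i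
      simp only [P, Polynomial.eval_mul, Polynomial.eval_C, Polynomial.eval_pow, Polynomial.eval_X,
        Polynomial.eval_sub, hYx]
      obtain ⟨e, he⟩ : ∃ e, p = e + 1 + j := ⟨p - 1 - j, by omega⟩
      have h2 : p - 1 = e + j := by omega
      simp only [h2, Nat.add_sub_cancel]
      rw [mul_pow, hrt, show t * x ^ D - x ^ D * y = x ^ D * (t - y) by ring, ← hyQ]
      have h3 : (x ^ (k * Q)) ^ Q = x ^ k := by
        rw [← pow_mul, mul_assoc, mul_comm, pow_mul, hxq]
      simp only [pow_add, mul_pow, h3]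
      ring
    rw [hLzero, Polynomial.eval_zero, mul_zero] at key
    rcases mul_eq_zero.1 key with h | h
    · exact pow_eq_zero_iff (by positivity) |>.1 h
    · exact absurd h (pow_ne_zero _ hx0)
  calc _ ≤ H.roots.toFinset.card := Finset.card_le_card hsub
    _ ≤ Multiset.card H.roots := Multiset.toFinset_card_le _
    _ ≤ H.natDegree := Polynomial.card_roots' _
    _ ≤ _ := hHdeg
    _ = _ := by
      rw [add_mul]
      congr 1
      rw [hD, hQ, ← pow_add]; congr 1; omega

section LFun
open Polynomial

/-- The monic polynomial of degree `n` with prescribed lower coefficients. -/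
def monicOf {F : Type*} [Field F] (n : ℕ) (c : Fin n → F) : F[X] := X ^ n + ∑ i : Fin n, C (c i) * X ^ (i : ℕ)

lemma monicOf_coeff {F : Type*} [Field F] {n : ℕ} (c : Fin n → F) (i : Fin n) :
    (monicOf n c).coeff i = c i := by
  unfold monicOf
  rw [coeff_add, coeff_X_pow, if_neg (by omega), zero_add, finsetSum_coeff,
    Finset.sum_eq_single i]
  · simp
  · intro j _ hj
    rw [coeff_C_mul, coeff_X_pow, if_neg, mul_zero]
    intro h
    exact hj (Fin.ext h.symm)
  · simp

lemma monicOf_degree {F : Type*} [Field F] {n : ℕ} (c : Fin n → F) :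
    (∑ i : Fin n, C (c i) * X ^ (i : ℕ)).degree < (n : WithBot ℕ) := by
  rw [degree_lt_iff_coeff_zero]
  intro m hm
  rw [finsetSum_coeff]
  refine Finset.sum_eq_zero fun i _ => ?_
  rw [coeff_C_mul, coeff_X_pow, if_neg (by omega), mul_zero]

lemma monicOf_monic {F : Type*} [Field F] {n : ℕ} (c : Fin n → F) : (monicOf n c).Monic :=
  monic_X_pow_add (monicOf_degree c)

lemma monicOf_natDegree {F : Type*} [Field F] {n : ℕ} (c : Fin n → F) :
    (monicOf n c).natDegree = n := by
  apply natDegree_eq_of_degree_eq_some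
  unfold monicOf
  rw [degree_add_eq_left_of_degree_lt] <;> rw [degree_X_pow]
  exact monicOf_degree c

variable {F : Type*} [Field F] [Fintype F] [DecidableEq F]

/-- The finite set of monic polynomials of degree `n` with nonzero constant term. -/
def monN (F : Type*) [Field F] [Fintype F] [DecidableEq F] (n : ℕ) : Finset F[X] :=
  (Finset.univ.image (monicOf n (F := F))).filter fun f => f.coeff 0 ≠ 0

lemma mem_monN {n : ℕ} {f : F[X]} :
    f ∈ monN F n ↔ f.Monic ∧ f.natDegree = n ∧ f.coeff 0 ≠ 0 := by
  unfold monN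
  rw [Finset.mem_filter, Finset.mem_image]
  constructor
  · rintro ⟨⟨c, -, rfl⟩, h⟩
    exact ⟨monicOf_monic c, monicOf_natDegree c, h⟩
  · rintro ⟨h1, h2, h3⟩
    refine ⟨⟨fun i => f.coeff i, Finset.mem_univ _, ?_⟩, h3⟩
    conv_rhs => rw [h1.as_sum, h2, Finset.sum_range]
    rfl

lemma sum_monN {M : Type*} [AddCommMonoid M] (n : ℕ) (w : F[X] → M) :
    ∑ f ∈ monN F n, w f = ∑ c : Fin n → F, if (monicOf n c).coeff 0 ≠ 0 then w (monicOf n c) else 0 := by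
  unfold monN
  rw [Finset.sum_filter, Finset.sum_image]
  intro c _ c' _ h
  ext i
  rw [← monicOf_coeff c i, ← monicOf_coeff c' i, h]

/-- The irreducible elements of `monN` of degree dividing `k`. -/
def irrN (F : Type*) [Field F] [Fintype F] [DecidableEq F] (k : ℕ) : Finset F[X] :=
  @Finset.filter _ (fun f : F[X] => Irreducible f ∧ f.natDegree ∣ k) (Classical.decPred _)
    ((Finset.range (k + 1)).biUnion (monN F))

lemma mem_irrN {k : ℕ} (hk : 0 < k) {f : F[X]} :
    f ∈ irrN F k ↔ f.Monic ∧ f.coeff 0 ≠ 0 ∧ Irreducible f ∧ f.natDegree ∣ k := by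
  unfold irrN
  rw [@Finset.mem_filter _ _ (Classical.decPred _), Finset.mem_biUnion]
  constructor
  · rintro ⟨⟨n, hn, h⟩, h2⟩
    rw [mem_monN] at h
    exact ⟨h.1, h.2.2, h2⟩
  · rintro ⟨h1, h2, h3⟩
    refine ⟨⟨f.natDegree, ?_, ?_⟩, h3⟩
    · rw [Finset.mem_range]; have := Nat.le_of_dvd hk h3.2; omega
    · rw [mem_monN]; exact ⟨h1, rfl, h2⟩

open scoped Classical in
/-- The degree of a monic polynomial, counted through its irreducible factors. -/
lemma sum_irr_degree {n : ℕ} {f : F[X]} (hf : f ∈ monN F n) :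
    (∑ k ∈ Finset.Icc 1 n, ∑ P ∈ irrN F k, if P ^ (k / P.natDegree) ∣ f then P.natDegree else 0) = n := by
  classical
  obtain ⟨hm, hd, h0⟩ := mem_monN.1 hf
  have hf0 : f ≠ 0 := hm.ne_zero
  set s := UniqueFactorizationMonoid.normalizedFactors f with hs
  have hprod : s.prod = f := by
    have := leadingCoeff_mul_prod_normalizedFactors f
    rwa [hm.leadingCoeff, C_1, one_mul] at this
  have hfac : ∀ P ∈ s, P.Monic ∧ P.coeff 0 ≠ 0 ∧ Irreducible P ∧ P ∣ f := by
    intro P hP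
    have hi := UniqueFactorizationMonoid.irreducible_of_normalized_factor P hP
    have hdv := UniqueFactorizationMonoid.dvd_of_mem_normalizedFactors hP
    have hn := UniqueFactorizationMonoid.normalize_normalized_factor P hP
    refine ⟨?_, ?_, hi, hdv⟩
    · rw [← hn]; exact monic_normalize hi.ne_zero
    · intro h
      obtain ⟨g, hg⟩ := hdv
      rw [hg, mul_coeff_zero, h, zero_mul] at h0
      exact h0 rfl
  have hdeg : n = ∑ P ∈ s.toFinset, s.count P * P.natDegree := by
    rw [← hd]
    conv_lhs => rw [← hprod]
    rw [natDegree_multiset_prod _ (UniqueFactorizationMonoid.zero_notMem_normalizedFactors f),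
      Finset.sum_multiset_map_count]
    simp only [smul_eq_mul]
    rfl
  have hmult : ∀ P ∈ s.toFinset, ∀ j, P ^ j ∣ f ↔ j ≤ s.count P := by
    intro P hP j
    have hP' := Multiset.mem_toFinset.1 hP
    rw [pow_dvd_iff_le_emultiplicity,
      UniqueFactorizationMonoid.emultiplicity_eq_count_normalizedFactors (hfac P hP').2.2.1 hf0,
      UniqueFactorizationMonoid.normalize_normalized_factor P hP']
    norm_cast
  have hset : ∀ k ∈ Finset.Icc 1 n, (∑ P ∈ irrN F k, if P ^ (k / P.natDegree) ∣ f then P.natDegree else 0)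
      = ∑ P ∈ s.toFinset, if P.natDegree ∣ k ∧ k / P.natDegree ≤ s.count P then P.natDegree else 0 := by
    intro k hk
    have hk1 := (Finset.mem_Icc.1 hk).1
    rw [← Finset.sum_filter, ← Finset.sum_filter]
    congr 1
    ext P
    rw [Finset.mem_filter, Finset.mem_filter, mem_irrN hk1]
    constructor
    · rintro ⟨⟨a1, a2, a3, a4⟩, a5⟩
      have hpos : 0 < k / P.natDegree := Nat.div_pos (Nat.le_of_dvd hk1 a4) a3.natDegree_pos
      have hPf : P ∣ f := (dvd_pow_self P hpos.ne').trans a5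
      have hPs : P ∈ s.toFinset := by
        rw [Multiset.mem_toFinset, hs, UniqueFactorizationMonoid.mem_normalizedFactors_iff' hf0]
        exact ⟨a3, a1.normalize_eq_self, hPf⟩
      exact ⟨hPs, a4, (hmult P hPs _).1 a5⟩
    · rintro ⟨a1, a2, a3⟩
      have := hfac P (Multiset.mem_toFinset.1 a1)
      exact ⟨⟨this.1, this.2.1, this.2.2.1, a2⟩, (hmult P a1 _).2 a3⟩
  rw [Finset.sum_congr rfl hset, Finset.sum_comm]
  conv_rhs => rw [hdeg]
  refine Finset.sum_congr rfl fun P hP => ?_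
  rw [← Finset.sum_filter, Finset.sum_const, smul_eq_mul]
  congr 1
  have hP' := hfac P (Multiset.mem_toFinset.1 hP)
  have hdp := hP'.2.2.1.natDegree_pos
  have hle : s.count P * P.natDegree ≤ n := by
    rw [← hd, ← natDegree_pow]
    exact natDegree_le_of_dvd ((hmult P hP _).2 le_rfl) hf0
  have himg : (Finset.Icc 1 n).filter (fun k => P.natDegree ∣ k ∧ k / P.natDegree ≤ s.count P)
      = (Finset.Icc 1 (s.count P)).image (fun j => j * P.natDegree) := by
    ext k
    simp only [Finset.mem_filter, Finset.mem_Icc, Finset.mem_image]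
    constructor
    · rintro ⟨⟨b1, b2⟩, ⟨j, rfl⟩, b4⟩
      rw [Nat.mul_div_cancel_left _ hdp] at b4
      exact ⟨j, ⟨Nat.pos_of_mul_pos_left b1, b4⟩, mul_comm _ _⟩
    · rintro ⟨j, ⟨b1, b2⟩, rfl⟩
      refine ⟨⟨Nat.mul_pos b1 hdp, (Nat.mul_le_mul_right _ b2).trans hle⟩, dvd_mul_left _ _, ?_⟩
      rwa [Nat.mul_div_cancel _ hdp]
  rw [himg, Finset.card_image_of_injective _ (fun a b h => Nat.eq_of_mul_eq_mul_right hdp h)]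
  simp

/-- Newton's recursion for the coefficients of the `L`-function of a multiplicative weight. -/
lemma newton_recursion (w : F[X] → ℂ)
    (hw : ∀ f g : F[X], f.Monic → g.Monic → f.coeff 0 ≠ 0 → g.coeff 0 ≠ 0 → w (f * g) = w f * w g)
    (hw1 : w 1 = 1) (n : ℕ) :
    (n : ℂ) * ∑ f ∈ monN F n, w f = ∑ k ∈ Finset.Icc 1 n,
      (∑ P ∈ irrN F k, (P.natDegree : ℂ) * w P ^ (k / P.natDegree)) * ∑ h ∈ monN F (n - k), w h := by
  classical
  have hpow : ∀ P : F[X], P.Monic → P.coeff 0 ≠ 0 → ∀ j, w (P ^ j) = w P ^ j := by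
    intro P h1 h2 j
    induction j with
    | zero => simpa using hw1
    | succ j ih =>
      rw [pow_succ, pow_succ, hw _ _ (h1.pow j) h1 _ h2, ih]
      rw [coeff_zero_eq_eval_zero, eval_pow, ← coeff_zero_eq_eval_zero]
      exact pow_ne_zero _ h2
  have key : ∀ k ∈ Finset.Icc 1 n, ∀ P ∈ irrN F k,
      w P ^ (k / P.natDegree) * ∑ h ∈ monN F (n - k), w h
        = ∑ f ∈ monN F n, if P ^ (k / P.natDegree) ∣ f then w f else 0 := by
    intro k hk P hP
    obtain ⟨hk1, hkn⟩ := Finset.mem_Icc.1 hk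
    obtain ⟨h1, h2, h3, h4⟩ := (mem_irrN hk1).1 hP
    set j := k / P.natDegree with hj
    have hPj : (P ^ j).natDegree = k := by rw [natDegree_pow, hj, Nat.div_mul_cancel h4]
    have hPm : (P ^ j).Monic := h1.pow j
    have hP0 : (P ^ j).coeff 0 ≠ 0 := by
      rw [coeff_zero_eq_eval_zero, eval_pow, ← coeff_zero_eq_eval_zero]
      exact pow_ne_zero _ h2
    rw [← Finset.sum_filter, Finset.mul_sum]
    refine Finset.sum_bij (fun h _ => P ^ j * h) ?_ ?_ ?_ ?_
    · intro h hh
      obtain ⟨b1, b2, b3⟩ := mem_monN.1 hh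
      rw [Finset.mem_filter, mem_monN]
      refine ⟨⟨hPm.mul b1, ?_, ?_⟩, dvd_mul_right _ _⟩
      · rw [hPm.natDegree_mul b1, hPj, b2]; omega
      · rw [mul_coeff_zero]; exact mul_ne_zero hP0 b3
    · intro h _ h' _ he
      exact mul_left_cancel₀ hPm.ne_zero he
    · intro f hf
      obtain ⟨hf1, g, rfl⟩ := Finset.mem_filter.1 hf
      obtain ⟨b1, b2, b3⟩ := mem_monN.1 hf1
      have hg := hPm.of_mul_monic_left b1
      refine ⟨g, mem_monN.2 ⟨hg, ?_, ?_⟩, rfl⟩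
      · rw [hPm.natDegree_mul hg, hPj] at b2; omega
      · rw [mul_coeff_zero] at b3; exact right_ne_zero_of_mul b3
    · intro h hh
      obtain ⟨b1, b2, b3⟩ := mem_monN.1 hh
      rw [hw _ _ hPm b1 hP0 b3, hpow P h1 h2]
  calc (n : ℂ) * ∑ f ∈ monN F n, w f
      = ∑ f ∈ monN F n, ((∑ k ∈ Finset.Icc 1 n, ∑ P ∈ irrN F k,
          if P ^ (k / P.natDegree) ∣ f then P.natDegree else 0 : ℕ) : ℂ) * w f := by
        rw [Finset.mul_sum]
        refine Finset.sum_congr rfl fun f hf => ?_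
        rw [sum_irr_degree hf]
    _ = ∑ k ∈ Finset.Icc 1 n, ∑ P ∈ irrN F k, (P.natDegree : ℂ) *
          ∑ f ∈ monN F n, if P ^ (k / P.natDegree) ∣ f then w f else 0 := by
        push_cast
        simp_rw [Finset.sum_mul, Finset.mul_sum]
        rw [Finset.sum_comm]
        refine Finset.sum_congr rfl fun k _ => ?_
        rw [Finset.sum_comm]
        refine Finset.sum_congr rfl fun P _ => Finset.sum_congr rfl fun f _ => ?_
        split_ifs <;> simp
    _ = _ := by
        refine Finset.sum_congr rfl fun k hk => ?_
        rw [Finset.sum_mul]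
        refine Finset.sum_congr rfl fun P hP => ?_
        rw [← key k hk P hP, mul_assoc]
end LFun

section Weil
open Polynomial
variable {F : Type*} [Field F] [Fintype F] [DecidableEq F]

/-- The Kloosterman weight of a polynomial: `ψ(a Σρ + b Σρ⁻¹)` over its roots. -/
def klWeight (ψ : AddChar F ℂ) (a b : F) (f : F[X]) : ℂ :=
  ψ (-(a * f.nextCoeff) - b * (f.coeff 1 * (f.coeff 0)⁻¹))

lemma klWeight_mul (ψ : AddChar F ℂ) (a b : F) (f g : F[X]) (hf : f.Monic) (hg : g.Monic)
    (hf0 : f.coeff 0 ≠ 0) (hg0 : g.coeff 0 ≠ 0) :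
    klWeight ψ a b (f * g) = klWeight ψ a b f * klWeight ψ a b g := by
  unfold klWeight
  rw [← AddChar.map_add_eq_mul, hf.nextCoeff_mul hg, mul_coeff_one, mul_coeff_zero]
  congr 1
  field_simp
  ring

lemma klWeight_one (ψ : AddChar F ℂ) (a b : F) : klWeight ψ a b 1 = 1 := by
  simp [klWeight, nextCoeff, coeff_one]

/-- The Kloosterman sum attached to the additive character `ψ`. -/
def klSum (ψ : AddChar F ℂ) (a b : F) : ℂ := ∑ x : F, if x ≠ 0 then ψ (a * x + b * x⁻¹) else 0

lemma addChar_sum_eq_zero {G : Type*} [AddCommGroup G] [Fintype G] (φ : G → ℂ) (t : G) (z : ℂ)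
    (hz : z ≠ 1) (h : ∀ x, φ (x + t) = z * φ x) : ∑ x, φ x = 0 := by
  have h1 : ∑ x, φ x = z * ∑ x, φ x := by
    rw [Finset.mul_sum, ← Equiv.sum_comp (Equiv.addRight t)]
    exact Finset.sum_congr rfl fun x _ => h x
  have h2 : (1 - z) * ∑ x, φ x = 0 := by rw [sub_mul, one_mul, ← h1, sub_self]
  rcases mul_eq_zero.1 h2 with h3 | h3
  · exact absurd (sub_eq_zero.1 h3).symm hz
  · exact h3

lemma nextCoeff_monicOf {n : ℕ} (c : Fin (n + 1) → F) :
    (monicOf (n + 1) c).nextCoeff = c (Fin.last n) := by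
  rw [nextCoeff_of_natDegree_pos (by rw [monicOf_natDegree]; omega), monicOf_natDegree]
  exact monicOf_coeff c (Fin.last n)

lemma sum_klWeight_zero (ψ : AddChar F ℂ) (a b : F) : ∑ f ∈ monN F 0, klWeight ψ a b f = 1 := by
  rw [sum_monN]
  have : ∀ c : Fin 0 → F, monicOf 0 c = 1 := by intro c; simp [monicOf]
  simp [this, klWeight_one]

lemma sum_klWeight_one (ψ : AddChar F ℂ) (a b : F) :
    ∑ f ∈ monN F 1, klWeight ψ a b f = klSum ψ a b := by
  rw [sum_monN, ← Equiv.sum_comp (Equiv.funUnique (Fin 1) F).symm, klSum,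
    ← Equiv.sum_comp (Equiv.neg F)]
  refine Finset.sum_congr rfl fun x _ => ?_
  have h0 : ∀ x, (monicOf 1 ((Equiv.funUnique (Fin 1) F).symm x)).coeff 0 = x :=
    fun x => monicOf_coeff _ (0 : Fin 1)
  have h1 : ∀ x, (monicOf 1 ((Equiv.funUnique (Fin 1) F).symm x)).coeff 1 = 1 := by
    intro x
    have := (monicOf_monic ((Equiv.funUnique (Fin 1) F).symm x)).coeff_natDegree
    rwa [monicOf_natDegree] at this
  have h2 : ∀ x, (monicOf 1 ((Equiv.funUnique (Fin 1) F).symm x)).nextCoeff = x :=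
    fun x => nextCoeff_monicOf _
  simp only [h0, klWeight, h1, h2, Equiv.neg_apply, ne_eq, neg_eq_zero]
  refine if_congr Iff.rfl (congrArg _ ?_) rfl
  rw [inv_neg]
  ring

lemma sum_klWeight_two (ψ : AddChar F ℂ) (hψ : ψ ≠ 1) {a b : F} (ha : a ≠ 0) (hb : b ≠ 0) :
    ∑ f ∈ monN F 2, klWeight ψ a b f = Fintype.card F := by
  rw [sum_monN, ← Equiv.sum_comp (finTwoArrowEquiv F).symm, Fintype.sum_prod_type]
  have hval : ∀ x y : F, (if (monicOf 2 ((finTwoArrowEquiv F).symm (x, y))).coeff 0 ≠ 0 then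
      klWeight ψ a b (monicOf 2 ((finTwoArrowEquiv F).symm (x, y))) else 0)
      = if x ≠ 0 then ψ (y * (-(a + b * x⁻¹))) else 0 := by
    intro x y
    have h0 : (monicOf 2 ((finTwoArrowEquiv F).symm (x, y))).coeff 0 = x :=
      monicOf_coeff _ (0 : Fin 2)
    have h1 : (monicOf 2 ((finTwoArrowEquiv F).symm (x, y))).coeff 1 = y :=
      monicOf_coeff _ (1 : Fin 2)
    have h2 : (monicOf 2 ((finTwoArrowEquiv F).symm (x, y))).nextCoeff = y :=
      nextCoeff_monicOf _
    rw [h0, klWeight, h0, h1, h2]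
    refine if_congr Iff.rfl (congrArg _ ?_) rfl
    ring
  simp_rw [hval]
  have hprim : ψ.IsPrimitive := AddChar.IsPrimitive.of_ne_one hψ
  rw [Finset.sum_eq_single (-(b / a))]
  · have hne : -(b / a) ≠ 0 := neg_ne_zero.2 (div_ne_zero hb ha)
    have hz : -(a + b * (-(b / a))⁻¹) = 0 := by
      rw [inv_neg, inv_div]; field_simp; ring
    simp only [if_pos hne, hz, mul_zero, AddChar.map_zero_eq_one]
    simp
  · intro x _ hx
    by_cases h0 : x = 0
    · simp [h0]
    · simp only [ne_eq, h0, not_false_eq_true, if_true]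
      rw [AddChar.sum_mulShift _ hprim, if_neg]
      · simp
      · intro h
        apply hx
        field_simp at h
        field_simp
        linear_combination (-1 : F) * h
  · simp

lemma sum_klWeight_three (ψ : AddChar F ℂ) (hψ : ψ ≠ 1) {a b : F} (ha : a ≠ 0) {n : ℕ}
    (hn : 3 ≤ n) : ∑ f ∈ monN F n, klWeight ψ a b f = 0 := by
  obtain ⟨n, rfl⟩ : ∃ m, n = m + 3 := ⟨n - 3, by omega⟩
  rw [sum_monN]
  obtain ⟨s, hs⟩ : ∃ s, ψ s ≠ 1 := by
    by_contra h; push Not at h; exact hψ (by ext x; simpa using h x)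
  refine addChar_sum_eq_zero _ (Pi.single (Fin.last (n + 2)) (-(s / a))) (ψ s) hs fun c => ?_
  have e0 : ∀ c : Fin (n + 3) → F, (monicOf (n + 3) c).coeff 0 = c 0 :=
    fun c => monicOf_coeff c 0
  have e1 : ∀ c : Fin (n + 3) → F, (monicOf (n + 3) c).coeff 1 = c 1 :=
    fun c => monicOf_coeff c 1
  have e2 : ∀ c : Fin (n + 3) → F, (monicOf (n + 3) c).nextCoeff = c (Fin.last _) :=
    fun c => nextCoeff_monicOf c
  simp only [klWeight, e0, e1, e2, Pi.add_apply, Pi.single_eq_same]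
  have n0 : (0 : Fin (n + 3)) ≠ Fin.last (n + 2) := by
    intro h; have := congrArg Fin.val h; simp at this
  have n1 : (1 : Fin (n + 3)) ≠ Fin.last (n + 2) := by
    intro h; have := congrArg Fin.val h; simp at this
  rw [Pi.single_eq_of_ne n0, Pi.single_eq_of_ne n1, add_zero, add_zero, mul_ite, mul_zero,
    ← AddChar.map_add_eq_mul]
  refine if_congr Iff.rfl (congrArg _ ?_) rfl
  field_simp
  ring

end Weil

section Weil
open Polynomial
open scoped IntermediateField
variable {F : Type*} [Field F] [Fintype F] [DecidableEq F]

lemma minpoly_inv {K : Type*} [Field K] [Algebra F K] [FiniteDimensional F K] {x : K}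
    (hx : x ≠ 0) :
    minpoly F x⁻¹ = C ((minpoly F x).coeff 0)⁻¹ * (minpoly F x).reverse := by
  have hint : IsIntegral F x := .of_finite F x
  have hint' : IsIntegral F x⁻¹ := .of_finite F _
  have h0 : (minpoly F x).coeff 0 ≠ 0 := minpoly.coeff_zero_ne_zero hint hx
  have hmon := minpoly.monic hint
  have hfin : F⟮x⁻¹⟯ = F⟮x⟯ := by
    apply le_antisymm <;> rw [IntermediateField.adjoin_simple_le_iff]
    · exact inv_mem (IntermediateField.mem_adjoin_simple_self F x)
    · have := inv_mem (IntermediateField.mem_adjoin_simple_self F x⁻¹)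
      rwa [inv_inv] at this
  have hdeg : (minpoly F x⁻¹).natDegree = (minpoly F x).natDegree := by
    rw [← IntermediateField.adjoin.finrank hint', ← IntermediateField.adjoin.finrank hint, hfin]
  apply eq_of_dvd_of_natDegree_le_of_leadingCoeff
  · apply minpoly.dvd
    rw [map_mul]
    have : aeval x⁻¹ (minpoly F x).reverse = 0 := by
      let := invertibleOfNonzero hx
      have := (eval₂_reverse_eq_zero_iff (algebraMap F K) x (minpoly F x)).2 (minpoly.aeval F x)
      rwa [invOf_eq_inv] at this
    rw [this, mul_zero]
  · rw [hdeg]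
    refine (natDegree_C_mul_le _ _).trans (reverse_natDegree_le _)
  · rw [(minpoly.monic hint').leadingCoeff, leadingCoeff_mul, leadingCoeff_C, reverse_leadingCoeff,
      trailingCoeff_eq_coeff_zero h0, inv_mul_cancel₀ h0]

lemma klWeight_minpoly {K : Type*} [Field K] [Algebra F K] [FiniteDimensional F K]
    (ψ : AddChar F ℂ) (a b : F) {x : K} (hx : x ≠ 0) :
    klWeight ψ a b (minpoly F x) ^ (Module.finrank F K / (minpoly F x).natDegree)
      = ψ (Algebra.trace F K (algebraMap F K a * x + algebraMap F K b * x⁻¹)) := by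
  have hint : IsIntegral F x := .of_finite F x
  have h0 : (minpoly F x).coeff 0 ≠ 0 := minpoly.coeff_zero_ne_zero hint hx
  have hint' : IsIntegral F x⁻¹ := .of_finite F _
  have hfin : F⟮x⁻¹⟯ = F⟮x⟯ := by
    apply le_antisymm <;> rw [IntermediateField.adjoin_simple_le_iff]
    · exact inv_mem (IntermediateField.mem_adjoin_simple_self F x)
    · have := inv_mem (IntermediateField.mem_adjoin_simple_self F x⁻¹)
      rwa [inv_inv] at this
  have hn : Module.finrank F K / (minpoly F x).natDegree = Module.finrank F⟮x⟯ K := by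
    rw [← IntermediateField.adjoin.finrank hint, ← Module.finrank_mul_finrank F F⟮x⟯ K,
      Nat.mul_div_cancel_left _ Module.finrank_pos]
  have hr : (minpoly F x⁻¹).nextCoeff = (minpoly F x).coeff 1 * ((minpoly F x).coeff 0)⁻¹ := by
    rw [minpoly_inv hx, nextCoeff_C_mul, mul_comm]
    congr 1
    have hpos : 0 < (minpoly F x).natDegree := minpoly.natDegree_pos hint
    have hnt : (minpoly F x).natTrailingDegree = 0 := by
      rw [natTrailingDegree_eq_zero]; exact Or.inr h0
    have hrd : (minpoly F x).reverse.natDegree = (minpoly F x).natDegree := by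
      rw [reverse_natDegree, hnt, Nat.sub_zero]
    rw [nextCoeff_of_natDegree_pos (by rw [hrd]; exact hpos), hrd, coeff_reverse,
      revAt_le (Nat.sub_le _ _)]
    congr 1
    omega
  rw [map_add, ← Algebra.smul_def, ← Algebra.smul_def, map_smul, map_smul, hn,
    trace_eq_finrank_mul_minpoly_nextCoeff, trace_eq_finrank_mul_minpoly_nextCoeff, hr, hfin,
    klWeight, ← AddChar.map_nsmul_eq_pow]
  congr 1
  simp only [smul_eq_mul, nsmul_eq_mul]
  ring

lemma card_minpoly_eq {K : Type*} [Field K] [Fintype K] [DecidableEq K] [Algebra F K]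
    {P : F[X]} (hP : P ∈ irrN F (Module.finrank F K)) :
    (Finset.univ.filter fun x : K => x ≠ 0 ∧ minpoly F x = P).card = P.natDegree := by
  have hfd : FiniteDimensional F K := inferInstance
  obtain ⟨hm, h0, hi, hd⟩ := (mem_irrN Module.finrank_pos).1 hP
  have hq : Fintype.card K = Nat.card F ^ Module.finrank F K := by
    rw [Nat.card_eq_fintype_card, ← Module.card_eq_pow_finrank]
  have hdvd := hi.natDegree_dvd_iff_dvd_X_pow_card_pow_sub_X.1 hd
  rw [← hq] at hdvd
  have hdvd' : P.map (algebraMap F K) ∣ X ^ Fintype.card K - X := by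
    have := map_dvd (mapRingHom (algebraMap F K)) hdvd
    simpa using this
  have hne : (X ^ Fintype.card K - X : K[X]) ≠ 0 :=
    FiniteField.X_pow_card_sub_X_ne_zero K Fintype.one_lt_card
  have hroots := FiniteField.roots_X_pow_card_sub_X K
  have hsp : (X ^ Fintype.card K - X : K[X]).Splits := by
    rw [splits_iff_card_roots, hroots, FiniteField.X_pow_card_sub_X_natDegree_eq K Fintype.one_lt_card]
    rfl
  have hspP := hsp.of_dvd hne hdvd'
  have hnd : (P.map (algebraMap F K)).roots.Nodup :=
    Multiset.nodup_of_le (roots.le_of_dvd hne hdvd') (by rw [hroots]; exact Finset.univ.nodup)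
  have hcard : (P.map (algebraMap F K)).roots.card = P.natDegree := by
    rw [← hspP.natDegree_eq_card_roots, natDegree_map]
  rw [← hcard, ← Multiset.toFinset_card_of_nodup hnd]
  congr 1
  ext x
  have hmap0 : P.map (algebraMap F K) ≠ 0 := by simpa using hi.ne_zero
  rw [Finset.mem_filter, Multiset.mem_toFinset, mem_roots hmap0, IsRoot.def, eval_map_algebraMap]
  constructor
  · rintro ⟨-, -, rfl⟩
    exact minpoly.aeval F x
  · intro h
    refine ⟨Finset.mem_univ _, ?_, (minpoly.eq_of_irreducible_of_monic hi h hm).symm⟩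
    rintro rfl
    apply h0
    rw [← coeff_zero_eq_aeval_zero'] at h
    simpa using h

/-- The power sums of the `L`-function are exponential sums over the extension fields. -/
lemma sum_irrN_eq_trace {K : Type*} [Field K] [Fintype K] [DecidableEq K] [Algebra F K]
    (ψ : AddChar F ℂ) (a b : F) :
    (∑ P ∈ irrN F (Module.finrank F K),
        (P.natDegree : ℂ) * klWeight ψ a b P ^ (Module.finrank F K / P.natDegree))
      = ∑ x ∈ Finset.univ.filter (fun x : K => x ≠ 0),
          ψ (Algebra.trace F K (algebraMap F K a * x + algebraMap F K b * x⁻¹)) := by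
  have hfd : FiniteDimensional F K := inferInstance
  rw [← Finset.sum_fiberwise_of_maps_to (s := Finset.univ.filter (fun x : K => x ≠ 0))
    (t := irrN F (Module.finrank F K)) (g := minpoly F)]
  · refine Finset.sum_congr rfl fun P hP => ?_
    rw [Finset.filter_filter, ← card_minpoly_eq hP, ← nsmul_eq_mul, ← Finset.sum_const]
    refine Finset.sum_congr rfl fun x hx => ?_
    obtain ⟨-, hx0, rfl⟩ := Finset.mem_filter.1 hx
    rw [← klWeight_minpoly ψ a b hx0, card_minpoly_eq hP]
  · intro x hx
    have hx0 := (Finset.mem_filter.1 hx).2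
    have hint : IsIntegral F x := .of_finite F x
    rw [mem_irrN Module.finrank_pos]
    exact ⟨minpoly.monic hint, minpoly.coeff_zero_ne_zero hint hx0, minpoly.irreducible hint,
      ⟨_, by rw [← IntermediateField.adjoin.finrank hint, Module.finrank_mul_finrank F F⟮x⟯ K]⟩⟩
end Weil

lemma norm_addChar_eq_one {G : Type*} [AddCommGroup G] [Finite G] (ψ : AddChar G ℂ) (x : G) :
    ‖ψ x‖ = 1 := ψ.norm_apply x

/-- The trace sum of `ax + b/x` over the field with `p ^ (2 * m)` elements. -/
lemma norm_trace_sum_le {p m : ℕ} [Fact p.Prime] (hp2 : 2 < p) (hm : 0 < m)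
    (ψ : AddChar (ZMod p) ℂ) {K : Type*} [Field K] [Fintype K] [DecidableEq K]
    [Algebra (ZMod p) K] (hK : Module.finrank (ZMod p) K = 2 * m) {a b : ZMod p} (ha : a ≠ 0)
    (hψ : ψ ≠ 1) :
    ‖∑ x ∈ Finset.univ.filter (fun x : K => x ≠ 0),
      ψ (Algebra.trace (ZMod p) K (algebraMap _ K a * x + algebraMap _ K b * x⁻¹))‖
      ≤ 6 * (p * p ^ m) := by
  have hp := Fact.out (p := p.Prime)
  have : CharP K p := charP_of_injective_algebraMap (algebraMap (ZMod p) K).injective p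
  have hcard : Fintype.card K = p ^ (2 * m) := by
    rw [Module.card_eq_pow_finrank (K := ZMod p), hK, ZMod.card]
  set S := Finset.univ.filter (fun x : K => x ≠ 0) with hS
  let T : K → ZMod p := fun x => Algebra.trace (ZMod p) K (algebraMap _ K a * x + algebraMap _ K b * x⁻¹)
  let N : ZMod p → ℕ := fun t => (S.filter fun x => T x = t).card
  have hN : ∀ t, N t ≤ p ^ (2 * m - 1) + 5 * p ^ m := by
    intro t
    have := stepanov_count (K := K) hp hp2 hm hcard (a := algebraMap _ K a) (b := algebraMap _ K b)
      (t := algebraMap _ K t) (by simpa using ha)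
    refine le_trans (Finset.card_le_card ?_) this
    intro x hx
    simp only [hS, Finset.mem_filter, Finset.mem_univ, true_and] at hx ⊢
    refine ⟨hx.1, ?_⟩
    rw [← hx.2, FiniteField.algebraMap_trace_eq_sum_pow, hK, Nat.card_eq_fintype_card, ZMod.card]
  have hsum : ∑ t, N t = p ^ (2 * m) - 1 := by
    rw [← Finset.card_eq_sum_card_fiberwise (fun x _ => Finset.mem_univ _)]
    rw [hS, Finset.filter_ne', Finset.card_erase_of_mem (Finset.mem_univ _), Finset.card_univ, hcard]
  have h1 : ∑ x ∈ S, ψ (T x) = ∑ t, (N t : ℂ) * ψ t := by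
    rw [← Finset.sum_fiberwise_of_maps_to (g := T) (t := Finset.univ) (fun x _ => Finset.mem_univ _)]
    refine Finset.sum_congr rfl fun t _ => ?_
    rw [← nsmul_eq_mul, ← Finset.sum_const]
    refine Finset.sum_congr rfl fun x hx => ?_
    rw [(Finset.mem_filter.1 hx).2]
  have h2 : ∑ t, ψ t = 0 := AddChar.sum_eq_zero_of_ne_one hψ
  set M : ℕ := p ^ (2 * m - 1) + 5 * p ^ m with hM
  have h3 : ∑ t, (N t : ℂ) * ψ t = - ∑ t, ((M - N t : ℝ) : ℂ) * ψ t := by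
    push_cast
    simp_rw [sub_mul, Finset.sum_sub_distrib, ← Finset.mul_sum, h2]
    ring
  change ‖∑ x ∈ S, ψ (T x)‖ ≤ _
  rw [h1, h3, norm_neg]
  calc ‖∑ t, ((M - N t : ℝ) : ℂ) * ψ t‖ ≤ ∑ t, (M - N t : ℝ) := by
        refine (norm_sum_le _ _).trans (Finset.sum_le_sum fun t _ => ?_)
        rw [norm_mul, norm_addChar_eq_one, mul_one, Complex.norm_real, Real.norm_of_nonneg]
        rw [sub_nonneg]; exact_mod_cast hN t
    _ = p * M - (p ^ (2 * m) - 1) := by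
        rw [Finset.sum_sub_distrib, Finset.sum_const, Finset.card_univ, ZMod.card, nsmul_eq_mul]
        congr 1
        have : ((∑ t, N t : ℕ) : ℝ) = ((p ^ (2 * m) - 1 : ℕ) : ℝ) := by rw [hsum]
        rw [Nat.cast_sub (Nat.one_le_pow _ _ hp.pos)] at this
        push_cast at this
        exact this
    _ = 5 * (p * p ^ m) + 1 := by
        rw [hM]; push_cast
        have : (p : ℝ) ^ (2 * m) = p * p ^ (2 * m - 1) := by
          rw [← pow_succ']; congr 1; omega
        rw [this]; ring
    _ ≤ 6 * (p * p ^ m) := by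
        have h1 : (1 : ℝ) ≤ p := by exact_mod_cast hp.one_lt.le
        have h2 : (1 : ℝ) ≤ (p : ℝ) ^ m := one_le_pow₀ h1
        nlinarith

/-- Weil's bound for Kloosterman sums over a prime field. -/
theorem weil_bound {p : ℕ} [Fact p.Prime] (hp2 : 2 < p) (ψ : AddChar (ZMod p) ℂ) (hψ : ψ ≠ 1)
    {a b : ZMod p} (ha : a ≠ 0) (hb : b ≠ 0) : ‖klSum ψ a b‖ ≤ 2 * Real.sqrt p := by
  classical
  have hp := Fact.out (p := p.Prime)
  have hppos : (0 : ℝ) < p := by exact_mod_cast hp.pos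
  let S : ℕ → ℂ := fun k => ∑ P ∈ irrN (ZMod p) k,
    (P.natDegree : ℂ) * klWeight ψ a b P ^ (k / P.natDegree)
  let A : ℕ → ℂ := fun n => ∑ f ∈ monN (ZMod p) n, klWeight ψ a b f
  have hrec : ∀ n : ℕ, (n : ℂ) * A n = ∑ k ∈ Finset.Icc 1 n, S k * A (n - k) :=
    newton_recursion (klWeight ψ a b) (klWeight_mul ψ a b) (klWeight_one ψ a b)
  have hA0 : A 0 = 1 := sum_klWeight_zero ψ a b
  have hA1 : A 1 = klSum ψ a b := sum_klWeight_one ψ a b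
  have hA2 : A 2 = p := by
    have := sum_klWeight_two ψ hψ ha hb
    rwa [ZMod.card] at this
  have hA3 : ∀ n, 3 ≤ n → A n = 0 := fun n hn => sum_klWeight_three ψ hψ ha hn
  obtain ⟨r, hr⟩ : ∃ r : ℝ, klSum ψ a b = r := by
    refine ⟨(klSum ψ a b).re, ?_⟩
    rw [eq_comm, ← Complex.conj_eq_iff_re]
    unfold klSum
    rw [map_sum, ← Equiv.sum_comp (Equiv.neg (ZMod p))]
    refine Finset.sum_congr rfl fun x _ => ?_
    simp only [Equiv.neg_apply, ne_eq, neg_eq_zero]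
    split_ifs with h
    · simp
    · rw [← AddChar.map_neg_eq_conj]
      congr 1
      rw [inv_neg]; ring
  rw [hr] at hA1 ⊢
  have hS1 : S 1 = r := by
    have := hrec 1
    simp [hA0, hA1] at this
    exact this.symm
  have hS2 : S 2 = 2 * p - r ^ 2 := by
    have := hrec 2
    rw [Finset.sum_Icc_succ_top (by norm_num)] at this
    simp [hA0, hA1, hA2, hS1] at this
    rw [this]; ring
  have hS3 : ∀ n, S (n + 3) = - r * S (n + 2) - p * S (n + 1) := by
    intro n
    have := hrec (n + 3)
    rw [hA3 _ (by omega), mul_zero, Finset.sum_Icc_succ_top (by omega),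
      Finset.sum_Icc_succ_top (by omega), Finset.sum_Icc_succ_top (by omega),
      Finset.sum_eq_zero] at this
    · rw [show n + 3 - (n + 1) = 2 by omega, show n + 3 - (n + 1 + 1) = 1 by omega,
        show n + 3 - (n + 2 + 1) = 0 by omega, hA0, hA1, hA2] at this
      linear_combination -this
    · intro k hk
      have := Finset.mem_Icc.1 hk
      rw [hA3 _ (by omega), mul_zero]
  by_contra hcon
  push Not at hcon
  rw [Complex.norm_real, Real.norm_eq_abs] at hcon
  have hsq : 4 * (p : ℝ) < r ^ 2 := by
    have h0 : 0 ≤ 2 * Real.sqrt p := by positivity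
    have := pow_lt_pow_left₀ hcon h0 (two_ne_zero)
    rw [sq_abs, mul_pow, Real.sq_sqrt hppos.le] at this
    linarith
  set δ := Real.sqrt (r ^ 2 - 4 * p) with hδ
  have hδ2 : δ ^ 2 = r ^ 2 - 4 * p := Real.sq_sqrt (by linarith)
  set α := (-r + δ) / 2 with hα
  set β := (-r - δ) / 2 with hβ
  have hab : α * β = p := by rw [hα, hβ]; linear_combination (-1/4 : ℝ) * hδ2
  have hapb : α + β = -r := by rw [hα, hβ]; ring
  have hSn : ∀ n, S (n + 1) = ((-(α ^ (n + 1) + β ^ (n + 1)) : ℝ) : ℂ) ∧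
      S (n + 2) = ((-(α ^ (n + 2) + β ^ (n + 2)) : ℝ) : ℂ) := by
    intro n
    induction n with
    | zero =>
      refine ⟨?_, ?_⟩
      · rw [zero_add, hS1, pow_one, pow_one, hapb, neg_neg]
      · rw [zero_add, hS2]
        have : -(α ^ 2 + β ^ 2) = 2 * p - r ^ 2 := by
          linear_combination (-(α + β) + r) * hapb + 2 * hab
        rw [this]; push_cast; ring
    | succ n ih =>
      refine ⟨ih.2, ?_⟩
      rw [show n + 1 + 2 = n + 3 by ring, hS3, ih.1, ih.2]
      have : -(α ^ (n + 3) + β ^ (n + 3)) = -r * (-(α ^ (n + 2) + β ^ (n + 2)))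
          - p * (-(α ^ (n + 1) + β ^ (n + 1))) := by
        rw [← hapb, ← hab]; ring
      rw [this]; push_cast; ring
  have hbd : ∀ m : ℕ, α ^ (2 * (m + 1)) + β ^ (2 * (m + 1)) ≤ 6 * (p * p ^ (m + 1)) := by
    intro m
    have hne : 2 * (m + 1) ≠ 0 := by omega
    let K := GaloisField p (2 * (m + 1))
    have : Fintype K := Fintype.ofFinite K
    have hfr : Module.finrank (ZMod p) K = 2 * (m + 1) := GaloisField.finrank p hne
    have h1 := sum_irrN_eq_trace (K := K) ψ a b
    rw [hfr] at h1
    have h2 := norm_trace_sum_le hp2 (Nat.succ_pos m) ψ (K := K) hfr (b := b) ha hψ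
    rw [← h1] at h2
    change ‖S (2 * m + 1 + 1)‖ ≤ _ at h2
    rw [(hSn (2 * m)).2, Complex.norm_real, Real.norm_eq_abs, abs_neg] at h2
    refine (le_abs_self _).trans ?_
    exact h2
  have hmax : ∃ γ : ℝ, (p : ℝ) < γ ∧ ∀ m : ℕ, γ ^ (m + 1) ≤ 6 * (p * p ^ (m + 1)) := by
    have hαβ : (p : ℝ) < α ^ 2 ∨ (p : ℝ) < β ^ 2 := by
      by_contra h
      push Not at h
      have h1 : (α - β) ^ 2 = r ^ 2 - 4 * p := by rw [← hδ2, hα, hβ]; ring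
      nlinarith
    rcases hαβ with h | h
    · refine ⟨α ^ 2, h, fun m => ?_⟩
      have := hbd m
      rw [pow_mul, pow_mul] at this
      have h0 : 0 ≤ (β ^ 2) ^ (m + 1) := by positivity
      linarith
    · refine ⟨β ^ 2, h, fun m => ?_⟩
      have := hbd m
      rw [pow_mul, pow_mul] at this
      have h0 : 0 ≤ (α ^ 2) ^ (m + 1) := by positivity
      linarith
  obtain ⟨γ, hγ, hγm⟩ := hmax
  obtain ⟨m, hm⟩ := pow_unbounded_of_one_lt (6 * p : ℝ) ((one_lt_div hppos).2 hγ)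
  have h1 := hγm m
  have h2 : (γ / p) ^ (m + 1) ≤ 6 * p := by
    rw [div_pow, div_le_iff₀ (by positivity)]
    linarith
  have h3 : (γ / p) ^ m ≤ (γ / p) ^ (m + 1) :=
    pow_le_pow_right₀ ((one_lt_div hppos).2 hγ).le (Nat.le_succ m)
  linarith

section GaussFamilies

variable {A : Type} [CommRing A] [Fintype A] [DecidableEq A]

/-- The quadratic Gauss sum `∑ₓ ψ(u x² + n x)`. -/
def gaussQ (ψ : AddChar A ℂ) (u n : A) : ℂ := ∑ x : A, ψ (u * x ^ 2 + n * x)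

/-- The function `|A|^{-d} ∑_u w(u) ∏ᵢ G(u, nᵢ)`. -/
def gaussFam (ψ : AddChar A ℂ) {d : ℕ} (w : Aˣ → ℂ) (n : Fin d → A) : ℂ :=
  ((Fintype.card A : ℂ)⁻¹) ^ d * ∑ u : Aˣ, w u * ∏ i, gaussQ ψ u (n i)

/-- The Fourier transform `∑ₙ k(n) ψ(-z·n)` on `A^d`. -/
def ringFT (ψ : AddChar A ℂ) {d : ℕ} (k : (Fin d → A) → ℂ) (z : Fin d → A) : ℂ :=
  ∑ n, k n * ψ (-∑ i, z i * n i)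

lemma addChar_norm_one (ψ : AddChar A ℂ) (x : A) : ‖ψ x‖ = 1 := ψ.norm_apply x

lemma addChar_sum_mul_left (ψ : AddChar A ℂ) (hψ : ψ.IsPrimitive) (b : A) :
    ∑ n : A, ψ (n * b) = if b = 0 then (Fintype.card A : ℂ) else 0 := by
  have := AddChar.sum_mulShift b hψ
  exact_mod_cast this

lemma addChar_map_sum (ψ : AddChar A ℂ) {ι : Type*} (s : Finset ι) (f : ι → A) :
    ψ (∑ i ∈ s, f i) = ∏ i ∈ s, ψ (f i) := by
  classical
  induction s using Finset.induction_on with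
  | empty => simp
  | insert a s ha ih => rw [Finset.sum_insert ha, Finset.prod_insert ha, AddChar.map_add_eq_mul, ih]

lemma sum_gaussQ_mul (ψ : AddChar A ℂ) (hψ : ψ.IsPrimitive) (u z : A) :
    ∑ n : A, gaussQ ψ u n * ψ (-(z * n)) = Fintype.card A * ψ (u * z ^ 2) := by
  classical
  simp only [gaussQ, Finset.sum_mul]
  rw [Finset.sum_comm]
  have : ∀ x n : A, ψ (u * x ^ 2 + n * x) * ψ (-(z * n)) = ψ (u * x ^ 2) * ψ (n * (x - z)) := by
    intro x n
    rw [← AddChar.map_add_eq_mul, ← AddChar.map_add_eq_mul]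
    congr 1; ring
  simp_rw [this, ← Finset.mul_sum, addChar_sum_mul_left ψ hψ, sub_eq_zero, mul_ite, mul_zero]
  rw [Finset.sum_ite_eq' Finset.univ z, if_pos (Finset.mem_univ _), mul_comm]

lemma ringFT_gaussFam (ψ : AddChar A ℂ) (hψ : ψ.IsPrimitive) {d : ℕ} (w : Aˣ → ℂ)
    (z : Fin d → A) :
    ringFT ψ (gaussFam ψ w) z = ∑ u : Aˣ, w u * ψ (u * ∑ i, z i ^ 2) := by
  classical
  have hc : (Fintype.card A : ℂ) ≠ 0 := by exact_mod_cast Fintype.card_ne_zero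
  simp only [ringFT, gaussFam]
  simp_rw [← Finset.sum_neg_distrib, addChar_map_sum, mul_assoc, Finset.sum_mul, Finset.mul_sum]
  rw [Finset.sum_comm]
  refine Finset.sum_congr rfl fun u _ => ?_
  simp_rw [mul_assoc, ← Finset.prod_mul_distrib]
  have := (Finset.prod_univ_sum (fun _ : Fin d => (Finset.univ : Finset A))
    (fun i n => gaussQ ψ (u : A) n * ψ (-(z i * n)))).symm
  rw [Fintype.piFinset_univ] at this
  rw [← Finset.mul_sum, ← Finset.mul_sum, this]
  simp_rw [sum_gaussQ_mul ψ hψ, Finset.prod_mul_distrib]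
  rw [Finset.prod_const, Finset.card_univ, Fintype.card_fin, addChar_map_sum]
  rw [mul_left_comm, ← mul_assoc (_ ^ d), ← mul_pow, inv_mul_cancel₀ hc, one_pow, one_mul]

lemma norm_gaussQ_sq_le (ψ : AddChar A ℂ) (hψ : ψ.IsPrimitive) (u : Aˣ) (n : A) :
    ‖gaussQ ψ u n‖ ^ 2 ≤ Fintype.card A * (Finset.univ.filter fun h : A => 2 * h = 0).card := by
  have h1 : (gaussQ ψ u n) * (starRingEnd ℂ) (gaussQ ψ u n) =
      ∑ h : A, ψ (u * h ^ 2 + n * h) * ∑ y : A, ψ (y * (2 * u * h)) := by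
    simp only [gaussQ, map_sum]
    rw [Finset.sum_mul_sum, Finset.sum_comm]
    simp_rw [Finset.mul_sum]
    refine Eq.trans ?_ Finset.sum_comm
    refine Finset.sum_congr rfl fun y _ => ?_
    rw [← Equiv.sum_comp (Equiv.addRight y)]
    refine Finset.sum_congr rfl fun h _ => ?_
    rw [← AddChar.map_neg_eq_conj, ← AddChar.map_add_eq_mul, ← AddChar.map_add_eq_mul]
    congr 1
    simp only [Equiv.coe_addRight]; ring
  have h2 : ((‖gaussQ ψ u n‖ ^ 2 : ℝ) : ℂ) = (gaussQ ψ u n) * (starRingEnd ℂ) (gaussQ ψ u n) := by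
    rw [Complex.mul_conj, Complex.normSq_eq_norm_sq]
  have h3 : ‖gaussQ ψ u n‖ ^ 2 = ‖(gaussQ ψ u n) * (starRingEnd ℂ) (gaussQ ψ u n)‖ := by
    rw [← h2, Complex.norm_real, Real.norm_of_nonneg (by positivity)]
  rw [h3, h1]
  have h4 : ∀ h : A, (2 * (u : A) * h = 0) ↔ 2 * h = 0 := by
    intro h
    rw [mul_comm 2, mul_assoc]
    exact (Units.mul_right_eq_zero u)
  simp_rw [addChar_sum_mul_left ψ hψ, h4]
  refine (norm_sum_le _ _).trans ?_
  simp_rw [norm_mul, addChar_norm_one, one_mul]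
  rw [Finset.card_filter, Nat.cast_sum, Finset.mul_sum]
  refine Finset.sum_le_sum fun h _ => ?_
  split_ifs <;> simp

end GaussFamilies

/-- The twisted family computing the normalized Kloosterman sum over a finite ring. -/
def ringKl {A : Type} [CommRing A] [Fintype A] [DecidableEq A] (ψ : AddChar A ℂ) {d : ℕ} (N : A)
    (n : Fin d → A) : ℂ := gaussFam ψ (fun u => ψ (-(u * N))) n

/-- The Kloosterman sums with parameter in `S` decompose into pieces of total
interpolated cost at most `β`. -/
def KlCost (A : Type) [CommRing A] [Fintype A] [DecidableEq A] (d : ℕ) (S : Set ℕ) (θ β : ℝ) : Prop :=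
  ∀ ψ : AddChar A ℂ, ψ.IsPrimitive → ∃ (ι : Type) (_ : Fintype ι)
    (k : ι → (Fin d → A) → ℂ) (a : ι → ℕ → ℂ) (L₁ L₂ : ι → ℝ),
    (∀ N ∈ S, ∀ n, ringKl ψ (N : A) n = ∑ i, a i N * k i n) ∧
    (∀ i N, ‖a i N‖ ≤ 1) ∧
    (∀ i, ((Fintype.card A : ℝ)⁻¹) ^ d * ∑ z, ‖ringFT ψ (k i) z‖ ≤ L₁ i) ∧
    (∀ i n, ‖k i n‖ ≤ L₂ i) ∧ (∀ i, 0 ≤ L₁ i) ∧ (∀ i, 0 ≤ L₂ i) ∧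
    ∑ i, L₁ i ^ (1 - θ) * L₂ i ^ θ ≤ β

section CostBad

variable {A : Type} [CommRing A] [Fintype A] [DecidableEq A]

lemma klCost_units {d : ℕ} {S : Set ℕ} {θ : ℝ} (hθ : 0 ≤ θ) {m : ℕ}
    (hm : (Finset.univ.filter fun h : A => 2 * h = 0).card ≤ m) :
    KlCost A d S θ (Fintype.card A *
      ((Real.sqrt (Fintype.card A * m) / Fintype.card A) ^ d) ^ θ) := by
  intro ψ hψ
  have hc : (0 : ℝ) < (Fintype.card A : ℝ) := by exact_mod_cast Fintype.card_pos
  have hcd : Fintype.card (Fin d → A) = Fintype.card A ^ d := by simp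
  refine ⟨Aˣ, inferInstance, fun u => gaussFam ψ (Pi.single u 1), fun u N => ψ (-(u * (N : A))),
    fun _ => 1, fun _ => (Real.sqrt (Fintype.card A * m) / Fintype.card A) ^ d, ?_, ?_, ?_, ?_,
    ?_, ?_, ?_⟩
  · intro N _ n
    simp only [ringKl, gaussFam]
    rw [Finset.mul_sum]
    refine Finset.sum_congr rfl fun u _ => ?_
    rw [Finset.sum_eq_single u]
    · simp only [Pi.single_eq_same, one_mul]; ring
    · intro b _ hb; simp [Pi.single_eq_of_ne hb]
    · simp
  · intro u N; rw [addChar_norm_one]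
  · intro u
    have : ∀ z : Fin d → A, ‖ringFT ψ (gaussFam ψ (Pi.single u 1)) z‖ = 1 := by
      intro z
      rw [ringFT_gaussFam ψ hψ, Finset.sum_eq_single u]
      · simp [addChar_norm_one]
      · intro b _ hb; simp [Pi.single_eq_of_ne hb]
      · simp
    simp_rw [this]
    rw [Finset.sum_const, Finset.card_univ, hcd, nsmul_eq_mul, mul_one, Nat.cast_pow, ← mul_pow,
      inv_mul_cancel₀ hc.ne', one_pow]
  · intro u n
    simp only [gaussFam]
    rw [Finset.sum_eq_single u (fun b _ hb => by simp [Pi.single_eq_of_ne hb]) (by simp)]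
    rw [Pi.single_eq_same, one_mul, norm_mul, norm_pow, norm_inv, Complex.norm_natCast, norm_prod,
      div_eq_inv_mul, mul_pow]
    gcongr
    calc ∏ i, ‖gaussQ ψ u (n i)‖ ≤ ∏ _i : Fin d, Real.sqrt (Fintype.card A * m) := by
          refine Finset.prod_le_prod (fun _ _ => norm_nonneg _) fun i _ => ?_
          refine Real.le_sqrt_of_sq_le ((norm_gaussQ_sq_le ψ hψ u (n i)).trans ?_)
          gcongr
      _ = _ := by simp
  · intro _; exact zero_le_one
  · intro _; positivity
  · rw [Finset.sum_const, nsmul_eq_mul, Finset.card_univ, Real.one_rpow, one_mul]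
    have : Fintype.card Aˣ ≤ Fintype.card A := Fintype.card_le_of_injective _ Units.val_injective
    gcongr

end CostBad

section CostProd

variable {A B : Type} [CommRing A] [Fintype A] [DecidableEq A] [CommRing B] [Fintype B]
  [DecidableEq B]

lemma KlCost.mono {d : ℕ} {S : Set ℕ} {θ β β' : ℝ} (h : KlCost A d S θ β) (hβ : β ≤ β') :
    KlCost A d S θ β' := by
  intro ψ hψ
  obtain ⟨ι, _, k, a, L₁, L₂, h1, h2, h3, h4, h5, h6, h7⟩ := h ψ hψ
  exact ⟨ι, _, k, a, L₁, L₂, h1, h2, h3, h4, h5, h6, h7.trans hβ⟩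

lemma KlCost.of_ringEquiv {d : ℕ} {S : Set ℕ} {θ β : ℝ} (e : A ≃+* B) (h : KlCost A d S θ β) :
    KlCost B d S θ β := by
  intro ψ hψ
  set φ : AddChar A ℂ := ψ.compAddMonoidHom (e : A →+ B) with hφ
  have hφv : ∀ x, φ x = ψ (e x) := fun x => rfl
  have hφp : φ.IsPrimitive := by
    intro a ha
    have := hψ (show e a ≠ 0 by simpa using ha)
    rw [AddChar.ne_one_iff] at this ⊢
    obtain ⟨x, hx⟩ := this
    refine ⟨e.symm x, ?_⟩
    rw [AddChar.mulShift_apply] at hx ⊢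
    rwa [hφv, map_mul, e.apply_symm_apply]
  obtain ⟨ι, _, k, a, L₁, L₂, h1, h2, h3, h4, h5, h6, h7⟩ := h φ hφp
  have hcard : Fintype.card A = Fintype.card B := Fintype.card_congr e.toEquiv
  have hG : ∀ u n : A, gaussQ ψ (e u) (e n) = gaussQ φ u n := by
    intro u n
    simp only [gaussQ]
    rw [← Equiv.sum_comp e.toEquiv]
    refine Finset.sum_congr rfl fun x _ => ?_
    rw [hφv]; simp
  refine ⟨ι, _, fun i n => k i (fun j => e.symm (n j)), a, L₁, L₂, ?_, h2, ?_, ?_, h5, h6, h7⟩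
  · intro N hN n
    rw [← h1 N hN]
    simp only [ringKl, gaussFam, hcard]
    congr 1
    rw [← Equiv.sum_comp (Units.mapEquiv (e : A ≃* B)).toEquiv]
    refine Finset.sum_congr rfl fun u _ => ?_
    rw [hφv]
    congr 1
    · simp
    · refine Finset.prod_congr rfl fun i _ => ?_
      rw [← hG]; simp
  · intro i
    refine le_trans (le_of_eq ?_) (h3 i)
    rw [hcard]
    congr 1
    rw [← Equiv.sum_comp (Equiv.piCongrRight fun _ : Fin d => e.toEquiv)]
    refine Finset.sum_congr rfl fun z _ => ?_
    congr 1
    simp only [ringFT]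
    rw [← Equiv.sum_comp (Equiv.piCongrRight fun _ : Fin d => e.toEquiv)]
    refine Finset.sum_congr rfl fun n _ => ?_
    rw [hφv]; simp
  · intro i n; exact h4 i _

lemma KlCost.prod {d : ℕ} {S : Set ℕ} {θ β₁ β₂ : ℝ} (h : KlCost A d S θ β₁)
    (h' : KlCost B d S θ β₂) : KlCost (A × B) d S θ (β₁ * β₂) := by
  intro ψ hψ
  set φ : AddChar A ℂ := ψ.compAddMonoidHom (AddMonoidHom.inl A B) with hφ
  set φ' : AddChar B ℂ := ψ.compAddMonoidHom (AddMonoidHom.inr A B) with hφ'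
  have hψv : ∀ x : A × B, ψ x = φ x.1 * φ' x.2 := by
    intro x
    change ψ x = ψ (x.1, 0) * ψ (0, x.2)
    rw [← AddChar.map_add_eq_mul]; simp
  have hφp : φ.IsPrimitive := by
    intro a ha
    have := hψ (show ((a, 0) : A × B) ≠ 0 by simpa using ha)
    rw [AddChar.ne_one_iff] at this ⊢
    obtain ⟨x, hx⟩ := this
    refine ⟨x.1, ?_⟩
    rw [AddChar.mulShift_apply] at hx ⊢
    simpa [hψv] using hx
  have hφp' : φ'.IsPrimitive := by
    intro a ha
    have := hψ (show ((0, a) : A × B) ≠ 0 by simpa using ha)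
    rw [AddChar.ne_one_iff] at this ⊢
    obtain ⟨x, hx⟩ := this
    refine ⟨x.2, ?_⟩
    rw [AddChar.mulShift_apply] at hx ⊢
    simpa [hψv] using hx
  obtain ⟨ι, _, k, a, L₁, L₂, h1, h2, h3, h4, h5, h6, h7⟩ := h φ hφp
  obtain ⟨ι', _, k', a', L₁', L₂', h1', h2', h3', h4', h5', h6', h7'⟩ := h' φ' hφp'
  have hG : ∀ u n : A × B, gaussQ ψ u n = gaussQ φ u.1 n.1 * gaussQ φ' u.2 n.2 := by
    intro u n
    simp only [gaussQ]
    rw [Finset.sum_mul_sum, Fintype.sum_prod_type]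
    simp [hψv]
  have hFT : ∀ (f : (Fin d → A) → ℂ) (g : (Fin d → B) → ℂ) (z : Fin d → A × B),
      ringFT ψ (fun n => f (fun j => (n j).1) * g (fun j => (n j).2)) z =
        ringFT φ f (fun j => (z j).1) * ringFT φ' g (fun j => (z j).2) := by
    intro f g z
    simp only [ringFT]
    rw [Finset.sum_mul_sum, ← Equiv.sum_comp (Equiv.arrowProdEquivProdArrow (Fin d) (fun _ => A) (fun _ => B)).symm,
      Fintype.sum_prod_type]
    refine Finset.sum_congr rfl fun n _ => Finset.sum_congr rfl fun m _ => ?_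
    rw [hψv]
    simp [Equiv.arrowProdEquivProdArrow, Prod.fst_sum, Prod.snd_sum]
    ring
  refine ⟨ι × ι', inferInstance,
    fun i n => k i.1 (fun j => (n j).1) * k' i.2 (fun j => (n j).2),
    fun i N => a i.1 N * a' i.2 N, fun i => L₁ i.1 * L₁' i.2, fun i => L₂ i.1 * L₂' i.2,
    ?_, ?_, ?_, ?_, ?_, ?_, ?_⟩
  · intro N hN n
    have hK : ringKl ψ (N : A × B) n = ringKl φ (N : A) (fun j => (n j).1) *
        ringKl φ' (N : B) (fun j => (n j).2) := by
      simp only [ringKl, gaussFam, Fintype.card_prod]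
      rw [mul_mul_mul_comm, Finset.sum_mul_sum, ← Equiv.sum_comp (MulEquiv.prodUnits).symm.toEquiv,
        Fintype.sum_prod_type]
      congr 1
      · push_cast; rw [mul_inv, mul_pow]
      · refine Finset.sum_congr rfl fun u _ => Finset.sum_congr rfl fun v _ => ?_
        simp_rw [hG, Finset.prod_mul_distrib, hψv]
        simp [MulEquiv.prodUnits]
        ring
    rw [hK, h1 N hN, h1' N hN, Finset.sum_mul_sum, Fintype.sum_prod_type]
    refine Finset.sum_congr rfl fun i _ => Finset.sum_congr rfl fun j _ => ?_
    ring
  · intro i N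
    rw [norm_mul]
    exact mul_le_one₀ (h2 _ _) (norm_nonneg _) (h2' _ _)
  · intro i
    refine le_trans (le_of_eq ?_) (mul_le_mul (h3 i.1) (h3' i.2) (by positivity) (h5 i.1))
    rw [mul_mul_mul_comm, Finset.sum_mul_sum,
      ← Equiv.sum_comp (Equiv.arrowProdEquivProdArrow (Fin d) (fun _ => A) (fun _ => B)).symm, Fintype.sum_prod_type]
    congr 1
    · rw [Fintype.card_prod]; push_cast; rw [mul_inv, mul_pow]
    · refine Finset.sum_congr rfl fun z _ => Finset.sum_congr rfl fun w _ => ?_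
      rw [hFT, norm_mul]; rfl
  · intro i n
    rw [norm_mul]
    exact mul_le_mul (h4 _ _) (h4' _ _) (norm_nonneg _) (h6 _)
  · intro i; exact mul_nonneg (h5 _) (h5' _)
  · intro i; exact mul_nonneg (h6 _) (h6' _)
  · have : ∑ i : ι × ι', (L₁ i.1 * L₁' i.2) ^ (1 - θ) * (L₂ i.1 * L₂' i.2) ^ θ =
        (∑ i, L₁ i ^ (1 - θ) * L₂ i ^ θ) * ∑ i, L₁' i ^ (1 - θ) * L₂' i ^ θ := by
      rw [Finset.sum_mul_sum, Fintype.sum_prod_type]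
      refine Finset.sum_congr rfl fun i _ => Finset.sum_congr rfl fun j _ => ?_
      rw [Real.mul_rpow (h5 _) (h5' _), Real.mul_rpow (h6 _) (h6' _)]
      ring
    rw [this]
    have hn : 0 ≤ ∑ i, L₁ i ^ (1 - θ) * L₂ i ^ θ := Finset.sum_nonneg fun i _ =>
      mul_nonneg (Real.rpow_nonneg (h5 i) _) (Real.rpow_nonneg (h6 i) _)
    have hn' : 0 ≤ ∑ i, L₁' i ^ (1 - θ) * L₂' i ^ θ := Finset.sum_nonneg fun i _ =>
      mul_nonneg (Real.rpow_nonneg (h5' i) _) (Real.rpow_nonneg (h6' i) _)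
    exact mul_le_mul h7 h7' hn' (hn.trans h7)

end CostProd

section Counting

lemma card_sq_eq_le_two {F : Type*} [Field F] [Fintype F] [DecidableEq F] (t : F) :
    (Finset.univ.filter fun y : F => y ^ 2 = t).card ≤ 2 := by
  by_cases h : ∃ y : F, y ^ 2 = t
  · obtain ⟨y, rfl⟩ := h
    refine (Finset.card_le_card (t := {y, -y}) ?_).trans Finset.card_le_two
    intro z hz
    simpa [sq_eq_sq_iff_eq_or_eq_neg] using hz
  · push Not at h
    rw [Finset.filter_eq_empty_iff.2 fun y _ => h y]; simp

variable {A F : Type} [CommRing A] [Fintype A] [DecidableEq A] [Field F] [Fintype F] [DecidableEq F]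

lemma card_fiber_mul {F' : Type} [CommRing F'] [Fintype F'] [DecidableEq F'] (φ : A →+* F')
    (hφ : Function.Surjective φ) (t : F') :
    Fintype.card F' * (Finset.univ.filter fun x : A => φ x = t).card = Fintype.card A := by
  have h0 : ∀ t, (Finset.univ.filter fun x : A => φ x = t).card =
      (Finset.univ.filter fun x : A => φ x = 0).card := by
    intro t
    obtain ⟨x, rfl⟩ := hφ t
    refine Finset.card_bij (fun y _ => y - x) ?_ ?_ ?_
    · intro y hy; simp at hy ⊢; simp [hy]
    · intro y _ z _ h; simpa using h
    · intro y hy; refine ⟨y + x, ?_, by simp⟩; simp at hy ⊢; simp [hy]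
  have := Finset.card_eq_sum_card_fiberwise (f := φ) (s := Finset.univ) (t := Finset.univ)
    (fun x _ => Finset.mem_univ _)
  simp_rw [h0] at this
  rw [h0, ← Finset.card_univ (α := A), this]
  simp

lemma card_sq_fiber_mul_le (φ : A →+* F) (hφ : Function.Surjective φ) (t : F) :
    Fintype.card F * (Finset.univ.filter fun x : A => φ x ^ 2 = t).card ≤ 2 * Fintype.card A := by
  rw [Finset.card_eq_sum_card_fiberwise (f := φ) (s := Finset.univ.filter fun x : A => φ x ^ 2 = t)
    (t := Finset.univ.filter fun y : F => y ^ 2 = t) (fun x hx => by simpa using hx), Finset.mul_sum]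
  calc _ ≤ ∑ y ∈ Finset.univ.filter (fun y : F => y ^ 2 = t), Fintype.card A := by
        refine Finset.sum_le_sum fun y _ => ?_
        rw [← card_fiber_mul φ hφ y]
        refine Nat.mul_le_mul_left _ (Finset.card_le_card ?_)
        exact Finset.filter_subset_filter _ (Finset.filter_subset _ _)
    _ ≤ _ := by
        rw [Finset.sum_const, smul_eq_mul]
        exact Nat.mul_le_mul_right _ (card_sq_eq_le_two t)

lemma card_quadric_mul_le (φ : A →+* F) (hφ : Function.Surjective φ) {d : ℕ} (hd : d ≠ 0) (c : F) :
    Fintype.card F * (Finset.univ.filter fun z : Fin d → A => ∑ i, φ (z i) ^ 2 = c).card ≤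
      2 * Fintype.card A ^ d := by
  obtain ⟨d, rfl⟩ := Nat.exists_eq_succ_of_ne_zero hd
  rw [Finset.card_filter, ← Equiv.sum_comp (Fin.consEquiv fun _ => A), Fintype.sum_prod_type,
    Finset.sum_comm, Finset.mul_sum]
  calc _ ≤ ∑ _y : Fin d → A, 2 * Fintype.card A := by
        refine Finset.sum_le_sum fun y _ => ?_
        refine le_trans (le_of_eq ?_) (card_sq_fiber_mul_le φ hφ (c - ∑ i, φ (y i) ^ 2))
        rw [Finset.card_filter]
        congr 1
        refine Finset.sum_congr rfl fun x _ => ?_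
        simp [Fin.consEquiv, Fin.sum_univ_succ, eq_sub_iff_add_eq]
    _ = _ := by
        rw [Finset.sum_const, Finset.card_univ, smul_eq_mul]
        simp; ring

end Counting

section PrimeKloosterman

variable {p : ℕ} [Fact p.Prime]

lemma gaussQ_eq (hp2 : 2 < p) (ψ : AddChar (ZMod p) ℂ) (hψ : ψ.IsPrimitive) {u : ZMod p} (hu : u ≠ 0) (n : ZMod p) :
    gaussQ ψ u n = ψ (-(n ^ 2 / 4) * u⁻¹) *
      (((quadraticChar (ZMod p) u : ℤ) : ℂ) * gaussQ ψ 1 0) := by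
  have h2 : (2 : ZMod p) ≠ 0 := by
    have : Fact (2 < p) := ⟨hp2⟩
    exact Ring.two_ne_zero (by rw [ZMod.ringChar_zmod_n]; omega)
  have hchar : ringChar (ZMod p) ≠ 2 := by rw [ZMod.ringChar_zmod_n]; omega
  have h4 : (4 : ZMod p) ≠ 0 := by
    have : (4 : ZMod p) = 2 * 2 := by norm_num
    rw [this]; exact mul_ne_zero h2 h2
  have hsq : gaussQ ψ u n = ψ (-(n ^ 2 / 4) * u⁻¹) * gaussQ ψ u 0 := by
    simp only [gaussQ]
    rw [← Equiv.sum_comp (Equiv.addRight (-(n / (2 * u)))), Finset.mul_sum]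
    refine Finset.sum_congr rfl fun x _ => ?_
    rw [← AddChar.map_add_eq_mul, Equiv.coe_addRight]
    congr 1
    field_simp
    ring
  rw [hsq]
  congr 1
  set χ := quadraticChar (ZMod p) with hχ
  have hgen : ∀ v : ZMod p, v ≠ 0 → gaussQ ψ v 0 = ((χ v : ℤ) : ℂ) * ∑ t, ((χ t : ℤ) : ℂ) * ψ t := by
    intro v hv
    have h1 : gaussQ ψ v 0 = ∑ t : ZMod p, (((χ t : ℤ) : ℂ) + 1) * ψ (t * v) := by
      simp only [gaussQ, zero_mul, add_zero]
      rw [← Finset.sum_fiberwise_of_maps_to (g := fun x : ZMod p => x ^ 2) (t := Finset.univ)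
        (fun x _ => Finset.mem_univ _)]
      refine Finset.sum_congr rfl fun t _ => ?_
      have hc := quadraticChar_card_sqrts hchar t
      rw [← hχ] at hc
      have hc' : (((χ t : ℤ) : ℂ) + 1) =
          ((Finset.univ.filter fun x : ZMod p => x ^ 2 = t).card : ℂ) := by
        rw [show (((χ t : ℤ) : ℂ) + 1) = ((χ t + 1 : ℤ) : ℂ) by push_cast; rfl, ← hc]
        rw [Int.cast_natCast]
        congr 2
        ext x; simp
      rw [hc', ← nsmul_eq_mul, ← Finset.sum_const]
      refine Finset.sum_congr rfl fun x hx => ?_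
      rw [(Finset.mem_filter.1 hx).2, mul_comm]
    have h2' : ∑ t : ZMod p, ψ (t * v) = 0 := by
      rw [addChar_sum_mul_left ψ hψ, if_neg hv]
    rw [h1]
    simp_rw [add_mul, one_mul, Finset.sum_add_distrib]
    rw [h2', add_zero, ← Equiv.sum_comp (Equiv.mulRight₀ v⁻¹ (inv_ne_zero hv)), Finset.mul_sum]
    refine Finset.sum_congr rfl fun t _ => ?_
    rw [Equiv.mulRight₀_apply, inv_mul_cancel_right₀ hv, map_mul]
    have : χ v⁻¹ = χ v := by
      have h1 : χ v⁻¹ * χ v = 1 := by rw [← map_mul, inv_mul_cancel₀ hv, map_one]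
      have h2 : χ v ^ 2 = 1 := quadraticChar_sq_one hv
      calc χ v⁻¹ = χ v⁻¹ * χ v ^ 2 := by rw [h2, mul_one]
        _ = _ := by rw [sq, ← mul_assoc, h1, one_mul]
    rw [this]; push_cast; ring
  rw [hgen u hu, hgen 1 one_ne_zero, map_one, Int.cast_one, one_mul]

lemma norm_gaussQ_one (hp2 : 2 < p) (ψ : AddChar (ZMod p) ℂ) (hψ : ψ.IsPrimitive) :
    ‖gaussQ ψ 1 0‖ = Real.sqrt p := by
  have h2 : (2 : ZMod p) ≠ 0 := by
    have : Fact (2 < p) := ⟨hp2⟩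
    exact Ring.two_ne_zero (by rw [ZMod.ringChar_zmod_n]; omega)
  have hm : ∑ n : ZMod p, gaussQ ψ 1 n * (starRingEnd ℂ) (gaussQ ψ 1 n) = p * p := by
    have h1 : ∀ n, (starRingEnd ℂ) (gaussQ ψ 1 n) = ∑ z, ψ (-z ^ 2) * ψ (-(z * n)) := by
      intro n
      simp only [gaussQ, map_sum]
      refine Finset.sum_congr rfl fun z _ => ?_
      rw [← AddChar.map_neg_eq_conj, ← AddChar.map_add_eq_mul]
      congr 1; ring
    simp_rw [h1, Finset.mul_sum]
    rw [Finset.sum_comm]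
    have h3 : ∀ z : ZMod p, ∑ n, gaussQ ψ 1 n * (ψ (-z ^ 2) * ψ (-(z * n))) = p := by
      intro z
      simp_rw [mul_left_comm (gaussQ ψ 1 _)]
      rw [← Finset.mul_sum, sum_gaussQ_mul ψ hψ, mul_left_comm, ← AddChar.map_add_eq_mul]
      simp [ZMod.card]
    simp_rw [h3]
    simp [ZMod.card]
  have hp0 : (0 : ℝ) < p := by exact_mod_cast (Fact.out (p := p.Prime)).pos
  have hn : ∀ n, gaussQ ψ 1 n * (starRingEnd ℂ) (gaussQ ψ 1 n) =
      ((‖gaussQ ψ 1 0‖ ^ 2 : ℝ) : ℂ) := by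
    intro n
    rw [Complex.mul_conj, Complex.normSq_eq_norm_sq, gaussQ_eq hp2 ψ hψ one_ne_zero n, norm_mul,
      addChar_norm_one, one_mul, map_one, Int.cast_one, one_mul]
  simp_rw [hn] at hm
  rw [Finset.sum_const, Finset.card_univ, ZMod.card, nsmul_eq_mul] at hm
  have hm' : (p : ℝ) * ‖gaussQ ψ 1 0‖ ^ 2 = p * p := by exact_mod_cast hm
  rw [← Real.sqrt_sq (norm_nonneg _), mul_left_cancel₀ hp0.ne' hm']

end PrimeKloosterman

section PrimeKloostermanBound

lemma sum_units_eq {F : Type*} [Field F] [Fintype F] [DecidableEq F] (f : F → ℂ) :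
    ∑ u : Fˣ, f u = ∑ x : F, if x ≠ 0 then f x else 0 := by
  rw [← Finset.sum_filter]
  refine Finset.sum_bij (fun u _ => (u : F)) (by simp) (fun u _ v _ h => Units.ext h) ?_ (by simp)
  intro x hx
  exact ⟨Units.mk0 x (Finset.mem_filter.1 hx).2, Finset.mem_univ _, rfl⟩

variable {p : ℕ} [Fact p.Prime]

lemma quadraticChar_sq_complex {u : ZMod p} (hu : u ≠ 0) :
    ((quadraticChar (ZMod p) u : ℤ) : ℂ) ^ 2 = 1 := by
  have := quadraticChar_sq_one hu
  exact_mod_cast congrArg (Int.cast (R := ℂ)) this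

lemma salie_bound (hp2 : 2 < p) (ψ : AddChar (ZMod p) ℂ) (hψ : ψ.IsPrimitive) {a b : ZMod p}
    (hb : b ≠ 0) :
    ‖∑ x : ZMod p, if x ≠ 0 then ((quadraticChar (ZMod p) x : ℤ) : ℂ) * ψ (a * x + b * x⁻¹) else 0‖
      ≤ 2 * Real.sqrt p := by
  classical
  have h2 : (2 : ZMod p) ≠ 0 := by
    have : Fact (2 < p) := ⟨hp2⟩
    exact Ring.two_ne_zero (by rw [ZMod.ringChar_zmod_n]; omega)
  have h4 : (4 : ZMod p) ≠ 0 := by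
    have : (4 : ZMod p) = 2 * 2 := by norm_num
    rw [this]; exact mul_ne_zero h2 h2
  have hp0 : (0 : ℝ) < p := by exact_mod_cast (Fact.out (p := p.Prime)).pos
  set T := ∑ x : ZMod p, if x ≠ 0 then ((quadraticChar (ZMod p) x : ℤ) : ℂ) * ψ (a * x + b * x⁻¹)
    else 0 with hT
  set χ := quadraticChar (ZMod p) with hχ
  have hkey : ((χ (-b⁻¹) : ℤ) : ℂ) * gaussQ ψ 1 0 * T =
      p * ∑ y ∈ Finset.univ.filter (fun y : ZMod p => y ^ 2 = a * b), ψ (2 * y) := by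
    have h1 : ((χ (-b⁻¹) : ℤ) : ℂ) * gaussQ ψ 1 0 * T =
        ∑ x : ZMod p, if x ≠ 0 then ψ (a * x) * gaussQ ψ (-b⁻¹ * x) 2 else 0 := by
      rw [hT, Finset.mul_sum]
      refine Finset.sum_congr rfl fun x _ => ?_
      split_ifs with hx
      · rw [gaussQ_eq hp2 ψ hψ (mul_ne_zero (neg_ne_zero.2 (inv_ne_zero hb)) hx),
          map_mul (quadraticChar (ZMod p)), AddChar.map_add_eq_mul, ← hχ]
        have : -((2 : ZMod p) ^ 2 / 4) * (-b⁻¹ * x)⁻¹ = b * x⁻¹ := by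
          have : (2 : ZMod p) ^ 2 / 4 = 1 := by rw [div_eq_one_iff_eq h4]; norm_num
          rw [this]; field_simp
        rw [this]; push_cast; ring
      · simp
    have h3 : ∀ x : ZMod p, (if x ≠ 0 then ψ (a * x) * gaussQ ψ (-b⁻¹ * x) 2 else 0) =
        ψ (a * x) * gaussQ ψ (-b⁻¹ * x) 2 := by
      intro x
      split_ifs with hx
      · rfl
      · push Not at hx
        subst hx
        simp only [gaussQ, mul_zero, zero_mul, zero_add]
        simp_rw [mul_comm (2 : ZMod p)]
        rw [addChar_sum_mul_left ψ hψ, if_neg h2, mul_zero]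
    rw [h1]
    simp_rw [h3, gaussQ, Finset.mul_sum]
    rw [Finset.sum_comm, Finset.sum_filter]
    refine Finset.sum_congr rfl fun y _ => ?_
    have h5 : ∀ x : ZMod p, ψ (a * x) * ψ (-b⁻¹ * x * y ^ 2 + 2 * y) =
        ψ (2 * y) * ψ (x * (a - y ^ 2 * b⁻¹)) := by
      intro x
      rw [← AddChar.map_add_eq_mul, ← AddChar.map_add_eq_mul]
      congr 1; ring
    simp_rw [h5]
    rw [← Finset.mul_sum, addChar_sum_mul_left ψ hψ, ZMod.card]
    have h6 : a - y ^ 2 * b⁻¹ = 0 ↔ y ^ 2 = a * b := by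
      rw [sub_eq_zero, eq_comm, ← div_eq_mul_inv, div_eq_iff hb]
    simp only [h6]
    split_ifs
    · ring
    · simp
  have hn : ‖((χ (-b⁻¹) : ℤ) : ℂ)‖ = 1 := by
    have := quadraticChar_sq_complex (neg_ne_zero.2 (inv_ne_zero hb))
    have h := congrArg norm this
    rw [norm_pow, norm_one] at h
    exact (pow_eq_one_iff_of_nonneg (norm_nonneg _) two_ne_zero).1 h
  have h7 := congrArg norm hkey
  rw [norm_mul, norm_mul, hn, one_mul, norm_gaussQ_one hp2 ψ hψ, norm_mul, Complex.norm_natCast] at h7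
  have h8 : ‖∑ y ∈ Finset.univ.filter (fun y : ZMod p => y ^ 2 = a * b), ψ (2 * y)‖ ≤ 2 := by
    refine (norm_sum_le _ _).trans ?_
    simp_rw [addChar_norm_one]
    rw [Finset.sum_const, nsmul_eq_mul, mul_one]
    exact_mod_cast card_sq_eq_le_two (a * b)
  have hs : 0 < Real.sqrt p := Real.sqrt_pos.2 hp0
  refine le_of_mul_le_mul_left ?_ hs
  rw [h7]
  calc (p : ℝ) * _ ≤ p * 2 := by gcongr
    _ = Real.sqrt p * Real.sqrt p * 2 := by rw [Real.mul_self_sqrt hp0.le]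
    _ = _ := by ring

lemma twisted_bound (hp2 : 2 < p) (ψ : AddChar (ZMod p) ℂ) (hψ : ψ.IsPrimitive) {a : ZMod p}
    (ha : a ≠ 0) (b : ZMod p) (d : ℕ) :
    ‖∑ u : (ZMod p)ˣ, ((quadraticChar (ZMod p) u : ℤ) : ℂ) ^ d * ψ (a * u + b * (u : ZMod p)⁻¹)‖
      ≤ 2 * Real.sqrt p := by
  have hp1 : (1 : ℝ) ≤ Real.sqrt p := Real.one_le_sqrt.2 (by exact_mod_cast (by omega : 1 ≤ p))
  have hψ1 : ψ ≠ 1 := by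
    have := hψ one_ne_zero
    rwa [AddChar.mulShift_one] at this
  rcases Nat.even_or_odd' d with ⟨e, rfl | rfl⟩
  · have h1 : ∀ u : (ZMod p)ˣ, ((quadraticChar (ZMod p) u : ℤ) : ℂ) ^ (2 * e) = 1 := by
      intro u
      rw [pow_mul, quadraticChar_sq_complex u.ne_zero, one_pow]
    simp_rw [h1, one_mul]
    rw [sum_units_eq fun x : ZMod p => ψ (a * x + b * x⁻¹)]
    by_cases hb : b = 0
    · subst hb
      have : ∑ x : ZMod p, (if x ≠ 0 then ψ (a * x + 0 * x⁻¹) else 0) = -1 := by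
        have h0 : ∑ x : ZMod p, ψ (x * a) = 0 := by rw [addChar_sum_mul_left ψ hψ, if_neg ha]
        rw [← Finset.sum_filter, Finset.filter_ne',
          ← add_right_inj (ψ (a * 0 + 0 * (0 : ZMod p)⁻¹)),
          Finset.add_sum_erase Finset.univ (fun x => ψ (a * x + 0 * x⁻¹)) (Finset.mem_univ 0)]
        simp_rw [zero_mul, add_zero, mul_comm a]
        rw [h0]; simp
      rw [this]; simp; linarith
    · exact weil_bound hp2 ψ hψ1 ha hb
  · have h1 : ∀ u : (ZMod p)ˣ, ((quadraticChar (ZMod p) u : ℤ) : ℂ) ^ (2 * e + 1) =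
        ((quadraticChar (ZMod p) u : ℤ) : ℂ) := by
      intro u
      rw [pow_succ, pow_mul, quadraticChar_sq_complex u.ne_zero, one_pow, one_mul]
    simp_rw [h1]
    rw [sum_units_eq fun x : ZMod p => ((quadraticChar (ZMod p) x : ℤ) : ℂ) * ψ (a * x + b * x⁻¹)]
    by_cases hb : b = 0
    · subst hb
      refine le_trans (le_of_eq ?_) (salie_bound hp2 ψ hψ (a := 0) ha)
      rw [← Equiv.sum_comp (Function.Involutive.toPerm (fun x : ZMod p => x⁻¹) inv_involutive)]
      congr 1
      refine Finset.sum_congr rfl fun x _ => ?_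
      by_cases hx : x = 0
      · simp [hx]
      · have hinv : quadraticChar (ZMod p) x⁻¹ = quadraticChar (ZMod p) x := by
          have h1 : quadraticChar (ZMod p) x⁻¹ * quadraticChar (ZMod p) x = 1 := by
            rw [← map_mul, inv_mul_cancel₀ hx, map_one]
          have h2 := quadraticChar_sq_one hx
          calc _ = quadraticChar (ZMod p) x⁻¹ * quadraticChar (ZMod p) x ^ 2 := by rw [h2, mul_one]
            _ = _ := by rw [sq, ← mul_assoc, h1, one_mul]
        simp [hx, hinv]
    · exact salie_bound hp2 ψ hψ hb

end PrimeKloostermanBound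

section GoodPrimes

variable {p : ℕ} [Fact p.Prime]

lemma norm_ringKl_le (hp2 : 2 < p) (ψ : AddChar (ZMod p) ℂ) (hψ : ψ.IsPrimitive) {c : ZMod p}
    (hc : c ≠ 0) {d : ℕ} (n : Fin d → ZMod p) :
    ‖ringKl ψ c n‖ ≤ (Real.sqrt p / p) ^ d * (2 * Real.sqrt p) := by
  have hp0 : (0 : ℝ) < p := by exact_mod_cast (Fact.out (p := p.Prime)).pos
  have h1 : ringKl ψ c n = ((p : ℂ)⁻¹) ^ d * (gaussQ ψ 1 0 ^ d *
      ∑ u : (ZMod p)ˣ, ((quadraticChar (ZMod p) u : ℤ) : ℂ) ^ d *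
        ψ (-c * u + (∑ i, -(n i ^ 2 / 4)) * (u : ZMod p)⁻¹)) := by
    simp only [ringKl, gaussFam, ZMod.card]
    congr 1
    rw [Finset.mul_sum]
    refine Finset.sum_congr rfl fun u _ => ?_
    simp_rw [gaussQ_eq hp2 ψ hψ u.ne_zero, Finset.prod_mul_distrib]
    rw [← addChar_map_sum, Finset.prod_const, Finset.prod_const, Finset.card_univ,
      Fintype.card_fin, AddChar.map_add_eq_mul, Finset.sum_mul]
    rw [show -((u : ZMod p) * c) = -c * u by ring]
    ring
  rw [h1, norm_mul, norm_mul, norm_pow, norm_pow, norm_inv, Complex.norm_natCast,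
    norm_gaussQ_one hp2 ψ hψ, ← mul_assoc, ← mul_pow, ← div_eq_inv_mul]
  gcongr
  exact twisted_bound hp2 ψ hψ (neg_ne_zero.2 hc) _ d

lemma klCost_good_prime (hp2 : 2 < p) {d : ℕ} (hd : d ≠ 0) {S : Set ℕ} {θ M : ℝ}
    (hS : ∀ N ∈ S, (N : ZMod p) ≠ 0) (hM : (((fun N : ℕ => (N : ZMod p)) '' S).ncard : ℝ) ≤ M) :
    KlCost (ZMod p) d S θ
      (M * (3 ^ (1 - θ) * ((Real.sqrt p / p) ^ d * (2 * Real.sqrt p)) ^ θ)) := by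
  classical
  intro ψ hψ
  have hp0 : (0 : ℝ) < p := by exact_mod_cast (Fact.out (p := p.Prime)).pos
  set I : Set (ZMod p) := (fun N : ℕ => (N : ZMod p)) '' S with hI
  refine ⟨I, inferInstance, fun c => ringKl ψ (c : ZMod p),
    fun c N => if (N : ZMod p) = c then 1 else 0, fun _ => 3,
    fun _ => (Real.sqrt p / p) ^ d * (2 * Real.sqrt p), ?_, ?_, ?_, ?_, ?_, ?_, ?_⟩
  · intro N hN n
    rw [Finset.sum_eq_single (⟨(N : ZMod p), N, hN, rfl⟩ : I)]
    · simp
    · intro c _ hc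
      have : ¬ (N : ZMod p) = c := fun h => hc (Subtype.ext h.symm)
      simp only [if_neg this, zero_mul]
    · simp
  · intro c N; dsimp only; split_ifs <;> simp
  · intro c
    have hFT : ∀ z : Fin d → ZMod p, ‖ringFT ψ (ringKl ψ (c : ZMod p)) z‖ ≤
        (if ∑ i, (RingHom.id (ZMod p)) (z i) ^ 2 = c then (p : ℝ) else 0) + 1 := by
      intro z
      have h1 : ringFT ψ (ringKl ψ (c : ZMod p)) z =
          (∑ x : ZMod p, ψ (x * (∑ i, z i ^ 2 - c))) - 1 := by
        have := ringFT_gaussFam ψ hψ (fun u => ψ (-(u * (c : ZMod p)))) z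
        unfold ringKl
        rw [this]
        simp_rw [← AddChar.map_add_eq_mul]
        rw [sum_units_eq fun u : ZMod p => ψ (-(u * (c : ZMod p)) + u * ∑ i, z i ^ 2),
          ← Finset.sum_filter, Finset.filter_ne', Finset.sum_erase_eq_sub (Finset.mem_univ _)]
        congr 1
        · refine Finset.sum_congr rfl fun x _ => ?_
          congr 1; ring
        · simp
      rw [h1, addChar_sum_mul_left ψ hψ, ZMod.card]
      simp only [sub_eq_zero, RingHom.id_apply]
      refine (norm_sub_le _ _).trans ?_
      split_ifs <;> simp
    have hcount := card_quadric_mul_le (RingHom.id (ZMod p)) Function.surjective_id hd (c : ZMod p)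
    rw [ZMod.card] at hcount ⊢
    have hcount' : (p : ℝ) * ((Finset.univ.filter fun z : Fin d → ZMod p =>
        ∑ i, (RingHom.id (ZMod p)) (z i) ^ 2 = c).card : ℝ) ≤ 2 * (p : ℝ) ^ d := by
      exact_mod_cast hcount
    calc ((p : ℝ)⁻¹) ^ d * ∑ z, ‖ringFT ψ (ringKl ψ (c : ZMod p)) z‖
        ≤ ((p : ℝ)⁻¹) ^ d * ∑ z : Fin d → ZMod p,
          ((if ∑ i, (RingHom.id (ZMod p)) (z i) ^ 2 = c then (p : ℝ) else 0) + 1) := by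
          gcongr with z; exact hFT z
      _ ≤ ((p : ℝ)⁻¹) ^ d * (2 * (p : ℝ) ^ d + (p : ℝ) ^ d) := by
          gcongr
          rw [Finset.sum_add_distrib, ← Finset.sum_filter, Finset.sum_const, nsmul_eq_mul, mul_comm]
          refine add_le_add hcount' (le_of_eq ?_)
          simp [ZMod.card]
      _ = 3 := by rw [inv_pow]; field_simp; norm_num
  · intro c n
    obtain ⟨N, hN, hNc⟩ := c.2
    exact norm_ringKl_le hp2 ψ hψ (by rw [← hNc]; exact hS N hN) n
  · intro _; norm_num
  · intro _; positivity
  · rw [Finset.sum_const, nsmul_eq_mul, Finset.card_univ, ← Set.toFinset_card,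
      ← Set.ncard_eq_toFinset_card']
    gcongr

end GoodPrimes

section GoodPrimePowers

variable {p k : ℕ} [Fact p.Prime]

lemma zmod_isUnit_of_cast_ne_zero (hk : k ≠ 0) {x : ZMod (p ^ k)}
    (hx : ZMod.castHom (dvd_pow_self p hk) (ZMod p) x ≠ 0) : IsUnit x := by
  have hp := Fact.out (p := p.Prime)
  have : NeZero (p ^ k) := ⟨pow_ne_zero _ hp.ne_zero⟩
  rw [← ZMod.natCast_zmod_val x] at hx ⊢
  rw [map_natCast, Ne, ZMod.natCast_eq_zero_iff] at hx
  rw [ZMod.isUnit_iff_coprime]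
  exact Nat.Coprime.pow_right _ ((Nat.Prime.coprime_iff_not_dvd hp).2 hx).symm

lemma zmod_two_mul_eq_zero_card (hp2 : 2 < p) (hk : k ≠ 0) :
    have : NeZero (p ^ k) := ⟨pow_ne_zero _ (Fact.out (p := p.Prime)).ne_zero⟩
    (Finset.univ.filter fun h : ZMod (p ^ k) => 2 * h = 0).card ≤ 1 := by
  have h2 : IsUnit (2 : ZMod (p ^ k)) := by
    refine zmod_isUnit_of_cast_ne_zero hk ?_
    rw [map_ofNat]
    have : Fact (2 < p) := ⟨hp2⟩
    exact Ring.two_ne_zero (by rw [ZMod.ringChar_zmod_n]; omega)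
  rw [Finset.card_le_one]
  intro x hx y hy
  rw [Finset.mem_filter] at hx hy
  rw [h2.mul_right_eq_zero] at hx hy
  rw [hx.2, hy.2]

lemma zmod_eq_pow_mul_of_cast_eq_zero {j : ℕ} (hj : j ≤ k) {x : ZMod (p ^ k)}
    (hx : ZMod.castHom (pow_dvd_pow p hj) (ZMod (p ^ j)) x = 0) :
    ∃ y : ZMod (p ^ k), x = (p : ZMod (p ^ k)) ^ j * y := by
  have hp := Fact.out (p := p.Prime)
  have : NeZero (p ^ k) := ⟨pow_ne_zero _ hp.ne_zero⟩
  rw [← ZMod.natCast_zmod_val x] at hx ⊢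
  rw [map_natCast, ZMod.natCast_eq_zero_iff] at hx
  obtain ⟨y, hy⟩ := hx
  exact ⟨y, by rw [hy]; push_cast; rfl⟩

/-- Summing over a class of units modulo `p^{k-1}` kills unit frequencies. -/
lemma sum_units_fiber_eq_zero (hk : 2 ≤ k) (ψ : AddChar (ZMod (p ^ k)) ℂ) (hψ : ψ.IsPrimitive)
    [NeZero (p ^ k)] (v : ZMod (p ^ (k - 1))) {m : ZMod (p ^ k)} (hm : IsUnit m) :
    ∑ u : (ZMod (p ^ k))ˣ, (if ZMod.castHom (pow_dvd_pow p (Nat.sub_le k 1)) (ZMod (p ^ (k - 1)))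
      (u : ZMod (p ^ k)) = v then ψ (u * m) else 0) = 0 := by
  classical
  have hp := Fact.out (p := p.Prime)
  set ρ := ZMod.castHom (pow_dvd_pow p (Nat.sub_le k 1)) (ZMod (p ^ (k - 1))) with hρ
  set t : ZMod (p ^ k) := (p : ZMod (p ^ k)) ^ (k - 1) with ht
  have hρt : ρ t = 0 := by
    rw [ht, map_pow, map_natCast]
    exact_mod_cast (ZMod.natCast_self (p ^ (k - 1)))
  have ht0 : t ≠ 0 := by
    intro h
    rw [ht] at h
    have h' : ((p ^ (k - 1) : ℕ) : ZMod (p ^ k)) = 0 := by exact_mod_cast h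
    rw [ZMod.natCast_eq_zero_iff] at h'
    have := (Nat.pow_dvd_pow_iff_le_right hp.one_lt).1 h'
    omega
  have htn : IsNilpotent t := ⟨2, by
    rw [ht, ← pow_mul]
    have h1 : (p : ZMod (p ^ k)) ^ k = 0 := by exact_mod_cast ZMod.natCast_self (p ^ k)
    rw [show (k - 1) * 2 = k + (k - 2) by omega, pow_add, h1, zero_mul]⟩
  have htm : ψ (t * m) ≠ 1 := by
    intro h
    refine hψ ht0 ?_
    ext x
    obtain ⟨m', rfl⟩ := hm
    rw [AddChar.mulShift_apply, AddChar.one_apply]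
    have h1 : t * x = ((m'⁻¹ : (ZMod (p ^ k))ˣ) * x : ZMod (p ^ k)).val • (t * (m' : ZMod (p ^ k))) := by
      rw [nsmul_eq_mul, ZMod.natCast_zmod_val]
      calc t * x = t * (((m' : ZMod (p ^ k)) * (m'⁻¹ : (ZMod (p ^ k))ˣ)) * x) := by simp
        _ = _ := by ring
    rw [h1, AddChar.map_nsmul_eq_pow, h, one_pow]
  set σ : (ZMod (p ^ k))ˣ → (ZMod (p ^ k))ˣ := fun u =>
    (htn.isUnit_add_left_of_commute u.isUnit (Commute.all _ _)).unit with hσ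
  have hσv : ∀ u, ((σ u : (ZMod (p ^ k))ˣ) : ZMod (p ^ k)) = u + t := fun u => rfl
  have hσb : Function.Bijective σ := by
    refine Finite.injective_iff_bijective.1 fun u v h => ?_
    have := congrArg Units.val h
    rw [hσv, hσv] at this
    exact Units.ext (add_right_cancel this)
  set T := ∑ u : (ZMod (p ^ k))ˣ, (if ρ (u : ZMod (p ^ k)) = v then ψ (u * m) else 0) with hT
  have hTT : T = ψ (t * m) * T := by
    conv_lhs => rw [hT, ← Equiv.sum_comp (Equiv.ofBijective σ hσb)]
    rw [hT, Finset.mul_sum]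
    refine Finset.sum_congr rfl fun u _ => ?_
    rw [Equiv.ofBijective_apply, hσv, map_add, hρt, add_zero, add_mul, AddChar.map_add_eq_mul]
    split_ifs
    · ring
    · simp
  have : (1 - ψ (t * m)) * T = 0 := by rw [sub_mul, one_mul, ← hTT, sub_self]
  rcases mul_eq_zero.1 this with h | h
  · exact absurd (sub_eq_zero.1 h).symm htm
  · exact h

lemma card_units_fiber_le [NeZero (p ^ k)] (hk : 1 ≤ k) (v : ZMod (p ^ (k - 1))) :
    (Finset.univ.filter fun u : (ZMod (p ^ k))ˣ => ZMod.castHom (pow_dvd_pow p (Nat.sub_le k 1))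
      (ZMod (p ^ (k - 1))) (u : ZMod (p ^ k)) = v).card ≤ p := by
  classical
  have hp := Fact.out (p := p.Prime)
  have : NeZero (p ^ (k - 1)) := ⟨pow_ne_zero _ hp.ne_zero⟩
  have h1 := card_fiber_mul (ZMod.castHom (pow_dvd_pow p (Nat.sub_le k 1)) (ZMod (p ^ (k - 1))))
    (ZMod.castHom_surjective _) v
  rw [ZMod.card, ZMod.card] at h1
  have h2 : p ^ k = p ^ (k - 1) * p := by rw [← pow_succ]; congr 1; omega
  have h3 := Nat.eq_of_mul_eq_mul_left (pow_pos hp.pos (k - 1)) (h1.trans h2)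
  refine le_trans ?_ h3.le
  exact Finset.card_le_card_of_injOn Units.val (fun u hu => by
    rw [Finset.mem_coe, Finset.mem_filter] at hu ⊢; exact ⟨Finset.mem_univ _, hu.2⟩)
    (fun u _ v _ h => Units.ext h)

lemma klCost_good_prime_pow [NeZero (p ^ k)] (hp2 : 2 < p) (hk : 2 ≤ k) {d : ℕ} (hd : d ≠ 0)
    {S : Set ℕ} {θ M : ℝ} (hθ : 0 ≤ θ)
    (hM : (((fun N : ℕ => (N : ZMod p)) '' S).ncard : ℝ) ≤ M) :
    KlCost (ZMod (p ^ k)) d S θ (M * (p : ℝ) ^ (k - 1) * (2 ^ (1 - θ) *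
      (p * (Real.sqrt ((p ^ k : ℕ) : ℝ) / ((p ^ k : ℕ) : ℝ)) ^ d) ^ θ)) := by
  classical
  intro ψ hψ
  have hp := Fact.out (p := p.Prime)
  have hp0 : (0 : ℝ) < p := by exact_mod_cast hp.pos
  have hq0 : (0 : ℝ) < ((p ^ k : ℕ) : ℝ) := by exact_mod_cast pow_pos hp.pos k
  have : NeZero (p ^ (k - 1)) := ⟨pow_ne_zero _ hp.ne_zero⟩
  set ρ := ZMod.castHom (pow_dvd_pow p (Nat.sub_le k 1)) (ZMod (p ^ (k - 1))) with hρ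
  set φ := ZMod.castHom (dvd_pow_self p (by omega : k ≠ 0)) (ZMod p) with hφ
  set I : Set (ZMod p) := (fun N : ℕ => (N : ZMod p)) '' S with hI
  choose r hrS hr using fun c : I => c.2
  set w : I × ZMod (p ^ (k - 1)) → (ZMod (p ^ k))ˣ → ℂ := fun i u =>
    if ρ (u : ZMod (p ^ k)) = i.2 then ψ (-(u * (r i.1 : ZMod (p ^ k)))) else 0 with hw
  have hwn : ∀ i, ∑ u, ‖w i u‖ ≤ p := by
    intro i
    have h1 : ∀ u, ‖w i u‖ = if ρ (u : ZMod (p ^ k)) = i.2 then (1 : ℝ) else 0 := by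
      intro u
      rw [hw]; dsimp only
      split_ifs
      · exact addChar_norm_one _ _
      · simp
    simp_rw [h1]
    rw [Finset.sum_boole]
    exact_mod_cast card_units_fiber_le (p := p) (k := k) (by omega) i.2
  have hG : ∀ (u : (ZMod (p ^ k))ˣ) n, ‖gaussQ ψ u n‖ ≤ Real.sqrt ((p ^ k : ℕ) : ℝ) := by
    intro u n
    refine Real.le_sqrt_of_sq_le ((norm_gaussQ_sq_le ψ hψ u n).trans ?_)
    have := zmod_two_mul_eq_zero_card (p := p) (k := k) hp2 (by omega)
    rw [ZMod.card]
    calc _ ≤ ((p ^ k : ℕ) : ℝ) * (1 : ℕ) := by gcongr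
      _ = _ := by simp
  refine ⟨I × ZMod (p ^ (k - 1)), inferInstance, fun i => gaussFam ψ (w i),
    fun i N => if (N : ZMod p) = i.1 then
      ψ (-((i.2.val : ZMod (p ^ k)) * ((N : ZMod (p ^ k)) - (r i.1 : ZMod (p ^ k))))) else 0,
    fun _ => 2, fun _ => p * (Real.sqrt ((p ^ k : ℕ) : ℝ) / ((p ^ k : ℕ) : ℝ)) ^ d,
    ?_, ?_, ?_, ?_, ?_, ?_, ?_⟩
  · intro N hN n
    rw [Fintype.sum_prod_type, Finset.sum_eq_single (⟨(N : ZMod p), N, hN, rfl⟩ : I)]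
    · set c : I := ⟨(N : ZMod p), N, hN, rfl⟩ with hc
      simp only [ringKl, gaussFam, if_true]
      have hre : ∀ (a Q : ℂ) (W P : (ZMod (p ^ k))ˣ → ℂ), a * (Q * ∑ u, W u * P u) =
          ∑ u, Q * ((a * W u) * P u) := by
        intro a Q W P
        rw [Finset.mul_sum, Finset.mul_sum]
        refine Finset.sum_congr rfl fun u _ => by ring
      simp_rw [hre]
      rw [Finset.sum_comm, Finset.mul_sum]
      refine Finset.sum_congr rfl fun u _ => ?_
      rw [← Finset.mul_sum, ← Finset.sum_mul]
      congr 2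
      rw [Finset.sum_eq_single (ρ (u : ZMod (p ^ k)))]
      · simp only [hw, if_true]
        rw [if_pos (show (N : ZMod p) = (c : ZMod p) from rfl), ← AddChar.map_add_eq_mul]
        congr 1
        set v := ρ (u : ZMod (p ^ k)) with hv
        have h1 : ρ ((u : ZMod (p ^ k)) - (v.val : ZMod (p ^ k))) = 0 := by
          rw [map_sub, map_natCast, ZMod.natCast_zmod_val, ← hv, sub_self]
        obtain ⟨y, hy⟩ := zmod_eq_pow_mul_of_cast_eq_zero (Nat.sub_le k 1) h1
        have h2 : ZMod.castHom (pow_dvd_pow p (show 1 ≤ k by omega)) (ZMod (p ^ 1))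
            ((N : ZMod (p ^ k)) - (r c : ZMod (p ^ k))) = 0 := by
          rw [map_sub, map_natCast, map_natCast, sub_eq_zero, ZMod.natCast_eq_natCast_iff, pow_one,
            ← ZMod.natCast_eq_natCast_iff]
          exact (hr c).symm
        obtain ⟨y', hy'⟩ := zmod_eq_pow_mul_of_cast_eq_zero (show 1 ≤ k by omega) h2
        have h3 : ((u : ZMod (p ^ k)) - (v.val : ZMod (p ^ k))) *
            ((N : ZMod (p ^ k)) - (r c : ZMod (p ^ k))) = 0 := by
          have h4 : (p : ZMod (p ^ k)) ^ (k - 1) * (p : ZMod (p ^ k)) ^ 1 = 0 := by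
            rw [← pow_add, show k - 1 + 1 = k by omega]
            exact_mod_cast ZMod.natCast_self (p ^ k)
          rw [hy, hy']
          linear_combination y * y' * h4
        linear_combination -h3
      · intro v _ hv
        simp [hw, Ne.symm hv]
      · simp
    · intro c _ hc
      have : ¬ (N : ZMod p) = c := fun h => hc (Subtype.ext h.symm)
      simp only [if_neg this, zero_mul, Finset.sum_const_zero]
    · simp
  · intro c N; dsimp only; split_ifs
    · rw [addChar_norm_one]
    · simp
  · intro i
    have hFT : ∀ z : Fin d → ZMod (p ^ k), ‖ringFT ψ (gaussFam ψ (w i)) z‖ ≤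
        if ∑ j, φ (z j) ^ 2 = i.1 then (p : ℝ) else 0 := by
      intro z
      rw [ringFT_gaussFam ψ hψ]
      split_ifs with hz
      · refine (norm_sum_le _ _).trans (le_trans (le_of_eq ?_) (hwn i))
        refine Finset.sum_congr rfl fun u _ => ?_
        rw [norm_mul, addChar_norm_one, mul_one]
      · have hm : IsUnit (∑ j, z j ^ 2 - (r i.1 : ZMod (p ^ k))) := by
          refine zmod_isUnit_of_cast_ne_zero (by omega) ?_
          rw [← hφ, map_sub, map_sum, map_natCast]
          simp_rw [map_pow]
          rw [sub_ne_zero]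
          have := hr i.1
          dsimp only at this
          rwa [this]
        have := sum_units_fiber_eq_zero hk ψ hψ i.2 hm
        rw [← hρ] at this
        refine le_of_eq ?_
        rw [norm_eq_zero, ← this]
        refine Finset.sum_congr rfl fun u _ => ?_
        rw [hw]; dsimp only
        split_ifs
        · rw [← AddChar.map_add_eq_mul]; congr 1; ring
        · simp
    have hcount := card_quadric_mul_le φ (ZMod.castHom_surjective _) hd (i.1 : ZMod p)
    rw [ZMod.card, ZMod.card] at hcount
    rw [ZMod.card]
    have hcount' : (p : ℝ) * ((Finset.univ.filter fun z : Fin d → ZMod (p ^ k) =>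
        ∑ j, φ (z j) ^ 2 = i.1).card : ℝ) ≤ 2 * ((p ^ k : ℕ) : ℝ) ^ d := by
      exact_mod_cast hcount
    calc (((p ^ k : ℕ) : ℝ)⁻¹) ^ d * ∑ z, ‖ringFT ψ (gaussFam ψ (w i)) z‖
        ≤ (((p ^ k : ℕ) : ℝ)⁻¹) ^ d * ∑ z : Fin d → ZMod (p ^ k),
          (if ∑ j, φ (z j) ^ 2 = i.1 then (p : ℝ) else 0) := by
          gcongr with z; exact hFT z
      _ ≤ (((p ^ k : ℕ) : ℝ)⁻¹) ^ d * (2 * ((p ^ k : ℕ) : ℝ) ^ d) := by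
          gcongr
          rw [← Finset.sum_filter, Finset.sum_const, nsmul_eq_mul, mul_comm]
          exact hcount'
      _ = 2 := by rw [inv_pow]; field_simp
  · intro i n
    simp only [gaussFam, ZMod.card]
    rw [norm_mul, norm_pow, norm_inv, Complex.norm_natCast]
    calc (((p ^ k : ℕ) : ℝ)⁻¹) ^ d * ‖∑ u, w i u * ∏ j, gaussQ ψ u (n j)‖
        ≤ (((p ^ k : ℕ) : ℝ)⁻¹) ^ d * (p * Real.sqrt ((p ^ k : ℕ) : ℝ) ^ d) := by
          gcongr
          refine (norm_sum_le _ _).trans ?_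
          calc ∑ u, ‖w i u * ∏ j, gaussQ ψ u (n j)‖
              ≤ ∑ u, ‖w i u‖ * Real.sqrt ((p ^ k : ℕ) : ℝ) ^ d := by
                refine Finset.sum_le_sum fun u _ => ?_
                rw [norm_mul, norm_prod]
                gcongr
                calc ∏ j, ‖gaussQ ψ u (n j)‖ ≤ ∏ _j : Fin d, Real.sqrt ((p ^ k : ℕ) : ℝ) :=
                      Finset.prod_le_prod (fun _ _ => norm_nonneg _) fun j _ => hG u (n j)
                  _ = _ := by simp
            _ ≤ _ := by rw [← Finset.sum_mul]; gcongr; exact hwn i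
      _ = _ := by rw [div_pow, inv_pow]; field_simp
  · intro _; norm_num
  · intro _; positivity
  · rw [Finset.sum_const, nsmul_eq_mul, Finset.card_univ, Fintype.card_prod, ZMod.card,
      ← Set.toFinset_card, ← Set.ncard_eq_toFinset_card']
    push_cast
    gcongr

end GoodPrimePowers

section EulerSum

/-- The multiplicative function with prescribed values on prime powers. -/
def primePowProd (β : ℕ → ℕ → ℝ) (q : ℕ) : ℝ := q.factorization.prod β

lemma primePowProd_nonneg {β : ℕ → ℕ → ℝ} (h : ∀ p k, 0 ≤ β p k) (q : ℕ) :
    0 ≤ primePowProd β q := by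
  unfold primePowProd
  exact Finset.prod_nonneg fun p _ => h _ _

lemma primePowProd_mul {β : ℕ → ℕ → ℝ} {m n : ℕ} (h : m.Coprime n) :
    primePowProd β (m * n) = primePowProd β m * primePowProd β n := by
  unfold primePowProd
  rw [Nat.factorization_mul_of_coprime h, Finsupp.prod_add_index_of_disjoint]
  exact h.disjoint_primeFactors

lemma primePowProd_pow {β : ℕ → ℕ → ℝ} (h0 : ∀ p, β p 0 = 1) {p : ℕ} (hp : p.Prime) (k : ℕ) :
    primePowProd β (p ^ k) = β p k := by
  unfold primePowProd
  rw [hp.factorization_pow, Finsupp.prod_single_index (h0 p)]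

lemma summable_primePowProd {β : ℕ → ℕ → ℝ} (h0 : ∀ p, β p 0 = 1) (hnn : ∀ p k, 0 ≤ β p k)
    {E : ℕ → ℝ} (hE : Summable E) (hE0 : ∀ p, 0 ≤ E p) {x : ℝ} (hx0 : 0 ≤ x) (hx1 : x < 1)
    (hβ : ∀ p k, p.Prime → β p (k + 1) ≤ E p * x ^ k) : Summable (primePowProd β) := by
  have hgeo := summable_geometric_of_lt_one hx0 hx1
  have hs1 : ∀ {p : ℕ}, p.Prime → Summable fun n : ℕ => β p (n + 1) := fun {p} hp =>
    Summable.of_nonneg_of_le (fun _ => hnn _ _) (fun k => hβ p k hp) (hgeo.mul_left (E p))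
  have hs : ∀ {p : ℕ}, p.Prime → Summable fun n : ℕ => β p n := fun {p} hp =>
    (summable_nat_add_iff 1).1 (hs1 hp)
  have hsn : ∀ {p : ℕ}, p.Prime → Summable fun n : ℕ => ‖primePowProd β (p ^ n)‖ := by
    intro p hp
    simp_rw [primePowProd_pow h0 hp, Real.norm_of_nonneg (hnn _ _)]
    exact hs hp
  have h1 : primePowProd β 1 = 1 := by simp [primePowProd]
  refine summable_of_sum_range_le (c := 1 + Real.exp ((∑' p, E p) * (1 - x)⁻¹))
    (primePowProd_nonneg hnn) fun N => ?_
  obtain ⟨hsum, hhas⟩ := EulerProduct.summable_and_hasSum_smoothNumbers_prod_primesBelow_tsum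
    (f := primePowProd β) h1 (fun h => primePowProd_mul h) hsn N
  have hprod : ∏ p ∈ N.primesBelow, ∑' n : ℕ, primePowProd β (p ^ n) ≤
      Real.exp ((∑' p, E p) * (1 - x)⁻¹) := by
    have hx : 0 ≤ (1 - x)⁻¹ := inv_nonneg.2 (by linarith)
    calc _ ≤ ∏ p ∈ N.primesBelow, Real.exp (E p * (1 - x)⁻¹) := by
          refine Finset.prod_le_prod (fun p _ => tsum_nonneg fun n => primePowProd_nonneg hnn _)
            fun p hp => ?_
          have hpp := Nat.prime_of_mem_primesBelow hp
          simp_rw [primePowProd_pow h0 hpp]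
          rw [(hs hpp).tsum_eq_zero_add, h0]
          refine le_trans ?_ (Real.add_one_le_exp _)
          rw [add_comm, ← tsum_geometric_of_lt_one hx0 hx1, ← tsum_mul_left]
          refine add_le_add ?_ le_rfl
          exact Summable.tsum_le_tsum (fun k => hβ p k hpp) (hs1 hpp) (hgeo.mul_left (E p))
      _ = Real.exp ((∑ p ∈ N.primesBelow, E p) * (1 - x)⁻¹) := by
          rw [← Real.exp_sum, Finset.sum_mul]
      _ ≤ _ := by
          gcongr
          exact hE.sum_le_tsum _ fun p _ => hE0 p
  rcases Nat.eq_zero_or_pos N with rfl | hN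
  · simp; positivity
  · obtain ⟨N, rfl⟩ : ∃ M, N = M + 1 := ⟨N - 1, by omega⟩
    rw [Finset.sum_range_succ']
    have hz : primePowProd β 0 = 1 := by simp [primePowProd]
    rw [hz, add_comm]
    gcongr
    refine le_trans ?_ hprod
    rw [← hhas.tsum_eq]
    have hmem : ∀ i ∈ Finset.range N, i + 1 ∈ (N + 1).smoothNumbers := fun i hi =>
      Nat.mem_smoothNumbers_of_lt (Nat.succ_pos _) (by have := Finset.mem_range.1 hi; omega)
    rw [← Finset.sum_attach]
    set g : {i // i ∈ Finset.range N} → (N + 1).smoothNumbers := fun i => ⟨i.1 + 1, hmem i.1 i.2⟩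
    have hg : Function.Injective g := by
      intro i j h
      have := congrArg Subtype.val h
      simp only [g] at this
      exact Subtype.ext (by omega)
    calc ∑ i ∈ (Finset.range N).attach, primePowProd β (i.1 + 1)
        = ∑ m ∈ (Finset.range N).attach.map ⟨g, hg⟩, primePowProd β m := by
          rw [Finset.sum_map]; rfl
      _ ≤ _ := hhas.summable.sum_le_tsum _ fun m _ => primePowProd_nonneg hnn _

lemma klCost_primePowProd {d : ℕ} {S : Set ℕ} {θ : ℝ} (hθ : 0 ≤ θ) {β : ℕ → ℕ → ℝ}
    (h0 : ∀ p, β p 0 = 1)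
    (h : ∀ p k, p.Prime → k ≠ 0 → ∀ _ : NeZero (p ^ k), KlCost (ZMod (p ^ k)) d S θ (β p k)) :
    ∀ q : ℕ, ∀ _ : NeZero q, KlCost (ZMod q) d S θ (primePowProd β q) := by
  intro q
  induction q using Nat.recOnPosPrimePosCoprime with
  | prime_pow p n hp hn =>
    intro _
    rw [primePowProd_pow h0 hp]
    exact h p n hp hn.ne' _
  | zero => exact fun h => absurd rfl h.out
  | one =>
    intro _
    refine (klCost_units (A := ZMod 1) hθ (m := 1) ?_).mono (le_of_eq ?_)
    · exact Finset.card_le_one.2 fun _ _ _ _ => Subsingleton.elim _ _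
    · simp [primePowProd, ZMod.card]
  | coprime a b ha hb hab iha ihb =>
    intro _
    have : NeZero a := ⟨by omega⟩
    have : NeZero b := ⟨by omega⟩
    rw [primePowProd_mul hab]
    exact ((iha inferInstance).prod (ihb inferInstance)).of_ringEquiv (ZMod.chineseRemainder hab).symm

lemma zmod_two_torsion_card_le (n : ℕ) [NeZero n] :
    (Finset.univ.filter fun h : ZMod n => 2 * h = 0).card ≤ 2 := by
  have hn := NeZero.pos n
  refine le_trans (Finset.card_le_card_of_injOn (t := {0, n}) (fun h => 2 * h.val) ?_ ?_)
    Finset.card_le_two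
  · intro h hh
    rw [Finset.mem_coe, Finset.mem_filter] at hh
    have h1 : ((2 * h.val : ℕ) : ZMod n) = 0 := by push_cast; rw [ZMod.natCast_zmod_val]; exact hh.2
    rw [ZMod.natCast_eq_zero_iff] at h1
    obtain ⟨c, hc⟩ := h1
    have hlt := ZMod.val_lt h
    have hc2 : c < 2 := by
      by_contra hcon
      have : n * 2 ≤ n * c := Nat.mul_le_mul_left _ (by omega)
      have hc' : 2 * h.val = n * c := hc
      omega
    have hc0 : c = 0 ∨ c = 1 := by omega
    rw [Finset.mem_coe, Finset.mem_insert, Finset.mem_singleton]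
    rcases hc0 with rfl | rfl
    · exact Or.inl (by simpa using hc)
    · exact Or.inr (by simpa using hc)
  · intro x _ y _ h
    exact ZMod.val_injective n (by simpa using h)

end EulerSum

section TotalCost

lemma exists_summable_cost {R : Set ℝ} {G B : Set ℕ} {s : ℝ} (hs0 : 0 < s)
    (hGB : GoodBadDichotomy R G B s) {d : ℕ} (hd : d ≠ 0) {θ : ℝ} (hθ0 : 0 ≤ θ) (hθ1 : θ ≤ 1)
    (h1 : 1 + s ≤ d * θ / 2) (h2 : 1 < (d - 1) * θ / 2) :
    ∃ b : ℕ → ℝ, (∀ q, 0 ≤ b q) ∧ Summable b ∧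
      ∀ q : ℕ, ∀ _ : NeZero q, KlCost (ZMod q) d (radSq '' R) θ (b q) := by
  classical
  obtain ⟨hcov, hGp, hBp, hunit, hcls, hBsum⟩ := hGB
  set δ : ℝ := (d - 1) * θ / 2 - 1 with hδ
  have hδ0 : 0 < δ := by linarith
  obtain ⟨C, hC0, hC⟩ := hcls (δ / 2) (by linarith)
  set good : ℕ → Prop := fun p => p ∈ G ∧ 2 < p with hgood
  set β : ℕ → ℕ → ℝ := fun p k => if k = 0 then 1 else
    if good p then 6 * C * (p : ℝ) ^ (δ / 2 - 1 - k * δ) else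
      (2 : ℝ) ^ ((d : ℝ) * θ / 2) * (p : ℝ) ^ (-(k * s)) with hβ
  have hβ0 : ∀ p, β p 0 = 1 := fun p => by simp [hβ]
  have hβnn : ∀ p k, 0 ≤ β p k := by
    intro p k
    simp only [hβ]
    split_ifs <;> positivity
  refine ⟨primePowProd β, primePowProd_nonneg hβnn, ?_, ?_⟩
  · set E : ℕ → ℝ := fun p => 6 * C * (p : ℝ) ^ (-1 - δ / 2) +
      (2 : ℝ) ^ ((d : ℝ) * θ / 2) * ((if p ∈ B then (p : ℝ) ^ (-s) else 0) +
        if p = 2 then 1 else 0) with hE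
    set x : ℝ := max ((2 : ℝ) ^ (-δ)) ((2 : ℝ) ^ (-s)) with hx
    refine summable_primePowProd (E := E) (x := x) hβ0 hβnn ?_ ?_ ?_ ?_ ?_
    · refine Summable.add ?_ (Summable.mul_left _ (Summable.add ?_ ?_))
      · exact (Real.summable_nat_rpow.2 (by linarith)).mul_left _
      · have : (fun p : ℕ => if p ∈ B then (p : ℝ) ^ (-s) else 0) =
            B.indicator fun p : ℕ => (p : ℝ) ^ (-s) := by ext p; simp [Set.indicator]
        rw [this, ← summable_subtype_iff_indicator]
        exact hBsum
      · exact summable_of_ne_finset_zero (s := {2}) fun p hp => by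
          rw [if_neg (by simpa using hp)]
    · intro p
      simp only [hE]
      have : (0 : ℝ) ≤ if p ∈ B then (p : ℝ) ^ (-s) else 0 := by split_ifs <;> positivity
      have : (0 : ℝ) ≤ if p = 2 then 1 else 0 := by split_ifs <;> positivity
      positivity
    · positivity
    · exact max_lt (Real.rpow_lt_one_of_one_lt_of_neg one_lt_two (by linarith))
        (Real.rpow_lt_one_of_one_lt_of_neg one_lt_two (by linarith))
    · intro p k hp
      have hp2 : (2 : ℝ) ≤ p := by exact_mod_cast hp.two_le
      have hp0 : (0 : ℝ) < p := by linarith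
      have hpow : ∀ t : ℝ, 0 < t → (2 : ℝ) ^ (-t) ≤ x → (p : ℝ) ^ (-(k * t)) ≤ x ^ k := by
        intro t ht htx
        rw [show -((k : ℝ) * t) = (-t) * k by ring, Real.rpow_mul hp0.le, Real.rpow_natCast]
        refine pow_le_pow_left₀ (by positivity) (le_trans ?_ htx) k
        exact Real.rpow_le_rpow_of_nonpos (by norm_num) hp2 (by linarith)
      simp only [hβ, if_neg (Nat.succ_ne_zero k)]
      have hi1 : (0 : ℝ) ≤ if p ∈ B then (p : ℝ) ^ (-s) else 0 := by split_ifs <;> positivity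
      have hi2 : (0 : ℝ) ≤ if p = 2 then 1 else 0 := by split_ifs <;> positivity
      split_ifs with hg
      · have h3 : (p : ℝ) ^ (δ / 2 - 1 - ((k + 1 : ℕ) : ℝ) * δ) =
            (p : ℝ) ^ (-1 - δ / 2) * (p : ℝ) ^ (-(k * δ)) := by
          rw [← Real.rpow_add hp0]; congr 1; push_cast; ring
        rw [h3, ← mul_assoc]
        refine mul_le_mul ?_ (hpow δ hδ0 (le_max_left _ _)) (by positivity) ?_
        · simp only [hE]
          exact le_add_of_nonneg_right (by positivity)
        · simp only [hE]; positivity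
      · have h3 : (p : ℝ) ^ (-(((k + 1 : ℕ) : ℝ) * s)) = (p : ℝ) ^ (-s) * (p : ℝ) ^ (-(k * s)) := by
          rw [← Real.rpow_add hp0]; congr 1; push_cast; ring
        rw [h3, ← mul_assoc]
        refine mul_le_mul ?_ (hpow s hs0 (le_max_right _ _)) (by positivity) ?_
        · simp only [hE]
          refine le_trans ?_ (le_add_of_nonneg_left (by positivity))
          refine mul_le_mul_of_nonneg_left ?_ (by positivity)
          have hps : (p : ℝ) ^ (-s) ≤ 1 := Real.rpow_le_one_of_one_le_of_nonpos (by linarith) (by linarith)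
          by_cases hB : p ∈ B
          · rw [if_pos hB]; linarith
          · have hpG : p ∈ G := (hcov p hp).resolve_right hB
            have : p = 2 := by
              have : ¬ 2 < p := fun h => hg ⟨hpG, h⟩
              have := hp.two_le
              omega
            rw [if_pos this]; linarith
        · simp only [hE]; positivity
  · refine klCost_primePowProd hθ0 hβ0 ?_
    intro p k hp hk hNZ
    have : Fact p.Prime := ⟨hp⟩
    have hp2 : (2 : ℝ) ≤ p := by exact_mod_cast hp.two_le
    have hp0 : (0 : ℝ) < p := by linarith
    have hsq : ∀ c : ℝ, 0 ≤ c → Real.sqrt ((p : ℝ) ^ k * c) / (p : ℝ) ^ k =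
        c ^ (1 / 2 : ℝ) * (p : ℝ) ^ (-(k / 2 : ℝ)) := by
      intro c hc
      rw [Real.sqrt_eq_rpow, Real.mul_rpow (by positivity) hc, ← Real.rpow_natCast, ← Real.rpow_mul hp0.le,
        mul_comm, mul_div_assoc, ← Real.rpow_sub hp0]
      congr 2; ring
    simp only [hβ, if_neg hk]
    split_ifs with hg
    · have hM : (((fun N : ℕ => (N : ZMod p)) '' (radSq '' R)).ncard : ℝ) ≤ C * (p : ℝ) ^ (δ / 2) := by
        refine le_trans (le_of_eq ?_) (hC p hg.1)
        congr 2
        ext z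
        simp [eq_comm]
      have h3 : (3 : ℝ) ^ (1 - θ) * 2 ^ θ ≤ 6 := by
        calc (3 : ℝ) ^ (1 - θ) * 2 ^ θ ≤ 3 ^ (1 : ℝ) * 2 ^ (1 : ℝ) := by
              exact mul_le_mul
                (Real.rpow_le_rpow_of_exponent_le (by norm_num) (by linarith))
                (Real.rpow_le_rpow_of_exponent_le (by norm_num) hθ1) (by positivity) (by positivity)
          _ = 6 := by norm_num
      rcases Nat.lt_or_ge k 2 with hk2 | hk2
      · obtain rfl : k = 1 := by omega
        have hc := klCost_good_prime (p := p) hg.2 hd (S := radSq '' R) (θ := θ) (by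
          rintro N ⟨r, hr, rfl⟩; exact (hunit p hg.1 r hr).ne_zero) hM
        have hc' := hc.of_ringEquiv (ZMod.ringEquivCongr (pow_one p).symm)
        refine hc'.mono ?_
        have hs : (Real.sqrt p / p) ^ d * (2 * Real.sqrt p) = 2 * (p : ℝ) ^ ((1 - d) / 2 : ℝ) := by
          have h4 : Real.sqrt p / p = (p : ℝ) ^ (-(1 / 2) : ℝ) := by
            rw [Real.sqrt_eq_rpow, ← Real.rpow_sub_one hp0.ne']; norm_num
          rw [h4, Real.sqrt_eq_rpow, ← Real.rpow_natCast, ← Real.rpow_mul hp0.le, mul_left_comm,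
            ← Real.rpow_add hp0]
          congr 2; ring
        rw [hs, Real.mul_rpow (by norm_num) (by positivity), ← Real.rpow_mul hp0.le]
        have h5 : (p : ℝ) ^ (δ / 2 - 1 - ((1 : ℕ) : ℝ) * δ) =
            (p : ℝ) ^ (δ / 2) * (p : ℝ) ^ ((1 - d) / 2 * θ : ℝ) := by
          rw [← Real.rpow_add hp0]; congr 1; rw [hδ]; push_cast; ring
        rw [h5]
        calc C * (p : ℝ) ^ (δ / 2) * (3 ^ (1 - θ) * (2 ^ θ * (p : ℝ) ^ ((1 - d) / 2 * θ : ℝ)))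
            = (3 ^ (1 - θ) * 2 ^ θ) * (C * ((p : ℝ) ^ (δ / 2) * (p : ℝ) ^ ((1 - d) / 2 * θ : ℝ))) := by
              ring
          _ ≤ 6 * (C * ((p : ℝ) ^ (δ / 2) * (p : ℝ) ^ ((1 - d) / 2 * θ : ℝ))) := by gcongr
          _ = _ := by ring
      · refine (klCost_good_prime_pow (p := p) (k := k) hg.2 hk2 hd hθ0 hM).mono ?_
        have hs := hsq 1 zero_le_one
        rw [mul_one, Real.one_rpow, one_mul] at hs
        have hs2 : (p : ℝ) * (Real.sqrt ((p ^ k : ℕ) : ℝ) / ((p ^ k : ℕ) : ℝ)) ^ d =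
            (p : ℝ) ^ (1 - k * d / 2 : ℝ) := by
          push_cast
          rw [hs, ← Real.rpow_natCast, ← Real.rpow_mul hp0.le]
          nth_rewrite 1 [← Real.rpow_one (p : ℝ)]
          rw [← Real.rpow_add hp0]
          congr 1; ring
        have hk1 : (p : ℝ) ^ (k - 1) = (p : ℝ) ^ ((k : ℝ) - 1) := by
          rw [← Real.rpow_natCast, Nat.cast_sub (by omega)]; simp
        have hk2' : (2 : ℝ) ≤ k := by exact_mod_cast hk2
        rw [hs2, ← Real.rpow_mul hp0.le, hk1]
        have h2' : (2 : ℝ) ^ (1 - θ) ≤ 6 := by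
          calc (2 : ℝ) ^ (1 - θ) ≤ 2 ^ (1 : ℝ) :=
                Real.rpow_le_rpow_of_exponent_le (by norm_num) (by linarith)
            _ ≤ 6 := by norm_num
        have h5 : (p : ℝ) ^ (δ / 2) * (p : ℝ) ^ ((k : ℝ) - 1) * (p : ℝ) ^ ((1 - k * d / 2) * θ : ℝ) ≤
            (p : ℝ) ^ (δ / 2 - 1 - k * δ) := by
          rw [← Real.rpow_add hp0, ← Real.rpow_add hp0]
          refine Real.rpow_le_rpow_of_exponent_le (by linarith) ?_
          rw [hδ]
          nlinarith [mul_nonneg (sub_nonneg.2 hk2') hθ0]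
        calc C * (p : ℝ) ^ (δ / 2) * (p : ℝ) ^ ((k : ℝ) - 1) *
              (2 ^ (1 - θ) * (p : ℝ) ^ ((1 - k * d / 2) * θ : ℝ))
            = 2 ^ (1 - θ) * (C * ((p : ℝ) ^ (δ / 2) * (p : ℝ) ^ ((k : ℝ) - 1) *
              (p : ℝ) ^ ((1 - k * d / 2) * θ : ℝ))) := by ring
          _ ≤ 6 * (C * (p : ℝ) ^ (δ / 2 - 1 - k * δ)) := by gcongr
          _ = _ := by ring
    · refine (klCost_units (A := ZMod (p ^ k)) hθ0 (zmod_two_torsion_card_le (p ^ k))).mono ?_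
      rw [ZMod.card]
      push_cast
      rw [hsq 2 (by norm_num), ← Real.rpow_natCast _ d, ← Real.rpow_mul (by positivity),
        Real.mul_rpow (by positivity) (by positivity), ← Real.rpow_mul (by norm_num),
        ← Real.rpow_mul hp0.le, mul_left_comm, ← Real.rpow_natCast (p : ℝ) k, ← Real.rpow_add hp0]
      refine mul_le_mul (le_of_eq ?_) ?_ (by positivity) (by positivity)
      · congr 1; ring
      · refine Real.rpow_le_rpow_of_exponent_le (by linarith) ?_
        have : (0 : ℝ) ≤ k := Nat.cast_nonneg k
        nlinarith
end TotalCost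

section MaximalFunction

variable {d : ℕ}

/-- The lattice cube of side length `2 * N + 1` centred at the origin. -/
def latticeCube (d N : ℕ) : Finset (Fin d → ℤ) :=
  Fintype.piFinset fun _ => Finset.Icc (-(N : ℤ)) N

lemma mem_latticeCube {N : ℕ} {y : Fin d → ℤ} : y ∈ latticeCube d N ↔ ∀ i, |y i| ≤ N := by
  simp [latticeCube, abs_le]

lemma card_latticeCube (N : ℕ) : (latticeCube d N).card = (2 * N + 1) ^ d := by
  simp only [latticeCube, Fintype.card_piFinset, Int.card_Icc, Finset.prod_const, Finset.card_univ,
    Fintype.card_fin]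
  congr 1
  omega

/-- The average of `F` over the dilated lattice cube `x - q • Q_N`. -/
def cubeAvg (q : ℕ) (F : (Fin d → ℤ) → ℝ≥0∞) (N : ℕ) (x : Fin d → ℤ) : ℝ≥0∞ :=
  ((2 * N + 1 : ℝ≥0∞) ^ d)⁻¹ * ∑ y ∈ latticeCube d N, F (x - (q : ℤ) • y)

/-- The centred maximal function along the sublattice `q ℤ^d`. -/
def maxFun (q : ℕ) (F : (Fin d → ℤ) → ℝ≥0∞) (x : Fin d → ℤ) : ℝ≥0∞ := ⨆ N : ℕ, cubeAvg q F N x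

lemma sum_latticeCube_le (q : ℕ) (F : (Fin d → ℤ) → ℝ≥0∞) (N : ℕ) (x : Fin d → ℤ) :
    ∑ y ∈ latticeCube d N, F (x - (q : ℤ) • y) ≤ (2 * N + 1 : ℝ≥0∞) ^ d * maxFun q F x := by
  have h0 : ((2 * N + 1 : ℝ≥0∞) ^ d) ≠ 0 := by positivity
  have ht : ((2 * N + 1 : ℝ≥0∞) ^ d) ≠ ∞ := by finiteness
  calc _ = (2 * N + 1 : ℝ≥0∞) ^ d * cubeAvg q F N x := by
        rw [cubeAvg, ← mul_assoc, ENNReal.mul_inv_cancel h0 ht, one_mul]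
    _ ≤ _ := by gcongr; exact le_iSup (fun N => cubeAvg q F N x) N

lemma maxFun_weak_type {q : ℕ} (hq : 0 < q) (F : (Fin d → ℤ) → ℝ≥0∞) (l : ℝ≥0∞) :
    l * ∑' x, (if l < maxFun q F x then 1 else 0) ≤ 3 ^ d * ∑' x, F x := by
  classical
  rw [ENNReal.tsum_eq_iSup_sum, ENNReal.mul_iSup]
  refine iSup_le fun s => ?_
  rw [← Finset.sum_filter, Finset.sum_const, nsmul_eq_mul, mul_one]
  set E := s.filter fun x => l < maxFun q F x with hE
  have hex : ∀ x ∈ E, ∃ N : ℕ, l < cubeAvg q F N x := fun x hx =>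
    lt_iSup_iff.1 (Finset.mem_filter.1 hx).2
  choose! N hN using hex
  have hqz : (q : ℤ) ≠ 0 := by exact_mod_cast hq.ne'
  set D : (Fin d → ℤ) → ℕ → Finset (Fin d → ℤ) := fun x n =>
    (latticeCube d n).image fun y => x - (q : ℤ) • y with hD
  have hinj : ∀ x : Fin d → ℤ, Function.Injective fun y : Fin d → ℤ => x - (q : ℤ) • y := by
    intro x y z h
    ext i
    have := congrFun h i
    simpa [hqz, hq.ne'] using this
  have hDcard : ∀ x n, (D x n).card = (2 * n + 1) ^ d := fun x n => by
    rw [hD, Finset.card_image_of_injective _ (hinj x), card_latticeCube]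
  obtain ⟨u, huE, hudis, hucov⟩ := Vitali.exists_disjoint_subfamily_covering_enlargement
    (fun x => (D x (N x) : Set (Fin d → ℤ))) (E : Set (Fin d → ℤ)) (fun x => (N x : ℝ)) 2
    one_lt_two (fun _ _ => Nat.cast_nonneg _) (∑ x ∈ E, (N x : ℝ))
    (fun a ha => Finset.single_le_sum (f := fun x => (N x : ℝ)) (fun _ _ => Nat.cast_nonneg _) ha)
    (fun a _ => by
      refine ⟨a, ?_⟩
      simp only [hD, Finset.coe_image, Set.mem_image, Finset.mem_coe]
      exact ⟨0, mem_latticeCube.2 (by simp), by simp⟩)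
  have hufin : u.Finite := E.finite_toSet.subset huE
  lift u to Finset (Fin d → ℤ) using hufin
  have huE' : u ⊆ E := by exact_mod_cast huE
  have hsub : E ⊆ u.biUnion fun b => D b (3 * N b) := by
    intro a ha
    obtain ⟨b, hb, ⟨z, hz1, hz2⟩, hab⟩ := hucov a ha
    simp only [hD, Finset.mem_coe, Finset.mem_image] at hz1 hz2
    obtain ⟨y, hy, rfl⟩ := hz1
    obtain ⟨y', hy', h⟩ := hz2
    rw [mem_latticeCube] at hy hy'
    have hab' : N a ≤ 2 * N b := by exact_mod_cast hab
    refine Finset.mem_biUnion.2 ⟨b, by exact_mod_cast hb, ?_⟩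
    simp only [hD, Finset.mem_image]
    refine ⟨y' - y, mem_latticeCube.2 fun i => ?_, ?_⟩
    · have h1 := abs_le.1 (hy i)
      have h2 := abs_le.1 (hy' i)
      simp only [Pi.sub_apply]
      rw [abs_le]
      push_cast
      omega
    · rw [smul_sub, ← sub_add, h]; simp
  have hcard : E.card ≤ ∑ b ∈ u, 3 ^ d * (2 * N b + 1) ^ d := by
    refine (Finset.card_le_card hsub).trans (Finset.card_biUnion_le.trans ?_)
    refine Finset.sum_le_sum fun b _ => ?_
    rw [hDcard, ← mul_pow]
    exact Nat.pow_le_pow_left (by omega) d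
  calc l * (E.card : ℝ≥0∞) ≤ l * ((∑ b ∈ u, 3 ^ d * (2 * N b + 1) ^ d : ℕ) : ℝ≥0∞) := by
        gcongr
    _ = 3 ^ d * ∑ b ∈ u, (2 * (N b : ℝ≥0∞) + 1) ^ d * l := by
        push_cast
        rw [Finset.mul_sum, Finset.mul_sum]
        refine Finset.sum_congr rfl fun b _ => by ring
    _ ≤ 3 ^ d * ∑ b ∈ u, ∑ z ∈ D b (N b), F z := by
        gcongr with b hb
        rw [hD, Finset.sum_image fun _ _ _ _ h => hinj b h]
        have h0 : ((2 * (N b : ℝ≥0∞) + 1) ^ d) ≠ 0 := by positivity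
        have ht : ((2 * (N b : ℝ≥0∞) + 1) ^ d) ≠ ∞ := by finiteness
        have := (hN b (huE' hb)).le
        calc _ ≤ (2 * (N b : ℝ≥0∞) + 1) ^ d * cubeAvg q F (N b) b := by gcongr
          _ = _ := by rw [cubeAvg, ← mul_assoc, ENNReal.mul_inv_cancel h0 ht, one_mul]
    _ = 3 ^ d * ∑ z ∈ u.biUnion fun b => D b (N b), F z := by
        rw [Finset.sum_biUnion]
        intro a ha b hb hab
        exact Finset.disjoint_coe.1 (hudis ha hb hab)
    _ ≤ _ := by gcongr; exact ENNReal.sum_le_tsum _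

lemma maxFun_mono {q : ℕ} {F G : (Fin d → ℤ) → ℝ≥0∞} (h : ∀ x, F x ≤ G x) (x : Fin d → ℤ) :
    maxFun q F x ≤ maxFun q G x := by
  unfold maxFun cubeAvg
  gcongr
  exact h _

lemma maxFun_add_le {q : ℕ} (F G : (Fin d → ℤ) → ℝ≥0∞) (x : Fin d → ℤ) :
    maxFun q (fun y => F y + G y) x ≤ maxFun q F x + maxFun q G x := by
  refine iSup_le fun N => ?_
  have : cubeAvg q (fun y => F y + G y) N x = cubeAvg q F N x + cubeAvg q G N x := by
    simp only [cubeAvg, Finset.sum_add_distrib, mul_add]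
  rw [this]
  exact add_le_add (le_iSup (fun N => cubeAvg q F N x) N) (le_iSup (fun N => cubeAvg q G N x) N)

lemma maxFun_le_of_le {q : ℕ} {F : (Fin d → ℤ) → ℝ≥0∞} {c : ℝ≥0∞} (h : ∀ x, F x ≤ c)
    (x : Fin d → ℤ) : maxFun q F x ≤ c := by
  refine iSup_le fun N => ?_
  have h0 : ((2 * N + 1 : ℝ≥0∞) ^ d) ≠ 0 := by positivity
  have ht : ((2 * N + 1 : ℝ≥0∞) ^ d) ≠ ∞ := by finiteness
  calc cubeAvg q F N x ≤ ((2 * N + 1 : ℝ≥0∞) ^ d)⁻¹ * ∑ y ∈ latticeCube d N, c := by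
        unfold cubeAvg; gcongr; exact h _
    _ = ((2 * N + 1 : ℝ≥0∞) ^ d)⁻¹ * ((2 * N + 1 : ℝ≥0∞) ^ d * c) := by
        rw [Finset.sum_const, card_latticeCube, nsmul_eq_mul]; push_cast; rfl
    _ = c := by rw [← mul_assoc, ENNReal.inv_mul_cancel h0 ht, one_mul]

end MaximalFunction

section LayerCake

lemma lintegral_rpow_lt {s : ℝ} (hs : 0 < s) {a : ℝ≥0∞} (ha : a ≠ ∞) :
    ∫⁻ l in Set.Ioi (0 : ℝ), (if ENNReal.ofReal l < a then ENNReal.ofReal (l ^ (s - 1)) else 0) =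
      a ^ s / ENNReal.ofReal s := by
  lift a to ℝ≥0 using ha
  have h1 : ∀ l ∈ Set.Ioi (0 : ℝ), (if ENNReal.ofReal l < a then ENNReal.ofReal (l ^ (s - 1)) else 0) =
      (Set.Iio (a : ℝ)).indicator (fun l => ENNReal.ofReal (l ^ (s - 1))) l := by
    intro l hl
    have : ENNReal.ofReal l < a ↔ l < a := by
      rw [← ENNReal.ofReal_coe_nnreal, ENNReal.ofReal_lt_ofReal_iff_of_nonneg (le_of_lt hl)]
    simp only [Set.indicator, Set.mem_Iio, this]
  rw [setLIntegral_congr_fun measurableSet_Ioi h1, setLIntegral_indicator measurableSet_Iio]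
  have h2 : Set.Iio (a : ℝ) ∩ Set.Ioi 0 = Set.Ioo 0 (a : ℝ) := by ext; simp [and_comm]
  rcases eq_or_lt_of_le a.coe_nonneg with ha0 | ha0
  · have : a = 0 := by exact_mod_cast ha0.symm
    subst this
    rw [h2]
    simp [hs]
  have hint : IntegrableOn (fun l : ℝ => l ^ (s - 1)) (Set.Ioo 0 (a : ℝ)) :=
    (intervalIntegral.integrableOn_Ioo_rpow_iff ha0).2 (by linarith)
  rw [h2, ← ofReal_integral_eq_lintegral_ofReal hint
    ((ae_restrict_mem measurableSet_Ioo).mono fun l hl => Real.rpow_nonneg hl.1.le _),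
    ← integral_Ioc_eq_integral_Ioo, ← intervalIntegral.integral_of_le ha0.le,
    integral_rpow (Or.inl (by linarith)), sub_add_cancel, Real.zero_rpow hs.ne', sub_zero,
    ENNReal.ofReal_div_of_pos hs, ← ENNReal.ofReal_rpow_of_pos ha0, ENNReal.ofReal_coe_nnreal]

lemma lintegral_rpow_ge {s : ℝ} (hs : s < 0) {a : ℝ≥0∞} (ha0 : a ≠ 0) (ha : a ≠ ∞) :
    ∫⁻ l in Set.Ioi (0 : ℝ), (if ENNReal.ofReal l < a then 0 else ENNReal.ofReal (l ^ (s - 1))) =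
      a ^ s / ENNReal.ofReal (-s) := by
  lift a to ℝ≥0 using ha
  have ha0' : (0 : ℝ) < a := by
    have : a ≠ 0 := by exact_mod_cast ha0
    positivity
  have h1 : ∀ l ∈ Set.Ioi (0 : ℝ), (if ENNReal.ofReal l < a then 0 else ENNReal.ofReal (l ^ (s - 1))) =
      (Set.Ici (a : ℝ)).indicator (fun l => ENNReal.ofReal (l ^ (s - 1))) l := by
    intro l hl
    have : ENNReal.ofReal l < a ↔ l < a := by
      rw [← ENNReal.ofReal_coe_nnreal, ENNReal.ofReal_lt_ofReal_iff_of_nonneg (le_of_lt hl)]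
    by_cases h : l < a
    · simp [Set.indicator, Set.mem_Ici, this, h]
    · simp [Set.indicator, Set.mem_Ici, this, h, not_lt.1 h]
  have h2 : Set.Ici (a : ℝ) ∩ Set.Ioi 0 = Set.Ici (a : ℝ) :=
    Set.inter_eq_left.2 fun x hx => lt_of_lt_of_le ha0' hx
  rw [setLIntegral_congr_fun measurableSet_Ioi h1, setLIntegral_indicator measurableSet_Ici, h2,
    setLIntegral_congr Ioi_ae_eq_Ici.symm,
    ← ofReal_integral_eq_lintegral_ofReal (integrableOn_Ioi_rpow_of_lt (by linarith) ha0')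
    ((ae_restrict_mem measurableSet_Ioi).mono fun l hl => Real.rpow_nonneg (ha0'.trans hl).le _),
    integral_Ioi_rpow_of_lt (by linarith) ha0', sub_add_cancel, neg_div, ← div_neg,
    ENNReal.ofReal_div_of_pos (by linarith), ← ENNReal.ofReal_rpow_of_pos ha0',
    ENNReal.ofReal_coe_nnreal]

variable {X : Type*} [Countable X]

/-- The number of points where `g` exceeds the level `l`. -/
def levelCount (g : X → ℝ≥0∞) (l : ℝ≥0∞) : ℝ≥0∞ := ∑' x, if l < g x then 1 else 0

lemma measurable_ite_ofReal_lt (a : ℝ≥0∞) {u v : ℝ → ℝ≥0∞} (hu : Measurable u) (hv : Measurable v) :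
    Measurable fun l : ℝ => if ENNReal.ofReal l < a then u l else v l :=
  Measurable.ite (measurableSet_lt ENNReal.measurable_ofReal measurable_const) hu hv

lemma tsum_rpow_eq_lintegral {s : ℝ} (hs : 0 < s) {g : X → ℝ≥0∞} (hg : ∀ x, g x ≠ ∞) :
    ∑' x, g x ^ s = ENNReal.ofReal s * ∫⁻ l in Set.Ioi (0 : ℝ),
      ENNReal.ofReal (l ^ (s - 1)) * levelCount g (ENNReal.ofReal l) := by
  have hs' : ENNReal.ofReal s ≠ 0 := by simpa using hs
  have h1 : ∀ l : ℝ, ENNReal.ofReal (l ^ (s - 1)) * levelCount g (ENNReal.ofReal l) =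
      ∑' x, if ENNReal.ofReal l < g x then ENNReal.ofReal (l ^ (s - 1)) else 0 := by
    intro l
    rw [levelCount, ← ENNReal.tsum_mul_left]
    simp
  simp_rw [h1]
  rw [lintegral_tsum fun x => (measurable_ite_ofReal_lt _ (by fun_prop) (by fun_prop)).aemeasurable,
    ← ENNReal.tsum_mul_left]
  refine tsum_congr fun x => ?_
  rw [lintegral_rpow_lt hs (hg x), ENNReal.mul_div_cancel hs' (by finiteness)]

end LayerCake

section Marcinkiewicz

variable {X : Type*} [Countable X]

lemma levelCount_add_le {g u v : X → ℝ≥0∞} (h : ∀ x, g x ≤ u x + v x) (l : ℝ≥0∞) :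
    levelCount g l ≤ levelCount u (l / 2) + levelCount v (l / 2) := by
  unfold levelCount
  rw [← ENNReal.tsum_add]
  refine ENNReal.tsum_le_tsum fun x => ?_
  by_cases hg : l < g x
  · have : l / 2 < u x ∨ l / 2 < v x := by
      by_contra! hcon
      exact absurd (hg.trans_le ((h x).trans (add_le_add hcon.1 hcon.2))) (by simp)
    rcases this with h | h <;> simp [hg, h]
  · simp [hg]

lemma mul_levelCount_le_tsum (g : X → ℝ≥0∞) (l : ℝ≥0∞) (n : ℕ) :
    l ^ n * levelCount g l ≤ ∑' x, g x ^ n := by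
  rw [levelCount, ← ENNReal.tsum_mul_left]
  refine ENNReal.tsum_le_tsum fun x => ?_
  by_cases h : l < g x
  · simp only [h, if_true, mul_one]
    gcongr
  · simp [h]

lemma marcinkiewicz {S : (X → ℂ) → X → ℝ≥0∞} {A₁ A₂ : ℝ} (hA₁ : 0 < A₁) (hA₂ : 0 < A₂)
    (hsub : ∀ f g : X → ℂ, f.support.Finite → g.support.Finite → ∀ x,
      S (fun y => f y + g y) x ≤ S f x + S g x)
    (hweak : ∀ f : X → ℂ, f.support.Finite → ∀ l : ℝ≥0∞,
      l * levelCount (S f) l ≤ ENNReal.ofReal A₁ * ∑' x, ‖f x‖ₑ)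
    (hstrong : ∀ f : X → ℂ, f.support.Finite →
      ∑' x, S f x ^ 2 ≤ ENNReal.ofReal A₂ ^ 2 * ∑' x, ‖f x‖ₑ ^ 2)
    {p : ℝ} (hp1 : 1 < p) (hp2 : p < 2) (f : X → ℂ) (hf : f.support.Finite) :
    ∑' x, S f x ^ p ≤ ENNReal.ofReal (p * (2 / (p - 1) + 4 / (2 - p)) *
      (A₁ ^ (2 - p) * A₂ ^ (2 * p - 2))) * ∑' x, ‖f x‖ₑ ^ p := by
  classical
  set c : ℝ := A₁ / A₂ ^ 2 with hc
  have hc0 : 0 < c := by positivity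
  have hcE : ENNReal.ofReal c ≠ 0 := by simpa using hc0
  set a : X → ℝ≥0∞ := fun x => ‖f x‖ₑ / ENNReal.ofReal c with ha
  have hafin : ∀ x, a x ≠ ∞ := fun x => ENNReal.div_ne_top enorm_ne_top hcE
  have hSfin : ∀ x, S f x ≠ ∞ := by
    intro x hx
    have h1 := (ENNReal.le_tsum (f := fun x => S f x ^ 2) x).trans (hstrong f hf)
    rw [hx, tsum_eq_sum (s := hf.toFinset) fun y hy => by
      have : f y = 0 := by simpa using hy
      simp [this]] at h1
    refine absurd h1 (not_le.2 ?_)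
    rw [ENNReal.top_pow two_ne_zero]
    exact ENNReal.mul_lt_top (by finiteness) (ENNReal.sum_lt_top.2 fun y _ => by finiteness)
  have hpt : ∀ l ∈ Set.Ioi (0 : ℝ), ENNReal.ofReal (l ^ (p - 1)) * levelCount (S f) (ENNReal.ofReal l) ≤
      (∑' x, ENNReal.ofReal (2 * A₁) * ‖f x‖ₑ *
        if ENNReal.ofReal l < a x then ENNReal.ofReal (l ^ (p - 1 - 1)) else 0) +
      ∑' x, ENNReal.ofReal (4 * A₂ ^ 2) * ‖f x‖ₑ ^ 2 *
        if ENNReal.ofReal l < a x then 0 else ENNReal.ofReal (l ^ (p - 2 - 1)) := by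
    intro l hl
    have hl0 : (0 : ℝ) < l := hl
    set f₁ : X → ℂ := fun x => if ENNReal.ofReal l < a x then f x else 0 with hf₁
    set f₂ : X → ℂ := fun x => if ENNReal.ofReal l < a x then 0 else f x with hf₂
    have hfs₁ : f₁.support.Finite := hf.subset fun x hx => by
      by_contra hcon
      have : f x = 0 := by simpa using hcon
      simp [hf₁, this] at hx
    have hfs₂ : f₂.support.Finite := hf.subset fun x hx => by
      by_contra hcon
      have : f x = 0 := by simpa using hcon
      simp [hf₂, this] at hx
    have hsum : (fun y => f₁ y + f₂ y) = f := by
      ext y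
      simp only [hf₁, hf₂]
      split_ifs <;> simp
    have h0 := levelCount_add_le (g := S f) (u := S f₁) (v := S f₂)
      (fun x => by have := hsub f₁ f₂ hfs₁ hfs₂ x; rwa [hsum] at this) (ENNReal.ofReal l)
    have hl2 : ENNReal.ofReal l / 2 = ENNReal.ofReal (l / 2) := by
      rw [ENNReal.ofReal_div_of_pos two_pos]; simp
    rw [hl2] at h0
    have h1 := hweak f₁ hfs₁ (ENNReal.ofReal (l / 2))
    have h2 := (mul_levelCount_le_tsum (S f₂) (ENNReal.ofReal (l / 2)) 2).trans (hstrong f₂ hfs₂)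
    have e1 : ENNReal.ofReal (l ^ (p - 1)) =
        ENNReal.ofReal (2 * l ^ (p - 1 - 1)) * ENNReal.ofReal (l / 2) := by
      rw [← ENNReal.ofReal_mul (by positivity)]
      congr 1
      rw [Real.rpow_sub_one hl0.ne' (p - 1)]
      field_simp
    have e2 : ENNReal.ofReal (l ^ (p - 1)) =
        ENNReal.ofReal (4 * l ^ (p - 2 - 1)) * ENNReal.ofReal (l / 2) ^ 2 := by
      rw [← ENNReal.ofReal_pow (by positivity), ← ENNReal.ofReal_mul (by positivity)]
      congr 1
      rw [Real.rpow_sub_one hl0.ne' (p - 2), show p - 2 = p - 1 - 1 by ring,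
        Real.rpow_sub_one hl0.ne' (p - 1)]
      field_simp
      ring
    calc _ ≤ ENNReal.ofReal (l ^ (p - 1)) * (levelCount (S f₁) (ENNReal.ofReal (l / 2)) +
          levelCount (S f₂) (ENNReal.ofReal (l / 2))) := by gcongr
      _ = ENNReal.ofReal (2 * l ^ (p - 1 - 1)) * (ENNReal.ofReal (l / 2) *
            levelCount (S f₁) (ENNReal.ofReal (l / 2))) +
          ENNReal.ofReal (4 * l ^ (p - 2 - 1)) * (ENNReal.ofReal (l / 2) ^ 2 *
            levelCount (S f₂) (ENNReal.ofReal (l / 2))) := by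
          rw [mul_add]; nth_rewrite 1 [e1]; rw [e2]; ring
      _ ≤ ENNReal.ofReal (2 * l ^ (p - 1 - 1)) * (ENNReal.ofReal A₁ * ∑' x, ‖f₁ x‖ₑ) +
          ENNReal.ofReal (4 * l ^ (p - 2 - 1)) * (ENNReal.ofReal A₂ ^ 2 * ∑' x, ‖f₂ x‖ₑ ^ 2) := by
          gcongr
      _ = _ := by
          rw [← mul_assoc, ← mul_assoc, ← ENNReal.tsum_mul_left, ← ENNReal.tsum_mul_left]
          congr 1
          · refine tsum_congr fun x => ?_
            rw [← ENNReal.ofReal_mul (by positivity)]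
            simp only [hf₁]
            split_ifs
            · rw [mul_right_comm (ENNReal.ofReal (2 * A₁)), ← ENNReal.ofReal_mul (by positivity)]
              congr 2; ring
            · simp
          · refine tsum_congr fun x => ?_
            rw [← ENNReal.ofReal_pow (by positivity), ← ENNReal.ofReal_mul (by positivity)]
            simp only [hf₂]
            split_ifs
            · simp
            · rw [mul_right_comm (ENNReal.ofReal (4 * A₂ ^ 2)), ← ENNReal.ofReal_mul (by positivity)]
              congr 2; ring
  have hmeas1 : ∀ x, Measurable fun l : ℝ => ENNReal.ofReal (2 * A₁) * ‖f x‖ₑ *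
      if ENNReal.ofReal l < a x then ENNReal.ofReal (l ^ (p - 1 - 1)) else 0 := fun x =>
    (measurable_ite_ofReal_lt _ (by fun_prop) (by fun_prop)).const_mul _
  have hmeas2 : ∀ x, Measurable fun l : ℝ => ENNReal.ofReal (4 * A₂ ^ 2) * ‖f x‖ₑ ^ 2 *
      if ENNReal.ofReal l < a x then 0 else ENNReal.ofReal (l ^ (p - 2 - 1)) := fun x =>
    (measurable_ite_ofReal_lt _ (by fun_prop) (by fun_prop)).const_mul _
  have hval : ∀ x, ENNReal.ofReal p * (ENNReal.ofReal (2 * A₁) * ‖f x‖ₑ *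
        (a x ^ (p - 1) / ENNReal.ofReal (p - 1))) +
      ENNReal.ofReal p * (∫⁻ l in Set.Ioi (0 : ℝ), ENNReal.ofReal (4 * A₂ ^ 2) * ‖f x‖ₑ ^ 2 *
        if ENNReal.ofReal l < a x then 0 else ENNReal.ofReal (l ^ (p - 2 - 1))) =
      ENNReal.ofReal (p * (2 / (p - 1) + 4 / (2 - p)) *
      (A₁ ^ (2 - p) * A₂ ^ (2 * p - 2))) * ‖f x‖ₑ ^ p := by
    intro x
    rcases eq_or_ne (f x) 0 with h0 | h0
    · simp [h0, ENNReal.zero_rpow_of_pos (zero_lt_one.trans hp1)]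
    have ht : 0 < ‖f x‖ := norm_pos_iff.2 h0
    have hax : a x = ENNReal.ofReal (‖f x‖ / c) := by
      rw [ENNReal.ofReal_div_of_pos hc0, ofReal_norm]
    have hax0 : a x ≠ 0 := by rw [hax]; simp; positivity
    rw [lintegral_const_mul _ (measurable_ite_ofReal_lt _ (by fun_prop) (by fun_prop)),
      lintegral_rpow_ge (by linarith) hax0 (hafin x), hax, ← ofReal_norm,
      ENNReal.ofReal_rpow_of_pos (by positivity), ENNReal.ofReal_rpow_of_pos (by positivity),
      ENNReal.ofReal_rpow_of_pos (by positivity),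
      ← ENNReal.ofReal_div_of_pos (by linarith), ← ENNReal.ofReal_div_of_pos (by linarith),
      ← ENNReal.ofReal_pow (by positivity)]
    have hp1' : 0 < p - 1 := by linarith
    have hp2' : 0 < 2 - p := by linarith
    have hp0 : 0 < p := by linarith
    have k1 : (‖f x‖ / c) ^ (p - 1) = (‖f x‖ ^ p / ‖f x‖) * (A₁ ^ (2 - p) / A₁ * A₂ ^ (2 * p - 2)) := by
      rw [Real.div_rpow (by positivity) hc0.le, Real.rpow_sub_one ht.ne', hc,
        Real.div_rpow (by positivity) (by positivity), ← Real.rpow_natCast A₂ 2,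
        ← Real.rpow_mul hA₂.le, show (2 - p : ℝ) = 1 - (p - 1) by ring, Real.rpow_sub hA₁ 1 (p - 1),
        Real.rpow_one, show ((2 : ℕ) : ℝ) * (p - 1) = 2 * p - 2 by push_cast; ring]
      have h1 := Real.rpow_pos_of_pos hA₁ (p - 1)
      have h2 := Real.rpow_pos_of_pos hA₂ (2 * p - 2)
      generalize A₁ ^ (p - 1) = u at *
      generalize A₂ ^ (2 * p - 2) = v at *
      field_simp
    have k2 : (‖f x‖ / c) ^ (p - 2) =
        (‖f x‖ ^ p / ‖f x‖ ^ 2) * (A₁ ^ (2 - p) * A₂ ^ (2 * p - 2) / A₂ ^ 2) := by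
      rw [show p - 2 = p - 1 - 1 by ring, Real.rpow_sub_one (by positivity), k1, hc]
      field_simp
    rw [k1, show -(p - 2) = 2 - p by ring, k2]
    simp only [← ENNReal.ofReal_mul (show 0 ≤ 2 * A₁ * ‖f x‖ by positivity),
      ← ENNReal.ofReal_mul (show 0 ≤ 2 * A₁ by positivity),
      ← ENNReal.ofReal_mul (show 0 ≤ 4 * A₂ ^ 2 * ‖f x‖ ^ 2 by positivity),
      ← ENNReal.ofReal_mul (show 0 ≤ 4 * A₂ ^ 2 by positivity), ← ENNReal.ofReal_mul hp0.le]
    rw [← ENNReal.ofReal_add (by positivity) (by positivity), ← ENNReal.ofReal_mul (by positivity)]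
    congr 1
    field_simp
  rw [tsum_rpow_eq_lintegral (by linarith) hSfin]
  calc _ ≤ ENNReal.ofReal p * ∫⁻ l in Set.Ioi (0 : ℝ), ((∑' x, ENNReal.ofReal (2 * A₁) * ‖f x‖ₑ *
        if ENNReal.ofReal l < a x then ENNReal.ofReal (l ^ (p - 1 - 1)) else 0) +
      ∑' x, ENNReal.ofReal (4 * A₂ ^ 2) * ‖f x‖ₑ ^ 2 *
        if ENNReal.ofReal l < a x then 0 else ENNReal.ofReal (l ^ (p - 2 - 1))) := by
        gcongr ENNReal.ofReal p * ?_
        exact setLIntegral_mono' measurableSet_Ioi hpt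
    _ = ∑' x, (ENNReal.ofReal p * (ENNReal.ofReal (2 * A₁) * ‖f x‖ₑ *
        (a x ^ (p - 1) / ENNReal.ofReal (p - 1))) +
      ENNReal.ofReal p * (∫⁻ l in Set.Ioi (0 : ℝ), ENNReal.ofReal (4 * A₂ ^ 2) * ‖f x‖ₑ ^ 2 *
        if ENNReal.ofReal l < a x then 0 else ENNReal.ofReal (l ^ (p - 2 - 1)))) := by
        rw [lintegral_add_left (Measurable.tsum hmeas1),
          lintegral_tsum fun x => (hmeas1 x).aemeasurable,
          lintegral_tsum fun x => (hmeas2 x).aemeasurable, ENNReal.tsum_add,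
          ENNReal.tsum_mul_left, ENNReal.tsum_mul_left, mul_add]
        congr 2
        refine tsum_congr fun x => ?_
        rw [lintegral_const_mul _ (measurable_ite_ofReal_lt _ (by fun_prop) (by fun_prop)),
          lintegral_rpow_lt (by linarith) (hafin x)]
    _ = _ := by
        simp_rw [hval]
        rw [ENNReal.tsum_mul_left]

end Marcinkiewicz

section MaximalStrong

lemma maxFun_strong_two {d q : ℕ} (hq : 0 < q) (F : (Fin d → ℤ) → ℝ≥0∞) :
    ∑' x, maxFun q F x ^ 2 ≤ 8 * 3 ^ d * ∑' x, F x ^ 2 := by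
  classical
  rcases eq_or_ne (∑' x, F x ^ 2) ∞ with htop | htop
  · rw [htop, ENNReal.mul_top (by positivity)]
    exact le_top
  have hF : ∀ x, F x ≤ (∑' x, F x ^ 2) ^ (1 / 2 : ℝ) := by
    intro x
    have h := ENNReal.le_tsum (f := fun x => F x ^ 2) x
    rw [one_div, ENNReal.le_rpow_inv_iff two_pos]
    exact_mod_cast h
  have hMfin : ∀ x, maxFun q F x ≠ ∞ := fun x =>
    ((maxFun_le_of_le hF x).trans_lt (by finiteness)).ne
  have hFfin : ∀ x, F x ≠ ∞ := fun x => ((hF x).trans_lt (by finiteness)).ne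
  have hpt : ∀ l ∈ Set.Ioi (0 : ℝ), ENNReal.ofReal (l ^ ((2 : ℝ) - 1)) *
      levelCount (maxFun q F) (ENNReal.ofReal l) ≤ ∑' x, 2 * 3 ^ d * F x *
        if ENNReal.ofReal l < 2 * F x then ENNReal.ofReal (l ^ ((1 : ℝ) - 1)) else 0 := by
    intro l hl
    set F₁ : (Fin d → ℤ) → ℝ≥0∞ := fun x => if ENNReal.ofReal l < 2 * F x then F x else 0 with hF₁
    have h1 : ∀ x, F x ≤ F₁ x + ENNReal.ofReal l / 2 := by
      intro x
      simp only [hF₁]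
      split_ifs with h
      · exact le_self_add
      · rw [zero_add, ENNReal.le_div_iff_mul_le (by simp) (by simp), mul_comm]
        exact not_lt.1 h
    have h2 : ∀ x, maxFun q F x ≤ maxFun q F₁ x + ENNReal.ofReal l / 2 := fun x =>
      (maxFun_mono h1 x).trans ((maxFun_add_le _ _ x).trans
        (add_le_add le_rfl (maxFun_le_of_le (fun _ => le_rfl) x)))
    have h3 := levelCount_add_le h2 (ENNReal.ofReal l)
    have h4 : levelCount (fun _ : Fin d → ℤ => ENNReal.ofReal l / 2) (ENNReal.ofReal l / 2) = 0 := by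
      simp [levelCount]
    rw [h4, add_zero] at h3
    have h5 := maxFun_weak_type hq F₁ (ENNReal.ofReal l / 2)
    calc _ ≤ ENNReal.ofReal l * levelCount (maxFun q F₁) (ENNReal.ofReal l / 2) := by
          gcongr; norm_num
      _ = 2 * (ENNReal.ofReal l / 2 * levelCount (maxFun q F₁) (ENNReal.ofReal l / 2)) := by
          rw [← mul_assoc, ENNReal.mul_div_cancel (by simp) (by simp)]
      _ ≤ 2 * (3 ^ d * ∑' x, F₁ x) := by gcongr 2 * ?_; exact h5
      _ = _ := by
          rw [← mul_assoc, ← ENNReal.tsum_mul_left]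
          refine tsum_congr fun x => ?_
          simp only [hF₁]
          split_ifs <;> simp
  have := tsum_rpow_eq_lintegral two_pos hMfin
  simp only [ENNReal.rpow_ofNat] at this
  rw [this]
  calc _ ≤ ENNReal.ofReal 2 * ∫⁻ l in Set.Ioi (0 : ℝ), ∑' x, 2 * 3 ^ d * F x *
        if ENNReal.ofReal l < 2 * F x then ENNReal.ofReal (l ^ ((1 : ℝ) - 1)) else 0 := by
        gcongr ENNReal.ofReal 2 * ?_
        exact setLIntegral_mono' measurableSet_Ioi hpt
    _ = ENNReal.ofReal 2 * ∑' x, 2 * 3 ^ d * F x * (2 * F x) := by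
        rw [lintegral_tsum fun x => ((measurable_ite_ofReal_lt _ (by fun_prop)
          (by fun_prop)).const_mul _).aemeasurable]
        congr 1
        refine tsum_congr fun x => ?_
        rw [lintegral_const_mul _ (measurable_ite_ofReal_lt _ (by fun_prop) (by fun_prop)),
          lintegral_rpow_lt one_pos (by finiteness [hFfin x])]
        simp
    _ = _ := by
        rw [← ENNReal.tsum_mul_left, ← ENNReal.tsum_mul_left]
        refine tsum_congr fun x => ?_
        simp only [ENNReal.ofReal_ofNat]
        ring

end MaximalStrong

section Minkowski

variable {X : Type*}

lemma Lp_tsum_le {p : ℝ} (hp : 1 ≤ p) (g : ℕ → X → ℝ≥0∞) :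
    (∑' x, (∑' n, g n x) ^ p) ^ (1 / p) ≤ ∑' n, (∑' x, g n x ^ p) ^ (1 / p) := by
  have hp0 : 0 < p := by linarith
  have hfin : ∀ (s : Finset X) (N : ℕ), (∑ x ∈ s, (∑ n ∈ Finset.range N, g n x) ^ p) ^ (1 / p) ≤
      ∑ n ∈ Finset.range N, (∑ x ∈ s, g n x ^ p) ^ (1 / p) := by
    intro s N
    induction N with
    | zero => simp [hp0]
    | succ N ih =>
      simp only [Finset.sum_range_succ]
      exact (ENNReal.Lp_add_le s _ _ hp).trans (by gcongr)
  rw [one_div, ENNReal.rpow_inv_le_iff hp0, ENNReal.tsum_eq_iSup_sum]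
  refine iSup_le fun s => ?_
  have ht : Filter.Tendsto (fun N => ∑ x ∈ s, (∑ n ∈ Finset.range N, g n x) ^ p) Filter.atTop
      (nhds (∑ x ∈ s, (∑' n, g n x) ^ p)) := by
    refine tendsto_finsetSum _ fun x _ => ?_
    exact (ENNReal.continuous_rpow_const.tendsto _).comp (ENNReal.tendsto_nat_tsum fun n => g n x)
  refine le_of_tendsto' ht fun N => ?_
  rw [← ENNReal.rpow_inv_le_iff hp0, ← one_div]
  refine (hfin s N).trans ?_
  refine le_trans ?_ (ENNReal.sum_le_tsum (Finset.range N))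
  rw [one_div]
  gcongr
  exact ENNReal.sum_le_tsum s

lemma Lp_sum_le {ι : Type*} {p : ℝ} (hp : 1 ≤ p) (s : Finset ι) (g : ι → X → ℝ≥0∞) :
    (∑' x, (∑ n ∈ s, g n x) ^ p) ^ (1 / p) ≤ ∑ n ∈ s, (∑' x, g n x ^ p) ^ (1 / p) := by
  classical
  have hp0 : 0 < p := by linarith
  rw [one_div, ENNReal.rpow_inv_le_iff hp0, ENNReal.tsum_eq_iSup_sum]
  refine iSup_le fun t => ?_
  rw [← ENNReal.rpow_inv_le_iff hp0, ← one_div]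
  have : (∑ x ∈ t, (∑ n ∈ s, g n x) ^ p) ^ (1 / p) ≤
      ∑ n ∈ s, (∑ x ∈ t, g n x ^ p) ^ (1 / p) := by
    induction s using Finset.induction_on with
    | empty => simp [hp0]
    | insert a s ha ih =>
      simp only [Finset.sum_insert ha]
      exact (ENNReal.Lp_add_le t _ _ hp).trans (by gcongr)
  refine this.trans (Finset.sum_le_sum fun n _ => ?_)
  gcongr
  exact ENNReal.sum_le_tsum t

end Minkowski

section SphereMeasure

variable {d : ℕ}

lemma norm_eC (t : ℝ) : ‖eC t‖ = 1 := by
  rw [eC, show (2 * Real.pi * Complex.I * t : ℂ) = ((2 * Real.pi * t : ℝ) : ℂ) * Complex.I by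
    push_cast; ring, Complex.norm_exp_ofReal_mul_I]

lemma eC_add (s t : ℝ) : eC (s + t) = eC s * eC t := by
  simp only [eC, ← Complex.exp_add]; congr 1; push_cast; ring

lemma continuous_eC : Continuous eC := by unfold eC; fun_prop

lemma eC_zero : eC 0 = 1 := by simp [eC]

lemma eC_intCast (n : ℤ) : eC n = 1 := by
  rw [eC, show (2 * Real.pi * Complex.I * ((n : ℝ) : ℂ) : ℂ) = n * (2 * Real.pi * Complex.I) by
    push_cast; ring, Complex.exp_int_mul_two_pi_mul_I]

/-- A finite rotation-invariant measure carried by the unit sphere. -/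
structure IsSphereMeasure (σ : Measure (EuclideanSpace ℝ (Fin d))) : Prop where
  finite : IsFiniteMeasure σ
  carried : ∀ᵐ x ∂σ, ‖x‖ = 1
  invariant : ∀ e : EuclideanSpace ℝ (Fin d) ≃ₗᵢ[ℝ] EuclideanSpace ℝ (Fin d), σ.map e = σ

open scoped Pointwise in
lemma sphMeasure_eq_map (hd : 1 ≤ d) {r : ℝ} (hr : 0 < r) :
    sphMeasure d r = (sphMeasure d 1).map (fun x => r • x) := by
  have hd' : (0 : ℝ) ≤ (d : ℝ) - 1 := by
    have : (1 : ℝ) ≤ d := by exact_mod_cast hd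
    linarith
  ext A hA
  rw [Measure.map_apply (by fun_prop) hA, sphMeasure, sphMeasure, Measure.smul_apply,
    Measure.smul_apply, Measure.restrict_apply hA,
    Measure.restrict_apply ((measurable_const_smul r) hA)]
  have hset : A ∩ Metric.sphere 0 r = r • ((fun x => r • x) ⁻¹' A ∩ Metric.sphere 0 1) := by
    ext x
    rw [Set.mem_smul_set_iff_inv_smul_mem₀ hr.ne']
    simp only [Set.mem_inter_iff, Set.mem_preimage, smul_inv_smul₀ hr.ne', mem_sphere_zero_iff_norm,
      norm_smul, norm_inv, Real.norm_of_nonneg hr.le]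
    rw [inv_mul_eq_one₀ hr.ne', eq_comm (a := r)]
  rw [hset, Measure.hausdorffMeasure_smul₀ hd' hr.ne', smul_eq_mul, smul_eq_mul, ENNReal.smul_def,
    smul_eq_mul, ← mul_assoc]
  congr 1
  have h1 : ((‖r‖₊ ^ ((d : ℝ) - 1) : ℝ≥0) : ℝ≥0∞) = ENNReal.ofReal (r ^ (d - 1)) := by
    rw [← ENNReal.ofReal_coe_nnreal]
    congr 1
    push_cast
    rw [Real.norm_of_nonneg hr.le, ← Real.rpow_natCast, Nat.cast_sub hd]
    simp
  rw [h1, ENNReal.ofReal_mul two_pos.le, one_pow, mul_one, ENNReal.mul_inv (by simp) (by simp),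
    mul_assoc, ENNReal.inv_mul_cancel (by simp; positivity) (by simp), mul_one]

lemma fourierSphMeasure_eq (hd : 1 ≤ d) {r : ℝ} (hr : 0 < r) (ξ : Fin d → ℝ) :
    fourierSphMeasure d r ξ = ∫ x, eC (∑ i, x i * (r * ξ i)) ∂(sphMeasure d 1) := by
  rw [fourierSphMeasure, sphMeasure_eq_map hd hr, integral_map (by fun_prop)]
  · congr 1; ext x; congr 1
    refine Finset.sum_congr rfl fun i _ => ?_
    simp only [PiLp.smul_apply, smul_eq_mul]; ring
  · exact (continuous_eC.comp (by fun_prop)).aestronglyMeasurable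

lemma exists_isSphereMeasure (hd : 1 ≤ d) : ∃ σ : Measure (EuclideanSpace ℝ (Fin d)),
    IsSphereMeasure σ ∧ ∀ r : ℝ, 0 < r → ∀ ξ : Fin d → ℝ,
      fourierSphMeasure d r ξ = ∫ x, eC (∑ i, x i * (r * ξ i)) ∂σ := by
  by_cases hfin : IsFiniteMeasure (sphMeasure d 1)
  · refine ⟨sphMeasure d 1, ⟨hfin, ?_, fun e => ?_⟩, fun r hr ξ => fourierSphMeasure_eq hd hr ξ⟩
    · rw [sphMeasure]
      refine Measure.ae_smul_measure ?_ _
      filter_upwards [ae_restrict_mem Metric.isClosed_sphere.measurableSet] with x hx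
      simpa using hx
    · have hpre : e ⁻¹' Metric.sphere 0 1 = Metric.sphere 0 1 := by ext x; simp
      have h1 := IsometryEquiv.map_hausdorffMeasure e.toIsometryEquiv ((d : ℝ) - 1)
      have h2 : Measure.map e (μH[(d : ℝ) - 1] : Measure (EuclideanSpace ℝ (Fin d))) = μH[(d : ℝ) - 1] := h1
      rw [sphMeasure, Measure.map_smul]
      congr 1
      conv_rhs => rw [← h2]
      rw [Measure.restrict_map e.continuous.measurable Metric.isClosed_sphere.measurableSet, hpre]
  · refine ⟨0, ⟨inferInstance, by simp, by simp⟩, fun r hr ξ => ?_⟩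
    rw [fourierSphMeasure_eq hd hr, integral_zero_measure, integral_undef]
    intro hint
    apply hfin
    have := hint.norm
    simp only [norm_eC] at this
    rcases integrable_const_iff.1 this with h | h
    · exact absurd h one_ne_zero
    · exact h

/-- The polynomial weight `(1 + u)^{-(d+1)}`. -/
def polyWeight (d : ℕ) (u : ℝ) : ℝ≥0∞ := ENNReal.ofReal ((1 + u) ^ (-(d + 1 : ℝ)))

lemma measurable_polyWeight : Measurable (polyWeight d) := by unfold polyWeight; fun_prop

lemma polyWeight_le_mul {u v : ℝ} (hv : 0 ≤ v) (h : 1 + v ≤ 2 * (1 + u)) :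
    polyWeight d u ≤ 2 ^ (d + 1) * polyWeight d v := by
  have h2 : (2 : ℝ≥0∞) ^ (d + 1) = ENNReal.ofReal ((2 : ℝ) ^ (d + 1 : ℝ)) := by
    rw [← ENNReal.ofReal_ofNat, ← ENNReal.ofReal_pow (by norm_num), ← Real.rpow_natCast]
    norm_cast
  rw [polyWeight, polyWeight, h2, ← ENNReal.ofReal_mul (by positivity)]
  refine ENNReal.ofReal_le_ofReal ?_
  have hu : 0 < 1 + u := by linarith
  calc (1 + u) ^ (-(d + 1 : ℝ)) = 2 ^ (d + 1 : ℝ) * (2 * (1 + u)) ^ (-(d + 1 : ℝ)) := by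
        rw [Real.mul_rpow (by norm_num) hu.le, ← mul_assoc, ← Real.rpow_add two_pos]; simp
    _ ≤ _ := by
        gcongr ?_ * ?_
        exact Real.rpow_le_rpow_of_nonpos (by linarith) h (by linarith [(Nat.cast_nonneg d : (0:ℝ) ≤ d)])

variable {σ : Measure (EuclideanSpace ℝ (Fin d))}

lemma IsSphereMeasure.lintegral_eq_of_norm_eq (hσ : IsSphereMeasure σ) {z z' : EuclideanSpace ℝ (Fin d)}
    (h : ‖z‖ = ‖z'‖) {g : ℝ → ℝ≥0∞} (hg : Measurable g) :
    ∫⁻ x, g ‖x - z‖ ∂σ = ∫⁻ x, g ‖x - z'‖ ∂σ := by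
  set e := (Submodule.span ℝ {z' - z})ᗮ.reflection with he
  have hez : e z' = z := Submodule.reflection_sub h.symm
  conv_lhs => rw [← hσ.invariant e]
  rw [lintegral_map (by fun_prop) e.continuous.measurable]
  refine lintegral_congr fun x => ?_
  rw [← hez, ← map_sub, LinearIsometryEquiv.norm_map]

end SphereMeasure

section SphereWeight

variable {d : ℕ}

lemma lintegral_polyWeight_lt_top :
    ∫⁻ u : EuclideanSpace ℝ (Fin d), polyWeight d ‖u‖ < ∞ := by
  have := finite_integral_one_add_norm (E := EuclideanSpace ℝ (Fin d)) (μ := volume)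
    (r := (d + 1 : ℝ)) (by simp)
  exact this

lemma lintegral_polyWeight_scaled {ε : ℝ} (hε : 0 < ε) (x : EuclideanSpace ℝ (Fin d)) :
    ∫⁻ u : EuclideanSpace ℝ (Fin d), polyWeight d (‖x - u‖ / ε) =
      ENNReal.ofReal (ε ^ d) * ∫⁻ u : EuclideanSpace ℝ (Fin d), polyWeight d ‖u‖ := by
  rw [lintegral_sub_left_eq_self (fun u => polyWeight d (‖u‖ / ε)) x]
  have h := Measure.map_addHaar_smul (volume : Measure (EuclideanSpace ℝ (Fin d)))
    (inv_ne_zero hε.ne')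
  have h2 : ∫⁻ u, polyWeight d ‖u‖ ∂(Measure.map (fun u => ε⁻¹ • u)
      (volume : Measure (EuclideanSpace ℝ (Fin d)))) =
      ∫⁻ u : EuclideanSpace ℝ (Fin d), polyWeight d (‖u‖ / ε) := by
    rw [lintegral_map (f := fun u : EuclideanSpace ℝ (Fin d) => polyWeight d ‖u‖)
      (measurable_polyWeight.comp measurable_norm) (measurable_const_smul _)]
    refine lintegral_congr fun u => ?_
    rw [norm_smul, norm_inv, Real.norm_of_nonneg hε.le, div_eq_inv_mul]
  rw [← h2]
  change ∫⁻ u, polyWeight d ‖u‖ ∂(Measure.map (ε⁻¹ • ·) _) = _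
  rw [h, lintegral_smul_measure, smul_eq_mul]
  congr 2
  rw [finrank_euclideanSpace_fin, inv_pow, inv_inv, abs_of_nonneg (by positivity)]

variable {σ : Measure (EuclideanSpace ℝ (Fin d))}

lemma IsSphereMeasure.exists_weight_bound_sphere (hd : 2 ≤ d) (hσ : IsSphereMeasure σ) :
    ∃ C : ℝ≥0, ∀ z : EuclideanSpace ℝ (Fin d), ‖z‖ = 1 → ∀ ε : ℝ, 0 < ε → ε ≤ 1 →
      ∫⁻ x, polyWeight d (‖x - z‖ / ε) ∂σ ≤ C * ENNReal.ofReal (ε ^ (d - 1)) := by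
  have := hσ.finite
  have : NeZero d := ⟨by omega⟩
  have : Nontrivial (EuclideanSpace ℝ (Fin d)) := Module.nontrivial_of_finrank_pos (R := ℝ)
    (by rw [finrank_euclideanSpace_fin]; omega)
  set V := (volume : Measure (EuclideanSpace ℝ (Fin d))) (Metric.ball 0 1) with hV
  have hV0 : V ≠ 0 := (Metric.measure_ball_pos _ _ one_pos).ne'
  have hVt : V ≠ ∞ := measure_ball_lt_top.ne
  set K := ∫⁻ u : EuclideanSpace ℝ (Fin d), polyWeight d ‖u‖ with hK
  have hKt : K ≠ ∞ := lintegral_polyWeight_lt_top.ne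
  set D : ℝ≥0∞ := V⁻¹ * (2 ^ (d + 1) * (σ Set.univ * K)) with hD
  have hDt : D ≠ ∞ := by
    have := measure_ne_top σ Set.univ
    have : V⁻¹ ≠ ∞ := ENNReal.inv_ne_top.2 hV0
    finiteness
  refine ⟨D.toNNReal, fun z hz ε hε hε1 => ?_⟩
  rw [ENNReal.coe_toNNReal hDt]
  set Φ : EuclideanSpace ℝ (Fin d) → ℝ≥0∞ := fun z => ∫⁻ x, polyWeight d (‖x - z‖ / ε) ∂σ with hΦ
  have hmeas : Measurable fun u : ℝ => polyWeight d (u / ε) :=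
    measurable_polyWeight.comp (by fun_prop)
  set A : Set (EuclideanSpace ℝ (Fin d)) := Metric.ball 0 (1 + ε) \ Metric.ball 0 1 with hA
  have hAm : MeasurableSet A := Metric.isOpen_ball.measurableSet.diff Metric.isOpen_ball.measurableSet
  have hvolA : ENNReal.ofReal ε * V ≤ volume A := by
    rw [hA, measure_sdiff (Metric.ball_subset_ball (by linarith))
      Metric.isOpen_ball.measurableSet.nullMeasurableSet hVt,
      Measure.addHaar_ball _ _ (by linarith : (0 : ℝ) ≤ 1 + ε), finrank_euclideanSpace_fin]
    refine ENNReal.le_sub_of_add_le_right hVt ?_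
    rw [← hV]
    nth_rewrite 2 [← one_mul V]
    rw [← add_mul, ← ENNReal.ofReal_one, ← ENNReal.ofReal_add hε.le zero_le_one]
    gcongr
    have := one_add_mul_le_pow (show (-2 : ℝ) ≤ ε by linarith) d
    have h2 : (2 : ℝ) ≤ d := by exact_mod_cast hd
    nlinarith
  have hcmp : ∀ u ∈ A, Φ z ≤ 2 ^ (d + 1) * Φ u := by
    intro u hu
    simp only [hA, Set.mem_sdiff, Metric.mem_ball, dist_zero_right, not_lt] at hu
    have hu0 : 0 < ‖u‖ := by linarith
    set z' := ‖u‖⁻¹ • u with hz'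
    have hz1 : ‖z'‖ = 1 := by
      rw [hz', norm_smul, norm_inv, norm_norm, inv_mul_cancel₀ hu0.ne']
    have hzu : ‖u - z'‖ ≤ ε := by
      have : u - z' = (1 - ‖u‖⁻¹) • u := by rw [hz', sub_smul, one_smul]
      rw [this, norm_smul, Real.norm_of_nonneg (sub_nonneg.2 (inv_le_one_of_one_le₀ hu.2)), sub_mul,
        inv_mul_cancel₀ hu0.ne']
      linarith
    have h1 : Φ z = Φ z' := hσ.lintegral_eq_of_norm_eq (by rw [hz, hz1]) hmeas
    rw [h1, hΦ]
    simp only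
    rw [← lintegral_const_mul _ (by exact hmeas.comp (by fun_prop))]
    refine lintegral_mono fun x => polyWeight_le_mul (by positivity) ?_
    have h3 : ‖x - u‖ ≤ ‖x - z'‖ + ε := by
      calc ‖x - u‖ = ‖(x - z') - (u - z')‖ := by congr 1; abel
        _ ≤ _ := (norm_sub_le _ _).trans (by gcongr)
    have h4 : ‖x - u‖ / ε ≤ ‖x - z'‖ / ε + 1 := by
      rw [div_le_iff₀ hε, add_mul, div_mul_cancel₀ _ hε.ne']; linarith
    have : 0 ≤ ‖x - z'‖ / ε := by positivity
    linarith
  have hmain : ENNReal.ofReal ε * V * Φ z ≤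
      2 ^ (d + 1) * (σ Set.univ * (ENNReal.ofReal (ε ^ d) * K)) := by
    have hjoint : Measurable fun q : EuclideanSpace ℝ (Fin d) × EuclideanSpace ℝ (Fin d) =>
        polyWeight d (‖q.2 - q.1‖ / ε) := hmeas.comp (by fun_prop)
    calc ENNReal.ofReal ε * V * Φ z ≤ volume A * Φ z := by gcongr
      _ = ∫⁻ u in A, Φ z := by rw [setLIntegral_const, mul_comm]
      _ ≤ ∫⁻ u in A, 2 ^ (d + 1) * Φ u := setLIntegral_mono' hAm hcmp
      _ ≤ ∫⁻ u, 2 ^ (d + 1) * Φ u := setLIntegral_le_lintegral _ _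
      _ = 2 ^ (d + 1) * ∫⁻ u, Φ u := lintegral_const_mul' _ _ (by finiteness)
      _ = 2 ^ (d + 1) * ∫⁻ x, (∫⁻ u, polyWeight d (‖x - u‖ / ε)) ∂σ := by
          rw [hΦ, lintegral_lintegral_swap hjoint.aemeasurable]
      _ = _ := by
          simp_rw [lintegral_polyWeight_scaled hε]
          rw [lintegral_const, mul_comm (σ Set.univ)]
  have hε0 : ENNReal.ofReal ε ≠ 0 := by simpa using hε
  have hpow : ENNReal.ofReal (ε ^ d) = ENNReal.ofReal ε * ENNReal.ofReal (ε ^ (d - 1)) := by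
    rw [← ENNReal.ofReal_mul hε.le, ← pow_succ', Nat.sub_add_cancel (by omega)]
  calc Φ z = (ENNReal.ofReal ε * V)⁻¹ * (ENNReal.ofReal ε * V * Φ z) := by
        rw [← mul_assoc, ENNReal.inv_mul_cancel (mul_ne_zero hε0 hV0) (by finiteness), one_mul]
    _ ≤ (ENNReal.ofReal ε * V)⁻¹ * (2 ^ (d + 1) * (σ Set.univ * (ENNReal.ofReal (ε ^ d) * K))) := by
        gcongr
    _ = ((ENNReal.ofReal ε)⁻¹ * ENNReal.ofReal ε) * (D * ENNReal.ofReal (ε ^ (d - 1))) := by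
        rw [ENNReal.mul_inv (Or.inl hε0) (Or.inr hV0), hpow, hD]; ring
    _ = _ := by rw [ENNReal.inv_mul_cancel hε0 (by simp), one_mul]

lemma IsSphereMeasure.exists_weight_bound (hd : 2 ≤ d) (hσ : IsSphereMeasure σ) :
    ∃ C : ℝ≥0, ∀ z : EuclideanSpace ℝ (Fin d), ∀ ε : ℝ, 0 < ε → ε ≤ 1 →
      ∫⁻ x, polyWeight d (‖x - z‖ / ε) ∂σ ≤ C * ENNReal.ofReal (ε ^ (d - 1)) := by
  obtain ⟨C, hC⟩ := hσ.exists_weight_bound_sphere hd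
  have : Nontrivial (EuclideanSpace ℝ (Fin d)) := Module.nontrivial_of_finrank_pos (R := ℝ)
    (by rw [finrank_euclideanSpace_fin]; omega)
  refine ⟨2 ^ (d + 1) * C, fun z ε hε hε1 => ?_⟩
  have hz : ∃ z' : EuclideanSpace ℝ (Fin d), ‖z'‖ = 1 ∧ ∀ x : EuclideanSpace ℝ (Fin d), ‖x‖ = 1 →
      ‖x - z'‖ ≤ 2 * ‖x - z‖ := by
    rcases eq_or_ne z 0 with rfl | hz0
    · obtain ⟨e, he⟩ := exists_norm_eq (EuclideanSpace ℝ (Fin d)) (zero_le_one' ℝ)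
      refine ⟨e, he, fun x hx => ?_⟩
      rw [sub_zero, hx]
      exact (norm_sub_le _ _).trans (by rw [hx, he]; norm_num)
    · have hz0' : 0 < ‖z‖ := norm_pos_iff.2 hz0
      refine ⟨‖z‖⁻¹ • z, by rw [norm_smul, norm_inv, norm_norm, inv_mul_cancel₀ hz0'.ne'],
        fun x hx => ?_⟩
      have h1 : ‖z - ‖z‖⁻¹ • z‖ = |‖z‖ - 1| := by
        have : z - ‖z‖⁻¹ • z = (1 - ‖z‖⁻¹) • z := by rw [sub_smul, one_smul]
        rw [this, norm_smul, Real.norm_eq_abs]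
        nth_rewrite 2 [← abs_norm z]
        rw [← abs_mul, sub_mul, inv_mul_cancel₀ hz0'.ne', one_mul]
      have h2 : |‖z‖ - 1| ≤ ‖x - z‖ := by
        rw [← hx, norm_sub_rev x z]; exact abs_norm_sub_norm_le z x
      calc ‖x - ‖z‖⁻¹ • z‖ = ‖(x - z) + (z - ‖z‖⁻¹ • z)‖ := by congr 1; abel
        _ ≤ _ := (norm_add_le _ _).trans (by rw [h1]; linarith)
  obtain ⟨z', hz1, hz2⟩ := hz
  calc ∫⁻ x, polyWeight d (‖x - z‖ / ε) ∂σ ≤ ∫⁻ x, 2 ^ (d + 1) * polyWeight d (‖x - z'‖ / ε) ∂σ := by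
        refine lintegral_mono_ae ?_
        filter_upwards [hσ.carried] with x hx
        refine polyWeight_le_mul (by positivity) ?_
        have : ‖x - z'‖ / ε ≤ 2 * (‖x - z‖ / ε) := by
          rw [← mul_div_assoc]; gcongr; exact hz2 x hx
        linarith
    _ = 2 ^ (d + 1) * ∫⁻ x, polyWeight d (‖x - z'‖ / ε) ∂σ := lintegral_const_mul' _ _ (by finiteness)
    _ ≤ 2 ^ (d + 1) * (C * ENNReal.ofReal (ε ^ (d - 1))) := by gcongr; exact hC z' hz1 ε hε hε1
    _ = _ := by push_cast; ring

end SphereWeight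

section LintegralCauchySchwarz

lemma lintegral_mul_sq_le {X : Type*} [MeasurableSpace X] {μ : Measure X} {w f : X → ℝ≥0∞}
    (hw : AEMeasurable w μ) (hf : AEMeasurable f μ) :
    (∫⁻ x, w x * f x ∂μ) ^ 2 ≤ (∫⁻ x, w x ∂μ) * ∫⁻ x, w x * f x ^ 2 ∂μ := by
  have h2 : Real.HolderConjugate 2 2 := Real.HolderConjugate.two_two
  have hsq : ∀ u : ℝ≥0∞, (u ^ (1 / 2 : ℝ)) ^ (2 : ℝ) = u := fun u => by
    rw [← ENNReal.rpow_mul]; norm_num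
  have hsq2 : ∀ u : ℝ≥0∞, (u ^ (1 / 2 : ℝ)) ^ 2 = u := fun u => by
    rw [← ENNReal.rpow_natCast]; exact hsq u
  have h := ENNReal.lintegral_mul_le_Lp_mul_Lq μ h2 (hw.pow_const (1 / 2 : ℝ))
    ((hw.pow_const (1 / 2 : ℝ)).mul hf)
  simp only [Pi.mul_apply, hsq] at h
  have e1 : ∀ x, w x ^ (1 / 2 : ℝ) * (w x ^ (1 / 2 : ℝ) * f x) = w x * f x := fun x => by
    rw [← mul_assoc, ← sq, hsq2]
  have e2 : ∀ x, (w x ^ (1 / 2 : ℝ) * f x) ^ (2 : ℝ) = w x * f x ^ 2 := fun x => by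
    rw [ENNReal.mul_rpow_of_nonneg _ _ (by norm_num), hsq]; norm_cast
  simp only [e1, e2] at h
  calc _ ≤ ((∫⁻ x, w x ∂μ) ^ (1 / 2 : ℝ) * (∫⁻ x, w x * f x ^ 2 ∂μ) ^ (1 / 2 : ℝ)) ^ 2 := by
        gcongr
    _ = _ := by rw [mul_pow, hsq2, hsq2]

end LintegralCauchySchwarz

section SphereFourier

open scoped RealInnerProductSpace

variable {d : ℕ} {σ : Measure (EuclideanSpace ℝ (Fin d))}

/-- The Fourier transform of a measure on Euclidean space. -/
def sphFT (σ : Measure (EuclideanSpace ℝ (Fin d))) (ξ : EuclideanSpace ℝ (Fin d)) : ℂ :=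
  ∫ x, eC ⟪x, ξ⟫ ∂σ

lemma continuous_eC_inner (ξ : EuclideanSpace ℝ (Fin d)) :
    Continuous fun x : EuclideanSpace ℝ (Fin d) => eC ⟪x, ξ⟫ :=
  continuous_eC.comp (by fun_prop)

lemma integrable_eC_comp {X : Type*} [MeasurableSpace X] {μ : Measure X} [IsFiniteMeasure μ]
    {g : X → ℝ} (hg : Measurable g) : Integrable (fun x => eC (g x)) μ :=
  Integrable.of_bound (continuous_eC.measurable.comp hg).aestronglyMeasurable 1
    (Filter.Eventually.of_forall fun x => by rw [norm_eC])

lemma norm_sphFT_le [IsFiniteMeasure σ] (ξ : EuclideanSpace ℝ (Fin d)) :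
    ‖sphFT σ ξ‖ ≤ σ.real Set.univ := by
  have := norm_integral_le_of_norm_le_const (μ := σ) (C := 1)
    (Filter.Eventually.of_forall fun x => (norm_eC ⟪x, ξ⟫).le)
  simpa [sphFT] using this

lemma continuous_sphFT [IsFiniteMeasure σ] : Continuous (sphFT σ) := by
  refine continuous_of_dominated (bound := fun _ => 1)
    (fun ξ => (continuous_eC_inner ξ).aestronglyMeasurable)
    (fun ξ => Filter.Eventually.of_forall fun x => (norm_eC _).le) (integrable_const 1)
    (Filter.Eventually.of_forall fun x => ?_)
  exact continuous_eC.comp (by fun_prop)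

lemma norm_eC_sub_one_le (t : ℝ) : ‖eC t - 1‖ ≤ 2 * Real.pi * |t| := by
  have h := Real.norm_exp_I_mul_ofReal_sub_one_le (x := 2 * Real.pi * t)
  have e : eC t = Complex.exp (Complex.I * ((2 * Real.pi * t : ℝ) : ℂ)) := by
    rw [eC]; congr 1; push_cast; ring
  rw [e]
  refine h.trans ?_
  rw [Real.norm_eq_abs, abs_mul, abs_of_pos (by positivity)]

lemma IsSphereMeasure.norm_sphFT_sub_le (hσ : IsSphereMeasure σ) (ξ : EuclideanSpace ℝ (Fin d)) :
    ‖sphFT σ ξ - sphFT σ 0‖ ≤ 2 * Real.pi * σ.real Set.univ * ‖ξ‖ := by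
  have := hσ.finite
  have h0 : sphFT σ ξ - sphFT σ 0 = ∫ x, (eC ⟪x, ξ⟫ - 1) ∂σ := by
    rw [integral_sub (integrable_eC_comp (by fun_prop)) (integrable_const _)]
    simp [sphFT, eC_zero]
  rw [h0]
  refine (norm_integral_le_of_norm_le_const (C := 2 * Real.pi * ‖ξ‖) ?_).trans (by nlinarith)
  filter_upwards [hσ.carried] with x hx
  refine (norm_eC_sub_one_le _).trans ?_
  gcongr
  simpa [hx] using abs_real_inner_le_norm x ξ

lemma IsSphereMeasure.sphFT_eq_of_norm_eq (hσ : IsSphereMeasure σ)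
    {z z' : EuclideanSpace ℝ (Fin d)} (h : ‖z‖ = ‖z'‖) : sphFT σ z = sphFT σ z' := by
  set e := (Submodule.span ℝ {z' - z})ᗮ.reflection with he
  have hez : e z' = z := Submodule.reflection_sub h.symm
  conv_lhs => rw [sphFT, ← hσ.invariant e]
  rw [integral_map e.continuous.measurable.aemeasurable
    (continuous_eC_inner z).aestronglyMeasurable, sphFT]
  refine integral_congr_ae (Filter.Eventually.of_forall fun x => ?_)
  simp only
  rw [← hez, e.inner_map_map]

lemma integral_gaussian_mul_eC {b : ℝ} (hb : 0 < b) (w : EuclideanSpace ℝ (Fin d)) :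
    ∫ v : EuclideanSpace ℝ (Fin d), (Real.exp (-b * ‖v‖ ^ 2) : ℂ) * eC ⟪w, v⟫ =
      (((Real.pi / b) ^ (d / 2 : ℝ) * Real.exp (-(Real.pi ^ 2 * ‖w‖ ^ 2 / b)) : ℝ) : ℂ) := by
  have h := GaussianFourier.integral_cexp_neg_mul_sq_norm_add (b := (b : ℂ)) (by simpa using hb)
    (2 * Real.pi * Complex.I) w
  have e : ∀ v : EuclideanSpace ℝ (Fin d), (Real.exp (-b * ‖v‖ ^ 2) : ℂ) * eC ⟪w, v⟫ =
      Complex.exp (-(b : ℂ) * ‖v‖ ^ 2 + 2 * Real.pi * Complex.I * ⟪w, v⟫) := fun v => by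
    rw [Complex.exp_add, eC]; push_cast; rfl
  simp_rw [e]
  rw [h, finrank_euclideanSpace_fin]
  push_cast
  rw [Complex.ofReal_cpow (by positivity)]
  push_cast
  congr 2
  have : (b : ℂ) ≠ 0 := by exact_mod_cast hb.ne'
  field_simp
  rw [Complex.I_sq]; ring

lemma integrable_gaussian {b : ℝ} (hb : 0 < b) :
    Integrable fun v : EuclideanSpace ℝ (Fin d) => Real.exp (-b * ‖v‖ ^ 2) := by
  have h := GaussianFourier.integrable_cexp_neg_mul_sq_norm_add (b := (b : ℂ)) (by simpa using hb)
    0 (0 : EuclideanSpace ℝ (Fin d))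
  refine h.norm.congr (Filter.Eventually.of_forall fun v => ?_)
  simp only [zero_mul, add_zero, Complex.norm_exp]
  congr 1
  norm_cast

lemma IsSphereMeasure.sphFT_eq_integral (hσ : IsSphereMeasure σ) (ξ : EuclideanSpace ℝ (Fin d)) :
    (Real.exp (-Real.pi) : ℂ) * sphFT σ ξ =
      ∫ η : EuclideanSpace ℝ (Fin d), (Real.exp (-Real.pi * ‖η - ξ‖ ^ 2) : ℂ) * sphFT σ η := by
  have := hσ.finite
  have h1 : (Real.exp (-Real.pi) : ℂ) * sphFT σ ξ =
      ∫ x, (∫ η : EuclideanSpace ℝ (Fin d),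
        (Real.exp (-Real.pi * ‖η‖ ^ 2) : ℂ) * eC ⟪x, η + ξ⟫) ∂σ := by
    rw [sphFT, ← integral_const_mul]
    refine integral_congr_ae ?_
    filter_upwards [hσ.carried] with x hx
    have : ∀ η : EuclideanSpace ℝ (Fin d), (Real.exp (-Real.pi * ‖η‖ ^ 2) : ℂ) * eC ⟪x, η + ξ⟫ =
        (Real.exp (-Real.pi * ‖η‖ ^ 2) : ℂ) * eC ⟪x, η⟫ * eC ⟪x, ξ⟫ := fun η => by
      rw [inner_add_right, eC_add, mul_assoc]
    simp_rw [this]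
    rw [integral_mul_const, integral_gaussian_mul_eC Real.pi_pos, hx]
    congr 2
    rw [div_self Real.pi_ne_zero, Real.one_rpow, one_mul]
    congr 1
    field_simp
  rw [h1, integral_integral_swap]
  · rw [← integral_sub_right_eq_self (fun η => ∫ x, (Real.exp (-Real.pi * ‖η‖ ^ 2) : ℂ) *
      eC ⟪x, η + ξ⟫ ∂σ) ξ]
    refine integral_congr_ae (Filter.Eventually.of_forall fun η => ?_)
    simp only [sub_add_cancel]
    rw [integral_const_mul, sphFT]
  · have hg : Integrable (fun q : EuclideanSpace ℝ (Fin d) × EuclideanSpace ℝ (Fin d) =>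
        (Real.exp (-Real.pi * ‖q.2‖ ^ 2) : ℂ)) (σ.prod volume) := by
      simpa using (integrable_const (1 : ℂ) (μ := σ)).mul_prod
        (integrable_gaussian (d := d) Real.pi_pos).ofReal
    refine hg.mul_bdd (c := 1) ?_ (Filter.Eventually.of_forall fun q => (norm_eC _).le)
    exact (continuous_eC.comp (by fun_prop)).aestronglyMeasurable

lemma IsSphereMeasure.enorm_sphFT_sq_le (hσ : IsSphereMeasure σ) (ξ : EuclideanSpace ℝ (Fin d)) :
    ‖sphFT σ ξ‖ₑ ^ 2 ≤ ENNReal.ofReal (Real.exp (2 * Real.pi)) *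
      ∫⁻ η : EuclideanSpace ℝ (Fin d),
        ENNReal.ofReal (Real.exp (-Real.pi * ‖η - ξ‖ ^ 2)) * ‖sphFT σ η‖ₑ ^ 2 := by
  have := hσ.finite
  set W : EuclideanSpace ℝ (Fin d) → ℝ≥0∞ :=
    fun η => ENNReal.ofReal (Real.exp (-Real.pi * ‖η - ξ‖ ^ 2)) with hW
  have hW1 : ∫⁻ η, W η = 1 := by
    rw [hW, lintegral_sub_right_eq_self (fun η : EuclideanSpace ℝ (Fin d) =>
      ENNReal.ofReal (Real.exp (-Real.pi * ‖η‖ ^ 2))) ξ,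
      ← ofReal_integral_eq_lintegral_ofReal (integrable_gaussian Real.pi_pos)
        (Filter.Eventually.of_forall fun _ => (Real.exp_pos _).le),
      GaussianFourier.integral_rexp_neg_mul_sq_norm Real.pi_pos, div_self Real.pi_ne_zero,
      Real.one_rpow, ENNReal.ofReal_one]
  have h1 : ENNReal.ofReal (Real.exp (-Real.pi)) * ‖sphFT σ ξ‖ₑ ≤ ∫⁻ η, W η * ‖sphFT σ η‖ₑ := by
    have h := congrArg (fun z : ℂ => ‖z‖ₑ) (hσ.sphFT_eq_integral ξ)
    simp only [enorm_mul] at h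
    have he : ∀ t : ℝ, ‖(Real.exp t : ℂ)‖ₑ = ENNReal.ofReal (Real.exp t) := fun t => by
      rw [← ofReal_norm, Complex.norm_real, Real.norm_of_nonneg (Real.exp_pos _).le]
    rw [he] at h
    rw [h]
    refine (enorm_integral_le_lintegral_enorm _).trans (le_of_eq (lintegral_congr fun η => ?_))
    rw [enorm_mul, he]
  have hm : Measurable W := by
    rw [hW]; fun_prop
  have h2 := lintegral_mul_sq_le (μ := volume) hm.aemeasurable
    (continuous_sphFT (σ := σ)).enorm.measurable.aemeasurable
  rw [hW1, one_mul] at h2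
  calc ‖sphFT σ ξ‖ₑ ^ 2 = ENNReal.ofReal (Real.exp (2 * Real.pi)) *
        (ENNReal.ofReal (Real.exp (-Real.pi)) * ‖sphFT σ ξ‖ₑ) ^ 2 := by
        rw [mul_pow, ← mul_assoc, ← ENNReal.ofReal_pow (Real.exp_pos _).le,
          ← ENNReal.ofReal_mul (Real.exp_pos _).le, ← Real.exp_nat_mul, ← Real.exp_add]
        norm_num
    _ ≤ _ := by gcongr; exact (pow_le_pow_left' h1 2).trans h2

lemma lintegral_gaussian_sphFT_sq [IsFiniteMeasure σ] {b : ℝ} (hb : 0 < b) :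
    ∫⁻ η : EuclideanSpace ℝ (Fin d), ENNReal.ofReal (Real.exp (-b * ‖η‖ ^ 2)) * ‖sphFT σ η‖ₑ ^ 2 =
      ∫⁻ y, ∫⁻ x, ENNReal.ofReal ((Real.pi / b) ^ (d / 2 : ℝ) *
        Real.exp (-(Real.pi ^ 2 * ‖x - y‖ ^ 2 / b))) ∂σ ∂σ := by
  have hint : Integrable fun η : EuclideanSpace ℝ (Fin d) =>
      Real.exp (-b * ‖η‖ ^ 2) * ‖sphFT σ η‖ ^ 2 := by
    refine (integrable_gaussian hb).mul_bdd (c := (σ.real Set.univ) ^ 2)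
      (continuous_sphFT.norm.pow 2).aestronglyMeasurable (Filter.Eventually.of_forall fun η => ?_)
    rw [norm_pow, norm_norm]
    gcongr
    exact norm_sphFT_le η
  have e1 : ∀ η : EuclideanSpace ℝ (Fin d),
      ENNReal.ofReal (Real.exp (-b * ‖η‖ ^ 2)) * ‖sphFT σ η‖ₑ ^ 2 =
        ENNReal.ofReal (Real.exp (-b * ‖η‖ ^ 2) * ‖sphFT σ η‖ ^ 2) := fun η => by
    rw [ENNReal.ofReal_mul (Real.exp_pos _).le, ENNReal.ofReal_pow (norm_nonneg _),
      ofReal_norm]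
  simp_rw [e1]
  rw [← ofReal_integral_eq_lintegral_ofReal hint
    (Filter.Eventually.of_forall fun _ => by positivity)]
  set H : EuclideanSpace ℝ (Fin d) → EuclideanSpace ℝ (Fin d) → ℝ := fun y x =>
    (Real.pi / b) ^ (d / 2 : ℝ) * Real.exp (-(Real.pi ^ 2 * ‖x - y‖ ^ 2 / b)) with hH
  have hHc : Continuous fun q : EuclideanSpace ℝ (Fin d) × EuclideanSpace ℝ (Fin d) =>
      H q.2 q.1 := by rw [hH]; fun_prop
  have hH0 : ∀ y x, 0 ≤ H y x := fun y x => by positivity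
  have hHint : Integrable (fun q : EuclideanSpace ℝ (Fin d) × EuclideanSpace ℝ (Fin d) =>
      H q.2 q.1) (σ.prod σ) := by
    refine Integrable.of_bound hHc.aestronglyMeasurable ((Real.pi / b) ^ (d / 2 : ℝ))
      (Filter.Eventually.of_forall fun q => ?_)
    rw [Real.norm_of_nonneg (hH0 _ _), hH]
    refine mul_le_of_le_one_right (by positivity) (Real.exp_le_one_iff.2 ?_)
    rw [Left.neg_nonpos_iff]; positivity
  have key : ∫ η : EuclideanSpace ℝ (Fin d), Real.exp (-b * ‖η‖ ^ 2) * ‖sphFT σ η‖ ^ 2 =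
      ∫ q, H q.2 q.1 ∂(σ.prod σ) := by
    have hc : ∀ t, (starRingEnd ℂ) (eC t) = eC (-t) := fun t => by
      rw [eC, ← Complex.exp_conj, eC]
      simp only [map_mul, Complex.conj_I, Complex.conj_ofReal, map_ofNat]
      congr 1; push_cast; ring
    have h1 : ∀ η : EuclideanSpace ℝ (Fin d),
        ((Real.exp (-b * ‖η‖ ^ 2) * ‖sphFT σ η‖ ^ 2 : ℝ) : ℂ) =
        ∫ q, (Real.exp (-b * ‖η‖ ^ 2) : ℂ) * eC ⟪q.1 - q.2, η⟫ ∂(σ.prod σ) := fun η => by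
      rw [integral_const_mul]
      push_cast
      rw [← Complex.mul_conj']
      congr 1
      rw [sphFT, ← integral_conj, ← integral_prod_mul]
      refine integral_congr_ae (Filter.Eventually.of_forall fun q => ?_)
      simp only
      rw [hc, ← eC_add, inner_sub_left, sub_eq_add_neg]
    have h2 : ((∫ η : EuclideanSpace ℝ (Fin d), Real.exp (-b * ‖η‖ ^ 2) * ‖sphFT σ η‖ ^ 2 : ℝ) : ℂ)
        = ((∫ q, H q.2 q.1 ∂(σ.prod σ) : ℝ) : ℂ) := by
      rw [← integral_complex_ofReal, ← integral_complex_ofReal]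
      simp_rw [h1]
      rw [integral_integral_swap]
      · simp_rw [integral_gaussian_mul_eC hb]
        rfl
      · have hg : Integrable (fun q : EuclideanSpace ℝ (Fin d) ×
            (EuclideanSpace ℝ (Fin d) × EuclideanSpace ℝ (Fin d)) =>
            (Real.exp (-b * ‖q.1‖ ^ 2) : ℂ)) (volume.prod (σ.prod σ)) := by
          simpa using (integrable_gaussian (d := d) hb).ofReal.mul_prod
            (integrable_const (1 : ℂ) (μ := σ.prod σ))
        refine hg.mul_bdd (c := 1) ?_ (Filter.Eventually.of_forall fun q => (norm_eC _).le)
        exact (continuous_eC.comp (by fun_prop)).aestronglyMeasurable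
    exact_mod_cast h2
  rw [key, ofReal_integral_eq_lintegral_ofReal hHint (Filter.Eventually.of_forall fun q => hH0 _ _),
    lintegral_prod_symm _ (by fun_prop)]

end SphereFourier

section SphereDecay

open scoped RealInnerProductSpace

variable {d : ℕ} {σ : Measure (EuclideanSpace ℝ (Fin d))}

lemma exists_exp_neg_sq_le_polyWeight (d : ℕ) : ∃ K : ℝ≥0, ∀ c : ℝ, 1 ≤ c → ∀ u : ℝ, 0 ≤ u →
    ENNReal.ofReal (Real.exp (-(c * u ^ 2))) ≤ K * polyWeight d u := by
  set m : ℝ := d + 1 with hm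
  have hm0 : 0 < m := by positivity
  refine ⟨((2 + m) ^ m).toNNReal, fun c hc u hu => ?_⟩
  rw [← ENNReal.ofReal_coe_nnreal, polyWeight, Real.coe_toNNReal _ (by positivity),
    ← ENNReal.ofReal_mul (by positivity)]
  refine ENNReal.ofReal_le_ofReal ?_
  have h1 : 1 + u ≤ (2 + m) * (1 + u ^ 2 / m) := by
    have : (2 + m) * (1 + u ^ 2 / m) = 2 + m + 2 * (u ^ 2 / m) + u ^ 2 := by field_simp; ring
    rw [this]
    have : 0 ≤ u ^ 2 / m := by positivity
    nlinarith [sq_nonneg (u - 1)]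
  have h2 : (1 + u) ^ m ≤ (2 + m) ^ m * Real.exp (u ^ 2) := by
    calc (1 + u) ^ m ≤ ((2 + m) * Real.exp (u ^ 2 / m)) ^ m := by
          refine Real.rpow_le_rpow (by positivity) (h1.trans ?_) hm0.le
          gcongr
          linarith [Real.add_one_le_exp (u ^ 2 / m)]
      _ = _ := by
          rw [Real.mul_rpow (by positivity) (Real.exp_pos _).le, ← Real.exp_mul,
            div_mul_cancel₀ _ hm0.ne']
  rw [Real.rpow_neg (by positivity), ← div_eq_mul_inv, le_div_iff₀ (by positivity)]
  calc Real.exp (-(c * u ^ 2)) * (1 + u) ^ m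
      ≤ Real.exp (-(u ^ 2)) * ((2 + m) ^ m * Real.exp (u ^ 2)) := by
        gcongr; nlinarith [sq_nonneg u]
    _ = (2 + m) ^ m * (Real.exp (-(u ^ 2)) * Real.exp (u ^ 2)) := by ring
    _ = _ := by rw [← Real.exp_add]; simp

lemma IsSphereMeasure.exists_decay_sq (hd : 2 ≤ d) (hσ : IsSphereMeasure σ) :
    ∃ C : ℝ≥0, ∀ ξ : EuclideanSpace ℝ (Fin d), 1 ≤ ‖ξ‖ →
      ‖sphFT σ ξ‖ₑ ^ 2 ≤ C * ENNReal.ofReal (‖ξ‖⁻¹ ^ (d - 2)) := by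
  have := hσ.finite
  obtain ⟨K, hK⟩ := exists_exp_neg_sq_le_polyWeight d
  obtain ⟨C, hC⟩ := hσ.exists_weight_bound hd
  rcases eq_or_ne (σ Set.univ) 0 with h0 | h0
  · refine ⟨0, fun ξ _ => ?_⟩
    have : σ = 0 := Measure.measure_univ_eq_zero.1 h0
    simp [sphFT, this]
  have ht := measure_ne_top σ Set.univ
  set A : ℝ≥0∞ := ENNReal.ofReal (Real.exp (2 * Real.pi)) with hA
  set P : ℝ≥0∞ := ENNReal.ofReal (Real.exp (Real.pi / 2)) with hP
  set D : ℝ≥0∞ := A * (K * P * C) * (2 ^ d * K * C) with hD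
  have hDt : D ≠ ∞ := by rw [hD, hA, hP]; finiteness
  refine ⟨D.toNNReal, fun ξ hξ => ?_⟩
  rw [ENNReal.coe_toNNReal hDt]
  set s := ‖ξ‖ with hs
  have hs0 : 0 < s := by linarith
  have hsi : s⁻¹ ≤ 1 := inv_le_one_of_one_le₀ hξ
  set T : ℝ≥0∞ := ENNReal.ofReal (s⁻¹ ^ (d - 1)) with hT
  set b : ℝ := Real.pi / (4 * s ^ 2) with hb
  have hb0 : 0 < b := by positivity
  have hpt : ∀ η ω : EuclideanSpace ℝ (Fin d), ‖ω‖ = 1 →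
      ENNReal.ofReal (Real.exp (-Real.pi * ‖η - s • ω‖ ^ 2)) ≤
      K * P * ENNReal.ofReal (Real.exp (-b * ‖η‖ ^ 2)) * polyWeight d (‖ω - s⁻¹ • η‖ / s⁻¹) := by
    intro η ω hω
    have e : ‖ω - s⁻¹ • η‖ / s⁻¹ = ‖η - s • ω‖ := by
      rw [div_inv_eq_mul, mul_comm, ← Real.norm_of_nonneg hs0.le, ← norm_smul, Real.norm_of_nonneg hs0.le,
        smul_sub, smul_inv_smul₀ hs0.ne', norm_sub_rev]
    rw [e]
    set z := ‖η - s • ω‖ with hz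
    have hη : ‖η‖ ≤ z + s := by
      have := norm_add_le (η - s • ω) (s • ω)
      rwa [sub_add_cancel, norm_smul, hω, mul_one, Real.norm_of_nonneg hs0.le] at this
    have h2 : b * ‖η‖ ^ 2 ≤ Real.pi / 2 * z ^ 2 + Real.pi / 2 := by
      have h3 : ‖η‖ ^ 2 ≤ 2 * z ^ 2 + 2 * s ^ 2 := by
        nlinarith [norm_nonneg η, sq_nonneg (z - s), norm_nonneg (η - s • ω)]
      rw [hb, div_mul_eq_mul_div, div_le_iff₀ (by positivity)]
      have h4 : 0 ≤ z ^ 2 * (s ^ 2 - 1) := mul_nonneg (sq_nonneg _) (by nlinarith)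
      have := Real.pi_pos
      nlinarith
    calc ENNReal.ofReal (Real.exp (-Real.pi * z ^ 2))
        ≤ ENNReal.ofReal (Real.exp (Real.pi / 2) * Real.exp (-b * ‖η‖ ^ 2) *
            Real.exp (-(Real.pi / 2 * z ^ 2))) := by
          rw [← Real.exp_add, ← Real.exp_add]
          gcongr
          linarith
      _ = P * ENNReal.ofReal (Real.exp (-b * ‖η‖ ^ 2)) *
            ENNReal.ofReal (Real.exp (-(Real.pi / 2 * z ^ 2))) := by
          rw [ENNReal.ofReal_mul (by positivity), ENNReal.ofReal_mul (by positivity)]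
      _ ≤ P * ENNReal.ofReal (Real.exp (-b * ‖η‖ ^ 2)) * (K * polyWeight d z) := by
          gcongr
          exact hK _ (by linarith [Real.pi_gt_three]) _ (norm_nonneg _)
      _ = _ := by ring
  have hinner : ∀ η : EuclideanSpace ℝ (Fin d),
      ∫⁻ ω, ENNReal.ofReal (Real.exp (-Real.pi * ‖η - s • ω‖ ^ 2)) ∂σ ≤
        K * P * C * T * ENNReal.ofReal (Real.exp (-b * ‖η‖ ^ 2)) := fun η => by
    calc _ ≤ ∫⁻ ω, K * P * ENNReal.ofReal (Real.exp (-b * ‖η‖ ^ 2)) *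
          polyWeight d (‖ω - s⁻¹ • η‖ / s⁻¹) ∂σ := by
          refine lintegral_mono_ae ?_
          filter_upwards [hσ.carried] with ω hω using hpt η ω hω
      _ = K * P * ENNReal.ofReal (Real.exp (-b * ‖η‖ ^ 2)) *
          ∫⁻ ω, polyWeight d (‖ω - s⁻¹ • η‖ / s⁻¹) ∂σ :=
          lintegral_const_mul' _ _ (by finiteness)
      _ ≤ K * P * ENNReal.ofReal (Real.exp (-b * ‖η‖ ^ 2)) * (C * T) := by
          gcongr; exact hC _ _ (by positivity) hsi
      _ = _ := by ring
  have hgauss : ∫⁻ η : EuclideanSpace ℝ (Fin d),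
      ENNReal.ofReal (Real.exp (-b * ‖η‖ ^ 2)) * ‖sphFT σ η‖ₑ ^ 2 ≤
      2 ^ d * K * C * ENNReal.ofReal (s ^ d) * T * σ Set.univ := by
    rw [lintegral_gaussian_sphFT_sq hb0]
    have hpi : Real.pi / b = (2 * s) ^ 2 := by rw [hb]; field_simp; norm_num
    have hpw : (Real.pi / b) ^ (d / 2 : ℝ) = (2 * s) ^ d := by
      rw [hpi, ← Real.rpow_natCast (2 * s) 2, ← Real.rpow_mul (by positivity), ← Real.rpow_natCast]
      congr 1; push_cast; ring
    have hptw : ∀ x y : EuclideanSpace ℝ (Fin d), ENNReal.ofReal ((Real.pi / b) ^ (d / 2 : ℝ) *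
        Real.exp (-(Real.pi ^ 2 * ‖x - y‖ ^ 2 / b))) ≤
        2 ^ d * ENNReal.ofReal (s ^ d) * K * polyWeight d (‖x - y‖ / s⁻¹) := fun x y => by
      have e2 : Real.pi ^ 2 * ‖x - y‖ ^ 2 / b = (4 * Real.pi) * (‖x - y‖ / s⁻¹) ^ 2 := by
        rw [hb]; field_simp
      rw [hpw, e2, ENNReal.ofReal_mul (by positivity), mul_pow, ENNReal.ofReal_mul (by positivity),
        ENNReal.ofReal_pow (by norm_num), ENNReal.ofReal_ofNat, mul_assoc _ (K : ℝ≥0∞)]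
      gcongr
      exact hK _ (by linarith [Real.pi_gt_three]) _ (by positivity)
    calc _ ≤ ∫⁻ y, ∫⁻ x, 2 ^ d * ENNReal.ofReal (s ^ d) * K * polyWeight d (‖x - y‖ / s⁻¹) ∂σ ∂σ :=
          lintegral_mono fun y => lintegral_mono fun x => hptw x y
      _ ≤ ∫⁻ y, 2 ^ d * ENNReal.ofReal (s ^ d) * K * (C * T) ∂σ := by
          refine lintegral_mono fun y => ?_
          rw [lintegral_const_mul' _ _ (by finiteness)]
          gcongr; exact hC _ _ (by positivity) hsi
      _ = _ := by rw [lintegral_const]; ring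
  have hmain : ‖sphFT σ ξ‖ₑ ^ 2 * σ Set.univ ≤
      D * ENNReal.ofReal (s⁻¹ ^ (d - 2)) * σ Set.univ := by
    have hWc : Measurable fun q : EuclideanSpace ℝ (Fin d) × EuclideanSpace ℝ (Fin d) =>
        ENNReal.ofReal (Real.exp (-Real.pi * ‖q.2 - s • q.1‖ ^ 2)) * ‖sphFT σ q.2‖ₑ ^ 2 := by
      have := (continuous_sphFT (σ := σ)).measurable
      fun_prop
    calc ‖sphFT σ ξ‖ₑ ^ 2 * σ Set.univ = ∫⁻ _, ‖sphFT σ ξ‖ₑ ^ 2 ∂σ := by rw [lintegral_const]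
      _ ≤ ∫⁻ ω, A * (∫⁻ η : EuclideanSpace ℝ (Fin d),
          ENNReal.ofReal (Real.exp (-Real.pi * ‖η - s • ω‖ ^ 2)) * ‖sphFT σ η‖ₑ ^ 2) ∂σ := by
          refine lintegral_mono_ae ?_
          filter_upwards [hσ.carried] with ω hω
          rw [hσ.sphFT_eq_of_norm_eq (z := ξ) (z' := s • ω)
            (by rw [norm_smul, hω, mul_one, Real.norm_of_nonneg hs0.le])]
          exact hσ.enorm_sphFT_sq_le _
      _ = A * ∫⁻ ω, (∫⁻ η : EuclideanSpace ℝ (Fin d),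
          ENNReal.ofReal (Real.exp (-Real.pi * ‖η - s • ω‖ ^ 2)) * ‖sphFT σ η‖ₑ ^ 2) ∂σ :=
          lintegral_const_mul' A _ ENNReal.ofReal_ne_top
      _ = A * ∫⁻ η : EuclideanSpace ℝ (Fin d), (∫⁻ ω,
          ENNReal.ofReal (Real.exp (-Real.pi * ‖η - s • ω‖ ^ 2)) * ‖sphFT σ η‖ₑ ^ 2 ∂σ) := by
          rw [lintegral_lintegral_swap hWc.aemeasurable]
      _ ≤ A * ∫⁻ η : EuclideanSpace ℝ (Fin d), (K * P * C * T) *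
          (ENNReal.ofReal (Real.exp (-b * ‖η‖ ^ 2)) * ‖sphFT σ η‖ₑ ^ 2) := by
          gcongr with η
          rw [lintegral_mul_const' _ _ (by finiteness), ← mul_assoc]
          gcongr
          exact hinner η
      _ ≤ A * ((K * P * C * T) * (2 ^ d * K * C * ENNReal.ofReal (s ^ d) * T * σ Set.univ)) := by
          rw [lintegral_const_mul' _ _ (by finiteness)]
          gcongr
      _ = D * (T * ENNReal.ofReal (s ^ d) * T) * σ Set.univ := by rw [hD]; ring
      _ = _ := by
          congr 2
          rw [hT, ← ENNReal.ofReal_mul (by positivity), ← ENNReal.ofReal_mul (by positivity)]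
          congr 1
          obtain ⟨m, rfl⟩ := Nat.exists_eq_add_of_le hd
          have e1 : 2 + m - 1 = m + 1 := by omega
          have e2 : 2 + m - 2 = m := by omega
          rw [e1, e2]
          simp only [inv_pow]
          field_simp
          ring
  exact (ENNReal.mul_le_mul_iff_left h0 ht).1 hmain

theorem IsSphereMeasure.exists_decay (hd : 2 ≤ d) (hσ : IsSphereMeasure σ) :
    ∃ C : ℝ, 0 < C ∧ ∀ ξ : EuclideanSpace ℝ (Fin d),
      ‖sphFT σ ξ‖ ≤ C * (1 + ‖ξ‖) ^ (-(((d : ℝ) - 2) / 2)) := by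
  have := hσ.finite
  obtain ⟨C, hC⟩ := hσ.exists_decay_sq hd
  set a : ℝ := ((d : ℝ) - 2) / 2 with ha
  have ha0 : 0 ≤ a := by
    have : (2 : ℝ) ≤ d := by exact_mod_cast hd
    rw [ha]; linarith
  refine ⟨2 ^ a * (σ.real Set.univ + Real.sqrt C + 1), by positivity, fun ξ => ?_⟩
  have hrw : (2 : ℝ) ^ a * (1 + ‖ξ‖) ^ (-a) = (2 / (1 + ‖ξ‖)) ^ a := by
    rw [Real.div_rpow (by norm_num) (by positivity), Real.rpow_neg (by positivity)]; rfl
  have hgoal : 2 ^ a * (σ.real Set.univ + Real.sqrt C + 1) * (1 + ‖ξ‖) ^ (-a) =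
      (σ.real Set.univ + Real.sqrt C + 1) * (2 / (1 + ‖ξ‖)) ^ a := by rw [← hrw]; ring
  rw [hgoal]
  rcases le_total ‖ξ‖ 1 with h | h
  · have h1 : 1 ≤ (2 / (1 + ‖ξ‖)) ^ a := by
      refine Real.one_le_rpow ?_ ha0
      rw [le_div_iff₀ (by positivity)]; linarith
    calc _ ≤ σ.real Set.univ := norm_sphFT_le ξ
      _ ≤ (σ.real Set.univ + Real.sqrt C + 1) * 1 := by
        linarith [Real.sqrt_nonneg C]
      _ ≤ _ := by gcongr
  · have hs0 : 0 < ‖ξ‖ := by linarith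
    have h1 := hC ξ h
    rw [← ofReal_norm, ← ENNReal.ofReal_pow (norm_nonneg _), ← ENNReal.ofReal_coe_nnreal,
      ← ENNReal.ofReal_mul (by positivity), ENNReal.ofReal_le_ofReal_iff (by positivity)] at h1
    have h2 : ‖ξ‖⁻¹ ^ (d - 2) = (‖ξ‖⁻¹ ^ a) ^ 2 := by
      rw [← Real.rpow_natCast, ← Real.rpow_natCast, ← Real.rpow_mul (by positivity), ha,
        Nat.cast_sub hd]
      congr 1; push_cast; ring
    rw [h2] at h1
    have h3 : ‖sphFT σ ξ‖ ≤ Real.sqrt C * ‖ξ‖⁻¹ ^ a := by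
      have := Real.sqrt_le_sqrt h1
      rwa [Real.sqrt_sq (norm_nonneg _), Real.sqrt_mul (by positivity),
        Real.sqrt_sq (by positivity)] at this
    calc _ ≤ Real.sqrt C * ‖ξ‖⁻¹ ^ a := h3
      _ ≤ _ := by
        gcongr
        · linarith [measureReal_nonneg (μ := σ) (s := Set.univ)]
        · rw [inv_eq_one_div, div_le_div_iff₀ hs0 (by positivity)]; linarith

end SphereDecay

section TorusFourier

variable {d : ℕ}

/-- The measure on the fundamental cube `[0,1]^d`. -/
def cubeMeasure (d : ℕ) : Measure (Fin d → ℝ) := volume.restrict (Set.Icc 0 1)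

instance : IsFiniteMeasure (cubeMeasure d) :=
  ⟨by simpa [cubeMeasure] using isCompact_Icc.measure_lt_top⟩

/-- The character `ξ ↦ e(n·ξ)`. -/
def eChar (n : Fin d → ℤ) (ξ : Fin d → ℝ) : ℂ := eC (∑ i, (n i : ℝ) * ξ i)

lemma continuous_eChar (n : Fin d → ℤ) : Continuous (eChar n) :=
  continuous_eC.comp (by fun_prop)

lemma norm_eChar (n : Fin d → ℤ) (ξ : Fin d → ℝ) : ‖eChar n ξ‖ = 1 := norm_eC _

lemma conj_eC (t : ℝ) : (starRingEnd ℂ) (eC t) = eC (-t) := by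
  rw [eC, ← Complex.exp_conj, eC]
  simp only [map_mul, Complex.conj_I, Complex.conj_ofReal, map_ofNat]
  congr 1; push_cast; ring

lemma eChar_neg (n : Fin d → ℤ) (ξ : Fin d → ℝ) : eChar (-n) ξ = (starRingEnd ℂ) (eChar n ξ) := by
  rw [eChar, eChar, conj_eC]; congr 1; simp

lemma eChar_add (m n : Fin d → ℤ) (ξ : Fin d → ℝ) : eChar (m + n) ξ = eChar m ξ * eChar n ξ := by
  rw [eChar, eChar, eChar, ← eC_add, ← Finset.sum_add_distrib]
  congr 1
  exact Finset.sum_congr rfl fun i _ => by simp only [Pi.add_apply]; push_cast; ring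

lemma eChar_sub (m n : Fin d → ℤ) (ξ : Fin d → ℝ) :
    eChar (m - n) ξ = eChar m ξ * (starRingEnd ℂ) (eChar n ξ) := by
  rw [sub_eq_add_neg, eChar_add, eChar_neg]

lemma eC_sum {ι : Type*} (s : Finset ι) (g : ι → ℝ) : eC (∑ i ∈ s, g i) = ∏ i ∈ s, eC (g i) := by
  classical
  induction s using Finset.induction_on with
  | empty => simp [eC_zero]
  | insert a s ha ih => rw [Finset.sum_insert ha, Finset.prod_insert ha, eC_add, ih]

lemma integral_Icc_eC (n : ℤ) :
    ∫ t in Set.Icc (0 : ℝ) 1, eC (n * t) = if n = 0 then 1 else 0 := by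
  rw [integral_Icc_eq_integral_Ioc, ← intervalIntegral.integral_of_le zero_le_one]
  split_ifs with h
  · simp [h, eC_zero]
  · have hc : (2 * Real.pi * Complex.I * n : ℂ) ≠ 0 := by
      simp [h, Real.pi_ne_zero]
    have e : ∀ t : ℝ, eC (n * t) = Complex.exp (2 * Real.pi * Complex.I * n * t) := fun t => by
      rw [eC]; congr 1; push_cast; ring
    simp_rw [e]
    rw [integral_exp_mul_complex hc]
    have h1 : Complex.exp (2 * Real.pi * Complex.I * n * (1 : ℝ)) = 1 := by
      rw [← e, mul_one, eC_intCast]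
    rw [h1]; simp

lemma integral_eChar (n : Fin d → ℤ) :
    ∫ ξ, eChar n ξ ∂(cubeMeasure d) = if n = 0 then 1 else 0 := by
  have hμ : cubeMeasure d =
      Measure.pi fun _ : Fin d => (volume : Measure ℝ).restrict (Set.Icc 0 1) := by
    rw [cubeMeasure, ← Set.pi_univ_Icc, volume_pi, Measure.restrict_pi_pi]; rfl
  rw [hμ]
  simp_rw [eChar, eC_sum]
  rw [integral_fintype_prod_eq_prod (fun i t => eC ((n i : ℝ) * t))]
  simp_rw [integral_Icc_eC]
  split_ifs with h
  · simp [h]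
  · obtain ⟨i, hi⟩ := Function.ne_iff.1 h
    exact Finset.prod_eq_zero (Finset.mem_univ i) (if_neg hi)

lemma memLp_eChar (n : Fin d → ℤ) : MemLp (eChar n) 2 (cubeMeasure d) :=
  MemLp.of_bound (continuous_eChar n).aestronglyMeasurable 1
    (Filter.Eventually.of_forall fun ξ => (norm_eChar n ξ).le)

lemma inner_toLp {g h : (Fin d → ℝ) → ℂ} (hg : MemLp g 2 (cubeMeasure d))
    (hh : MemLp h 2 (cubeMeasure d)) :
    inner ℂ (hg.toLp g) (hh.toLp h) = ∫ ξ, h ξ * (starRingEnd ℂ) (g ξ) ∂(cubeMeasure d) := by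
  rw [L2.inner_def]
  refine integral_congr_ae ?_
  filter_upwards [hg.coeFn_toLp, hh.coeFn_toLp] with ξ h1 h2
  rw [h1, h2]; rfl

lemma orthonormal_eChar :
    Orthonormal ℂ fun n : Fin d → ℤ => (memLp_eChar n).toLp (eChar n) := by
  classical
  rw [orthonormal_iff_ite]
  intro m n
  rw [inner_toLp]
  simp_rw [← eChar_sub]
  rw [integral_eChar]
  simp only [sub_eq_zero, eq_comm]

lemma enorm_toLp_sq {g : (Fin d → ℝ) → ℂ} (hg : MemLp g 2 (cubeMeasure d)) :
    ‖hg.toLp g‖ₑ ^ 2 = ∫⁻ ξ, ‖g ξ‖ₑ ^ 2 ∂(cubeMeasure d) := by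
  rw [Lp.enorm_toLp, eLpNorm_eq_lintegral_rpow_enorm_toReal (by norm_num) (by norm_num)]
  rw [← ENNReal.rpow_natCast, ← ENNReal.rpow_mul]
  norm_num

lemma bessel_cube {h : (Fin d → ℝ) → ℂ} (hh : MemLp h 2 (cubeMeasure d)) :
    ∑' x : Fin d → ℤ, ‖∫ ξ, h ξ * eChar (-x) ξ ∂(cubeMeasure d)‖ₑ ^ 2 ≤
      ∫⁻ ξ, ‖h ξ‖ₑ ^ 2 ∂(cubeMeasure d) := by
  rw [← enorm_toLp_sq hh, ENNReal.tsum_eq_iSup_sum]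
  refine iSup_le fun s => ?_
  have hB := (orthonormal_eChar (d := d)).sum_inner_products_le (s := s) (hh.toLp h)
  simp_rw [inner_toLp, ← eChar_neg] at hB
  calc _ = ENNReal.ofReal (∑ x ∈ s, ‖∫ ξ, h ξ * eChar (-x) ξ ∂(cubeMeasure d)‖ ^ 2) := by
        rw [ENNReal.ofReal_sum_of_nonneg fun _ _ => by positivity]
        refine Finset.sum_congr rfl fun x _ => ?_
        rw [ENNReal.ofReal_pow (norm_nonneg _), ofReal_norm]
    _ ≤ ENNReal.ofReal (‖hh.toLp h‖ ^ 2) := ENNReal.ofReal_le_ofReal hB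
    _ = _ := by rw [ENNReal.ofReal_pow (norm_nonneg _), ofReal_norm]

variable {f : (Fin d → ℤ) → ℂ}

lemma ftZ_eq_sum (hf : (Function.support f).Finite) (ξ : Fin d → ℝ) :
    ftZ f ξ = ∑ y ∈ hf.toFinset, f y * eChar y ξ := by
  rw [ftZ, tsum_eq_sum (s := hf.toFinset)]
  · rfl
  · intro y hy
    have : f y = 0 := by simpa using hy
    rw [this, zero_mul]

lemma continuous_ftZ (hf : (Function.support f).Finite) : Continuous (ftZ f) := by
  have : ftZ f = fun ξ => ∑ y ∈ hf.toFinset, f y * eChar y ξ := funext (ftZ_eq_sum hf)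
  rw [this]
  exact continuous_finsetSum _ fun y _ => continuous_const.mul (continuous_eChar y)

lemma tsum_enorm_sq_eq_sum (hf : (Function.support f).Finite) :
    ∑' x, ‖f x‖ₑ ^ 2 = ∑ x ∈ hf.toFinset, ‖f x‖ₑ ^ 2 := by
  refine tsum_eq_sum fun y hy => ?_
  have : f y = 0 := by simpa using hy
  simp [this]

lemma memLp_of_continuousOn {h : (Fin d → ℝ) → ℂ} (hh : ContinuousOn h (Set.Icc 0 1)) :
    MemLp h 2 (cubeMeasure d) := by
  obtain ⟨C, hC⟩ := isCompact_Icc.exists_bound_of_continuousOn hh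
  refine MemLp.of_bound (hh.aestronglyMeasurable measurableSet_Icc) C ?_
  exact (ae_restrict_iff' measurableSet_Icc).2 (Filter.Eventually.of_forall hC)

lemma plancherel_cube (hf : (Function.support f).Finite) :
    ∫⁻ ξ, ‖ftZ f ξ‖ₑ ^ 2 ∂(cubeMeasure d) = ∑' x, ‖f x‖ₑ ^ 2 := by
  have hc := memLp_of_continuousOn (continuous_ftZ hf).continuousOn
  rw [← enorm_toLp_sq hc, tsum_enorm_sq_eq_sum hf]
  have h1 : hc.toLp (ftZ f) =
      ∑ y ∈ hf.toFinset, f y • (memLp_eChar y).toLp (eChar y) := by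
    refine Lp.ext ?_
    have hsum : ∀ s : Finset (Fin d → ℤ),
        ⇑(∑ y ∈ s, f y • (memLp_eChar y).toLp (eChar y)) =ᵐ[cubeMeasure d]
          fun ξ => ∑ y ∈ s, f y * eChar y ξ := by
      intro s
      classical
      induction s using Finset.induction_on with
      | empty => simp only [Finset.sum_empty]; exact Lp.coeFn_zero ℂ 2 (cubeMeasure d)
      | insert a s ha ih =>
        simp only [Finset.sum_insert ha]
        filter_upwards [Lp.coeFn_add (f a • (memLp_eChar a).toLp (eChar a))
          (∑ y ∈ s, f y • (memLp_eChar y).toLp (eChar y)), ih,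
          Lp.coeFn_smul (f a) ((memLp_eChar a).toLp (eChar a)),
          (memLp_eChar a).coeFn_toLp] with ξ h1 h2 h3 h4
        rw [h1, Pi.add_apply, h2, h3, Pi.smul_apply, h4, smul_eq_mul]
    filter_upwards [hc.coeFn_toLp, hsum hf.toFinset] with ξ h1 h2
    rw [h1, h2, ftZ_eq_sum hf]
  have h2 : ‖hc.toLp (ftZ f)‖ ^ 2 = ∑ y ∈ hf.toFinset, ‖f y‖ ^ 2 := by
    have : ((‖hc.toLp (ftZ f)‖ ^ 2 : ℝ) : ℂ) = ((∑ y ∈ hf.toFinset, ‖f y‖ ^ 2 : ℝ) : ℂ) := by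
      push_cast
      refine (inner_self_eq_norm_sq_to_K (𝕜 := ℂ) (hc.toLp (ftZ f))).symm.trans ?_
      rw [h1, (orthonormal_eChar (d := d)).inner_sum]
      exact Finset.sum_congr rfl fun y _ => Complex.conj_mul' _
    exact_mod_cast this
  rw [← ofReal_norm, ← ENNReal.ofReal_pow (norm_nonneg _), h2,
    ENNReal.ofReal_sum_of_nonneg fun _ _ => by positivity]
  exact Finset.sum_congr rfl fun x _ => by
    rw [ENNReal.ofReal_pow (norm_nonneg _), ofReal_norm]

/-- The kernel of the operator with multiplier `m`. -/
def mulKernel (m : (Fin d → ℝ) → ℂ) (z : Fin d → ℤ) : ℂ :=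
  ∫ ξ, m ξ * eChar (-z) ξ ∂(cubeMeasure d)

lemma mulOp_eq_integral (m : (Fin d → ℝ) → ℂ) (x : Fin d → ℤ) :
    mulOp d m f x = ∫ ξ, m ξ * ftZ f ξ * eChar (-x) ξ ∂(cubeMeasure d) := by
  rw [mulOp, cubeMeasure]
  refine integral_congr_ae (Filter.Eventually.of_forall fun ξ => ?_)
  simp only [eChar]
  congr 2
  rw [← Finset.sum_neg_distrib]
  exact Finset.sum_congr rfl fun i _ => by simp

lemma integrable_mul_eChar {m : (Fin d → ℝ) → ℂ} (hm : ContinuousOn m (Set.Icc 0 1))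
    (z : Fin d → ℤ) : Integrable (fun ξ => m ξ * eChar z ξ) (cubeMeasure d) :=
  (hm.mul (continuous_eChar z).continuousOn).integrableOn_compact isCompact_Icc

lemma mulOp_eq_sum {m : (Fin d → ℝ) → ℂ} (hm : ContinuousOn m (Set.Icc 0 1))
    (hf : (Function.support f).Finite) (x : Fin d → ℤ) :
    mulOp d m f x = ∑ y ∈ hf.toFinset, f y * mulKernel m (x - y) := by
  rw [mulOp_eq_integral]
  have : ∀ ξ, m ξ * ftZ f ξ * eChar (-x) ξ =
      ∑ y ∈ hf.toFinset, f y * (m ξ * eChar (-(x - y)) ξ) := fun ξ => by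
    rw [ftZ_eq_sum hf, Finset.mul_sum, Finset.sum_mul]
    refine Finset.sum_congr rfl fun y _ => ?_
    rw [neg_sub, sub_eq_add_neg, eChar_add]; ring
  simp_rw [this]
  rw [integral_finsetSum _ fun y _ => (integrable_mul_eChar hm _).const_mul _]
  exact Finset.sum_congr rfl fun y _ => by rw [integral_const_mul, mulKernel]

lemma mulOp_eq_tsum {m : (Fin d → ℝ) → ℂ} (hm : ContinuousOn m (Set.Icc 0 1))
    (hf : (Function.support f).Finite) (x : Fin d → ℤ) :
    mulOp d m f x = ∑' y, f y * mulKernel m (x - y) := by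
  rw [mulOp_eq_sum hm hf, tsum_eq_sum]
  intro y hy
  have : f y = 0 := by simpa using hy
  rw [this, zero_mul]

lemma tsum_enorm_mulOp_sq_le {m : (Fin d → ℝ) → ℂ} (hm : ContinuousOn m (Set.Icc 0 1))
    (hf : (Function.support f).Finite) :
    ∑' x, ‖mulOp d m f x‖ₑ ^ 2 ≤ ∫⁻ ξ, ‖m ξ‖ₑ ^ 2 * ‖ftZ f ξ‖ₑ ^ 2 ∂(cubeMeasure d) := by
  have h := bessel_cube (memLp_of_continuousOn (hm.mul (continuous_ftZ hf).continuousOn))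
  simp_rw [mulOp_eq_integral]
  refine h.trans (le_of_eq (lintegral_congr fun ξ => ?_))
  simp only [enorm_mul, mul_pow, Pi.mul_apply]

lemma square_function_le {ι : Type*} [Countable ι] {m : ι → (Fin d → ℝ) → ℂ} {A : ℝ≥0∞}
    (hm : ∀ r, ContinuousOn (m r) (Set.Icc 0 1))
    (hA : ∀ ξ ∈ Set.Icc (0 : Fin d → ℝ) 1, ∑' r, ‖m r ξ‖ₑ ^ 2 ≤ A)
    (hf : (Function.support f).Finite) :
    ∑' x, (⨆ r, ‖mulOp d (m r) f x‖ₑ) ^ 2 ≤ A * ∑' x, ‖f x‖ₑ ^ 2 := by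
  calc ∑' x, (⨆ r, ‖mulOp d (m r) f x‖ₑ) ^ 2
      ≤ ∑' x, ∑' r, ‖mulOp d (m r) f x‖ₑ ^ 2 := by
        refine ENNReal.tsum_le_tsum fun x => ?_
        rw [← ENNReal.rpow_natCast, ENNReal.monotone_rpow_of_nonneg (by norm_num : (0 : ℝ) ≤ (2 : ℕ))
          |>.map_iSup_of_continuousAt ENNReal.continuous_rpow_const.continuousAt (by simp)]
        refine iSup_le fun r => ?_
        rw [ENNReal.rpow_natCast]
        exact ENNReal.le_tsum r
    _ = ∑' r, ∑' x, ‖mulOp d (m r) f x‖ₑ ^ 2 := ENNReal.tsum_comm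
    _ ≤ ∑' r, ∫⁻ ξ, ‖m r ξ‖ₑ ^ 2 * ‖ftZ f ξ‖ₑ ^ 2 ∂(cubeMeasure d) :=
        ENNReal.tsum_le_tsum fun r => tsum_enorm_mulOp_sq_le (hm r) hf
    _ = ∫⁻ ξ, ∑' r, ‖m r ξ‖ₑ ^ 2 * ‖ftZ f ξ‖ₑ ^ 2 ∂(cubeMeasure d) := by
        refine (lintegral_tsum fun r => ?_).symm
        exact (((hm r).aestronglyMeasurable measurableSet_Icc).enorm.pow_const 2).mul
          ((continuous_ftZ hf).aestronglyMeasurable.enorm.pow_const 2)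
    _ ≤ ∫⁻ ξ, A * ‖ftZ f ξ‖ₑ ^ 2 ∂(cubeMeasure d) := by
        refine lintegral_mono_ae ((ae_restrict_iff' measurableSet_Icc).2
          (Filter.Eventually.of_forall fun ξ hξ => ?_))
        rw [ENNReal.tsum_mul_right]
        gcongr
        exact hA ξ hξ
    _ = A * ∑' x, ‖f x‖ₑ ^ 2 := by
        rw [lintegral_const_mul _ ((continuous_ftZ hf).measurable.enorm.pow_const 2),
          plancherel_cube hf]

end TorusFourier

section Periodization

variable {d : ℕ}

/-- The real vector underlying an integer vector. -/
def intVec (l : Fin d → ℤ) : Fin d → ℝ := fun i => (l i : ℝ)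

/-- The half-open lattice cell with corner `l`. -/
def latticeCell (l : Fin d → ℤ) : Set (Fin d → ℝ) := {ξ | ∀ i, ⌊ξ i⌋ = l i}

lemma measurableSet_latticeCell (l : Fin d → ℤ) : MeasurableSet (latticeCell l) := by
  have : latticeCell l = ⋂ i, {ξ : Fin d → ℝ | ⌊ξ i⌋ = l i} := by
    ext ξ; simp [latticeCell]
  rw [this]
  refine MeasurableSet.iInter fun i => ?_
  exact (Int.measurable_floor.comp (measurable_pi_apply i)) (measurableSet_singleton (l i))

lemma latticeCell_zero_ae_eq : (latticeCell (0 : Fin d → ℤ)) =ᵐ[volume] Set.Icc (0 : Fin d → ℝ) 1 := by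
  have h : latticeCell (0 : Fin d → ℤ) = Set.pi Set.univ fun i => Set.Ico (0 : ℝ) 1 := by
    ext ξ; simp [latticeCell, Int.floor_eq_zero_iff]
  rw [h]
  exact Measure.univ_pi_Ico_ae_eq_Icc (μ := fun _ : Fin d => (volume : Measure ℝ))

lemma setIntegral_latticeCell (g : (Fin d → ℝ) → ℂ) (l : Fin d → ℤ) :
    ∫ ξ in latticeCell l, g ξ = ∫ ξ, g (ξ + intVec l) ∂(cubeMeasure d) := by
  rw [cubeMeasure, ← setIntegral_congr_set latticeCell_zero_ae_eq,
    ← integral_indicator (measurableSet_latticeCell l),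
    ← integral_indicator (measurableSet_latticeCell 0),
    ← integral_add_right_eq_self _ (intVec l)]
  refine integral_congr_ae (Filter.Eventually.of_forall fun ξ => ?_)
  have : ξ + intVec l ∈ latticeCell l ↔ ξ ∈ latticeCell 0 := by
    simp [latticeCell, intVec]
  by_cases h : ξ ∈ latticeCell 0
  · rw [Set.indicator_of_mem h]; exact Set.indicator_of_mem (this.2 h) g
  · rw [Set.indicator_of_notMem h]; exact Set.indicator_of_notMem (mt this.1 h) g

lemma integral_eq_tsum_cube {g : (Fin d → ℝ) → ℂ} (hg : Integrable g) :
    ∫ ξ, g ξ = ∑' l : Fin d → ℤ, ∫ ξ, g (ξ - intVec l) ∂(cubeMeasure d) := by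
  have hU : (⋃ l : Fin d → ℤ, latticeCell l) = Set.univ :=
    Set.eq_univ_of_forall fun ξ => Set.mem_iUnion.2 ⟨fun i => ⌊ξ i⌋, fun _ => rfl⟩
  have hdisj : Pairwise (Function.onFun Disjoint (latticeCell (d := d))) := by
    intro l l' hll
    refine Set.disjoint_left.2 fun ξ h h' => hll (funext fun i => ?_)
    rw [← h i, h' i]
  rw [← setIntegral_univ, ← hU, integral_iUnion measurableSet_latticeCell hdisj hg.integrableOn,
    ← (Equiv.neg (Fin d → ℤ)).tsum_eq]
  refine tsum_congr fun l => ?_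
  rw [setIntegral_latticeCell]
  refine integral_congr_ae (Filter.Eventually.of_forall fun ξ => ?_)
  simp only
  congr 1
  ext i; simp [intVec, sub_eq_add_neg]

end Periodization

section PeriodicMultiplier

variable {d q : ℕ}

/-- Functions on `ℝ^d` supported in the cube `[-1/4,1/4]^d`. -/
def QuarterSupported (B : (Fin d → ℝ) → ℂ) : Prop :=
  ∀ η, η ∉ Set.Icc (fun _ => -(1 / 4 : ℝ)) (fun _ => (1 / 4 : ℝ)) → B η = 0

/-- Reduction modulo `q`. -/
def redMod (q : ℕ) (n : Fin d → ℤ) : Fin d → ZMod q := fun i => (n i : ZMod q)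

/-- The `1`-periodic multiplier `∑ k(n) B(qξ - n)`. -/
def perMul (q : ℕ) (k : (Fin d → ZMod q) → ℂ) (B : (Fin d → ℝ) → ℂ) (ξ : Fin d → ℝ) : ℂ :=
  ∑' n : Fin d → ℤ, k (redMod q n) * B ((q : ℝ) • ξ - intVec n)

/-- The closest lattice point. -/
def roundVec (η : Fin d → ℝ) : Fin d → ℤ := fun i => round (η i)

lemma QuarterSupported.abs_apply_le {B : (Fin d → ℝ) → ℂ} (hB : QuarterSupported B) {η : Fin d → ℝ}
    (h : B η ≠ 0) (i : Fin d) : |η i| ≤ 1 / 4 := by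
  by_contra hc
  refine h (hB η fun hm => hc ?_)
  exact abs_le.2 ⟨hm.1 i, hm.2 i⟩

lemma QuarterSupported.eq_roundVec {B : (Fin d → ℝ) → ℂ} (hB : QuarterSupported B) {η : Fin d → ℝ}
    {n : Fin d → ℤ} (h : B (η - intVec n) ≠ 0) : n = roundVec η := by
  funext i
  have h1 := hB.abs_apply_le h i
  have h2 := abs_sub_round (η i)
  have h3 : |((n i - round (η i) : ℤ) : ℝ)| < 1 := by
    push_cast
    calc |(n i : ℝ) - round (η i)| = |(η i - round (η i)) - (η - intVec n) i| := by
          congr 1; simp only [Pi.sub_apply, intVec]; ring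
      _ ≤ _ := abs_sub _ _
      _ < 1 := by linarith
  have h4 : |n i - round (η i)| < 1 := by exact_mod_cast h3
  exact sub_eq_zero.1 (Int.abs_lt_one_iff.1 h4)

lemma perMul_eq_single (k : (Fin d → ZMod q) → ℂ) {B : (Fin d → ℝ) → ℂ} (hB : QuarterSupported B)
    (ξ : Fin d → ℝ) : perMul q k B ξ = k (redMod q (roundVec ((q : ℝ) • ξ))) *
      B ((q : ℝ) • ξ - intVec (roundVec ((q : ℝ) • ξ))) := by
  refine tsum_eq_single _ fun n hn => ?_
  by_contra hc
  exact hn (hB.eq_roundVec (right_ne_zero_of_mul hc))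

lemma QuarterSupported.mem_latticeCube {B : (Fin d → ℝ) → ℂ} (hB : QuarterSupported B)
    {ξ : Fin d → ℝ} (hξ : ξ ∈ Set.Icc (0 : Fin d → ℝ) 1) {n : Fin d → ℤ}
    (h : B ((q : ℝ) • ξ - intVec n) ≠ 0) : n ∈ latticeCube d (q + 1) := by
  rw [_root_.mem_latticeCube]
  intro i
  have h1 := hB.abs_apply_le h i
  have h2 : 0 ≤ ξ i := hξ.1 i
  have h3 : ξ i ≤ 1 := hξ.2 i
  have hq : (0 : ℝ) ≤ q := Nat.cast_nonneg q
  have h4 : |((n i : ℤ) : ℝ)| ≤ ((q + 1 : ℕ) : ℤ) := by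
    simp only [Pi.sub_apply, Pi.smul_apply, smul_eq_mul, intVec, abs_le] at h1
    push_cast
    rw [abs_le]
    constructor <;> nlinarith
  exact_mod_cast h4

lemma perMul_eq_sum (k : (Fin d → ZMod q) → ℂ) {B : (Fin d → ℝ) → ℂ} (hB : QuarterSupported B)
    {ξ : Fin d → ℝ} (hξ : ξ ∈ Set.Icc (0 : Fin d → ℝ) 1) : perMul q k B ξ =
      ∑ n ∈ latticeCube d (q + 1), k (redMod q n) * B ((q : ℝ) • ξ - intVec n) := by
  refine tsum_eq_sum fun n hn => ?_
  by_contra hc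
  exact hn (hB.mem_latticeCube hξ (right_ne_zero_of_mul hc))

lemma continuousOn_perMul (k : (Fin d → ZMod q) → ℂ) {B : (Fin d → ℝ) → ℂ}
    (hB : QuarterSupported B) (hc : Continuous B) :
    ContinuousOn (perMul q k B) (Set.Icc 0 1) := by
  have : Continuous fun ξ : Fin d → ℝ =>
      ∑ n ∈ latticeCube d (q + 1), k (redMod q n) * B ((q : ℝ) • ξ - intVec n) := by fun_prop
  exact this.continuousOn.congr fun ξ hξ => perMul_eq_sum k hB hξ

/-- The Euclidean Fourier transform `∫ B(η) e(-w·η) dη`. -/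
def euclFT (B : (Fin d → ℝ) → ℂ) (w : Fin d → ℝ) : ℂ := ∫ η, B η * eC (-∑ i, w i * η i)

/-- Division with remainder as a bijection. -/
def divModVec (d q : ℕ) [NeZero q] : (Fin d → ZMod q) × (Fin d → ℤ) ≃ (Fin d → ℤ) where
  toFun p := fun i => p.2 i * q + ((p.1 i).val : ℤ)
  invFun n := (redMod q n, fun i => n i / q)
  left_inv p := by
    have hq : (q : ℤ) ≠ 0 := by exact_mod_cast NeZero.ne q
    refine Prod.ext (funext fun i => ?_) (funext fun i => ?_)
    · simp [redMod]
    · simp only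
      rw [add_comm, Int.add_mul_ediv_right _ _ hq, Int.ediv_eq_zero_of_lt (by positivity), zero_add]
      exact_mod_cast ZMod.val_lt (p.1 i)
  right_inv n := by
    funext i
    simp only [redMod]
    rw [ZMod.val_intCast, mul_comm]
    exact Int.mul_ediv_add_emod (n i) q

lemma QuarterSupported.integrable {B : (Fin d → ℝ) → ℂ} (hB : QuarterSupported B)
    (hc : Continuous B) : Integrable B := by
  refine hc.integrable_of_hasCompactSupport ?_
  refine HasCompactSupport.of_support_subset_isCompact
    (K := Set.Icc (fun _ => -(1 / 4 : ℝ)) (fun _ => (1 / 4 : ℝ))) isCompact_Icc fun η hη => ?_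
  by_contra h
  exact hη (hB η h)

lemma stdAddChar_neg_sum [NeZero q] (z : Fin d → ℤ) (r : Fin d → ZMod q) :
    ZMod.stdAddChar (-∑ i, redMod q z i * r i) =
      eC (-∑ i, (z i : ℝ) * (((r i).val : ℝ) / q)) := by
  have h : -∑ i, redMod q z i * r i = ((-∑ i, z i * ((r i).val : ℤ) : ℤ) : ZMod q) := by
    push_cast
    congr 1
    exact Finset.sum_congr rfl fun i _ => by simp [redMod]
  rw [h, ZMod.stdAddChar_coe, eC]
  congr 1
  push_cast
  rw [mul_div_assoc, neg_div, Finset.sum_div]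
  congr 2
  exact Finset.sum_congr rfl fun i _ => by rw [mul_div_assoc]

lemma integral_shifted_piece [NeZero q] {B : (Fin d → ℝ) → ℂ} (z : Fin d → ℤ) (r : Fin d → ZMod q) :
    ∫ ξ, B ((q : ℝ) • ξ - intVec (fun i => ((r i).val : ℤ))) * eChar (-z) ξ =
      ((q : ℂ)⁻¹) ^ d * ZMod.stdAddChar (-∑ i, redMod q z i * r i) *
        euclFT B (fun i => (z i : ℝ) / q) := by
  have hq : (q : ℝ) ≠ 0 := by exact_mod_cast NeZero.ne q
  set v : Fin d → ℝ := intVec (fun i => ((r i).val : ℤ)) with hv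
  have h1 : ∀ ξ : Fin d → ℝ, B ((q : ℝ) • ξ - v) * eChar (-z) ξ =
      (fun η => B (η - v) * eC (-∑ i, (z i : ℝ) / q * η i)) ((q : ℝ) • ξ) := fun ξ => by
    simp only [eChar, Pi.neg_apply, Pi.smul_apply, smul_eq_mul]
    congr 2
    rw [← Finset.sum_neg_distrib]
    refine Finset.sum_congr rfl fun i _ => ?_
    push_cast; field_simp
  rw [integral_congr_ae (Filter.Eventually.of_forall h1)]
  rw [Measure.integral_comp_smul volume (fun η => B (η - v) * eC (-∑ i, (z i : ℝ) / q * η i)) (q : ℝ),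
    Module.finrank_fin_fun,
    ← integral_add_right_eq_self _ v, stdAddChar_neg_sum]
  have h2 : ∀ η : Fin d → ℝ, B (η + v - v) * eC (-∑ i, (z i : ℝ) / q * (η + v) i) =
      eC (-∑ i, (z i : ℝ) * (((r i).val : ℝ) / q)) * (B η * eC (-∑ i, (z i : ℝ) / q * η i)) := by
    intro η
    rw [add_sub_cancel_right]
    have : -∑ i, (z i : ℝ) / q * (η + v) i =
        -∑ i, (z i : ℝ) * (((r i).val : ℝ) / q) + -∑ i, (z i : ℝ) / q * η i := by
      rw [← neg_add, ← Finset.sum_add_distrib]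
      congr 1
      refine Finset.sum_congr rfl fun i _ => ?_
      simp only [Pi.add_apply, hv, intVec]
      push_cast; ring
    rw [this, eC_add]; ring
  simp_rw [h2]
  rw [integral_const_mul, euclFT, abs_of_nonneg (by positivity), Complex.real_smul]
  push_cast
  rw [inv_pow]; ring

lemma mulKernel_perMul [NeZero q] (k : (Fin d → ZMod q) → ℂ) {B : (Fin d → ℝ) → ℂ}
    (hB : QuarterSupported B) (hc : Continuous B) (z : Fin d → ℤ) :
    mulKernel (perMul q k B) z = ((q : ℂ)⁻¹) ^ d * ringFT ZMod.stdAddChar k (redMod q z) *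
      euclFT B (fun i => (z i : ℝ) / q) := by
  have hq : (q : ℝ) ≠ 0 := by exact_mod_cast NeZero.ne q
  set J : (Fin d → ℤ) → ℂ := fun n =>
    ∫ ξ, B ((q : ℝ) • ξ - intVec n) * eChar (-z) ξ ∂(cubeMeasure d) with hJ
  have hJ0 : ∀ n ∉ latticeCube d (q + 1), k (redMod q n) * J n = 0 := by
    intro n hn
    have : J n = 0 := by
      refine (setIntegral_congr_fun measurableSet_Icc fun ξ hξ => ?_).trans
        (integral_zero _ _)
      by_contra h
      exact hn (hB.mem_latticeCube hξ (left_ne_zero_of_mul h))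
    rw [this, mul_zero]
  have h1 : mulKernel (perMul q k B) z = ∑' n, k (redMod q n) * J n := by
    rw [tsum_eq_sum hJ0, mulKernel]
    have e : ∫ ξ, perMul q k B ξ * eChar (-z) ξ ∂(cubeMeasure d) =
        ∫ ξ, (∑ n ∈ latticeCube d (q + 1), k (redMod q n) *
          (B ((q : ℝ) • ξ - intVec n) * eChar (-z) ξ)) ∂(cubeMeasure d) := by
      refine setIntegral_congr_fun measurableSet_Icc fun ξ hξ => ?_
      rw [perMul_eq_sum k hB hξ, Finset.sum_mul]
      exact Finset.sum_congr rfl fun n _ => mul_assoc _ _ _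
    rw [e, integral_finsetSum]
    · exact Finset.sum_congr rfl fun n _ => integral_const_mul _ _
    · intro n _
      refine (integrable_mul_eChar (m := fun ξ => B ((q : ℝ) • ξ - intVec n)) ?_ (-z)).const_mul _
      fun_prop
  have hsum : Summable fun n => k (redMod q n) * J n := summable_of_ne_finset_zero hJ0
  rw [h1, ← (divModVec d q).tsum_eq]
  have hsum2 := (divModVec d q).summable_iff.2 hsum
  simp only [Function.comp_def] at hsum2
  rw [hsum2.tsum_prod, tsum_fintype, ringFT, Finset.mul_sum, Finset.sum_mul]
  refine Finset.sum_congr rfl fun r _ => ?_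
  have h2 : ∀ l : Fin d → ℤ, k (redMod q (divModVec d q (r, l))) * J (divModVec d q (r, l)) =
      k r * ∫ ξ, (fun ξ => B ((q : ℝ) • ξ - intVec (fun i => ((r i).val : ℤ))) * eChar (-z) ξ)
        (ξ - intVec l) ∂(cubeMeasure d) := by
    intro l
    have hr : redMod q (divModVec d q (r, l)) = r := by
      funext i; simp [redMod, divModVec]
    rw [hr, hJ]
    congr 1
    refine integral_congr_ae (Filter.Eventually.of_forall fun ξ => ?_)
    simp only
    congr 1
    · congr 1
      ext i
      simp only [divModVec, Equiv.coe_fn_mk, intVec, Pi.sub_apply, Pi.smul_apply, smul_eq_mul]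
      push_cast; ring
    · rw [eChar, eChar]
      have : ∑ i, (((-z) i : ℤ) : ℝ) * (ξ - intVec l) i =
          ∑ i, (((-z) i : ℤ) : ℝ) * ξ i + ((∑ i, z i * l i : ℤ) : ℝ) := by
        push_cast
        rw [← Finset.sum_add_distrib]
        refine Finset.sum_congr rfl fun i _ => ?_
        simp only [Pi.neg_apply, Pi.sub_apply, intVec]; push_cast; ring
      rw [this, eC_add, eC_intCast, mul_one]
  simp_rw [h2]
  rw [tsum_mul_left]
  have hint : Integrable fun ξ : Fin d → ℝ =>
      B ((q : ℝ) • ξ - intVec (fun i => ((r i).val : ℤ))) * eChar (-z) ξ := by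
    refine Integrable.mul_bdd (c := 1) ?_ (continuous_eChar _).aestronglyMeasurable
      (Filter.Eventually.of_forall fun ξ => (norm_eChar _ ξ).le)
    exact ((hB.integrable hc).comp_sub_right (intVec (fun i => ((r i).val : ℤ)))).comp_smul hq
  rw [← integral_eq_tsum_cube hint, integral_shifted_piece]
  ring

end PeriodicMultiplier

section EuclideanKernels

open scoped RealInnerProductSpace FourierTransform

variable {d : ℕ} {Ψ : (Fin d → ℝ) → ℝ} {σ : Measure (EuclideanSpace ℝ (Fin d))}

/-- A coordinate vector as an element of Euclidean space. -/
def eucVec (ξ : Fin d → ℝ) : EuclideanSpace ℝ (Fin d) := WithLp.toLp 2 ξ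

lemma norm_le_norm_eucVec (ξ : Fin d → ℝ) : ‖ξ‖ ≤ ‖eucVec ξ‖ :=
  (pi_norm_le_iff_of_nonneg (norm_nonneg _)).2 fun i => PiLp.norm_apply_le (eucVec ξ) i

lemma norm_eucVec_le (ξ : Fin d → ℝ) : ‖eucVec ξ‖ ≤ d * ‖ξ‖ := by
  rw [EuclideanSpace.norm_eq]
  refine Real.sqrt_le_iff.2 ⟨by positivity, ?_⟩
  calc ∑ i, ‖(eucVec ξ) i‖ ^ 2 ≤ ∑ _i : Fin d, ‖ξ‖ ^ 2 :=
        Finset.sum_le_sum fun i _ => by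
          have := norm_le_pi_norm ξ i
          change ‖ξ i‖ ^ 2 ≤ _
          gcongr
    _ = d * ‖ξ‖ ^ 2 := by simp
    _ ≤ (d * ‖ξ‖) ^ 2 := by
        rw [mul_pow]
        gcongr
        rcases Nat.eq_zero_or_pos d with h | h
        · simp [h]
        · have : (1 : ℝ) ≤ d := by exact_mod_cast h
          nlinarith

lemma continuous_eucVec : Continuous (eucVec (d := d)) := PiLp.continuous_toLp 2 _

lemma IsBump.quarterSupported (h : IsBump d Ψ) : QuarterSupported fun η => (Ψ η : ℂ) :=
  fun η hη => by simp [h.2.1 η hη]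

lemma IsBump.continuous (h : IsBump d Ψ) : Continuous Ψ := h.1.continuous

lemma IsBump.exists_euclFT_decay (h : IsBump d Ψ) (M : ℕ) :
    ∃ C : ℝ≥0, ∀ u : Fin d → ℝ,
      ‖euclFT (fun η => (Ψ η : ℂ)) u‖ * (1 + ‖eucVec u‖) ^ M ≤ C := by
  let g : EuclideanSpace ℝ (Fin d) → ℂ := fun v => (Ψ (WithLp.ofLp v) : ℂ)
  have hs : HasCompactSupport g := by
    refine HasCompactSupport.of_support_subset_isCompact
      (K := eucVec '' Set.Icc (fun _ => -(1 / 4 : ℝ)) (fun _ => (1 / 4 : ℝ)))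
      (isCompact_Icc.image continuous_eucVec) fun v hv => ⟨WithLp.ofLp v, ?_, rfl⟩
    by_contra hc
    exact hv (h.quarterSupported _ hc)
  have hd : ContDiff ℝ (⊤ : ℕ∞) g := by
    have e : ContDiff ℝ (⊤ : ℕ∞) fun v : EuclideanSpace ℝ (Fin d) => WithLp.ofLp v :=
      (PiLp.continuousLinearEquiv 2 ℝ fun _ : Fin d => ℝ).contDiff
    exact Complex.ofRealCLM.contDiff.comp (h.1.comp e)
  let G : SchwartzMap (EuclideanSpace ℝ (Fin d)) ℂ := 𝓕 (hs.toSchwartzMap hd)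
  have hG : ∀ u : Fin d → ℝ, euclFT (fun η => (Ψ η : ℂ)) u = G (eucVec u) := by
    intro u
    simp only [G, SchwartzMap.fourier_coe]
    rw [Real.fourier_eq', euclFT, ← (PiLp.volume_preserving_toLp (Fin d)).integral_comp
      (MeasurableEquiv.toLp 2 (Fin d → ℝ)).measurableEmbedding]
    refine integral_congr_ae (Filter.Eventually.of_forall fun η => ?_)
    simp only [HasCompactSupport.toSchwartzMap_toFun, g, smul_eq_mul]
    rw [mul_comm]
    congr 1
    rw [eC]
    congr 1
    have : ⟪(WithLp.toLp 2 η : EuclideanSpace ℝ (Fin d)), eucVec u⟫ = ∑ i, u i * η i := by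
      rw [PiLp.inner_apply]
      rfl
    rw [this]; push_cast; ring
  have hb := SchwartzMap.one_add_le_sup_seminorm_apply (𝕜 := ℝ) (m := (M, 0)) le_rfl le_rfl G
  refine ⟨⟨_, (by positivity : (0 : ℝ) ≤ _).trans (hb 0)⟩, fun u => ?_⟩
  have := hb (eucVec u)
  rw [norm_iteratedFDeriv_zero] at this
  rw [hG, mul_comm]
  exact this

/-- The Fourier transform of a measure in coordinates. -/
def sphHat (σ : Measure (EuclideanSpace ℝ (Fin d))) (ξ : Fin d → ℝ) : ℂ := sphFT σ (eucVec ξ)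

lemma continuous_sphHat [IsFiniteMeasure σ] : Continuous (sphHat σ) :=
  continuous_sphFT.comp continuous_eucVec

lemma sphHat_eq (ξ : Fin d → ℝ) : sphHat σ ξ = ∫ x, eC (∑ i, x i * ξ i) ∂σ := by
  rw [sphHat, sphFT]
  refine integral_congr_ae (Filter.Eventually.of_forall fun x => ?_)
  simp only
  congr 1
  rw [PiLp.inner_apply]
  exact Finset.sum_congr rfl fun i _ => mul_comm _ _

lemma IsBump.euclFT_smul (a : ℝ) (ha : 0 < a) (u : Fin d → ℝ) :
    euclFT (fun η => (Ψ (a • η) : ℂ)) u =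
      ((a : ℂ)⁻¹) ^ d * euclFT (fun η => (Ψ η : ℂ)) (a⁻¹ • u) := by
  have h1 : ∀ η : Fin d → ℝ, (Ψ (a • η) : ℂ) * eC (-∑ i, u i * η i) =
      (fun η => (Ψ η : ℂ) * eC (-∑ i, (a⁻¹ • u) i * η i)) (a • η) := fun η => by
    simp only
    congr 3
    refine Finset.sum_congr rfl fun i _ => ?_
    simp only [Pi.smul_apply, smul_eq_mul]
    field_simp
  rw [euclFT, integral_congr_ae (Filter.Eventually.of_forall h1),
    Measure.integral_comp_smul volume (fun η => (Ψ η : ℂ) * eC (-∑ i, (a⁻¹ • u) i * η i)) a,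
    Module.finrank_fin_fun, abs_of_nonneg (by positivity), Complex.real_smul, euclFT]
  push_cast
  rw [inv_pow]

lemma IsBump.euclFT_mul_sphHat [IsFiniteMeasure σ] (h : IsBump d Ψ) {a : ℝ} (ha : 0 < a) (t : ℝ)
    (w : Fin d → ℝ) :
    euclFT (fun η => (Ψ (a • η) : ℂ) * sphHat σ (t • η)) w =
      ∫ x : EuclideanSpace ℝ (Fin d), ((a : ℂ)⁻¹) ^ d *
        euclFT (fun η => (Ψ η : ℂ)) (a⁻¹ • (w - t • WithLp.ofLp x)) ∂σ := by
  have hcont : Continuous fun η : Fin d → ℝ => (Ψ (a • η) : ℂ) :=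
    Complex.continuous_ofReal.comp (h.continuous.comp (continuous_const_smul a))
  have hint : Integrable fun η : Fin d → ℝ => (Ψ (a • η) : ℂ) :=
    (h.quarterSupported.integrable (Complex.continuous_ofReal.comp h.continuous)).comp_smul ha.ne'
  simp_rw [← IsBump.euclFT_smul a ha]
  simp only [euclFT]
  rw [integral_integral_swap]
  · refine integral_congr_ae (Filter.Eventually.of_forall fun η => ?_)
    simp only
    rw [sphHat_eq, integral_const_mul, mul_assoc]
    congr 1
    rw [mul_comm, ← integral_const_mul]
    refine integral_congr_ae (Filter.Eventually.of_forall fun x => ?_)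
    simp only
    rw [← eC_add, ← Finset.sum_neg_distrib, ← Finset.sum_neg_distrib, ← Finset.sum_add_distrib]
    congr 1
    refine Finset.sum_congr rfl fun i _ => ?_
    simp only [Pi.sub_apply, Pi.smul_apply, smul_eq_mul]
    ring
  · have h1 : Integrable (fun p : EuclideanSpace ℝ (Fin d) × (Fin d → ℝ) => (Ψ (a • p.2) : ℂ))
        (σ.prod volume) := hint.comp_snd σ
    refine h1.mul_bdd (c := 1) ?_ (Filter.Eventually.of_forall fun p => (norm_eC _).le)
    refine (continuous_eC.comp ?_).aestronglyMeasurable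
    refine (continuous_finsetSum _ fun i _ => ?_).neg
    simp only [Pi.sub_apply, Pi.smul_apply]
    fun_prop

lemma IsSphereMeasure.exists_euclFT_bound (hd : 2 ≤ d) (hσ : IsSphereMeasure σ) (h : IsBump d Ψ) :
    ∃ C : ℝ≥0, ∀ a t : ℝ, 0 < a → a ≤ t → ∀ w : Fin d → ℝ,
      ‖euclFT (fun η => (Ψ (a • η) : ℂ) * sphHat σ (t • η)) w‖ₑ ≤
        C * ENNReal.ofReal (t / a) * ENNReal.ofReal ((t ^ d)⁻¹) * polyWeight d (‖w‖ / t) := by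
  have := hσ.finite
  obtain ⟨C₁, hC₁⟩ := h.exists_euclFT_decay (2 * (d + 1))
  obtain ⟨C₂, hC₂⟩ := hσ.exists_weight_bound hd
  have hpw : ∀ u : Fin d → ℝ, ‖euclFT (fun η => (Ψ η : ℂ)) u‖ₑ ≤
      C₁ * (polyWeight d ‖eucVec u‖ * polyWeight d ‖eucVec u‖) := by
    intro u
    have hpos : 0 < 1 + ‖eucVec u‖ := by positivity
    rw [polyWeight, ← ENNReal.ofReal_mul (by positivity), ← Real.rpow_add hpos,
      ← ofReal_norm, ← ENNReal.ofReal_coe_nnreal, ← ENNReal.ofReal_mul (by positivity)]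
    refine ENNReal.ofReal_le_ofReal ?_
    have e : (1 + ‖eucVec u‖) ^ (-(d + 1 : ℝ) + -(d + 1 : ℝ)) =
        ((1 + ‖eucVec u‖) ^ (2 * (d + 1)))⁻¹ := by
      rw [← Real.rpow_natCast, ← Real.rpow_neg hpos.le]
      congr 1; push_cast; ring
    rw [e, ← div_eq_mul_inv, le_div_iff₀ (by positivity)]
    exact hC₁ u
  refine ⟨C₁ * 2 ^ (d + 1) * C₂, fun a t ha hat w => ?_⟩
  have ht : 0 < t := ha.trans_le hat
  have hscale : ∀ x : EuclideanSpace ℝ (Fin d),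
      ‖eucVec (a⁻¹ • (w - t • WithLp.ofLp x))‖ = ‖x - t⁻¹ • eucVec w‖ / (a / t) := by
    intro x
    have : eucVec (a⁻¹ • (w - t • WithLp.ofLp x)) = (-(a⁻¹ * t)) • (x - t⁻¹ • eucVec w) := by
      ext i
      simp only [eucVec, PiLp.smul_apply, PiLp.sub_apply, Pi.smul_apply, Pi.sub_apply, smul_eq_mul]
      field_simp
      ring
    rw [this, norm_smul, norm_neg, Real.norm_of_nonneg (by positivity)]
    field_simp
  rw [h.euclFT_mul_sphHat ha]
  refine (enorm_integral_le_lintegral_enorm _).trans ?_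
  have hpt : ∀ᵐ x ∂σ, ‖((a : ℂ)⁻¹) ^ d *
      euclFT (fun η => (Ψ η : ℂ)) (a⁻¹ • (w - t • WithLp.ofLp x))‖ₑ ≤
      (ENNReal.ofReal ((a ^ d)⁻¹) * C₁ * (2 ^ (d + 1) * polyWeight d (‖w‖ / t))) *
        polyWeight d (‖x - t⁻¹ • eucVec w‖ / (a / t)) := by
    filter_upwards [hσ.carried] with x hx
    have e0 : ‖((a : ℂ)⁻¹) ^ d‖ₑ = ENNReal.ofReal ((a ^ d)⁻¹) := by
      rw [← ofReal_norm, norm_pow, norm_inv, Complex.norm_real,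
        Real.norm_of_nonneg ha.le, inv_pow]
    have h1 := hpw (a⁻¹ • (w - t • WithLp.ofLp x))
    rw [hscale x] at h1
    have h2 : polyWeight d (‖x - t⁻¹ • eucVec w‖ / (a / t)) ≤
        2 ^ (d + 1) * polyWeight d (‖w‖ / t) := by
      refine polyWeight_le_mul (by positivity) ?_
      have h3 : ‖w‖ / t ≤ ‖t⁻¹ • eucVec w‖ := by
        rw [norm_smul, norm_inv, Real.norm_of_nonneg ht.le, div_eq_inv_mul]
        gcongr
        exact norm_le_norm_eucVec w
      have h4 : ‖t⁻¹ • eucVec w‖ ≤ 1 + ‖x - t⁻¹ • eucVec w‖ := by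
        have := norm_sub_norm_le (t⁻¹ • eucVec w) x
        rw [norm_sub_rev, hx] at this
        linarith
      have h5 : ‖x - t⁻¹ • eucVec w‖ ≤ ‖x - t⁻¹ • eucVec w‖ / (a / t) :=
        le_div_self (norm_nonneg _) (by positivity) ((div_le_one ht).2 hat)
      linarith [norm_nonneg (x - t⁻¹ • eucVec w)]
    rw [enorm_mul, e0]
    calc _ ≤ ENNReal.ofReal ((a ^ d)⁻¹) * (C₁ * (2 ^ (d + 1) * polyWeight d (‖w‖ / t) *
          polyWeight d (‖x - t⁻¹ • eucVec w‖ / (a / t)))) := by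
          gcongr
          exact h1.trans (by gcongr)
      _ = _ := by ring
  refine (lintegral_mono_ae hpt).trans ?_
  rw [lintegral_const_mul']
  swap
  · have : polyWeight d (‖w‖ / t) ≠ ∞ := ENNReal.ofReal_ne_top
    finiteness
  calc _ ≤ (ENNReal.ofReal ((a ^ d)⁻¹) * C₁ * (2 ^ (d + 1) * polyWeight d (‖w‖ / t))) *
        (C₂ * ENNReal.ofReal ((a / t) ^ (d - 1))) := by
        gcongr
        exact hC₂ _ _ (by positivity) ((div_le_one ht).2 hat)
    _ = C₁ * 2 ^ (d + 1) * C₂ * (ENNReal.ofReal ((a ^ d)⁻¹) * ENNReal.ofReal ((a / t) ^ (d - 1))) *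
        polyWeight d (‖w‖ / t) := by ring
    _ = _ := by
        rw [← ENNReal.ofReal_mul (by positivity)]
        have : (a ^ d)⁻¹ * (a / t) ^ (d - 1) = t / a * (t ^ d)⁻¹ := by
          obtain ⟨m, rfl⟩ : ∃ m, d = m + 1 := ⟨d - 1, by omega⟩
          rw [Nat.add_sub_cancel, div_pow]
          field_simp
          ring
        rw [this, ENNReal.ofReal_mul (by positivity)]
        push_cast
        ring

end EuclideanKernels

section KernelDomination

variable {d q : ℕ}

lemma polyWeight_le_tsum {u : ℝ} (hu : 0 ≤ u) :
    polyWeight d u ≤ ∑' k : ℕ, (2 : ℝ≥0∞) ^ (d + 1) * (2⁻¹ : ℝ≥0∞) ^ (k * (d + 1)) *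
      (if u ≤ 2 ^ k then 1 else 0) := by
  have key : ∀ k : ℕ, u ≤ 2 ^ k → (2 : ℝ) ^ k ≤ 2 * (1 + u) → polyWeight d u ≤
      ∑' k : ℕ, (2 : ℝ≥0∞) ^ (d + 1) * (2⁻¹ : ℝ≥0∞) ^ (k * (d + 1)) *
        (if u ≤ 2 ^ k then 1 else 0) := by
    intro k hk hk2
    refine le_trans ?_ (ENNReal.le_tsum k)
    rw [if_pos hk, mul_one, pow_mul, ← ENNReal.inv_pow]
    have e : (2 : ℝ≥0∞) ^ (d + 1) * (((2 : ℝ≥0∞) ^ k)⁻¹) ^ (d + 1) =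
        ENNReal.ofReal ((2 * (2 ^ k)⁻¹) ^ (d + 1)) := by
      rw [← mul_pow, ENNReal.ofReal_pow (by positivity), ENNReal.ofReal_mul (by norm_num),
        ENNReal.ofReal_inv_of_pos (by positivity), ENNReal.ofReal_pow (by norm_num)]
      norm_num
    rw [e, polyWeight]
    refine ENNReal.ofReal_le_ofReal ?_
    rw [Real.rpow_neg (by positivity), show ((d : ℝ) + 1) = ((d + 1 : ℕ) : ℝ) by push_cast; rfl,
      Real.rpow_natCast, ← inv_pow]
    refine pow_le_pow_left₀ (by positivity) ?_ _
    rw [inv_eq_one_div, div_le_iff₀ (by positivity)]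
    field_simp
    linarith
  rcases le_or_gt u 1 with h1 | h1
  · exact key 0 (by simpa using h1) (by simp; linarith)
  · obtain ⟨n, hn, hn2⟩ := exists_nat_pow_near h1.le (by norm_num : (1 : ℝ) < 2)
    refine key (n + 1) hn2.le ?_
    rw [pow_succ]; linarith

lemma tsum_polyWeight_le (F : (Fin d → ℤ) → ℝ≥0∞) {t : ℝ} (ht : 1 ≤ t) (x : Fin d → ℤ) :
    ∑' m : Fin d → ℤ, ENNReal.ofReal ((t ^ d)⁻¹) * polyWeight d (‖intVec m‖ / t) *
      F (x - (q : ℤ) • m) ≤ 3 ^ d * 2 ^ (d + 2) * maxFun q F x := by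
  have ht0 : 0 < t := by linarith
  have h1 : ∀ k : ℕ, ENNReal.ofReal ((t ^ d)⁻¹) * ∑' m : Fin d → ℤ,
      (if ‖intVec m‖ / t ≤ 2 ^ k then 1 else 0) * F (x - (q : ℤ) • m) ≤
        3 ^ d * 2 ^ (k * d) * maxFun q F x := by
    intro k
    set N : ℕ := ⌊t * 2 ^ k⌋₊ with hN
    have hb : 1 ≤ t * 2 ^ k := by
      have : (1 : ℝ) ≤ 2 ^ k := one_le_pow₀ (by norm_num)
      nlinarith
    have h2 : ∑' m : Fin d → ℤ, (if ‖intVec m‖ / t ≤ 2 ^ k then 1 else 0) * F (x - (q : ℤ) • m) ≤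
        ∑ m ∈ latticeCube d N, F (x - (q : ℤ) • m) := by
      rw [tsum_eq_sum (s := latticeCube d N)]
      · refine Finset.sum_le_sum fun m _ => ?_
        split_ifs <;> simp
      · intro m hm
        rw [if_neg, zero_mul]
        intro hle
        refine hm (mem_latticeCube.2 fun i => ?_)
        have h3 : ‖intVec m i‖ ≤ t * 2 ^ k := by
          rw [div_le_iff₀ ht0, mul_comm] at hle
          exact (norm_le_pi_norm _ i).trans hle
        have h4 : ((m i).natAbs : ℝ) ≤ t * 2 ^ k := by
          rwa [Nat.cast_natAbs, Int.cast_abs]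
        have h5 : (m i).natAbs ≤ N := Nat.le_floor h4
        rw [Int.abs_eq_natAbs]
        exact_mod_cast h5
    refine (mul_le_mul_right (h2.trans (sum_latticeCube_le q F N x)) _).trans ?_
    have e : (3 : ℝ≥0∞) ^ d * 2 ^ (k * d) = ENNReal.ofReal ((t ^ d)⁻¹) *
        ENNReal.ofReal (3 * (t * 2 ^ k)) ^ d := by
      rw [← ENNReal.ofReal_pow (by positivity), ← ENNReal.ofReal_mul (by positivity)]
      have : (t ^ d)⁻¹ * (3 * (t * 2 ^ k)) ^ d = 3 ^ d * 2 ^ (k * d) := by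
        rw [mul_pow, mul_pow, ← pow_mul]; field_simp
      rw [this, ENNReal.ofReal_mul (by positivity), ENNReal.ofReal_pow (by norm_num),
        ENNReal.ofReal_pow (by norm_num)]
      norm_num
    rw [← mul_assoc, e]
    gcongr
    have : (2 * N + 1 : ℝ≥0∞) = ENNReal.ofReal (2 * N + 1) := by
      rw [ENNReal.ofReal_add (by positivity) (by norm_num), ENNReal.ofReal_mul (by norm_num)]
      simp
    rw [this]
    refine ENNReal.ofReal_le_ofReal ?_
    have := Nat.floor_le (by positivity : 0 ≤ t * 2 ^ k)
    rw [← hN] at this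
    linarith
  calc _ ≤ ∑' m : Fin d → ℤ, ∑' k : ℕ, (2 : ℝ≥0∞) ^ (d + 1) * (2⁻¹ : ℝ≥0∞) ^ (k * (d + 1)) *
        (ENNReal.ofReal ((t ^ d)⁻¹) * ((if ‖intVec m‖ / t ≤ 2 ^ k then 1 else 0) *
          F (x - (q : ℤ) • m))) := by
        refine ENNReal.tsum_le_tsum fun m => ?_
        calc _ ≤ ENNReal.ofReal ((t ^ d)⁻¹) * (∑' k : ℕ, (2 : ℝ≥0∞) ^ (d + 1) *
              (2⁻¹ : ℝ≥0∞) ^ (k * (d + 1)) * (if ‖intVec m‖ / t ≤ 2 ^ k then 1 else 0)) *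
              F (x - (q : ℤ) • m) := by
              gcongr; exact polyWeight_le_tsum (by positivity)
          _ = _ := by
              rw [← ENNReal.tsum_mul_left, ← ENNReal.tsum_mul_right]
              exact tsum_congr fun k => by ring
    _ = ∑' k : ℕ, (2 : ℝ≥0∞) ^ (d + 1) * (2⁻¹ : ℝ≥0∞) ^ (k * (d + 1)) *
        (ENNReal.ofReal ((t ^ d)⁻¹) * ∑' m : Fin d → ℤ,
          ((if ‖intVec m‖ / t ≤ 2 ^ k then 1 else 0) * F (x - (q : ℤ) • m))) := by
        rw [ENNReal.tsum_comm]
        simp_rw [ENNReal.tsum_mul_left]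
    _ ≤ ∑' k : ℕ, (2 : ℝ≥0∞) ^ (d + 1) * (2⁻¹ : ℝ≥0∞) ^ (k * (d + 1)) *
        (3 ^ d * 2 ^ (k * d) * maxFun q F x) := by
        exact ENNReal.tsum_le_tsum fun k => mul_le_mul_right (h1 k) _
    _ = ∑' k : ℕ, (2 : ℝ≥0∞) ^ (d + 1) * 3 ^ d * maxFun q F x * (2⁻¹ : ℝ≥0∞) ^ k := by
        refine tsum_congr fun k => ?_
        have : (2⁻¹ : ℝ≥0∞) ^ (k * (d + 1)) * 2 ^ (k * d) = 2⁻¹ ^ k := by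
          rw [mul_add, mul_one, pow_add, mul_right_comm, ← mul_pow,
            ENNReal.inv_mul_cancel (by norm_num) (by norm_num), one_pow, one_mul]
        rw [← this]; ring
    _ = _ := by
        rw [ENNReal.tsum_mul_left, ENNReal.tsum_geometric, ENNReal.one_sub_inv_two, inv_inv]
        ring

/-- The weighted sum of translates of `|f|` controlling a periodic multiplier. -/
def kerSum (q : ℕ) [NeZero q] (κ : (Fin d → ZMod q) → ℂ) (f : (Fin d → ℤ) → ℂ)
    (y : Fin d → ℤ) : ℝ≥0∞ :=
  ∑ r : Fin d → ZMod q, (q : ℝ≥0∞)⁻¹ ^ d * ‖κ r‖ₑ * ‖f (y - fun i => ((r i).val : ℤ))‖ₑ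

lemma tsum_kerSum_le [NeZero q] {κ : (Fin d → ZMod q) → ℂ} {Λ : ℝ}
    (hκ : ((q : ℝ)⁻¹) ^ d * ∑ r, ‖κ r‖ ≤ Λ) (f : (Fin d → ℤ) → ℂ) :
    ∑' y, kerSum q κ f y ≤ ENNReal.ofReal Λ * ∑' y, ‖f y‖ₑ := by
  have hq : (0 : ℝ) < q := by exact_mod_cast NeZero.pos q
  simp only [kerSum]
  rw [Summable.tsum_finsetSum fun _ _ => ENNReal.summable]
  have h : ∀ r : Fin d → ZMod q, ∑' y : Fin d → ℤ, (q : ℝ≥0∞)⁻¹ ^ d * ‖κ r‖ₑ *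
      ‖f (y - fun i => ((r i).val : ℤ))‖ₑ = (q : ℝ≥0∞)⁻¹ ^ d * ‖κ r‖ₑ * ∑' y, ‖f y‖ₑ := by
    intro r
    rw [ENNReal.tsum_mul_left]
    congr 1
    exact (Equiv.subRight (fun i => ((r i).val : ℤ))).tsum_eq fun y => ‖f y‖ₑ
  simp_rw [h]
  rw [← Finset.sum_mul, ← Finset.mul_sum]
  gcongr
  have e : (q : ℝ≥0∞)⁻¹ = ENNReal.ofReal ((q : ℝ)⁻¹) := by
    rw [ENNReal.ofReal_inv_of_pos hq, ENNReal.ofReal_natCast]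
  simp_rw [← ofReal_norm]
  rw [e, ← ENNReal.ofReal_pow (by positivity), ← ENNReal.ofReal_sum_of_nonneg fun _ _ => norm_nonneg _,
    ← ENNReal.ofReal_mul (by positivity)]
  exact ENNReal.ofReal_le_ofReal hκ

lemma enorm_mulOp_perMul_le [NeZero q] (k : (Fin d → ZMod q) → ℂ) {B : (Fin d → ℝ) → ℂ}
    (hB : QuarterSupported B) (hc : Continuous B) {t : ℝ} (ht : 1 ≤ t) {A : ℝ≥0∞}
    (hA : ∀ w : Fin d → ℝ, ‖euclFT B w‖ₑ ≤
      A * ENNReal.ofReal ((t ^ d)⁻¹) * polyWeight d (‖w‖ / t))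
    {f : (Fin d → ℤ) → ℂ} (hf : f.support.Finite) (x : Fin d → ℤ) :
    ‖mulOp d (perMul q k B) f x‖ₑ ≤ A * (2 ^ (d + 1) * (3 ^ d * 2 ^ (d + 2))) *
      maxFun q (kerSum q (ringFT ZMod.stdAddChar k) f) x := by
  have hq : (0 : ℝ) < q := by exact_mod_cast NeZero.pos q
  have ht0 : 0 < t := by linarith
  rw [mulOp_eq_tsum (continuousOn_perMul k hB hc) hf]
  refine (enorm_tsum_le_tsum_enorm).trans ?_
  set κ := ringFT ZMod.stdAddChar k with hκ
  have hpt : ∀ (r : Fin d → ZMod q) (m : Fin d → ℤ),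
      ‖f (x - divModVec d q (r, m))‖ₑ * ‖mulKernel (perMul q k B) (divModVec d q (r, m))‖ₑ ≤
      A * 2 ^ (d + 1) * (ENNReal.ofReal ((t ^ d)⁻¹) * polyWeight d (‖intVec m‖ / t) *
        ((q : ℝ≥0∞)⁻¹ ^ d * ‖κ r‖ₑ * ‖f (x - (q : ℤ) • m - fun i => ((r i).val : ℤ))‖ₑ)) := by
    intro r m
    have hr : redMod q (divModVec d q (r, m)) = r := by
      funext i; simp [redMod, divModVec]
    have hx : x - divModVec d q (r, m) = x - (q : ℤ) • m - fun i => ((r i).val : ℤ) := by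
      funext i
      simp only [divModVec, Equiv.coe_fn_mk, Pi.sub_apply, Pi.smul_apply, smul_eq_mul]
      ring
    have hw : polyWeight d (‖fun i => ((divModVec d q (r, m) i : ℤ) : ℝ) / q‖ / t) ≤
        2 ^ (d + 1) * polyWeight d (‖intVec m‖ / t) := by
      refine polyWeight_le_mul (by positivity) ?_
      have h1 : ‖intVec m‖ ≤ ‖fun i => ((divModVec d q (r, m) i : ℤ) : ℝ) / q‖ + 1 := by
        refine (pi_norm_le_iff_of_nonneg (by positivity)).2 fun i => ?_
        have h2 := norm_le_pi_norm (fun i => ((divModVec d q (r, m) i : ℤ) : ℝ) / q) i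
        have h3 : intVec m i = ((divModVec d q (r, m) i : ℤ) : ℝ) / q - ((r i).val : ℝ) / q := by
          simp only [divModVec, Equiv.coe_fn_mk, intVec]
          push_cast
          field_simp
          ring
        rw [h3]
        refine (norm_sub_le _ _).trans (add_le_add h2 ?_)
        rw [Real.norm_of_nonneg (by positivity), div_le_one hq]
        exact_mod_cast (ZMod.val_lt (r i)).le
      have h4 : ‖intVec m‖ / t ≤ ‖fun i => ((divModVec d q (r, m) i : ℤ) : ℝ) / q‖ / t + 1 := by
        calc _ ≤ (‖fun i => ((divModVec d q (r, m) i : ℤ) : ℝ) / q‖ + 1) / t := by gcongr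
          _ ≤ _ := by
            rw [add_div]
            gcongr
            exact (div_le_one ht0).2 ht
      have h5 : 0 ≤ ‖fun i => ((divModVec d q (r, m) i : ℤ) : ℝ) / q‖ / t := by positivity
      linarith
    rw [mulKernel_perMul k hB hc, hr, hx, enorm_mul, enorm_mul, enorm_pow, enorm_inv (by exact_mod_cast NeZero.ne q),
      ← hκ]
    have e : ‖(q : ℂ)‖ₑ = (q : ℝ≥0∞) := by
      rw [← ofReal_norm, Complex.norm_natCast, ENNReal.ofReal_natCast]
    rw [e]
    calc _ ≤ ‖f (x - (q : ℤ) • m - fun i => ((r i).val : ℤ))‖ₑ * ((q : ℝ≥0∞)⁻¹ ^ d * ‖κ r‖ₑ *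
          (A * ENNReal.ofReal ((t ^ d)⁻¹) * (2 ^ (d + 1) * polyWeight d (‖intVec m‖ / t)))) := by
          gcongr
          exact (hA _).trans (by gcongr)
      _ = _ := by ring
  calc ∑' y, ‖f y * mulKernel (perMul q k B) (x - y)‖ₑ
      = ∑' z, ‖f (x - z)‖ₑ * ‖mulKernel (perMul q k B) z‖ₑ := by
        rw [← (Equiv.subLeft x).tsum_eq]
        refine tsum_congr fun z => ?_
        simp [enorm_mul]
    _ = ∑' p : (Fin d → ZMod q) × (Fin d → ℤ), ‖f (x - divModVec d q p)‖ₑ *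
          ‖mulKernel (perMul q k B) (divModVec d q p)‖ₑ :=
        ((divModVec d q).tsum_eq fun z => ‖f (x - z)‖ₑ * ‖mulKernel (perMul q k B) z‖ₑ).symm
    _ = ∑' m : Fin d → ℤ, ∑ r : Fin d → ZMod q, ‖f (x - divModVec d q (r, m))‖ₑ *
          ‖mulKernel (perMul q k B) (divModVec d q (r, m))‖ₑ := by
        rw [ENNReal.tsum_prod', ENNReal.tsum_comm]
        simp_rw [tsum_fintype]
    _ ≤ ∑' m : Fin d → ℤ, A * 2 ^ (d + 1) * (ENNReal.ofReal ((t ^ d)⁻¹) *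
          polyWeight d (‖intVec m‖ / t) * kerSum q κ f (x - (q : ℤ) • m)) := by
        refine ENNReal.tsum_le_tsum fun m => ?_
        rw [kerSum, Finset.mul_sum, Finset.mul_sum]
        exact Finset.sum_le_sum fun r _ => hpt r m
    _ ≤ A * 2 ^ (d + 1) * (3 ^ d * 2 ^ (d + 2) * maxFun q (kerSum q κ f) x) := by
        rw [ENNReal.tsum_mul_left]
        gcongr
        exact tsum_polyWeight_le _ ht x
    _ = _ := by ring

end KernelDomination

section LacunarySums

/-- Sets of positive reals which are lacunary with ratio `c`. -/
def LacunaryWith (c : ℝ) (R : Set ℝ) : Prop :=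
  (∀ r ∈ R, 0 < r) ∧ ∀ r ∈ R, ∀ s ∈ R, r < s → c * r ≤ s

lemma LacunaryWith.mono {c : ℝ} {R R' : Set ℝ} (h : LacunaryWith c R) (hR : R' ⊆ R) :
    LacunaryWith c R' :=
  ⟨fun r hr => h.1 r (hR hr), fun r hr s hs => h.2 r (hR hr) s (hR hs)⟩

lemma LacunaryWith.injective_floor_log {c : ℝ} (hc : 1 < c) {R : Set ℝ} (h : LacunaryWith c R)
    {s : ℝ} (hs : 0 < s) :
    Function.Injective fun r : R => ⌊Real.log (r * s) / Real.log c⌋ := by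
  have hlog : 0 < Real.log c := Real.log_pos hc
  have key : ∀ r r' : R, (r : ℝ) < r' →
      ⌊Real.log (r * s) / Real.log c⌋ < ⌊Real.log (r' * s) / Real.log c⌋ := by
    intro r r' hlt
    have hr : 0 < (r : ℝ) := h.1 _ r.2
    have h1 : Real.log c + Real.log (r * s) ≤ Real.log (r' * s) := by
      rw [← Real.log_mul (by positivity) (by positivity), ← mul_assoc]
      refine Real.log_le_log (by positivity) ?_
      have := h.2 _ r.2 _ r'.2 hlt
      gcongr
    have h2 : Real.log (r * s) / Real.log c + 1 ≤ Real.log (r' * s) / Real.log c := by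
      rw [div_add_one hlog.ne', div_le_div_iff_of_pos_right hlog]
      linarith
    have h3 := Int.floor_le_floor h2
    rw [Int.floor_add_one] at h3
    omega
  intro r r' he
  by_contra hne
  rcases lt_or_gt_of_ne (fun e => hne (Subtype.ext e)) with h1 | h1
  · exact absurd he (key _ _ h1).ne
  · exact absurd he (key _ _ h1).ne'

lemma LacunaryWith.countable {c : ℝ} (hc : 1 < c) {R : Set ℝ} (h : LacunaryWith c R) :
    Countable R := (h.injective_floor_log hc one_pos).countable

lemma exists_lacunary_sum_bound {c : ℝ} (hc : 1 < c) : ∃ C : ℝ≥0, ∀ R : Set ℝ, LacunaryWith c R →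
    ∀ s : ℝ, 0 ≤ s → ∑' r : R, ENNReal.ofReal (min (r * s) ((r * s)⁻¹)) ≤ C := by
  have hc0 : 0 < c := by linarith
  have hlog : 0 < Real.log c := Real.log_pos hc
  have hgeo : Summable fun n : ℕ => (c⁻¹) ^ n :=
    summable_geometric_of_lt_one (by positivity) (inv_lt_one_of_one_lt₀ hc)
  have hsum : Summable fun n : ℤ => c * (c⁻¹) ^ n.natAbs := by
    refine Summable.mul_left _ (Summable.of_nat_of_neg ?_ ?_) <;> simpa using hgeo
  refine ⟨Real.toNNReal (∑' n : ℤ, c * (c⁻¹) ^ n.natAbs), fun R hR s hs => ?_⟩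
  rcases hs.eq_or_lt with rfl | hs
  · simp
  have hpt : ∀ r : R, ENNReal.ofReal (min (r * s) ((r * s)⁻¹)) ≤
      ENNReal.ofReal (c * (c⁻¹) ^ (⌊Real.log (r * s) / Real.log c⌋).natAbs) := by
    intro r
    refine ENNReal.ofReal_le_ofReal ?_
    have hr : 0 < (r : ℝ) := hR.1 _ r.2
    set u : ℝ := r * s with hu
    have hu0 : 0 < u := by positivity
    set n : ℤ := ⌊Real.log u / Real.log c⌋ with hn
    have h1 : (n : ℝ) * Real.log c ≤ Real.log u := by
      rw [← le_div_iff₀ hlog]; exact Int.floor_le _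
    have h2 : Real.log u < (n + 1 : ℝ) * Real.log c := by
      rw [← div_lt_iff₀ hlog]; exact Int.lt_floor_add_one _
    have h3 : c ^ n ≤ u := by
      rw [← Real.log_le_log_iff (by positivity) hu0, Real.log_zpow]; exact h1
    have h4 : u ≤ c ^ (n + 1) := by
      rw [← Real.log_le_log_iff hu0 (by positivity), Real.log_zpow]; push_cast; exact h2.le
    rcases le_or_gt 0 n with h0 | h0
    · obtain ⟨m, hm⟩ := Int.eq_ofNat_of_zero_le h0
      rw [hm] at h3 ⊢
      rw [zpow_natCast] at h3
      calc min u u⁻¹ ≤ u⁻¹ := min_le_right _ _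
        _ ≤ (c ^ m)⁻¹ := by gcongr
        _ ≤ c * (c ^ m)⁻¹ := le_mul_of_one_le_left (by positivity) hc.le
        _ = _ := by rw [inv_pow]; rfl
    · obtain ⟨m, hm⟩ := Int.eq_ofNat_of_zero_le (neg_nonneg.2 h0.le)
      have hm' : n = -(m : ℤ) := by omega
      rw [hm'] at h4 ⊢
      calc min u u⁻¹ ≤ u := min_le_left _ _
        _ ≤ c ^ (-(m : ℤ) + 1) := h4
        _ = c * (c⁻¹) ^ m := by
            rw [zpow_add₀ hc0.ne', zpow_neg, zpow_natCast, zpow_one, inv_pow, mul_comm]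
        _ = _ := by simp
  calc _ ≤ ∑' r : R, ENNReal.ofReal (c * (c⁻¹) ^ (⌊Real.log (r * s) / Real.log c⌋).natAbs) :=
        ENNReal.tsum_le_tsum hpt
    _ ≤ ∑' n : ℤ, ENNReal.ofReal (c * (c⁻¹) ^ n.natAbs) :=
        ENNReal.tsum_comp_le_tsum_of_injective (hR.injective_floor_log hc hs)
          fun n : ℤ => ENNReal.ofReal (c * (c⁻¹) ^ n.natAbs)
    _ = _ := by
        rw [← ENNReal.ofReal_tsum_of_nonneg (fun n => by positivity) hsum]
        rfl

end LacunarySums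

section StrongType

variable {d q : ℕ}

lemma exists_strong_type {c : ℝ} (hc : 1 < c) : ∃ C : ℝ≥0, ∀ (d q : ℕ) [NeZero q] (R : Set ℝ),
    LacunaryWith c R → ∀ (k : (Fin d → ZMod q) → ℂ) (Λ A lam : ℝ), (∀ n, ‖k n‖ ≤ Λ) → 0 ≤ Λ →
      0 ≤ A → 0 ≤ lam → ∀ B : ℝ → (Fin d → ℝ) → ℂ, (∀ r ∈ R, QuarterSupported (B r)) →
      (∀ r ∈ R, Continuous (B r)) →
      (∀ r ∈ R, ∀ η, ‖B r η‖ ^ 2 ≤ A ^ 2 * min (r * (lam * ‖η‖)) ((r * (lam * ‖η‖))⁻¹)) →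
      ∀ f : (Fin d → ℤ) → ℂ, f.support.Finite →
        ∑' x, (⨆ r : R, ‖mulOp d (perMul q k (B r)) f x‖ₑ) ^ 2 ≤
          ENNReal.ofReal ((A * Λ) ^ 2) * C * ∑' x, ‖f x‖ₑ ^ 2 := by
  obtain ⟨C, hC⟩ := exists_lacunary_sum_bound hc
  refine ⟨C, fun d q _ R hR k Λ A lam hk hΛ hA hlam B hB hBc hBb f hf => ?_⟩
  have := hR.countable hc
  refine square_function_le (fun r : R => continuousOn_perMul k (hB r r.2) (hBc r r.2))
    (fun ξ _ => ?_) hf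
  set η : Fin d → ℝ := (q : ℝ) • ξ - intVec (roundVec ((q : ℝ) • ξ)) with hη
  calc ∑' r : R, ‖perMul q k (B r) ξ‖ₑ ^ 2 ≤
      ∑' r : R, ENNReal.ofReal ((A * Λ) ^ 2) *
        ENNReal.ofReal (min (r * (lam * ‖η‖)) ((r * (lam * ‖η‖))⁻¹)) := by
        refine ENNReal.tsum_le_tsum fun r => ?_
        rw [perMul_eq_single k (hB r r.2), ← hη, ← ofReal_norm,
          ← ENNReal.ofReal_pow (norm_nonneg _), ← ENNReal.ofReal_mul (by positivity)]
        refine ENNReal.ofReal_le_ofReal ?_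
        rw [norm_mul, mul_pow, mul_pow, mul_comm (A ^ 2), mul_assoc]
        exact mul_le_mul (pow_le_pow_left₀ (norm_nonneg _) (hk _) 2) (hBb r r.2 η) (by positivity)
          (by positivity)
    _ ≤ _ := by
        rw [ENNReal.tsum_mul_left]
        gcongr
        exact hC R hR _ (by positivity)

end StrongType

section DyadicPieces

variable {d : ℕ} {Ψ : (Fin d → ℝ) → ℝ} {σ : Measure (EuclideanSpace ℝ (Fin d))}

lemma IsBump.eq_zero_of_lt_norm (h : IsBump d Ψ) {η : Fin d → ℝ} (hη : 1 / 4 < ‖η‖) : Ψ η = 0 := by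
  refine h.2.1 η fun hm => hη.not_ge ?_
  exact (pi_norm_le_iff_of_nonneg (by norm_num)).2 fun i => _root_.abs_le.2 ⟨hm.1 i, hm.2 i⟩

lemma IsBump.norm_le_of_ne_zero (h : IsBump d Ψ) {η : Fin d → ℝ} (hη : Ψ η ≠ 0) : ‖η‖ ≤ 1 / 4 :=
  not_lt.1 fun hc => hη (h.eq_zero_of_lt_norm hc)

lemma IsBump.eq_one_of_norm_le (h : IsBump d Ψ) {η : Fin d → ℝ} (hη : ‖η‖ ≤ 1 / 8) : Ψ η = 1 := by
  refine h.2.2 η ⟨fun i => ?_, fun i => ?_⟩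
  · exact (_root_.abs_le.1 ((norm_le_pi_norm η i).trans hη)).1
  · exact (_root_.abs_le.1 ((norm_le_pi_norm η i).trans hη)).2

lemma IsBump.exists_bound (h : IsBump d Ψ) : ∃ C : ℝ, 1 ≤ C ∧ ∀ η, |Ψ η| ≤ C := by
  obtain ⟨C, hC⟩ := (isCompact_Icc (a := fun _ : Fin d => -(1 / 4 : ℝ))
    (b := fun _ => (1 / 4 : ℝ))).exists_bound_of_continuousOn h.continuous.continuousOn
  refine ⟨max C 1, le_max_right _ _, fun η => ?_⟩
  by_cases hη : η ∈ Set.Icc (fun _ : Fin d => -(1 / 4 : ℝ)) (fun _ => (1 / 4 : ℝ))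
  · exact (hC η hη).trans (le_max_left _ _)
  · rw [h.2.1 η hη, abs_zero]; positivity

/-- The low-frequency piece of the spherical multiplier. -/
def lowPiece (Ψ : (Fin d → ℝ) → ℝ) (σ : Measure (EuclideanSpace ℝ (Fin d))) (a t : ℝ)
    (η : Fin d → ℝ) : ℂ := (Ψ (a • η) : ℂ) * sphHat σ (t • η)

lemma IsBump.quarterSupported_lowPiece (h : IsBump d Ψ) {a : ℝ} (ha : 1 ≤ a) (t : ℝ) :
    QuarterSupported (lowPiece Ψ σ a t) := by
  intro η hη
  by_contra hc
  have h1 : Ψ (a • η) ≠ 0 := fun h0 => hc (by simp [lowPiece, h0])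
  have h2 := h.norm_le_of_ne_zero h1
  rw [norm_smul, Real.norm_of_nonneg (by linarith)] at h2
  have h3 : ‖η‖ ≤ 1 / 4 := (le_mul_of_one_le_left (norm_nonneg _) ha).trans h2
  refine hη ⟨fun i => ?_, fun i => ?_⟩
  · exact (_root_.abs_le.1 ((norm_le_pi_norm η i).trans h3)).1
  · exact (_root_.abs_le.1 ((norm_le_pi_norm η i).trans h3)).2

lemma IsBump.continuous_lowPiece [IsFiniteMeasure σ] (h : IsBump d Ψ) (a t : ℝ) :
    Continuous (lowPiece Ψ σ a t) :=
  (Complex.continuous_ofReal.comp (h.continuous.comp (continuous_const_smul a))).mul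
    (continuous_sphHat.comp (continuous_const_smul t))

/-- The dyadic pieces of the spherical multiplier. -/
def highPiece (Ψ : (Fin d → ℝ) → ℝ) (σ : Measure (EuclideanSpace ℝ (Fin d))) (a t : ℝ)
    (η : Fin d → ℝ) : ℂ := lowPiece Ψ σ a t η - lowPiece Ψ σ (2 * a) t η

lemma QuarterSupported.sub {B B' : (Fin d → ℝ) → ℂ} (h : QuarterSupported B)
    (h' : QuarterSupported B') : QuarterSupported fun η => B η - B' η :=
  fun η hη => by simp [h η hη, h' η hη]

lemma IsBump.quarterSupported_highPiece (h : IsBump d Ψ) {a : ℝ} (ha : 1 ≤ a) (t : ℝ) :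
    QuarterSupported (highPiece Ψ σ a t) :=
  (h.quarterSupported_lowPiece ha t).sub (h.quarterSupported_lowPiece (by linarith) t)

lemma IsBump.continuous_highPiece [IsFiniteMeasure σ] (h : IsBump d Ψ) (a t : ℝ) :
    Continuous (highPiece Ψ σ a t) :=
  (h.continuous_lowPiece a t).sub (h.continuous_lowPiece (2 * a) t)

lemma IsSphereMeasure.exists_highPiece_bound (hd : 2 ≤ d) (hσ : IsSphereMeasure σ)
    (h : IsBump d Ψ) : ∃ C : ℝ, 0 < C ∧ ∀ (j : ℕ) (a t : ℝ), 0 < a → a * 2 ^ j ≤ t →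
      t ≤ a * 2 ^ (j + 1) → ∀ η,
      ‖highPiece Ψ σ a t η‖ ^ 2 ≤ (C * ((2 : ℝ) ^ (-(((d : ℝ) - 2) / 2))) ^ j) ^ 2 *
        min (t * ((2 ^ j)⁻¹ * ‖η‖)) ((t * ((2 ^ j)⁻¹ * ‖η‖))⁻¹) := by
  obtain ⟨C₁, hC₁, hb₁⟩ := h.exists_bound
  obtain ⟨C₂, hC₂, hb₂⟩ := hσ.exists_decay hd
  set α : ℝ := ((d : ℝ) - 2) / 2 with hα
  have hα0 : 0 ≤ α := by
    have : (2 : ℝ) ≤ d := by exact_mod_cast hd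
    rw [hα]; linarith
  have hpα : 0 < (16 : ℝ) ^ α := by positivity
  refine ⟨4 * (2 * C₁ * C₂ * 16 ^ α), by positivity, fun j a t ha h1 h2 η => ?_⟩
  have h2j : (0 : ℝ) < 2 ^ j := by positivity
  have ht : 0 < t := lt_of_lt_of_le (by positivity) h1
  by_cases hz : highPiece Ψ σ a t η = 0
  · rw [hz, norm_zero]
    have : 0 ≤ min (t * ((2 ^ j)⁻¹ * ‖η‖)) ((t * ((2 ^ j)⁻¹ * ‖η‖))⁻¹) :=
      le_min (by positivity) (by positivity)
    simpa using mul_nonneg (sq_nonneg _) this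
  have hfac : highPiece Ψ σ a t η = ((Ψ (a • η) : ℂ) - Ψ ((2 * a) • η)) * sphHat σ (t • η) := by
    rw [highPiece, lowPiece, lowPiece]; ring
  have hup : a * ‖η‖ ≤ 1 / 4 := by
    by_contra hc
    push Not at hc
    refine hz ?_
    have e1 : Ψ (a • η) = 0 := h.eq_zero_of_lt_norm (by
      rwa [norm_smul, Real.norm_of_nonneg ha.le])
    have e2 : Ψ ((2 * a) • η) = 0 := h.eq_zero_of_lt_norm (by
      rw [norm_smul, Real.norm_of_nonneg (by positivity)]; linarith)
    rw [hfac, e1, e2]; simp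
  have hlow : 1 / 16 ≤ a * ‖η‖ := by
    by_contra hc
    push Not at hc
    refine hz ?_
    have e1 : Ψ (a • η) = 1 := h.eq_one_of_norm_le (by
      rw [norm_smul, Real.norm_of_nonneg ha.le]; linarith)
    have e2 : Ψ ((2 * a) • η) = 1 := h.eq_one_of_norm_le (by
      rw [norm_smul, Real.norm_of_nonneg (by positivity)]; linarith)
    rw [hfac, e1, e2]; simp
  have hn : 0 < ‖η‖ := by
    by_contra hc
    have : ‖η‖ = 0 := le_antisymm (not_lt.1 hc) (norm_nonneg _)
    rw [this] at hlow; norm_num at hlow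
  set u : ℝ := t * ((2 ^ j)⁻¹ * ‖η‖) with hu
  have hul : 1 / 16 ≤ u := by
    calc 1 / 16 ≤ a * ‖η‖ := hlow
      _ = (a * 2 ^ j) * ((2 ^ j)⁻¹ * ‖η‖) := by field_simp
      _ ≤ u := by rw [hu]; gcongr
  have huu : u ≤ 1 / 2 := by
    calc u ≤ (a * 2 ^ (j + 1)) * ((2 ^ j)⁻¹ * ‖η‖) := by rw [hu]; gcongr
      _ = 2 * (a * ‖η‖) := by rw [pow_succ]; field_simp
      _ ≤ _ := by linarith
  have hu0 : 0 < u := by linarith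
  have hmin : 1 / 16 ≤ min u u⁻¹ := by
    refine le_min hul ?_
    rw [inv_eq_one_div, le_div_iff₀ hu0]; linarith
  have hdec : ‖sphHat σ (t • η)‖ ≤ C₂ * (16 ^ α * ((2 : ℝ) ^ (-α)) ^ j) := by
    refine (hb₂ _).trans ?_
    gcongr
    have hbase : (2 : ℝ) ^ j / 16 ≤ 1 + ‖eucVec (t • η)‖ := by
      have e1 := norm_le_norm_eucVec (t • η)
      rw [norm_smul, Real.norm_of_nonneg ht.le] at e1
      have e2 : t * ‖η‖ = 2 ^ j * u := by rw [hu]; field_simp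
      nlinarith
    calc (1 + ‖eucVec (t • η)‖) ^ (-α) ≤ ((2 : ℝ) ^ j / 16) ^ (-α) :=
          Real.rpow_le_rpow_of_nonpos (by positivity) hbase (by linarith)
      _ = 16 ^ α * ((2 : ℝ) ^ (-α)) ^ j := by
          rw [Real.div_rpow (by positivity) (by norm_num), Real.rpow_neg (by norm_num : (0:ℝ) ≤ 16),
            div_inv_eq_mul, mul_comm, ← Real.rpow_natCast, ← Real.rpow_natCast,
            ← Real.rpow_mul (by norm_num), ← Real.rpow_mul (by norm_num), mul_comm (j : ℝ)]
  have hnorm : ‖highPiece Ψ σ a t η‖ ≤ 2 * C₁ * C₂ * 16 ^ α * ((2 : ℝ) ^ (-α)) ^ j := by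
    rw [hfac, norm_mul]
    have e1 : ‖(Ψ (a • η) : ℂ) - Ψ ((2 * a) • η)‖ ≤ 2 * C₁ := by
      refine (norm_sub_le _ _).trans ?_
      rw [Complex.norm_real, Complex.norm_real]
      have := hb₁ (a • η)
      have := hb₁ ((2 * a) • η)
      simp only [Real.norm_eq_abs]
      linarith
    calc _ ≤ 2 * C₁ * (C₂ * (16 ^ α * ((2 : ℝ) ^ (-α)) ^ j)) := by gcongr
      _ = _ := by ring
  calc ‖highPiece Ψ σ a t η‖ ^ 2 ≤ (2 * C₁ * C₂ * 16 ^ α * ((2 : ℝ) ^ (-α)) ^ j) ^ 2 := by gcongr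
    _ = (4 * (2 * C₁ * C₂ * 16 ^ α) * ((2 : ℝ) ^ (-α)) ^ j) ^ 2 * (1 / 16) := by ring
    _ ≤ _ := by gcongr

end DyadicPieces

section DirichletAverage

variable {d : ℕ} {Ψ : (Fin d → ℝ) → ℝ} {σ : Measure (EuclideanSpace ℝ (Fin d))}

/-- The normalized exponential sum over the lattice box `[0, N)^d`. -/
def boxAvg (d N : ℕ) (η : Fin d → ℝ) : ℂ :=
  ((N : ℂ)⁻¹) ^ d * ∑ v ∈ Fintype.piFinset fun _ : Fin d => Finset.range N,
    eC (∑ i, (v i : ℝ) * η i)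

lemma boxAvg_eq_prod (N : ℕ) (η : Fin d → ℝ) :
    boxAvg d N η = ∏ i, ((N : ℂ)⁻¹ * ∑ v ∈ Finset.range N, eC ((v : ℝ) * η i)) := by
  rw [boxAvg, Finset.prod_mul_distrib, Finset.prod_const, Finset.card_univ, Fintype.card_fin,
    Finset.prod_univ_sum]
  congr 1
  exact Finset.sum_congr rfl fun v _ => eC_sum _ _

lemma norm_avg_eC_le_one (N : ℕ) (y : ℝ) :
    ‖(N : ℂ)⁻¹ * ∑ v ∈ Finset.range N, eC ((v : ℝ) * y)‖ ≤ 1 := by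
  rw [norm_mul, norm_inv, Complex.norm_natCast]
  have : ‖∑ v ∈ Finset.range N, eC ((v : ℝ) * y)‖ ≤ N := by
    refine (norm_sum_le _ _).trans ?_
    simp [norm_eC]
  exact (mul_le_mul_of_nonneg_left this (by positivity)).trans inv_mul_le_one

lemma two_mul_abs_le_norm_eC_sub_one {y : ℝ} (hy : |y| ≤ 1 / 2) : 4 * |y| ≤ ‖eC y - 1‖ := by
  have e : eC y - 1 = eC (y / 2) * (2 * Complex.I * (Real.sin (Real.pi * y) : ℂ)) := by
    have h1 : eC y = eC (y / 2) * eC (y / 2) := by rw [← eC_add]; congr 1; ring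
    have h2 : (1 : ℂ) = eC (y / 2) * eC (-(y / 2)) := by
      rw [← eC_add, add_neg_cancel, eC_zero]
    have h3 : eC (y / 2) - eC (-(y / 2)) = 2 * Complex.I * (Real.sin (Real.pi * y) : ℂ) := by
      have e1 : eC (y / 2) = Complex.exp ((Real.pi * y : ℝ) * Complex.I) := by
        rw [eC]; congr 1; push_cast; ring
      have e2 : eC (-(y / 2)) = Complex.exp (-(Real.pi * y : ℝ) * Complex.I) := by
        rw [eC]; congr 1; push_cast; ring
      rw [e1, e2, Complex.ofReal_sin, Complex.sin]
      ring_nf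
      rw [Complex.I_sq]; ring
    calc eC y - 1 = eC (y / 2) * eC (y / 2) - eC (y / 2) * eC (-(y / 2)) := by rw [← h1, ← h2]
      _ = _ := by rw [← mul_sub, h3]
  rw [e, norm_mul, norm_eC, one_mul, norm_mul, norm_mul, Complex.norm_I, Complex.norm_real]
  have h4 := Real.mul_abs_le_abs_sin (x := Real.pi * y) (by
    rw [abs_mul, abs_of_pos Real.pi_pos]; nlinarith [Real.pi_pos])
  rw [abs_mul, abs_of_pos Real.pi_pos] at h4
  have h5 : 2 / Real.pi * (Real.pi * |y|) = 2 * |y| := by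
    field_simp
  rw [h5] at h4
  simp only [Real.norm_eq_abs, Complex.norm_ofNat]
  linarith

lemma norm_avg_eC_le {N : ℕ} (hN : 0 < N) {y : ℝ} (hy : |y| ≤ 1 / 2) (hy0 : y ≠ 0) :
    ‖(N : ℂ)⁻¹ * ∑ v ∈ Finset.range N, eC ((v : ℝ) * y)‖ ≤ (N * |y|)⁻¹ := by
  have hN' : (0 : ℝ) < N := by exact_mod_cast hN
  have hy1 : 0 < |y| := abs_pos.2 hy0
  have h1 := two_mul_abs_le_norm_eC_sub_one hy
  have hpow : ∀ v : ℕ, eC ((v : ℝ) * y) = eC y ^ v := by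
    intro v
    rw [eC, eC, ← Complex.exp_nat_mul]; congr 1; push_cast; ring
  have h2 : ‖∑ v ∈ Finset.range N, eC ((v : ℝ) * y)‖ * ‖eC y - 1‖ ≤ 2 := by
    rw [← norm_mul]
    simp_rw [hpow]
    rw [geom_sum_mul, ← hpow]
    refine (norm_sub_le _ _).trans ?_
    rw [norm_eC, norm_one]; norm_num
  have h3 : ‖∑ v ∈ Finset.range N, eC ((v : ℝ) * y)‖ ≤ |y|⁻¹ := by
    rw [← one_div, le_div_iff₀ hy1]
    have := mul_le_mul_of_nonneg_left h1 (norm_nonneg (∑ v ∈ Finset.range N, eC ((v : ℝ) * y)))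
    linarith
  rw [norm_mul, norm_inv, Complex.norm_natCast, mul_inv]
  gcongr

lemma norm_boxAvg_le {N : ℕ} (hN : 0 < N) {η : Fin d → ℝ} (h : ‖η‖ ≤ 1 / 2) (h0 : 0 < ‖η‖) :
    ‖boxAvg d N η‖ ≤ (N * ‖η‖)⁻¹ := by
  have : Nonempty (Fin d) := by
    by_contra hc
    rw [not_nonempty_iff] at hc
    rw [Subsingleton.elim η 0, norm_zero] at h0
    exact h0.false
  obtain ⟨i, hi⟩ : ∃ i, ‖η‖ = ‖η i‖ := by
    obtain ⟨i, _, hi⟩ := Finset.exists_max_image Finset.univ (fun i => ‖η i‖) Finset.univ_nonempty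
    refine ⟨i, le_antisymm ?_ (norm_le_pi_norm η i)⟩
    exact (pi_norm_le_iff_of_nonneg (norm_nonneg _)).2 fun j => hi j (Finset.mem_univ j)
  rw [hi, Real.norm_eq_abs] at h h0 ⊢
  rw [boxAvg_eq_prod, norm_prod, ← Finset.mul_prod_erase _ _ (Finset.mem_univ i)]
  calc _ ≤ (N * |η i|)⁻¹ * 1 := by
        refine mul_le_mul (norm_avg_eC_le hN h (abs_pos.1 h0)) ?_
          (Finset.prod_nonneg fun _ _ => norm_nonneg _) (by positivity)
        exact Finset.prod_le_one (fun _ _ => norm_nonneg _) fun j _ => norm_avg_eC_le_one N (η j)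
    _ = _ := mul_one _

lemma norm_one_sub_boxAvg_le {N : ℕ} (hN : 0 < N) (η : Fin d → ℝ) :
    ‖1 - boxAvg d N η‖ ≤ 2 * Real.pi * d * (N * ‖η‖) := by
  have hN' : (N : ℂ) ≠ 0 := by exact_mod_cast hN.ne'
  have hcard : ((Fintype.piFinset fun _ : Fin d => Finset.range N).card : ℝ) = (N : ℝ) ^ d := by
    simp
  have e : 1 - boxAvg d N η = -(((N : ℂ)⁻¹) ^ d *
      ∑ v ∈ Fintype.piFinset fun _ : Fin d => Finset.range N,
        (eC (∑ i, (v i : ℝ) * η i) - 1)) := by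
    rw [Finset.sum_sub_distrib, boxAvg, mul_sub]
    have : ((N : ℂ)⁻¹) ^ d * ∑ v ∈ Fintype.piFinset fun _ : Fin d => Finset.range N, (1 : ℂ) = 1 := by
      simp only [Finset.sum_const, Fintype.card_piFinset, Finset.card_range, Finset.prod_const,
        Finset.card_univ, Fintype.card_fin, nsmul_eq_mul, mul_one]
      push_cast
      rw [← mul_pow, inv_mul_cancel₀ hN', one_pow]
    rw [this]; ring
  rw [e, norm_neg, norm_mul, norm_pow, norm_inv, Complex.norm_natCast]
  have h1 : ‖∑ v ∈ Fintype.piFinset fun _ : Fin d => Finset.range N,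
      (eC (∑ i, (v i : ℝ) * η i) - 1)‖ ≤ (N : ℝ) ^ d * (2 * Real.pi * d * (N * ‖η‖)) := by
    refine (norm_sum_le _ _).trans ?_
    rw [← hcard, ← nsmul_eq_mul, ← Finset.sum_const]
    refine Finset.sum_le_sum fun v hv => (norm_eC_sub_one_le _).trans ?_
    have h2 : |∑ i, (v i : ℝ) * η i| ≤ ∑ _i : Fin d, N * ‖η‖ := by
      refine (Finset.abs_sum_le_sum_abs _ _).trans (Finset.sum_le_sum fun i _ => ?_)
      rw [abs_mul, Nat.abs_cast]
      have h3 : v i < N := by simpa using Fintype.mem_piFinset.1 hv i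
      exact mul_le_mul (by exact_mod_cast h3.le) (norm_le_pi_norm η i) (abs_nonneg _)
        (Nat.cast_nonneg _)
    rw [Finset.sum_const, Finset.card_univ, Fintype.card_fin, nsmul_eq_mul] at h2
    calc _ ≤ 2 * Real.pi * (d * (N * ‖η‖)) := by gcongr
      _ = _ := by ring
  calc _ ≤ ((N : ℝ)⁻¹) ^ d * ((N : ℝ) ^ d * (2 * Real.pi * d * (N * ‖η‖))) := by gcongr
    _ = _ := by
      have : (N : ℝ) ≠ 0 := by exact_mod_cast hN.ne'
      rw [← mul_assoc, ← mul_pow, inv_mul_cancel₀ this, one_pow, one_mul]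

lemma continuous_boxAvg (N : ℕ) : Continuous (boxAvg d N) := by
  unfold boxAvg
  refine continuous_const.mul (continuous_finsetSum _ fun v _ => continuous_eC.comp ?_)
  fun_prop

lemma boxAvg_sub_intVec (N : ℕ) (η : Fin d → ℝ) (n : Fin d → ℤ) :
    boxAvg d N (η - intVec n) = boxAvg d N η := by
  unfold boxAvg
  congr 1
  refine Finset.sum_congr rfl fun v _ => ?_
  have : ∑ i, (v i : ℝ) * η i = ∑ i, (v i : ℝ) * (η - intVec n) i +
      ((∑ i, (v i : ℤ) * n i : ℤ) : ℝ) := by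
    push_cast
    rw [← Finset.sum_add_distrib]
    refine Finset.sum_congr rfl fun i _ => ?_
    simp only [Pi.sub_apply, intVec]; ring
  rw [this, eC_add, eC_intCast, mul_one]

lemma IsSphereMeasure.exists_lowPiece_bound (hσ : IsSphereMeasure σ) (h : IsBump d Ψ) :
    ∃ C : ℝ, 0 < C ∧ ∀ (N : ℕ) (t : ℝ), 0 < N → N ≤ t → t ≤ 2 * N → ∀ η : Fin d → ℝ,
      ‖lowPiece Ψ σ N t η - sphHat σ 0 * (Ψ η * boxAvg d N η)‖ ^ 2 ≤
        C ^ 2 * min (t * ‖η‖) ((t * ‖η‖)⁻¹) := by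
  have := hσ.finite
  obtain ⟨C₁, hC₁, hb₁⟩ := h.exists_bound
  set S : ℝ := σ.real Set.univ with hS
  have hS0 : 0 ≤ S := measureReal_nonneg
  set C : ℝ := C₁ * (2 * Real.pi * S * d) + S * (16 * C₁) + S * (16 * C₁) +
    S * (C₁ * (2 * Real.pi * d)) + 3 * C₁ * S + 1 with hC
  have hCpos : 0 < C := by rw [hC]; positivity
  have hsph : ∀ η : Fin d → ℝ, ‖sphHat σ η‖ ≤ S := fun η => norm_sphFT_le _
  have hone : ∀ u : Fin d → ℝ, |1 - Ψ u| ≤ 16 * C₁ * ‖u‖ := by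
    intro u
    rcases le_or_gt ‖u‖ (1 / 8) with hu | hu
    · rw [h.eq_one_of_norm_le hu, sub_self, abs_zero]; positivity
    · have h1 := abs_sub (1 : ℝ) (Ψ u)
      have h2 := hb₁ u
      rw [abs_one] at h1
      nlinarith
  have hΨn : ∀ u : Fin d → ℝ, ‖(Ψ u : ℂ)‖ ≤ C₁ := fun u => by
    rw [Complex.norm_real]; exact hb₁ u
  have hsmall : ∀ (N : ℕ) (t : ℝ), 0 < N → N ≤ t → t ≤ 2 * N → ∀ η : Fin d → ℝ,
      ‖lowPiece Ψ σ N t η - sphHat σ 0 * (Ψ η * boxAvg d N η)‖ ≤ C * (t * ‖η‖) := by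
    intro N t hN hNt htN η
    have hN' : (1 : ℝ) ≤ N := by exact_mod_cast hN
    have ht0 : 0 ≤ t := by linarith
    have e : lowPiece Ψ σ N t η - sphHat σ 0 * (Ψ η * boxAvg d N η) =
        (Ψ ((N : ℝ) • η) : ℂ) * (sphHat σ (t • η) - sphHat σ 0) -
          sphHat σ 0 * ((1 - Ψ ((N : ℝ) • η) : ℝ) : ℂ) + sphHat σ 0 * ((1 - Ψ η : ℝ) : ℂ) +
          sphHat σ 0 * (Ψ η * (1 - boxAvg d N η)) := by
      rw [lowPiece]; push_cast; ring
    have hle : ‖η‖ ≤ t * ‖η‖ := le_mul_of_one_le_left (norm_nonneg _) (by linarith)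
    have hle2 : N * ‖η‖ ≤ t * ‖η‖ := by gcongr
    have b1 : ‖(Ψ ((N : ℝ) • η) : ℂ) * (sphHat σ (t • η) - sphHat σ 0)‖ ≤
        C₁ * (2 * Real.pi * S * d) * (t * ‖η‖) := by
      rw [norm_mul]
      have h1 := hσ.norm_sphFT_sub_le (eucVec (t • η))
      have h2 := norm_eucVec_le (t • η)
      rw [norm_smul, Real.norm_of_nonneg ht0] at h2
      calc _ ≤ C₁ * (2 * Real.pi * S * (d * (t * ‖η‖))) :=
            mul_le_mul (hΨn _) (h1.trans (by gcongr)) (norm_nonneg _) (by positivity)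
        _ = _ := by ring
    have b2 : ‖sphHat σ 0 * ((1 - Ψ ((N : ℝ) • η) : ℝ) : ℂ)‖ ≤ S * (16 * C₁) * (t * ‖η‖) := by
      rw [norm_mul, Complex.norm_real, Real.norm_eq_abs]
      have h1 := hone ((N : ℝ) • η)
      rw [norm_smul, Real.norm_of_nonneg (by positivity)] at h1
      calc _ ≤ S * (16 * C₁ * (t * ‖η‖)) := by
            refine mul_le_mul (hsph _) (h1.trans ?_) (abs_nonneg _) hS0
            gcongr
        _ = _ := by ring
    have b3 : ‖sphHat σ 0 * ((1 - Ψ η : ℝ) : ℂ)‖ ≤ S * (16 * C₁) * (t * ‖η‖) := by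
      rw [norm_mul, Complex.norm_real, Real.norm_eq_abs]
      calc _ ≤ S * (16 * C₁ * (t * ‖η‖)) := by
            refine mul_le_mul (hsph _) ((hone η).trans ?_) (abs_nonneg _) hS0
            gcongr
        _ = _ := by ring
    have b4 : ‖sphHat σ 0 * (Ψ η * (1 - boxAvg d N η))‖ ≤
        S * (C₁ * (2 * Real.pi * d)) * (t * ‖η‖) := by
      rw [norm_mul, norm_mul]
      calc _ ≤ S * (C₁ * (2 * Real.pi * d * (t * ‖η‖))) := by
            refine mul_le_mul (hsph _) (mul_le_mul (hΨn _)
              ((norm_one_sub_boxAvg_le hN η).trans ?_) (norm_nonneg _) (by positivity))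
              (by positivity) hS0
            gcongr
        _ = _ := by ring
    rw [e]
    have b := (norm_add_le _ _).trans (add_le_add ((norm_add_le _ _).trans
      (add_le_add ((norm_sub_le _ _).trans (add_le_add b1 b2)) b3)) b4)
    refine b.trans ?_
    have : 0 ≤ (3 * C₁ * S + 1) * (t * ‖η‖) := by positivity
    rw [hC]
    linarith
  have hlarge : ∀ (N : ℕ) (t : ℝ), 0 < N → N ≤ t → t ≤ 2 * N → ∀ η : Fin d → ℝ, 0 < ‖η‖ →
      ‖lowPiece Ψ σ N t η - sphHat σ 0 * (Ψ η * boxAvg d N η)‖ ≤ C * (t * ‖η‖)⁻¹ := by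
    intro N t hN hNt htN η hη
    have hN' : (1 : ℝ) ≤ N := by exact_mod_cast hN
    have ht0 : 0 < t := by linarith
    have hτ : 0 < t * ‖η‖ := by positivity
    have b1 : ‖lowPiece Ψ σ N t η‖ ≤ C₁ * S * (t * ‖η‖)⁻¹ := by
      by_cases hz : Ψ ((N : ℝ) • η) = 0
      · rw [lowPiece, hz]; simp; positivity
      have h1 := h.norm_le_of_ne_zero hz
      rw [norm_smul, Real.norm_of_nonneg (by positivity)] at h1
      have h2 : t * ‖η‖ ≤ 1 := by nlinarith
      have h3 : 1 ≤ (t * ‖η‖)⁻¹ := (one_le_inv₀ hτ).2 h2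
      rw [lowPiece, norm_mul]
      calc _ ≤ C₁ * S := mul_le_mul (hΨn _) (hsph _) (norm_nonneg _) (by positivity)
        _ ≤ _ := le_mul_of_one_le_right (by positivity) h3
    have b2 : ‖sphHat σ 0 * (Ψ η * boxAvg d N η)‖ ≤ S * (C₁ * (2 * (t * ‖η‖)⁻¹)) := by
      by_cases hz : Ψ η = 0
      · rw [hz]; simp; positivity
      have h1 := h.norm_le_of_ne_zero hz
      rw [norm_mul, norm_mul]
      refine mul_le_mul (hsph _) (mul_le_mul (hΨn _) ((norm_boxAvg_le hN (by linarith) hη).trans ?_)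
        (norm_nonneg _) (by positivity)) (by positivity) hS0
      rw [← inv_inv (2 : ℝ), ← mul_inv]
      refine inv_anti₀ (by positivity) ?_
      nlinarith
    refine ((norm_sub_le _ _).trans (add_le_add b1 b2)).trans ?_
    have hr : 0 ≤ (t * ‖η‖)⁻¹ := by positivity
    have h3 : 3 * C₁ * S ≤ C := by
      rw [hC]
      have : 0 ≤ C₁ * (2 * Real.pi * S * d) + S * (16 * C₁) + S * (16 * C₁) +
        S * (C₁ * (2 * Real.pi * d)) := by positivity
      linarith
    have := mul_le_mul_of_nonneg_right h3 hr
    linarith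
  refine ⟨C, hCpos, fun N t hN hNt htN η => ?_⟩
  have hN' : (1 : ℝ) ≤ N := by exact_mod_cast hN
  have ht0 : 0 < t := by linarith
  rcases (norm_nonneg η).eq_or_lt with h0 | h0
  · have := hsmall N t hN hNt htN η
    rw [← h0, mul_zero, mul_zero] at this
    rw [le_antisymm this (norm_nonneg _), ← h0]
    simp
  · set u : ℝ := t * ‖η‖ with hu
    have hu0 : 0 < u := by positivity
    have h1 := hsmall N t hN hNt htN η
    have h2 := hlarge N t hN hNt htN η h0
    have hm : 0 < min u u⁻¹ := lt_min hu0 (by positivity)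
    have hm1 : min u u⁻¹ ≤ 1 := by
      rcases le_total u 1 with h | h
      · exact (min_le_left _ _).trans h
      · exact (min_le_right _ _).trans (inv_le_one_of_one_le₀ h)
    have h3 : ‖lowPiece Ψ σ N t η - sphHat σ 0 * (Ψ η * boxAvg d N η)‖ ≤ C * min u u⁻¹ := by
      rw [mul_min_of_nonneg _ _ hCpos.le]
      exact le_min h1 h2
    calc _ ≤ (C * min u u⁻¹) ^ 2 := by gcongr
      _ = C ^ 2 * (min u u⁻¹ * min u u⁻¹) := by ring
      _ ≤ C ^ 2 * (min u u⁻¹ * 1) := by gcongr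
      _ = _ := by rw [mul_one]

end DirichletAverage

section Interpolation

variable {X : Type*} [Countable X]

/-- The Marcinkiewicz interpolation theorem in terms of norms, including the endpoint `p = 2`. -/
lemma exists_marcinkiewicz_norm {p : ℝ} (hp1 : 1 < p) (hp2 : p ≤ 2) : ∃ D : ℝ, 0 < D ∧
    ∀ (S : (X → ℂ) → X → ℝ≥0∞) (A₁ A₂ : ℝ), 0 < A₁ → 0 < A₂ →
      (∀ f g : X → ℂ, f.support.Finite → g.support.Finite → ∀ x,
        S (fun y => f y + g y) x ≤ S f x + S g x) →
      (∀ f : X → ℂ, f.support.Finite → ∀ l : ℝ≥0∞,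
        l * levelCount (S f) l ≤ ENNReal.ofReal A₁ * ∑' x, ‖f x‖ₑ) →
      (∀ f : X → ℂ, f.support.Finite →
        ∑' x, S f x ^ 2 ≤ ENNReal.ofReal A₂ ^ 2 * ∑' x, ‖f x‖ₑ ^ 2) →
      ∀ f : X → ℂ, f.support.Finite → (∑' x, S f x ^ p) ^ (1 / p) ≤
        ENNReal.ofReal (D * (A₁ ^ (2 / p - 1) * A₂ ^ (2 - 2 / p))) *
          (∑' x, ‖f x‖ₑ ^ p) ^ (1 / p) := by
  have hp0 : 0 < p := by linarith
  have hpi : 0 ≤ 1 / p := by positivity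
  rcases hp2.lt_or_eq with hlt | rfl
  · have hK : 0 < p * (2 / (p - 1) + 4 / (2 - p)) := by
      have h1 : 0 < p - 1 := by linarith
      have h2 : 0 < 2 - p := by linarith
      positivity
    refine ⟨(p * (2 / (p - 1) + 4 / (2 - p))) ^ (1 / p), by positivity,
      fun S A₁ A₂ hA₁ hA₂ hsub hweak hstrong f hf => ?_⟩
    refine (ENNReal.rpow_le_rpow (marcinkiewicz hA₁ hA₂ hsub hweak hstrong hp1 hlt f hf)
      hpi).trans (le_of_eq ?_)
    generalize p * (2 / (p - 1) + 4 / (2 - p)) = K at hK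
    rw [ENNReal.mul_rpow_of_nonneg _ _ hpi, ENNReal.ofReal_rpow_of_nonneg (by positivity) hpi,
      Real.mul_rpow hK.le (by positivity), Real.mul_rpow (by positivity) (by positivity),
      ← Real.rpow_mul hA₁.le, ← Real.rpow_mul hA₂.le]
    congr 5
    · field_simp
    · field_simp
  · refine ⟨1, one_pos, fun S A₁ A₂ hA₁ hA₂ hsub hweak hstrong f hf => ?_⟩
    have h2 : ∀ a : ℝ≥0∞, a ^ (2 : ℝ) = a ^ 2 := fun a => by
      rw [← ENNReal.rpow_natCast]; norm_num
    refine (ENNReal.rpow_le_rpow (by simpa only [h2] using hstrong f hf) hpi).trans (le_of_eq ?_)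
    rw [ENNReal.mul_rpow_of_nonneg _ _ hpi, ← h2, ← ENNReal.rpow_mul]
    norm_num

end Interpolation

section ShiftedWindows

variable {d : ℕ}

/-- The integer part of the binary logarithm of a real number. -/
def dyLog (t : ℝ) : ℕ := Nat.log 2 ⌊t⌋₊

lemma pow_dyLog_le {t : ℝ} (ht : 1 ≤ t) : (2 : ℝ) ^ dyLog t ≤ t := by
  have h1 : ⌊t⌋₊ ≠ 0 := (Nat.floor_pos.2 ht).ne'
  have := Nat.pow_log_le_self 2 h1
  exact (by exact_mod_cast this : (2 : ℝ) ^ dyLog t ≤ (⌊t⌋₊ : ℝ)).trans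
    (Nat.floor_le (by linarith))

lemma le_pow_dyLog {t : ℝ} : t ≤ (2 : ℝ) ^ (dyLog t + 1) := by
  have h := Nat.lt_pow_succ_log_self (b := 2) (by norm_num) ⌊t⌋₊
  have h2 : t < ⌊t⌋₊ + 1 := Nat.lt_floor_add_one t
  have h3 : ((⌊t⌋₊ + 1 : ℕ) : ℝ) ≤ ((2 ^ (dyLog t + 1) : ℕ) : ℝ) := by exact_mod_cast h
  push_cast at h3
  linarith

/-- The `j`-th dyadic piece of `Ψ(η) σ̂(tη)`. -/
def dyPiece (Ψ : (Fin d → ℝ) → ℝ) (σ : Measure (EuclideanSpace ℝ (Fin d))) (j : ℕ) (t : ℝ) :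
    (Fin d → ℝ) → ℂ :=
  if j = 0 then lowPiece Ψ σ (2 ^ dyLog t) t
  else if j ≤ dyLog t then highPiece Ψ σ (2 ^ (dyLog t - j)) t else 0

lemma sum_dyPiece (Ψ : (Fin d → ℝ) → ℝ) (σ : Measure (EuclideanSpace ℝ (Fin d))) (t : ℝ)
    (η : Fin d → ℝ) :
    ∑ j ∈ Finset.range (dyLog t + 1), dyPiece Ψ σ j t η = (Ψ η : ℂ) * sphHat σ (t • η) := by
  set L := dyLog t with hL
  have h : ∀ n ≤ L, ∑ j ∈ Finset.range (n + 1), dyPiece Ψ σ j t η =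
      lowPiece Ψ σ (2 ^ (L - n)) t η := by
    intro n
    induction n with
    | zero => intro _; simp [dyPiece, hL]
    | succ n ih =>
      intro hn
      rw [Finset.sum_range_succ, ih (by omega), dyPiece, if_neg (by omega), ← hL, if_pos hn,
        highPiece, ← pow_succ', show L - (n + 1) + 1 = L - n by omega]
      ring
  rw [h L le_rfl, lowPiece]
  simp

lemma IsBump.quarterSupported_dyPiece {Ψ : (Fin d → ℝ) → ℝ} (h : IsBump d Ψ)
    (σ : Measure (EuclideanSpace ℝ (Fin d))) (j : ℕ) (t : ℝ) :
    QuarterSupported (dyPiece Ψ σ j t) := by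
  have h1 : ∀ n : ℕ, (1 : ℝ) ≤ 2 ^ n := fun n => one_le_pow₀ (by norm_num)
  rw [dyPiece]
  split_ifs
  · exact h.quarterSupported_lowPiece (h1 _) t
  · exact h.quarterSupported_highPiece (h1 _) t
  · exact fun η _ => rfl

lemma IsBump.continuous_dyPiece {Ψ : (Fin d → ℝ) → ℝ} (h : IsBump d Ψ)
    (σ : Measure (EuclideanSpace ℝ (Fin d))) [IsFiniteMeasure σ] (j : ℕ) (t : ℝ) :
    Continuous (dyPiece Ψ σ j t) := by
  rw [dyPiece]
  split_ifs
  · exact h.continuous_lowPiece _ t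
  · exact h.continuous_highPiece _ t
  · exact continuous_const

lemma euclFT_sub {B B' : (Fin d → ℝ) → ℂ} (hB : QuarterSupported B) (hc : Continuous B)
    (hB' : QuarterSupported B') (hc' : Continuous B') (w : Fin d → ℝ) :
    euclFT (fun η => B η - B' η) w = euclFT B w - euclFT B' w := by
  have hE : Continuous fun η : Fin d → ℝ => eC (-∑ i, w i * η i) :=
    continuous_eC.comp (by fun_prop)
  rw [euclFT, euclFT, euclFT, ← integral_sub]
  · simp_rw [sub_mul]
  · exact QuarterSupported.integrable (fun η hη => by simp [hB η hη]) (hc.mul hE)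
  · exact QuarterSupported.integrable (fun η hη => by simp [hB' η hη]) (hc'.mul hE)

lemma IsSphereMeasure.exists_euclFT_dyPiece_bound {σ : Measure (EuclideanSpace ℝ (Fin d))}
    (hd : 2 ≤ d) (hσ : IsSphereMeasure σ) {Ψ : (Fin d → ℝ) → ℝ} (h : IsBump d Ψ) :
    ∃ C : ℝ≥0, ∀ (j : ℕ) (t : ℝ), 1 ≤ t → ∀ w, ‖euclFT (dyPiece Ψ σ j t) w‖ₑ ≤
      (C * 2 ^ j : ℝ≥0∞) * ENNReal.ofReal ((t ^ d)⁻¹) * polyWeight d (‖w‖ / t) := by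
  have := hσ.finite
  obtain ⟨C, hC⟩ := hσ.exists_euclFT_bound hd h
  refine ⟨4 * C, fun j t ht w => ?_⟩
  have ht0 : 0 < t := by linarith
  set L := dyLog t with hL
  have hL1 := pow_dyLog_le ht
  have hL2 := le_pow_dyLog (t := t)
  have key : ∀ n j : ℕ, n ≤ L → L ≤ n + j → ‖euclFT (lowPiece Ψ σ (2 ^ n) t) w‖ₑ ≤
      (2 * C * 2 ^ j : ℝ≥0∞) * ENNReal.ofReal ((t ^ d)⁻¹) * polyWeight d (‖w‖ / t) := by
    intro n j hn hj
    refine (hC (2 ^ n) t (by positivity)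
      ((pow_le_pow_right₀ (by norm_num) hn).trans hL1) w).trans ?_
    rw [mul_comm (2 : ℝ≥0∞) C, mul_assoc (C : ℝ≥0∞) 2, ← pow_succ']
    gcongr
    have : t / 2 ^ n ≤ (2 : ℝ) ^ (j + 1) := by
      rw [div_le_iff₀ (by positivity), ← pow_add]
      exact hL2.trans (pow_le_pow_right₀ (by norm_num) (by omega))
    refine (ENNReal.ofReal_le_ofReal this).trans (le_of_eq ?_)
    rw [ENNReal.ofReal_pow (by norm_num)]
    norm_num
  rw [dyPiece]
  split_ifs with h0 h1
  · refine (key L j le_rfl (by omega)).trans ?_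
    push_cast
    gcongr
    norm_num
  · have h2 : (2 : ℝ) * 2 ^ (L - j) = 2 ^ (L - j + 1) := (pow_succ' _ _).symm
    have hone : ∀ n : ℕ, (1 : ℝ) ≤ 2 ^ n := fun n => one_le_pow₀ (by norm_num)
    have : highPiece Ψ σ (2 ^ (L - j)) t = fun η =>
        lowPiece Ψ σ (2 ^ (L - j)) t η - lowPiece Ψ σ (2 ^ (L - j + 1)) t η := by
      funext η; rw [highPiece, h2]
    rw [this, euclFT_sub (h.quarterSupported_lowPiece (hone _) t) (h.continuous_lowPiece _ t)
      (h.quarterSupported_lowPiece (hone _) t) (h.continuous_lowPiece _ t)]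
    refine enorm_sub_le.trans ((add_le_add (key (L - j) j (by omega) (by omega))
      (key (L - j + 1) j (by omega) (by omega))).trans (le_of_eq ?_))
    push_cast
    ring
  · simp [euclFT]

end ShiftedWindows

section Linearity

variable {d q : ℕ} {f g : (Fin d → ℤ) → ℂ}

lemma mulOp_finset_sum {ι : Type*} (s : Finset ι) {m : ι → (Fin d → ℝ) → ℂ}
    (hm : ∀ i ∈ s, ContinuousOn (m i) (Set.Icc 0 1)) (hf : f.support.Finite) (x : Fin d → ℤ) :
    mulOp d (fun ξ => ∑ i ∈ s, m i ξ) f x = ∑ i ∈ s, mulOp d (m i) f x := by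
  simp_rw [mulOp_eq_integral, Finset.sum_mul]
  refine integral_finsetSum s fun i hi => ?_
  exact (((hm i hi).mul (continuous_ftZ hf).continuousOn).mul
    (continuous_eChar (-x)).continuousOn).integrableOn_compact isCompact_Icc

lemma mulOp_const_mul (c : ℂ) (m : (Fin d → ℝ) → ℂ) (f : (Fin d → ℤ) → ℂ) (x : Fin d → ℤ) :
    mulOp d (fun ξ => c * m ξ) f x = c * mulOp d m f x := by
  simp_rw [mulOp_eq_integral, mul_assoc]
  exact integral_const_mul c _

lemma mulOp_eChar_mul (m : (Fin d → ℝ) → ℂ) (f : (Fin d → ℤ) → ℂ) (z x : Fin d → ℤ) :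
    mulOp d (fun ξ => eChar z ξ * m ξ) f x = mulOp d m f (x - z) := by
  simp_rw [mulOp_eq_integral, neg_sub, sub_eq_add_neg, eChar_add]
  congr 1
  funext ξ
  ring

lemma mulOp_add_fun {m : (Fin d → ℝ) → ℂ} (hm : ContinuousOn m (Set.Icc 0 1))
    (hf : f.support.Finite) (hg : g.support.Finite) (x : Fin d → ℤ) :
    mulOp d m (fun y => f y + g y) x = mulOp d m f x + mulOp d m g x := by
  have hfg : (Function.support fun y => f y + g y).Finite :=
    (hf.union hg).subset (Function.support_add f g)
  have hs : ∀ {h : (Fin d → ℤ) → ℂ}, h.support.Finite →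
      Summable fun y => h y * mulKernel m (x - y) := fun hh =>
    summable_of_finite_support (hh.subset (Function.support_mul_subset_left _ _))
  rw [mulOp_eq_tsum hm hf, mulOp_eq_tsum hm hg, mulOp_eq_tsum hm hfg, ← (hs hf).tsum_add (hs hg)]
  simp_rw [add_mul]

lemma perMul_finset_sum {ι : Type*} (s : Finset ι) (k : (Fin d → ZMod q) → ℂ)
    {B : ι → (Fin d → ℝ) → ℂ} (hB : ∀ i ∈ s, QuarterSupported (B i)) (ξ : Fin d → ℝ) :
    perMul q k (fun η => ∑ i ∈ s, B i η) ξ = ∑ i ∈ s, perMul q k (B i) ξ := by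
  rw [perMul_eq_single k (fun η hη => Finset.sum_eq_zero fun i hi => hB i hi η hη),
    Finset.mul_sum]
  exact Finset.sum_congr rfl fun i hi => (perMul_eq_single k (hB i hi) ξ).symm

lemma perMul_add (k : (Fin d → ZMod q) → ℂ) {B B' : (Fin d → ℝ) → ℂ} (hB : QuarterSupported B)
    (hB' : QuarterSupported B') (ξ : Fin d → ℝ) :
    perMul q k (fun η => B η + B' η) ξ = perMul q k B ξ + perMul q k B' ξ := by
  rw [perMul_eq_single k (fun η hη => by simp [hB η hη, hB' η hη]), perMul_eq_single k hB,
    perMul_eq_single k hB', mul_add]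

lemma mulOp_perMul_add (k : (Fin d → ZMod q) → ℂ) {B B' : (Fin d → ℝ) → ℂ}
    (hB : QuarterSupported B) (hc : Continuous B) (hB' : QuarterSupported B') (hc' : Continuous B')
    (hf : f.support.Finite) (x : Fin d → ℤ) :
    mulOp d (perMul q k fun η => B η + B' η) f x =
      mulOp d (perMul q k B) f x + mulOp d (perMul q k B') f x := by
  have h := mulOp_finset_sum (f := f) Finset.univ
    (m := fun b : Bool => perMul q k (bif b then B else B'))
    (fun b _ => by cases b <;> exact continuousOn_perMul k (by assumption) (by assumption)) hf x
  simp only [Fintype.sum_bool, cond_true, cond_false] at h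
  rw [← h]
  congr 1
  funext ξ
  exact perMul_add k hB hB' ξ

lemma perMul_mul_boxAvg (k : (Fin d → ZMod q) → ℂ) {B : (Fin d → ℝ) → ℂ} (N : ℕ) (c : ℂ)
    (ξ : Fin d → ℝ) :
    perMul q k (fun η => c * (B η * boxAvg d N η)) ξ =
      (c * ((N : ℂ)⁻¹) ^ d) * ∑ v ∈ Fintype.piFinset fun _ : Fin d => Finset.range N,
        eChar ((q : ℤ) • fun i => (v i : ℤ)) ξ * perMul q k B ξ := by
  rw [← Finset.sum_mul]
  have h1 : perMul q k (fun η => c * (B η * boxAvg d N η)) ξ =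
      c * boxAvg d N ((q : ℝ) • ξ) * perMul q k B ξ := by
    rw [perMul, perMul, ← tsum_mul_left]
    refine tsum_congr fun n => ?_
    rw [boxAvg_sub_intVec]
    ring
  rw [h1, boxAvg, ← mul_assoc, ← mul_assoc]
  congr 2
  refine Finset.sum_congr rfl fun v _ => ?_
  rw [eChar]
  congr 1
  refine Finset.sum_congr rfl fun i _ => ?_
  simp only [Pi.smul_apply, smul_eq_mul]
  push_cast
  ring

lemma sum_piFinset_range_le (q : ℕ) (F : (Fin d → ℤ) → ℝ≥0∞) {N : ℕ} (hN : 0 < N)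
    (x : Fin d → ℤ) :
    ((N : ℝ≥0∞)⁻¹) ^ d * ∑ v ∈ Fintype.piFinset fun _ : Fin d => Finset.range N,
      F (x - (q : ℤ) • fun i => (v i : ℤ)) ≤ 3 ^ d * maxFun q F x := by
  have hinj : Set.InjOn (fun (v : Fin d → ℕ) (i : Fin d) => (v i : ℤ))
      (Fintype.piFinset fun _ : Fin d => Finset.range N : Finset (Fin d → ℕ)) :=
    fun v _ w _ h => funext fun i => by simpa using congrFun h i
  have h1 : ∑ v ∈ Fintype.piFinset fun _ : Fin d => Finset.range N,
      F (x - (q : ℤ) • fun i => (v i : ℤ)) ≤ ∑ y ∈ latticeCube d N, F (x - (q : ℤ) • y) := by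
    classical
    rw [← Finset.sum_image (f := fun y : Fin d → ℤ => F (x - (q : ℤ) • y)) hinj]
    refine Finset.sum_le_sum_of_subset fun y hy => ?_
    obtain ⟨v, hv, rfl⟩ := Finset.mem_image.1 hy
    rw [mem_latticeCube]
    intro i
    have := Finset.mem_range.1 (Fintype.mem_piFinset.1 hv i)
    simp only [Nat.abs_cast]
    exact_mod_cast this.le
  have hN0 : (N : ℝ≥0∞) ≠ 0 := by exact_mod_cast hN.ne'
  calc _ ≤ ((N : ℝ≥0∞)⁻¹) ^ d * ((2 * N + 1 : ℝ≥0∞) ^ d * maxFun q F x) := by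
        gcongr
        exact h1.trans (sum_latticeCube_le q F N x)
    _ ≤ ((N : ℝ≥0∞)⁻¹) ^ d * ((3 * N : ℝ≥0∞) ^ d * maxFun q F x) := by
        gcongr
        have : (2 * N + 1 : ℕ) ≤ 3 * N := by omega
        exact_mod_cast this
    _ = _ := by
        rw [mul_pow, mul_comm ((3 : ℝ≥0∞) ^ d), mul_assoc, ← mul_assoc, ← mul_pow,
          ENNReal.inv_mul_cancel hN0 (ENNReal.natCast_ne_top N), one_pow, one_mul]

lemma enorm_mulOp_boxAvg_le (k : (Fin d → ZMod q) → ℂ) {B : (Fin d → ℝ) → ℂ}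
    (hB : QuarterSupported B) (hc : Continuous B) {N : ℕ} (hN : 0 < N) (c : ℂ)
    (hf : f.support.Finite) (x : Fin d → ℤ) :
    ‖mulOp d (perMul q k fun η => c * (B η * boxAvg d N η)) f x‖ₑ ≤
      ‖c‖ₑ * (3 ^ d * maxFun q (fun y => ‖mulOp d (perMul q k B) f y‖ₑ) x) := by
  have h1 : mulOp d (perMul q k fun η => c * (B η * boxAvg d N η)) f x =
      (c * ((N : ℂ)⁻¹) ^ d) * ∑ v ∈ Fintype.piFinset fun _ : Fin d => Finset.range N,
        mulOp d (perMul q k B) f (x - (q : ℤ) • fun i => (v i : ℤ)) := by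
    rw [show perMul q k (fun η => c * (B η * boxAvg d N η)) = _ from
      funext fun ξ => perMul_mul_boxAvg k (B := B) N c ξ, mulOp_const_mul, mulOp_finset_sum _ _ hf]
    · simp_rw [mulOp_eChar_mul]
    · exact fun v _ => (continuous_eChar _).continuousOn.mul (continuousOn_perMul k hB hc)
  rw [h1, enorm_mul, enorm_mul, mul_assoc]
  refine mul_le_mul' le_rfl (le_trans ?_ (sum_piFinset_range_le q _ hN x))
  gcongr
  · rw [enorm_pow, enorm_inv (by exact_mod_cast hN.ne')]
    simp [enorm_eq_nnnorm]
  · exact enorm_sum_le _ _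

end Linearity

section PieceMax

variable {d q : ℕ} {Ψ : (Fin d → ℝ) → ℝ} {σ : Measure (EuclideanSpace ℝ (Fin d))}

/-- The maximal function over `r ∈ R` built from the `j`-th dyadic pieces. -/
def pieceMax (Ψ : (Fin d → ℝ) → ℝ) (σ : Measure (EuclideanSpace ℝ (Fin d))) (q : ℕ) (R : Set ℝ)
    (k : (Fin d → ZMod q) → ℂ) (j : ℕ) (f : (Fin d → ℤ) → ℂ) (x : Fin d → ℤ) : ℝ≥0∞ :=
  ⨆ r : R, ‖mulOp d (perMul q k (dyPiece Ψ σ j (r / q))) f x‖ₑ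

lemma pieceMax_add_le [IsFiniteMeasure σ] (h : IsBump d Ψ) (R : Set ℝ) (k : (Fin d → ZMod q) → ℂ)
    (j : ℕ) {f g : (Fin d → ℤ) → ℂ} (hf : f.support.Finite) (hg : g.support.Finite)
    (x : Fin d → ℤ) : pieceMax Ψ σ q R k j (fun y => f y + g y) x ≤
      pieceMax Ψ σ q R k j f x + pieceMax Ψ σ q R k j g x := by
  refine iSup_le fun r => ?_
  rw [mulOp_add_fun (continuousOn_perMul k (h.quarterSupported_dyPiece σ j _)
    (h.continuous_dyPiece σ j _)) hf hg]
  exact (enorm_add_le _ _).trans (add_le_add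
    (le_iSup (fun r : R => ‖mulOp d (perMul q k (dyPiece Ψ σ j (r / q))) f x‖ₑ) r)
    (le_iSup (fun r : R => ‖mulOp d (perMul q k (dyPiece Ψ σ j (r / q))) g x‖ₑ) r))

lemma maxFun_const_mul (q : ℕ) (c : ℝ≥0∞) (F : (Fin d → ℤ) → ℝ≥0∞) (x : Fin d → ℤ) :
    maxFun q (fun y => c * F y) x = c * maxFun q F x := by
  rw [maxFun, maxFun, ENNReal.mul_iSup]
  refine iSup_congr fun N => ?_
  rw [cubeAvg, cubeAvg, ← Finset.mul_sum]
  ring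

lemma exists_pieceMax_weak (hd : 2 ≤ d) (hσ : IsSphereMeasure σ) (h : IsBump d Ψ) :
    ∃ C : ℝ, 0 < C ∧ ∀ (q : ℕ) [NeZero q] (R : Set ℝ), (∀ r ∈ R, (q : ℝ) ≤ r) →
      ∀ (k : (Fin d → ZMod q) → ℂ) (Λ : ℝ), 0 ≤ Λ →
      ((q : ℝ)⁻¹) ^ d * ∑ z, ‖ringFT ZMod.stdAddChar k z‖ ≤ Λ →
      ∀ (j : ℕ) (f : (Fin d → ℤ) → ℂ), f.support.Finite → ∀ l : ℝ≥0∞,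
        l * levelCount (pieceMax Ψ σ q R k j f) l ≤
          ENNReal.ofReal (C * (2 ^ j * Λ)) * ∑' x, ‖f x‖ₑ := by
  have := hσ.finite
  obtain ⟨C, hC⟩ := hσ.exists_euclFT_dyPiece_bound hd h
  set M : ℝ≥0 := 3 ^ d * (C * (2 ^ (d + 1) * (3 ^ d * 2 ^ (d + 2)))) with hM
  refine ⟨(M + 1 : ℝ≥0), by positivity, fun q _ R hR k Λ hΛ hk j f hf l => ?_⟩
  have hq : (0 : ℝ) < q := by exact_mod_cast NeZero.pos q
  set D : ℝ≥0∞ := (C * 2 ^ j : ℝ≥0∞) * (2 ^ (d + 1) * (3 ^ d * 2 ^ (d + 2))) with hD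
  set F : (Fin d → ℤ) → ℝ≥0∞ := fun y => D * kerSum q (ringFT ZMod.stdAddChar k) f y with hF
  have hle : ∀ x, pieceMax Ψ σ q R k j f x ≤ maxFun q F x := by
    intro x
    rw [hF, maxFun_const_mul]
    refine iSup_le fun r => ?_
    have ht : 1 ≤ (r : ℝ) / q := (one_le_div hq).2 (hR r r.2)
    exact enorm_mulOp_perMul_le k (h.quarterSupported_dyPiece σ j _) (h.continuous_dyPiece σ j _)
      ht (hC j _ ht) hf x
  calc l * levelCount (pieceMax Ψ σ q R k j f) l
      ≤ l * ∑' x, (if l < maxFun q F x then 1 else 0) := by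
        rw [levelCount]
        gcongr with x
        split_ifs with h1 h2 <;> simp
        exact absurd (h1.trans_le (hle x)) h2
    _ ≤ 3 ^ d * ∑' x, F x := maxFun_weak_type (NeZero.pos q) F l
    _ ≤ 3 ^ d * (D * (ENNReal.ofReal Λ * ∑' x, ‖f x‖ₑ)) := by
        rw [hF, ENNReal.tsum_mul_left]
        gcongr
        exact tsum_kerSum_le hk f
    _ ≤ _ := by
        have e2 : ENNReal.ofReal (((M + 1 : ℝ≥0) : ℝ) * (2 ^ j * Λ)) =
            ((M + 1 : ℝ≥0) : ℝ≥0∞) * (2 ^ j * ENNReal.ofReal Λ) := by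
          rw [ENNReal.ofReal_mul (by positivity), ENNReal.ofReal_mul (by positivity),
            ENNReal.ofReal_coe_nnreal, ENNReal.ofReal_pow (by norm_num), ENNReal.ofReal_ofNat]
        have e3 : 3 ^ d * (D * (ENNReal.ofReal Λ * ∑' x, ‖f x‖ₑ)) =
            (M : ℝ≥0∞) * (2 ^ j * ENNReal.ofReal Λ) * ∑' x, ‖f x‖ₑ := by
          rw [hD, hM]
          push_cast
          ring
        rw [e2, e3]
        gcongr
        exact le_self_add

end PieceMax

section StrongPieces

variable {d : ℕ} {Ψ : (Fin d → ℝ) → ℝ} {σ : Measure (EuclideanSpace ℝ (Fin d))}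

lemma ENNReal.add_sq_le_four_mul (a b : ℝ≥0∞) : (a + b) ^ 2 ≤ 4 * (a ^ 2 + b ^ 2) := by
  have h : ∀ {u v : ℝ≥0∞}, u ≤ v → (u + v) ^ 2 ≤ 4 * (u ^ 2 + v ^ 2) := fun {u v} huv =>
    calc (u + v) ^ 2 ≤ (v + v) ^ 2 := by gcongr
      _ = 4 * v ^ 2 := by ring
      _ ≤ _ := by gcongr; exact le_add_self
  rcases le_total a b with hab | hab
  · exact h hab
  · rw [add_comm a, add_comm (a ^ 2)]; exact h hab

lemma exists_tsum_enorm_mulOp_bump_sq_le (h : IsBump d Ψ) : ∃ C : ℝ≥0,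
    ∀ (q : ℕ) (k : (Fin d → ZMod q) → ℂ) (Λ : ℝ), (∀ n, ‖k n‖ ≤ Λ) →
      ∀ f : (Fin d → ℤ) → ℂ, f.support.Finite →
        ∑' x, ‖mulOp d (perMul q k fun η => (Ψ η : ℂ)) f x‖ₑ ^ 2 ≤
          C * ENNReal.ofReal Λ ^ 2 * ∑' x, ‖f x‖ₑ ^ 2 := by
  obtain ⟨C, hC1, hC⟩ := h.exists_bound
  refine ⟨Real.toNNReal C ^ 2, fun q k Λ hk f hf => ?_⟩
  refine (tsum_enorm_mulOp_sq_le (continuousOn_perMul k h.quarterSupported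
    (Complex.continuous_ofReal.comp h.continuous)) hf).trans ?_
  rw [← plancherel_cube hf, ← lintegral_const_mul' _ _ (by finiteness)]
  refine lintegral_mono fun ξ => ?_
  gcongr
  rw [perMul_eq_single k h.quarterSupported, enorm_mul, mul_pow, mul_comm]
  push_cast
  have e1 : ∀ η, ‖(Ψ η : ℂ)‖ₑ ≤ (Real.toNNReal C : ℝ≥0∞) := fun η => by
    rw [← ofReal_norm, Complex.norm_real]
    exact ENNReal.ofReal_le_ofReal (hC η)
  have e2 : ∀ n, ‖k n‖ₑ ≤ ENNReal.ofReal Λ := fun n => by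
    rw [← ofReal_norm]
    exact ENNReal.ofReal_le_ofReal (hk n)
  gcongr
  · exact e1 _
  · exact e2 _

lemma exists_pieceMax_zero_strong {c : ℝ} (hc : 1 < c) (hσ : IsSphereMeasure σ) (h : IsBump d Ψ) :
    ∃ C : ℝ≥0, ∀ (q : ℕ) [NeZero q] (R : Set ℝ), LacunaryWith c R → (∀ r ∈ R, (q : ℝ) ≤ r) →
      ∀ (k : (Fin d → ZMod q) → ℂ) (Λ : ℝ), 0 ≤ Λ → (∀ n, ‖k n‖ ≤ Λ) →
      ∀ f : (Fin d → ℤ) → ℂ, f.support.Finite →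
        ∑' x, pieceMax Ψ σ q R k 0 f x ^ 2 ≤ C * ENNReal.ofReal Λ ^ 2 * ∑' x, ‖f x‖ₑ ^ 2 := by
  have := hσ.finite
  obtain ⟨C₁, hC₁⟩ := exists_strong_type hc
  obtain ⟨C₂, hC₂0, hC₂⟩ := hσ.exists_lowPiece_bound h
  obtain ⟨C₃, hC₃⟩ := exists_tsum_enorm_mulOp_bump_sq_le h
  refine ⟨4 * (Real.toNNReal C₂ ^ 2 * C₁ + ‖sphHat σ 0‖₊ ^ 2 * 3 ^ (2 * d) * (8 * 3 ^ d * C₃)),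
    fun q _ R hR hqR k Λ hΛ hk f hf => ?_⟩
  have hq : (0 : ℝ) < q := by exact_mod_cast NeZero.pos q
  set N : ℝ → ℕ := fun r => 2 ^ dyLog (r / q) with hN
  have hN0 : ∀ r, 0 < N r := fun r => by positivity
  set M : ℝ → (Fin d → ℝ) → ℂ := fun r η => sphHat σ 0 * (Ψ η * boxAvg d (N r) η) with hM
  set E : ℝ → (Fin d → ℝ) → ℂ := fun r η => dyPiece Ψ σ 0 (r / q) η - M r η with hE
  have hMq : ∀ r, QuarterSupported (M r) := fun r η hη => by
    simp only [hM, h.quarterSupported η hη]; simp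
  have hMc : ∀ r, Continuous (M r) := fun r => continuous_const.mul
    ((Complex.continuous_ofReal.comp h.continuous).mul (continuous_boxAvg _))
  have hEq : ∀ r, QuarterSupported (E r) := fun r =>
    (h.quarterSupported_dyPiece σ 0 _).sub (hMq r)
  have hEc : ∀ r, Continuous (E r) := fun r => (h.continuous_dyPiece σ 0 _).sub (hMc r)
  have hEb : ∀ r ∈ R, ∀ η, ‖E r η‖ ^ 2 ≤
      C₂ ^ 2 * min (r * ((q : ℝ)⁻¹ * ‖η‖)) ((r * ((q : ℝ)⁻¹ * ‖η‖))⁻¹) := by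
    intro r hr η
    have ht : 1 ≤ r / q := (one_le_div hq).2 (hqR r hr)
    have hL2 := le_pow_dyLog (t := r / q)
    have := hC₂ (N r) (r / q) (hN0 r) (by simpa [hN] using pow_dyLog_le ht)
      (by simp only [hN]; push_cast; rw [← pow_succ']; exact hL2) η
    rw [← mul_assoc, ← div_eq_mul_inv]
    simpa [hE, hM, hN, dyPiece] using this
  set U : (Fin d → ℤ) → ℝ≥0∞ := fun y => ‖mulOp d (perMul q k fun η => (Ψ η : ℂ)) f y‖ₑ with hU
  have hpt : ∀ x, pieceMax Ψ σ q R k 0 f x ≤ (⨆ r : R, ‖mulOp d (perMul q k (E r)) f x‖ₑ) +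
      ‖sphHat σ 0‖ₑ * (3 ^ d * maxFun q U x) := by
    intro x
    refine iSup_le fun r => ?_
    have e1 : dyPiece Ψ σ 0 ((r : ℝ) / q) = fun η => E r η + M r η := by
      funext η; simp [hE]
    rw [e1, mulOp_perMul_add k (hEq r) (hEc r) (hMq r) (hMc r) hf]
    refine (enorm_add_le _ _).trans (add_le_add
      (le_iSup (fun r : R => ‖mulOp d (perMul q k (E r)) f x‖ₑ) r) ?_)
    exact enorm_mulOp_boxAvg_le k h.quarterSupported
      (Complex.continuous_ofReal.comp h.continuous) (hN0 r) _ hf x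
  calc ∑' x, pieceMax Ψ σ q R k 0 f x ^ 2
      ≤ ∑' x, 4 * ((⨆ r : R, ‖mulOp d (perMul q k (E r)) f x‖ₑ) ^ 2 +
          ‖sphHat σ 0‖ₑ ^ 2 * 3 ^ (2 * d) * maxFun q U x ^ 2) := by
        refine ENNReal.tsum_le_tsum fun x => ((pow_le_pow_left' (hpt x) 2).trans
          (ENNReal.add_sq_le_four_mul _ _)).trans (le_of_eq ?_)
        ring
    _ = 4 * (∑' x, (⨆ r : R, ‖mulOp d (perMul q k (E r)) f x‖ₑ) ^ 2 +
          ‖sphHat σ 0‖ₑ ^ 2 * 3 ^ (2 * d) * ∑' x, maxFun q U x ^ 2) := by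
        rw [ENNReal.tsum_mul_left, ENNReal.tsum_add, ENNReal.tsum_mul_left]
    _ ≤ 4 * (ENNReal.ofReal ((C₂ * Λ) ^ 2) * C₁ * ∑' x, ‖f x‖ₑ ^ 2 +
          ‖sphHat σ 0‖ₑ ^ 2 * 3 ^ (2 * d) *
            (8 * 3 ^ d * (C₃ * ENNReal.ofReal Λ ^ 2 * ∑' x, ‖f x‖ₑ ^ 2))) := by
        gcongr
        · exact hC₁ d q R hR k Λ C₂ (q : ℝ)⁻¹ hk hΛ hC₂0.le (by positivity) E
            (fun r _ => hEq r) (fun r _ => hEc r) hEb f hf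
        · refine (maxFun_strong_two (NeZero.pos q) U).trans ?_
          gcongr
          exact hC₃ q k Λ hk f hf
    _ = _ := by
        have e1 : ENNReal.ofReal ((C₂ * Λ) ^ 2) =
            (Real.toNNReal C₂ : ℝ≥0∞) ^ 2 * ENNReal.ofReal Λ ^ 2 := by
          rw [mul_pow, ENNReal.ofReal_mul (by positivity), ENNReal.ofReal_pow hC₂0.le,
            ENNReal.ofReal_pow hΛ]
          rfl
        rw [e1, enorm_eq_nnnorm]
        push_cast
        ring

/-- The geometric gain of the dyadic pieces on `ℓ²`. -/
def pieceDecay (d : ℕ) : ℝ := (2 : ℝ) ^ (-(((d : ℝ) - 2) / 2))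

lemma pieceDecay_pos (d : ℕ) : 0 < pieceDecay d := Real.rpow_pos_of_pos two_pos _

lemma exists_pieceMax_strong {c : ℝ} (hc : 1 < c) (hd : 2 ≤ d) (hσ : IsSphereMeasure σ)
    (h : IsBump d Ψ) :
    ∃ C : ℝ, 0 < C ∧ ∀ (q : ℕ) [NeZero q] (R : Set ℝ), LacunaryWith c R →
      (∀ r ∈ R, (q : ℝ) ≤ r) → ∀ (k : (Fin d → ZMod q) → ℂ) (Λ : ℝ), 0 ≤ Λ → (∀ n, ‖k n‖ ≤ Λ) →
      ∀ (j : ℕ) (f : (Fin d → ℤ) → ℂ), f.support.Finite →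
        ∑' x, pieceMax Ψ σ q R k j f x ^ 2 ≤
          ENNReal.ofReal (C * (pieceDecay d ^ j * Λ)) ^ 2 * ∑' x, ‖f x‖ₑ ^ 2 := by
  have := hσ.finite
  obtain ⟨C₀, hC₀⟩ := exists_pieceMax_zero_strong hc hσ h
  obtain ⟨C₁, hC₁⟩ := exists_strong_type hc
  obtain ⟨C₂, hC₂0, hC₂⟩ := hσ.exists_highPiece_bound hd h
  refine ⟨((C₀ + 1 + Real.toNNReal C₂ * (C₁ + 1) : ℝ≥0) : ℝ), by positivity,
    fun q _ R hR hqR k Λ hΛ hk j f hf => ?_⟩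
  have hq : (0 : ℝ) < q := by exact_mod_cast NeZero.pos q
  have hsq : ∀ a : ℝ≥0∞, a ≤ (a + 1) ^ 2 := fun a => by
    calc a ≤ 1 * (a + 1) := by rw [one_mul]; exact le_self_add
      _ ≤ (a + 1) * (a + 1) := by gcongr; exact le_add_self
      _ = _ := (sq _).symm
  rw [ENNReal.ofReal_mul (by positivity), ENNReal.ofReal_coe_nnreal]
  have hρ := pieceDecay_pos d
  rcases Nat.eq_zero_or_pos j with rfl | hj
  · refine (hC₀ q R hR hqR k Λ hΛ hk f hf).trans ?_
    rw [mul_pow, pow_zero, one_mul]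
    gcongr
    refine (hsq _).trans ?_
    gcongr
    push_cast
    exact le_self_add
  · refine (hC₁ d q R hR k Λ (C₂ * pieceDecay d ^ j) ((2 ^ j)⁻¹ * (q : ℝ)⁻¹) hk hΛ
      (by positivity) (by positivity) (fun r => dyPiece Ψ σ j (r / q))
      (fun r _ => h.quarterSupported_dyPiece σ j _) (fun r _ => h.continuous_dyPiece σ j _)
      (fun r hr η => ?_) f hf).trans ?_
    · have hr0 := hR.1 r hr
      have e1 : r * ((2 ^ j)⁻¹ * (q : ℝ)⁻¹ * ‖η‖) = r / q * ((2 ^ j)⁻¹ * ‖η‖) := by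
        rw [div_eq_mul_inv]; ring
      have ht : 1 ≤ r / q := (one_le_div hq).2 (hqR r hr)
      simp only [dyPiece]
      rw [e1, if_neg hj.ne']
      split_ifs with hjL
      · refine hC₂ j _ (r / q) (by positivity) ?_ ?_ η
        · rw [← pow_add, Nat.sub_add_cancel hjL]; exact pow_dyLog_le ht
        · rw [← pow_add, show dyLog (r / q) - j + (j + 1) = dyLog (r / q) + 1 by omega]
          exact le_pow_dyLog
      · simp only [Pi.zero_apply, norm_zero, ne_eq, OfNat.ofNat_ne_zero, not_false_eq_true,
          zero_pow]
        positivity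
    · rw [mul_assoc C₂, mul_pow C₂, ENNReal.ofReal_mul (by positivity), ENNReal.ofReal_pow hC₂0.le,
        ENNReal.ofReal_pow (by positivity), mul_right_comm (ENNReal.ofReal C₂ ^ 2), mul_pow]
      gcongr
      push_cast
      calc ENNReal.ofReal C₂ ^ 2 * (C₁ : ℝ≥0∞)
          ≤ ENNReal.ofReal C₂ ^ 2 * (C₁ + 1 : ℝ≥0∞) ^ 2 := by gcongr; exact hsq _
        _ = (ENNReal.ofReal C₂ * (C₁ + 1)) ^ 2 := (mul_pow _ _ _).symm
        _ ≤ _ := by gcongr; exact le_add_self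

end StrongPieces

section MaximalBound

variable {d q : ℕ} {Ψ : (Fin d → ℝ) → ℝ} {σ : Measure (EuclideanSpace ℝ (Fin d))}

lemma mulOp_perMul_eq_zero [NeZero q] {k : (Fin d → ZMod q) → ℂ} {B : (Fin d → ℝ) → ℂ}
    (hB : QuarterSupported B) (hc : Continuous B) {f : (Fin d → ℤ) → ℂ} (hf : f.support.Finite)
    (hk : ∀ z, ringFT ZMod.stdAddChar k z = 0) (x : Fin d → ℤ) :
    mulOp d (perMul q k B) f x = 0 := by
  rw [mulOp_eq_sum (continuousOn_perMul k hB hc) hf]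
  exact Finset.sum_eq_zero fun y _ => by rw [mulKernel_perMul k hB hc, hk]; simp

lemma iSup_enorm_le_tsum_pieceMax [IsFiniteMeasure σ] (h : IsBump d Ψ) (q : ℕ) (R : Set ℝ)
    (k : (Fin d → ZMod q) → ℂ) {f : (Fin d → ℤ) → ℂ} (hf : f.support.Finite) (x : Fin d → ℤ) :
    ⨆ r : R, ‖mulOp d (perMul q k fun η => (Ψ η : ℂ) * sphHat σ (((r : ℝ) / q) • η)) f x‖ₑ ≤
      ∑' j, pieceMax Ψ σ q R k j f x := by
  refine iSup_le fun r => ?_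
  have hq : ∀ j, QuarterSupported (dyPiece Ψ σ j ((r : ℝ) / q)) :=
    fun j => h.quarterSupported_dyPiece σ j _
  rw [← funext fun η => sum_dyPiece Ψ σ ((r : ℝ) / q) η,
    show perMul q k (fun η => ∑ j ∈ Finset.range (dyLog ((r : ℝ) / q) + 1),
      dyPiece Ψ σ j ((r : ℝ) / q) η) = _ from funext fun ξ => perMul_finset_sum _ k
        (fun j _ => hq j) ξ,
    mulOp_finset_sum _ (fun j _ => continuousOn_perMul k (hq j) (h.continuous_dyPiece σ j _)) hf]
  refine (enorm_sum_le _ _).trans ((Finset.sum_le_sum fun j _ => ?_).trans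
    (ENNReal.sum_le_tsum _))
  exact le_iSup (fun r : R => ‖mulOp d (perMul q k (dyPiece Ψ σ j (r / q))) f x‖ₑ) r

lemma two_rpow_mul_pieceDecay_lt_one {p : ℝ} (hp : 1 < p) (hdp : 1 < d * (1 - 1 / p)) :
    (2 : ℝ) ^ (2 / p - 1) * pieceDecay d ^ (2 - 2 / p) < 1 := by
  rw [pieceDecay, ← Real.rpow_mul (by norm_num), ← Real.rpow_add (by norm_num)]
  refine Real.rpow_lt_one_of_one_lt_of_neg (by norm_num) ?_
  have : 2 / p - 1 + -(((d : ℝ) - 2) / 2) * (2 - 2 / p) = 1 - d * (1 - 1 / p) := by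
    have : p ≠ 0 := by linarith
    field_simp
    ring
  rw [this]
  linarith

lemma exists_maximal_bound {c : ℝ} (hc : 1 < c) (hd : 2 ≤ d) (hσ : IsSphereMeasure σ)
    (h : IsBump d Ψ) {p : ℝ} (hp1 : 1 < p) (hp2 : p ≤ 2) (hdp : 1 < d * (1 - 1 / p)) :
    ∃ C : ℝ, 0 < C ∧ ∀ (q : ℕ) [NeZero q] (R : Set ℝ), LacunaryWith c R →
      (∀ r ∈ R, (q : ℝ) ≤ r) → ∀ (k : (Fin d → ZMod q) → ℂ) (Λ₁ Λ₂ : ℝ), 0 ≤ Λ₁ → 0 ≤ Λ₂ →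
      ((q : ℝ)⁻¹) ^ d * ∑ z, ‖ringFT ZMod.stdAddChar k z‖ ≤ Λ₁ → (∀ n, ‖k n‖ ≤ Λ₂) →
      ∀ f : (Fin d → ℤ) → ℂ, f.support.Finite →
        (∑' x, (⨆ r : R, ‖mulOp d (perMul q k fun η =>
          (Ψ η : ℂ) * sphHat σ (((r : ℝ) / q) • η)) f x‖ₑ) ^ p) ^ (1 / p) ≤
        ENNReal.ofReal (C * (Λ₁ ^ (2 / p - 1) * Λ₂ ^ (2 - 2 / p))) *
          (∑' x, ‖f x‖ₑ ^ p) ^ (1 / p) := by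
  have := hσ.finite
  obtain ⟨C₁, hC₁0, hC₁⟩ := exists_pieceMax_weak hd hσ h
  obtain ⟨C₂, hC₂0, hC₂⟩ := exists_pieceMax_strong hc hd hσ h
  obtain ⟨D, hD0, hD⟩ := exists_marcinkiewicz_norm (X := Fin d → ℤ) hp1 hp2
  have hp0 : 0 < p := by linarith
  have hρ := pieceDecay_pos d
  set α : ℝ := 2 / p - 1 with hα
  set β : ℝ := 2 - 2 / p with hβ
  set g : ℝ := (2 : ℝ) ^ α * pieceDecay d ^ β with hg
  have hg0 : 0 ≤ g := by positivity
  have hg1 : g < 1 := two_rpow_mul_pieceDecay_lt_one hp1 hdp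
  have hg1' : 0 < (1 - g)⁻¹ := inv_pos.2 (by linarith)
  refine ⟨D * (C₁ ^ α * C₂ ^ β) * (1 - g)⁻¹, by positivity,
    fun q _ R hR hqR k Λ₁ Λ₂ hΛ₁ hΛ₂ hk₁ hk₂ f hf => ?_⟩
  have hq : (0 : ℝ) < q := by exact_mod_cast NeZero.pos q
  by_cases hzero : ∀ z, ringFT ZMod.stdAddChar k z = 0
  · have hB : ∀ t : ℝ, QuarterSupported fun η => (Ψ η : ℂ) * sphHat σ (t • η) :=
      fun t η hη => by simp [h.quarterSupported η hη]
    have hBc : ∀ t : ℝ, Continuous fun η => (Ψ η : ℂ) * sphHat σ (t • η) := fun t =>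
      (Complex.continuous_ofReal.comp h.continuous).mul
        (continuous_sphHat.comp (continuous_const_smul t))
    simp [mulOp_perMul_eq_zero (hB _) (hBc _) hf hzero, ENNReal.zero_rpow_of_pos hp0, hp0]
  have hΛ₁' : 0 < Λ₁ := by
    push Not at hzero
    obtain ⟨z, hz⟩ := hzero
    refine lt_of_lt_of_le (mul_pos (by positivity) ?_) hk₁
    exact Finset.sum_pos' (fun _ _ => norm_nonneg _) ⟨z, Finset.mem_univ _, norm_pos_iff.2 hz⟩
  have hΛ₂' : 0 < Λ₂ := by
    refine lt_of_le_of_ne hΛ₂ fun h0 => hzero fun z => ?_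
    have hk0 : ∀ n, k n = 0 := fun n => norm_le_zero_iff.1 ((hk₂ n).trans h0.ge)
    simp [ringFT, hk0]
  calc (∑' x, (⨆ r : R, ‖mulOp d (perMul q k fun η =>
          (Ψ η : ℂ) * sphHat σ (((r : ℝ) / q) • η)) f x‖ₑ) ^ p) ^ (1 / p)
      ≤ (∑' x, (∑' j, pieceMax Ψ σ q R k j f x) ^ p) ^ (1 / p) := by
        gcongr with x
        exact iSup_enorm_le_tsum_pieceMax h q R k hf x
    _ ≤ ∑' j, (∑' x, pieceMax Ψ σ q R k j f x ^ p) ^ (1 / p) :=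
        Lp_tsum_le hp1.le fun j => pieceMax Ψ σ q R k j f
    _ ≤ ∑' j : ℕ, ENNReal.ofReal (D * (C₁ ^ α * C₂ ^ β) * (Λ₁ ^ α * Λ₂ ^ β) * g ^ j) *
          (∑' x, ‖f x‖ₑ ^ p) ^ (1 / p) := by
        refine ENNReal.tsum_le_tsum fun j => ?_
        refine (hD (pieceMax Ψ σ q R k j) (C₁ * (2 ^ j * Λ₁)) (C₂ * (pieceDecay d ^ j * Λ₂))
          (by positivity) (by positivity) (fun u v hu hv => pieceMax_add_le h R k j hu hv)
          (hC₁ q R hqR k Λ₁ hΛ₁ hk₁ j) (hC₂ q R hR hqR k Λ₂ hΛ₂ hk₂ j) f hf).trans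
          (le_of_eq ?_)
        congr 2
        rw [Real.mul_rpow hC₁0.le (by positivity), Real.mul_rpow (by positivity) hΛ₁,
          Real.mul_rpow hC₂0.le (by positivity), Real.mul_rpow (by positivity) hΛ₂, hg, mul_pow,
          ← Real.rpow_natCast_mul (by norm_num), ← Real.rpow_natCast_mul hρ.le,
          mul_comm (j : ℝ), mul_comm (j : ℝ), Real.rpow_mul_natCast (by norm_num),
          Real.rpow_mul_natCast hρ.le]
        ring
    _ = _ := by
        rw [ENNReal.tsum_mul_right, ← ENNReal.ofReal_tsum_of_nonneg (fun j => by positivity)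
          ((summable_geometric_of_lt_one hg0 hg1).mul_left _), tsum_mul_left,
          tsum_geometric_of_lt_one hg0 hg1]
        congr 2
        ring

end MaximalBound

section KloostermanLink

variable {d q : ℕ}

lemma eC_intCast_div [NeZero q] (j : ℤ) : eC ((j : ℝ) / q) = ZMod.stdAddChar (j : ZMod q) := by
  rw [ZMod.stdAddChar_coe, eC]
  push_cast
  congr 1
  ring

lemma sum_units_zmod [NeZero q] (F : ZMod q → ℂ) :
    ∑ u : ZMod q, (if Nat.Coprime u.val q then F u else 0) = ∑ u : (ZMod q)ˣ, F u := by
  rw [← Finset.sum_filter, ← Finset.sum_subtype_eq_sum_filter]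
  simp only [Finset.subtype_univ]
  exact (Fintype.sum_equiv ZMod.unitsEquivCoprime (fun u : (ZMod q)ˣ => F u)
    (fun x : {x : ZMod q // Nat.Coprime x.val q} => F x) fun u => rfl).symm

lemma kloosterman_eq_ringKl [hq : NeZero q] (N : ℕ) (n : Fin d → ℤ) :
    kloosterman d q (N : ℤ) n = ringKl ZMod.stdAddChar (N : ZMod q) (redMod q n) := by
  rw [kloosterman, ringKl, gaussFam, ZMod.card, ← sum_units_zmod
    (fun u => ZMod.stdAddChar (-(u * (N : ZMod q))) *
      ∏ i, gaussQ ZMod.stdAddChar u (redMod q n i))]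
  congr 1
  obtain ⟨m, rfl⟩ : ∃ m, q = m + 1 := ⟨q - 1, (Nat.succ_pred_eq_of_pos (NeZero.pos q)).symm⟩
  refine Finset.sum_congr rfl fun (u : Fin (m + 1)) _ => ?_
  have hval : ∀ v : ZMod (m + 1), ((ZMod.val v : ℤ) : ZMod (m + 1)) = v := fun v => by simp
  refine if_congr Iff.rfl ?_ rfl
  congr 1
  · have : -(((u : ℕ) : ℝ) * ((N : ℤ) : ℝ)) = ((-(((u : ℕ) : ℤ) * N) : ℤ) : ℝ) := by push_cast; ring
    rw [this, eC_intCast_div]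
    congr 1
    push_cast
    congr 2
    exact_mod_cast hval u
  · simp only [gaussQ]
    rw [Finset.prod_univ_sum, Fintype.piFinset_univ]
    refine Finset.sum_congr rfl fun (b : Fin d → Fin (m + 1)) _ => ?_
    have : ((u : ℕ) : ℝ) * ∑ i, (((b i : ℕ) : ℝ)) ^ 2 + ∑ i, ((b i : ℕ) : ℝ) * ((n i : ℝ)) =
        ((∑ i, (((u : ℕ) : ℤ) * ((b i : ℕ) : ℤ) ^ 2 + n i * ((b i : ℕ) : ℤ)) : ℤ) : ℝ) := by
      push_cast
      rw [Finset.mul_sum, ← Finset.sum_add_distrib]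
      exact Finset.sum_congr rfl fun i _ => by ring
    rw [this, eC_intCast_div, Int.cast_sum, addChar_map_sum]
    refine Finset.prod_congr rfl fun i _ => ?_
    congr 1
    have h1 : (((u : ℕ) : ℤ) : ZMod (m + 1)) = u := hval u
    have h2 : (((b i : ℕ) : ℤ) : ZMod (m + 1)) = b i := hval (b i)
    simp only [Int.cast_add, Int.cast_mul, Int.cast_pow, h1, h2, redMod]

variable {Ψ : (Fin d → ℝ) → ℝ} {σ : Measure (EuclideanSpace ℝ (Fin d))}

lemma mHqr_eq_perMul [NeZero q] (hσ : ∀ r : ℝ, 0 < r → ∀ ξ : Fin d → ℝ,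
      fourierSphMeasure d r ξ = ∫ x, eC (∑ i, x i * (r * ξ i)) ∂σ) {r : ℝ} (hr : 0 < r)
    (ξ : Fin d → ℝ) :
    mHqr d q r Ψ ξ = perMul q (ringKl ZMod.stdAddChar (radSq r : ZMod q))
      (fun η => (Ψ η : ℂ) * sphHat σ ((r / q) • η)) ξ := by
  have hq : (q : ℝ) ≠ 0 := by exact_mod_cast NeZero.ne q
  rw [mHqr, perMul]
  refine tsum_congr fun n => ?_
  rw [kloosterman_eq_ringKl, mul_assoc, hσ r hr, sphHat_eq]
  congr 2
  refine integral_congr_ae (Filter.Eventually.of_forall fun x => ?_)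
  simp only [intVec, Pi.smul_apply, Pi.sub_apply, smul_eq_mul]
  congr 1
  refine Finset.sum_congr rfl fun i _ => ?_
  field_simp

lemma enorm_mulOp_mHqr_le [NeZero q] [IsFiniteMeasure σ] (h : IsBump d Ψ)
    (hσ : ∀ r : ℝ, 0 < r → ∀ ξ : Fin d → ℝ,
      fourierSphMeasure d r ξ = ∫ x, eC (∑ i, x i * (r * ξ i)) ∂σ) {r : ℝ} (hr : 0 < r)
    {ι : Type} [Fintype ι] {k : ι → (Fin d → ZMod q) → ℂ} {a : ι → ℂ} (ha : ∀ i, ‖a i‖ ≤ 1)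
    (hk : ∀ n : Fin d → ZMod q,
      ringKl ZMod.stdAddChar (radSq r : ZMod q) n = ∑ i, a i * k i n)
    {f : (Fin d → ℤ) → ℂ} (hf : f.support.Finite) (x : Fin d → ℤ) :
    ‖mulOp d (mHqr d q r Ψ) f x‖ₑ ≤ ∑ i, ‖mulOp d (perMul q (k i)
      fun η => (Ψ η : ℂ) * sphHat σ ((r / q) • η)) f x‖ₑ := by
  have hB : QuarterSupported fun η => (Ψ η : ℂ) * sphHat σ ((r / q) • η) :=
    fun η hη => by simp [h.quarterSupported η hη]
  have hBc : Continuous fun η => (Ψ η : ℂ) * sphHat σ ((r / q) • η) :=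
    (Complex.continuous_ofReal.comp h.continuous).mul
      (continuous_sphHat.comp (continuous_const_smul _))
  have h1 : mHqr d q r Ψ = fun ξ => ∑ i, a i * perMul q (k i)
      (fun η => (Ψ η : ℂ) * sphHat σ ((r / q) • η)) ξ := by
    funext ξ
    rw [mHqr_eq_perMul hσ hr, perMul_eq_single _ hB, hk, Finset.sum_mul]
    exact Finset.sum_congr rfl fun i _ => by rw [perMul_eq_single _ hB, mul_assoc]
  have h2 := mulOp_finset_sum (f := f) Finset.univ (m := fun i ξ => a i * perMul q (k i)
    (fun η => (Ψ η : ℂ) * sphHat σ ((r / q) • η)) ξ)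
    (fun i _ => continuousOn_const.mul (continuousOn_perMul _ hB hBc)) hf x
  rw [h1, h2]
  refine (enorm_sum_le _ _).trans (Finset.sum_le_sum fun i _ => ?_)
  rw [mulOp_const_mul, enorm_mul]
  refine mul_le_of_le_one_left zero_le' ?_
  rw [← ofReal_norm]
  exact ENNReal.ofReal_le_one.2 (ha i)

/-- The maximal function over `r ∈ R`, `r ≥ q`, of the main terms with modulus `q`. -/
def modulusMax (d q : ℕ) (Ψ : (Fin d → ℝ) → ℝ) (R : Set ℝ) (f : (Fin d → ℤ) → ℂ)
    (x : Fin d → ℤ) : ℝ≥0∞ :=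
  ⨆ r : {r : ℝ | r ∈ R ∧ (q : ℝ) ≤ r}, ‖mulOp d (mHqr d q r Ψ) f x‖ₑ

lemma iSup_enorm_sum_le_tsum_modulusMax (Ψ : (Fin d → ℝ) → ℝ) {R : Set ℝ} (hR : ∀ r ∈ R, 0 < r)
    (f : (Fin d → ℤ) → ℂ) (x : Fin d → ℤ) :
    ⨆ r : R, ‖∑ q ∈ Finset.Icc 1 ⌊(r : ℝ)⌋₊, mulOp d (mHqr d q (r : ℝ) Ψ) f x‖ₑ ≤
      ∑' q : ℕ, modulusMax d (q + 1) Ψ R f x := by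
  refine iSup_le fun r => (enorm_sum_le _ _).trans ?_
  have hr : (0 : ℝ) ≤ r := (hR r r.2).le
  rw [← Finset.Ico_add_one_right_eq_Icc,
    Finset.sum_Ico_eq_sum_range]
  refine (Finset.sum_le_sum fun q hq => ?_).trans (ENNReal.sum_le_tsum (Finset.range ⌊(r : ℝ)⌋₊))
  rw [add_comm 1 q]
  exact le_iSup (fun t : {t : ℝ | t ∈ R ∧ ((q + 1 : ℕ) : ℝ) ≤ t} =>
    ‖mulOp d (mHqr d (q + 1) t Ψ) f x‖ₑ)
    ⟨r, r.2, (Nat.le_floor_iff hr).1 (Finset.mem_range.1 hq)⟩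

end KloostermanLink

section Assembly

variable {d : ℕ} {Ψ : (Fin d → ℝ) → ℝ}

lemma exists_modulusMax_bound {c : ℝ} (hc : 1 < c) (hd : 2 ≤ d) (h : IsBump d Ψ)
    {p : ℝ} (hp1 : 1 < p) (hp2 : p ≤ 2) (hdp : 1 < d * (1 - 1 / p)) :
    ∃ C : ℝ, 0 < C ∧ ∀ (q : ℕ) [NeZero q] (R : Set ℝ), LacunaryWith c R →
      ∀ β : ℝ, KlCost (ZMod q) d (radSq '' R) (2 - 2 / p) β →
      ∀ f : (Fin d → ℤ) → ℂ, f.support.Finite →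
        (∑' x, modulusMax d q Ψ R f x ^ p) ^ (1 / p) ≤
          ENNReal.ofReal (C * β) * (∑' x, ‖f x‖ₑ ^ p) ^ (1 / p) := by
  obtain ⟨σ, hσ, hft⟩ := exists_isSphereMeasure (d := d) (by omega)
  have := hσ.finite
  obtain ⟨C, hC0, hC⟩ := exists_maximal_bound hc hd hσ h hp1 hp2 hdp
  refine ⟨C, hC0, fun q _ R hR β hβ f hf => ?_⟩
  obtain ⟨ι, _, k, a, L₁, L₂, hk, ha, hL₁, hL₂, hL₁0, hL₂0, hsum⟩ :=
    hβ ZMod.stdAddChar (ZMod.isPrimitive_stdAddChar q)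
  rw [ZMod.card] at hL₁
  rw [show 1 - (2 - 2 / p) = 2 / p - 1 by ring] at hsum
  set Rq : Set ℝ := {r : ℝ | r ∈ R ∧ (q : ℝ) ≤ r} with hRq
  set M : ι → (Fin d → ℤ) → ℝ≥0∞ := fun i x => ⨆ r : Rq, ‖mulOp d (perMul q (k i) fun η =>
    (Ψ η : ℂ) * sphHat σ (((r : ℝ) / q) • η)) f x‖ₑ with hM
  have hle : ∀ x, modulusMax d q Ψ R f x ≤ ∑ i, M i x := fun x => iSup_le fun r =>
    (enorm_mulOp_mHqr_le h hft (hR.1 r r.2.1) (fun i => ha i (radSq r))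
      (hk _ ⟨r, r.2.1, rfl⟩) hf x).trans
      (Finset.sum_le_sum fun i _ => le_iSup (fun t : Rq => ‖mulOp d (perMul q (k i) fun η =>
        (Ψ η : ℂ) * sphHat σ (((t : ℝ) / q) • η)) f x‖ₑ) r)
  have hp0 : 0 < p := by linarith
  calc (∑' x, modulusMax d q Ψ R f x ^ p) ^ (1 / p)
      ≤ (∑' x, (∑ i, M i x) ^ p) ^ (1 / p) := by
        gcongr with x
        exact hle x
    _ ≤ ∑ i, (∑' x, M i x ^ p) ^ (1 / p) := Lp_sum_le hp1.le _ _
    _ ≤ ∑ i, ENNReal.ofReal (C * (L₁ i ^ (2 / p - 1) * L₂ i ^ (2 - 2 / p))) *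
          (∑' x, ‖f x‖ₑ ^ p) ^ (1 / p) :=
        Finset.sum_le_sum fun i _ => hC q Rq (hR.mono fun r hr => hr.1) (fun r hr => hr.2)
          (k i) _ _ (hL₁0 i) (hL₂0 i) (hL₁ i) (hL₂ i) f hf
    _ ≤ ENNReal.ofReal (C * β) * (∑' x, ‖f x‖ₑ ^ p) ^ (1 / p) := by
        rw [← Finset.sum_mul, ← ENNReal.ofReal_sum_of_nonneg fun i _ => by
          have := hL₁0 i
          have := hL₂0 i
          positivity, ← Finset.mul_sum]
        gcongr

end Assembly

theorem statement7 (d : ℕ) (Ψ : (Fin d → ℝ) → ℝ) (hΨ : IsBump d Ψ)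
    (R : Set ℝ) (hadm : ∀ r ∈ R, IsAdmissible r) (hlac : Lacunary R)
    (G B : Set ℕ) (s : ℝ) (hs0 : 0 < s) (hs1 : s ≤ 1)
    (hGB : GoodBadDichotomy R G B s)
    (hd : 5 ≤ d ∨ (d = 4 ∧ 2 ∈ G))
    (p : ℝ) (hp1 : (d : ℝ) / ((d : ℝ) - (1 + s)) ≤ p)
    (hp2 : ((d : ℝ) - 1) / ((d : ℝ) - 2) < p) (hp3 : p ≤ 2) :
    ∃ C : ℝ, 0 < C ∧ ∀ f : (Fin d → ℤ) → ℂ, (Function.support f).Finite →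
      (∑' x : Fin d → ℤ,
          (⨆ r : R,
            ((‖∑ q ∈ Finset.Icc 1 ⌊(r : ℝ)⌋₊, mulOp d (mHqr d q (r : ℝ) Ψ) f x‖₊ : ℝ≥0∞))) ^ p)
          ^ (1 / p)
        ≤ ENNReal.ofReal C * lpNorm d p f := by
  have hd4 : 4 ≤ d := by omega
  have hdR : (4 : ℝ) ≤ d := by exact_mod_cast hd4
  rw [div_le_iff₀ (by linarith)] at hp1
  rw [div_lt_iff₀ (by linarith)] at hp2
  have hp : 1 < p := by nlinarith
  have hp0 : 0 < p := by linarith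
  have h1 : 1 + s ≤ d * (2 - 2 / p) / 2 := by
    rw [show (d : ℝ) * (2 - 2 / p) / 2 = d * (p - 1) / p by field_simp, le_div_iff₀ hp0]
    linarith
  have h2 : 1 < ((d : ℝ) - 1) * (2 - 2 / p) / 2 := by
    rw [show ((d : ℝ) - 1) * (2 - 2 / p) / 2 = (d - 1) * (p - 1) / p by field_simp,
      lt_div_iff₀ hp0]
    linarith
  have hdp : 1 < d * (1 - 1 / p) := by
    have : (d : ℝ) * (1 - 1 / p) = d * (2 - 2 / p) / 2 := by ring
    linarith
  have hθ : 1 ≤ 2 / p ∧ 2 / p ≤ 2 :=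
    ⟨by rwa [one_le_div hp0], (div_le_iff₀ hp0).2 (by linarith)⟩
  obtain ⟨b, hb0, hbs, hb⟩ := exists_summable_cost hs0 hGB (d := d) (by omega)
    (by linarith [hθ.2]) (by linarith [hθ.1]) h1 h2
  obtain ⟨c, hc, hcR⟩ := hlac
  have hR : LacunaryWith c R := ⟨fun r hr => (hadm r hr).1, hcR⟩
  obtain ⟨C, hC0, hC⟩ := exists_modulusMax_bound hc (by omega) hΨ hp hp3 hdp
  have hbs' : Summable fun q => C * b (q + 1) := ((summable_nat_add_iff 1).2 hbs).mul_left C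
  have hb0' : ∀ q, 0 ≤ C * b (q + 1) := fun q => mul_nonneg hC0.le (hb0 _)
  refine ⟨∑' q, C * b (q + 1) + 1, add_pos_of_nonneg_of_pos (tsum_nonneg hb0') one_pos, fun f hf => ?_⟩
  change (∑' x, (⨆ r : R, ‖∑ q ∈ Finset.Icc 1 ⌊(r : ℝ)⌋₊,
    mulOp d (mHqr d q (r : ℝ) Ψ) f x‖ₑ) ^ p) ^ (1 / p) ≤ _ * (∑' x, ‖f x‖ₑ ^ p) ^ (1 / p)
  calc _ ≤ (∑' x, (∑' q : ℕ, modulusMax d (q + 1) Ψ R f x) ^ p) ^ (1 / p) := by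
        gcongr with x
        exact iSup_enorm_sum_le_tsum_modulusMax Ψ hR.1 f x
    _ ≤ ∑' q : ℕ, (∑' x, modulusMax d (q + 1) Ψ R f x ^ p) ^ (1 / p) := Lp_tsum_le hp.le _
    _ ≤ ∑' q : ℕ, ENNReal.ofReal (C * b (q + 1)) * (∑' x, ‖f x‖ₑ ^ p) ^ (1 / p) :=
        ENNReal.tsum_le_tsum fun q => hC (q + 1) R hR _ (hb (q + 1) inferInstance) f hf
    _ ≤ _ := by
        rw [ENNReal.tsum_mul_right, ← ENNReal.ofReal_tsum_of_nonneg hb0' hbs']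
        gcongr
        linarith

end
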